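/- Let d ≥ 3, r > 0, and let P = P_{C,r} and P' = P_{C',r} be basic r-ball polyhedra in E^d. For S ⊆ C with V_S ∩ bd(P) ≠ ∅ write F_S := cl(V_S) ∩ bd(P) (a closed face of P), and likewise F'_{S'} := cl(V'_{S'}) ∩ bd(P') for S' ⊆ C'. Let L(P) be the collection of all closed faces of P together with ∅ and P, partially ordered by inclusion, and likewise L(P'). Suppose φ : L(P) → L(P') is an order isomorphism such that whenever S = {c₁, c₂} ⊆ C is a two-element set with dim V_S = d−1 and F_S ∈ L(P), and φ(F_S) = F'_{S'} with S' = {c₁', c₂'} ⊆ C', then for every p ∈ V_S ∩ bd(P) and p' ∈ V'_{S'} ∩ bd(P') the inner dihedral angles agree, i.e., π − ∠(c₁ − p, c₂ − p) = π − ∠(c₁' − p', c₂' − p'). Then there exists an isometry of E^d mapping P onto P'. -/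

import Mathlib

open Metric Set
open scoped RealInnerProductSpace

/-- The dimension of a set: the dimension of its affine span. -/
noncomputable def setDim {d : ℕ} (A : Set (EuclideanSpace ℝ (Fin d))) : ℕ :=
  Module.finrank ℝ (affineSpan ℝ A).direction

/-- The farthest-point Voronoi face `V_S`: the set of points whose set of farthest points
of `C` is exactly `S`. -/
def vorF {d : ℕ} (C S : Set (EuclideanSpace ℝ (Fin d))) : Set (EuclideanSpace ℝ (Fin d)) :=
  {x | S = {c | c ∈ C ∧ ∀ c' ∈ C, dist x c' ≤ dist x c}}

/-- `P_{C,r}`: the intersection of the closed balls of radius `r` centered at points of `C`. -/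
def ballPoly {d : ℕ} (C : Set (EuclideanSpace ℝ (Fin d))) (r : ℝ) :
    Set (EuclideanSpace ℝ (Fin d)) :=
  ⋂ c ∈ C, closedBall c r

/-- The `r`-convex hull of `X`. -/
def rConvexHull {d : ℕ} (r : ℝ) (X : Set (EuclideanSpace ℝ (Fin d))) :
    Set (EuclideanSpace ℝ (Fin d)) :=
  ⋂ x ∈ {x | X ⊆ closedBall x r}, closedBall x r

/-- `C` lies in `r`-convex position. -/
def RConvexPosition {d : ℕ} (r : ℝ) (C : Set (EuclideanSpace ℝ (Fin d))) : Prop :=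
  (∃ p, C ⊆ ball p r) ∧ ∀ c ∈ C, c ∉ rConvexHull r (C \ {c})

/-- `P_{C,r}` is a basic `r`-ball polyhedron with center-polytope `conv C`. -/
def IsBasicBallPolyhedron {d : ℕ} (C : Set (EuclideanSpace ℝ (Fin d))) (r : ℝ) : Prop :=
  0 < r ∧ C.Finite ∧ d + 1 ≤ C.ncard ∧ 2 ≤ d ∧
  setDim (convexHull ℝ C) = d ∧
  C = Set.extremePoints ℝ (convexHull ℝ C) ∧
  RConvexPosition r C ∧
  ∀ S ⊆ C, ∀ v, vorF C S = {v} → v ∈ interior (ballPoly C r)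

/-- `fFace C r k` is the number of `(k-1)`-dimensional faces of `P_{C,r}`, i.e. the number of
`S ⊆ C` with `V_S ∩ bd(P_{C,r}) ≠ ∅` and `dim V_S = k`. -/
noncomputable def fFace {d : ℕ} (C : Set (EuclideanSpace ℝ (Fin d))) (r : ℝ) (k : ℕ) : ℕ :=
  {S : Set (EuclideanSpace ℝ (Fin d)) | S ⊆ C ∧
    (vorF C S ∩ frontier (ballPoly C r)).Nonempty ∧ setDim (vorF C S) = k}.ncard

/-- The collection of closed faces of the basic `r`-ball polyhedron `P_{C,r}`. -/
def closedFaces {d : ℕ} (C : Set (EuclideanSpace ℝ (Fin d))) (r : ℝ) :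
    Set (Set (EuclideanSpace ℝ (Fin d))) :=
  {F | ∃ S, S ⊆ C ∧ (vorF C S ∩ frontier (ballPoly C r)).Nonempty ∧
    F = closure (vorF C S) ∩ frontier (ballPoly C r)}

/-- The face lattice `L(P_{C,r})`: closed faces together with `∅` and `P_{C,r}`. -/
def faceLat {d : ℕ} (C : Set (EuclideanSpace ℝ (Fin d))) (r : ℝ) :
    Set (Set (EuclideanSpace ℝ (Fin d))) :=
  closedFaces C r ∪ {∅, ballPoly C r}

/-! ### Faces of a finitely generated cone -/

section ConeFaces

variable {ι W : Type*} [Fintype ι] [AddCommGroup W] [Module ℝ W] [FiniteDimensional ℝ W]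
  {v : ι → W} {S T U G R : Set ι}

/-- The index sets cut out of a finite vector configuration by supporting hyperplanes through the
origin. -/
def IsFace (v : ι → W) (S : Set ι) : Prop :=
  ∃ φ : W →ₗ[ℝ] ℝ, (∀ i, 0 ≤ φ (v i)) ∧ ∀ i, i ∈ S ↔ φ (v i) = 0

/-- The dimension of the span of a subconfiguration. -/
noncomputable def rk (v : ι → W) (S : Set ι) : ℕ :=
  Module.finrank ℝ (Submodule.span ℝ (v '' S))

omit [Fintype ι] [FiniteDimensional ℝ W] in
theorem isFace_univ (v : ι → W) : IsFace v univ :=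
  ⟨0, by simp, by simp⟩

omit [Fintype ι] [FiniteDimensional ℝ W] in
theorem IsFace.inter (hS : IsFace v S) (hT : IsFace v T) : IsFace v (S ∩ T) := by
  obtain ⟨φ, hφ, hS⟩ := hS
  obtain ⟨ψ, hψ, hT⟩ := hT
  refine ⟨φ + ψ, fun i => add_nonneg (hφ i) (hψ i), fun i => ?_⟩
  rw [mem_inter_iff, hS, hT, LinearMap.add_apply]
  exact (add_eq_zero_iff_of_nonneg (hφ i) (hψ i)).symm

omit [FiniteDimensional ℝ W] in
/-- A face of a face is a face. -/
theorem IsFace.of_restrict (hS : IsFace v S) (ψ : W →ₗ[ℝ] ℝ) (hψ : ∀ i ∈ S, 0 ≤ ψ (v i)) :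
    IsFace v {i | i ∈ S ∧ ψ (v i) = 0} := by
  classical
  obtain ⟨φ, hφ, hS⟩ := hS
  obtain ⟨K, hK⟩ : ∃ K : ℝ, ∀ i, i ∉ S → 0 < ψ (v i) + K * φ (v i) := by
    obtain ⟨K, hK⟩ := Finite.exists_le (fun i => (1 - ψ (v i)) / φ (v i))
    refine ⟨K, fun i hi => ?_⟩
    have h0 : 0 < φ (v i) := lt_of_le_of_ne (hφ i) fun h => hi ((hS i).2 h.symm)
    have := (div_le_iff₀ h0).1 (hK i)
    linarith
  refine ⟨ψ + K • φ, fun i => ?_, fun i => ?_⟩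
  · by_cases hi : i ∈ S
    · simpa [(hS i).1 hi] using hψ i hi
    · simpa using (hK i hi).le
  · by_cases hi : i ∈ S
    · simp [(hS i).1 hi, hi]
    · simpa [hi] using (hK i hi).ne'

omit [Fintype ι] in
theorem rk_mono (h : S ⊆ T) : rk v S ≤ rk v T :=
  Submodule.finrank_mono (Submodule.span_mono (image_mono h))

omit [Fintype ι] [FiniteDimensional ℝ W] in
theorem eq_zero_of_mem_span {φ : W →ₗ[ℝ] ℝ} (h : ∀ i ∈ S, φ (v i) = 0) {x : W}
    (hx : x ∈ Submodule.span ℝ (v '' S)) : φ x = 0 := by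
  have : Submodule.span ℝ (v '' S) ≤ LinearMap.ker φ := by
    rw [Submodule.span_le]
    rintro _ ⟨i, hi, rfl⟩
    exact h i hi
  exact this hx

omit [Fintype ι] in
theorem rk_lt_of_ne_zero {φ : W →ₗ[ℝ] ℝ} (h : S ⊆ T) (hS : ∀ i ∈ S, φ (v i) = 0) {i : ι}
    (hi : i ∈ T) (hφ : φ (v i) ≠ 0) : rk v S < rk v T := by
  refine lt_of_le_of_ne (rk_mono h) fun he => hφ ?_
  refine eq_zero_of_mem_span (S := S) (v := v) hS ?_
  rw [Submodule.eq_of_le_of_finrank_eq (Submodule.span_mono (image_mono h)) he]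
  exact Submodule.subset_span ⟨i, hi, rfl⟩

omit [Fintype ι] in
theorem IsFace.rk_lt (hS : IsFace v S) (h : S ⊂ T) : rk v S < rk v T := by
  obtain ⟨i, hiT, hiS⟩ := exists_of_ssubset h
  obtain ⟨φ, -, hS⟩ := hS
  exact rk_lt_of_ne_zero h.1 (fun j hj => (hS j).1 hj) hiT fun hi => hiS ((hS i).2 hi)

omit [Fintype ι] in
theorem IsFace.eq_of_rk_le (hS : IsFace v S) (h : S ⊆ T) (hr : rk v T ≤ rk v S) : S = T := by
  by_contra hne
  exact absurd (hS.rk_lt (h.ssubset_of_ne hne)) (by omega)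

omit [Fintype ι] in
/-- Two functionals vanishing on a face of corank one are proportional. -/
theorem proportional {φ χ : W →ₗ[ℝ] ℝ} (h : S ⊆ T)
    (hr : rk v T ≤ rk v S + 1)
    (hφS : ∀ i ∈ S, φ (v i) = 0) (hφ : ∀ i ∈ T, i ∉ S → φ (v i) ≠ 0)
    (hχ : ∀ i ∈ S, χ (v i) = 0) : ∃ c : ℝ, ∀ i ∈ T, χ (v i) = c * φ (v i) := by
  by_cases hne : ∃ i ∈ T, i ∉ S
  · obtain ⟨i, hiT, hiS⟩ := hne
    refine ⟨χ (v i) / φ (v i), fun j hj => ?_⟩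
    have hi0 := hφ i hiT hiS
    set ψ := χ - (χ (v i) / φ (v i)) • φ with hψ
    have hins : rk v S + 1 ≤ rk v (insert i S) :=
      rk_lt_of_ne_zero (subset_insert i S) hφS (mem_insert i S) hi0
    have hle : insert i S ⊆ T := insert_subset hiT h
    have hsp := Submodule.eq_of_le_of_finrank_le
      (Submodule.span_mono (R := ℝ) (image_mono (f := v) hle)) (by
        change rk v T ≤ rk v (insert i S); omega)
    have : ψ (v j) = 0 := by
      refine eq_zero_of_mem_span (S := insert i S) (v := v) ?_ ?_
      · rintro k (rfl | hk)
        · simp [hψ, hi0]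
        · simp [hψ, hφS k hk, hχ k hk]
      · rw [hsp]; exact Submodule.subset_span ⟨j, hj, rfl⟩
    simpa [hψ, sub_eq_zero] using this
  · push Not at hne
    exact ⟨0, fun i hi => by simp [hχ i (hne i hi)]⟩

omit [FiniteDimensional ℝ W] in
/-- The face where the ratio of two functionals vanishing on `S` is minimal. -/
theorem exists_argmin_face {φ χ : W →ₗ[ℝ] ℝ} (hT : IsFace v T) (h : S ⊂ T)
    (hφ : ∀ i ∈ T, 0 ≤ φ (v i)) (hφS : ∀ i ∈ T, i ∈ S ↔ φ (v i) = 0)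
    (hχ : ∀ i ∈ S, χ (v i) = 0) :
    ∃ (t : ℝ) (R : Set ι), IsFace v R ∧ S ⊂ R ∧ R ⊆ T ∧
      (∀ i ∈ T, t * φ (v i) ≤ χ (v i)) ∧ ∀ i ∈ T, i ∈ R ↔ χ (v i) = t * φ (v i) := by
  classical
  obtain ⟨i₀, hi₀T, hi₀S⟩ := exists_of_ssubset h
  have hpos : ∀ i ∈ T, i ∉ S → 0 < φ (v i) := fun i hi hiS =>
    lt_of_le_of_ne (hφ i hi) fun h => hiS ((hφS i hi).2 h.symm)
  obtain ⟨m, hm, hmin⟩ := (Set.toFinite (T \ S)).exists_minimalFor (fun i => χ (v i) / φ (v i))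
    (T \ S) ⟨i₀, hi₀T, hi₀S⟩
  have hmin' : ∀ i ∈ T \ S, χ (v m) / φ (v m) ≤ χ (v i) / φ (v i) := by
    intro i hi
    by_contra! hlt
    exact absurd (hmin hi hlt.le) (not_le.2 hlt)
  set t := χ (v m) / φ (v m)
  have hle : ∀ i ∈ T, t * φ (v i) ≤ χ (v i) := by
    intro i hi
    by_cases hiS : i ∈ S
    · simp [hχ i hiS, (hφS i hi).1 hiS]
    · exact (le_div_iff₀ (hpos i hi hiS)).1 (hmin' i ⟨hi, hiS⟩)
  refine ⟨t, {i | i ∈ T ∧ (χ - t • φ) (v i) = 0}, hT.of_restrict (χ - t • φ) ?_, ?_, ?_, hle, ?_⟩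
  · intro i hi
    simpa using hle i hi
  · refine ⟨fun i hi => ⟨h.1 hi, by simp [hχ i hi, (hφS i (h.1 hi)).1 hi]⟩, fun hsub => ?_⟩
    refine hm.2 (hsub ⟨hm.1, ?_⟩)
    have := hpos m hm.1 hm.2
    simp only [LinearMap.sub_apply, LinearMap.smul_apply, smul_eq_mul, t]
    field_simp
    ring
  · exact fun i hi => hi.1
  · intro i hi
    simp [hi, sub_eq_zero]

theorem IsFace.exists_between (hS : IsFace v S) (hT : IsFace v T) (h : S ⊆ T)
    (hr : rk v S + 2 ≤ rk v T) : ∃ R, IsFace v R ∧ S ⊂ R ∧ R ⊂ T := by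
  have hne : S ≠ T := by rintro rfl; omega
  have hss := h.ssubset_of_ne hne
  obtain ⟨i, hiT, hiS⟩ := exists_of_ssubset hss
  have hfin : Module.finrank ℝ (Submodule.span ℝ (v '' (insert i S))) ≤ rk v S + 1 := by
    rw [image_insert_eq, Submodule.span_insert, add_comm]
    refine (Submodule.finrank_add_le_finrank_add_finrank _ _).trans ?_
    exact Nat.add_le_add_right (finrank_span_le_card ({v i} : Set W) |>.trans (by simp)) _
  obtain ⟨j, hjT, hj⟩ : ∃ j ∈ T, v j ∉ Submodule.span ℝ (v '' (insert i S)) := by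
    by_contra! hall
    have : Submodule.span ℝ (v '' T) ≤ Submodule.span ℝ (v '' (insert i S)) := by
      rw [Submodule.span_le]
      rintro _ ⟨k, hk, rfl⟩
      exact hall k hk
    have := Submodule.finrank_mono this
    change rk v T ≤ _ at this
    omega
  obtain ⟨χ, hχj, hχ⟩ := Submodule.exists_le_ker_of_notMem hj
  have hχ' : ∀ k ∈ insert i S, χ (v k) = 0 := fun k hk =>
    hχ (Submodule.subset_span ⟨k, hk, rfl⟩)
  obtain ⟨φ, hφ, hφS⟩ := hS
  obtain ⟨t, R, hR, hSR, hRT, -, ht⟩ := exists_argmin_face hT hss (fun i _ => hφ i)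
    (fun i _ => hφS i) (fun k hk => hχ' k (mem_insert_of_mem _ hk))
  refine ⟨R, hR, hSR, hRT.ssubset_of_ne ?_⟩
  rintro rfl
  have h1 := (ht i hiT).1 hiT
  have h2 := (ht j hjT).1 hjT
  rw [hχ' i (mem_insert _ _)] at h1
  have hφi : φ (v i) ≠ 0 := fun h => hiS ((hφS i).2 h)
  have ht0 : t = 0 := by
    rcases mul_eq_zero.1 h1.symm with h | h
    · exact h
    · exact absurd h hφi
  rw [ht0, zero_mul] at h2
  exact hχj h2

theorem IsFace.exists_cover (hS : IsFace v S) (hT : IsFace v T) (h : S ⊂ T) :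
    ∃ R, IsFace v R ∧ S ⊂ R ∧ R ⊆ T ∧ rk v R = rk v S + 1 := by
  obtain ⟨R, ⟨hR, hSR, hRT⟩, hmin⟩ := (Set.toFinite {R | IsFace v R ∧ S ⊂ R ∧ R ⊆ T}).exists_minimal
    ⟨T, hT, h, le_rfl⟩
  refine ⟨R, hR, hSR, hRT, ?_⟩
  by_contra hne
  have h1 := hS.rk_lt hSR
  obtain ⟨R', hR', h1', h2'⟩ := hS.exists_between hR hSR.1 (by omega)
  exact h2'.2 (hmin ⟨hR', h1', h2'.1.trans hRT⟩ h2'.1)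

theorem IsFace.exists_cocover (hS : IsFace v S) (hT : IsFace v T) (h : S ⊂ T) :
    ∃ R, IsFace v R ∧ S ⊆ R ∧ R ⊂ T ∧ rk v R + 1 = rk v T := by
  obtain ⟨R, ⟨hR, hSR, hRT⟩, hmax⟩ := (Set.toFinite {R | IsFace v R ∧ S ⊆ R ∧ R ⊂ T}).exists_maximal
    ⟨S, hS, le_rfl, h⟩
  refine ⟨R, hR, hSR, hRT, ?_⟩
  by_contra hne
  have h1 := hR.rk_lt hRT
  obtain ⟨R', hR', h1', h2'⟩ := hR.exists_between hT hRT.1 (by omega)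
  exact h1'.2 (hmax ⟨hR', hSR.trans h1'.1, h2'⟩ h1'.1)

/-- A simplex step: a functional vanishing on `T` and positive somewhere on `G` is positive on some
minimal face over `T`. -/
theorem IsFace.exists_improving {χ : W →ₗ[ℝ] ℝ} (hT : IsFace v T) (hG : IsFace v G) (h : T ⊆ G)
    (hχ : ∀ i ∈ T, χ (v i) = 0) (hpos : ∃ i ∈ G, 0 < χ (v i)) :
    ∃ R, IsFace v R ∧ T ⊂ R ∧ R ⊆ G ∧ rk v R = rk v T + 1 ∧ ∀ i ∈ R, i ∉ T → 0 < χ (v i) := by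
  obtain ⟨i, hiG, hi⟩ := hpos
  have hss : T ⊂ G := ⟨h, fun hsub => by rw [hχ i (hsub hiG)] at hi; exact lt_irrefl _ hi⟩
  have hT' := hT
  obtain ⟨φ, hφ, hφT⟩ := hT'
  obtain ⟨t, R, hR, hTR, hRG, hle, ht⟩ := exists_argmin_face (χ := -χ) hG hss (fun i _ => hφ i)
    (fun i _ => hφT i) (fun k hk => by simp [hχ k hk])
  obtain ⟨R', hR', hTR', hR'R, hrk⟩ := hT.exists_cover hR hTR
  refine ⟨R', hR', hTR', hR'R.trans hRG, hrk, fun j hj hjT => ?_⟩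
  have h1 := (ht j (hRG (hR'R hj))).1 (hR'R hj)
  have h2 := hle i hiG
  simp only [LinearMap.neg_apply] at h1 h2
  have hφj : 0 < φ (v j) := lt_of_le_of_ne (hφ j) fun h => hjT ((hφT j).2 h.symm)
  have htneg : t < 0 := by
    by_contra! h0
    have := mul_nonneg h0 (hφ i)
    linarith
  have := mul_neg_of_neg_of_pos htneg hφj
  linarith

/-- The faces of relative rank `k` in the interval between `U` and `G`. -/
def ivl (v : ι → W) (U G : Set ι) (k : ℕ) : Set (Set ι) :=
  {T | IsFace v T ∧ U ⊆ T ∧ T ⊆ G ∧ rk v T = rk v U + k}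

omit [Fintype ι] in
theorem IsFace.inter_eq_of_cover (hR : IsFace v R) (hT : IsFace v T) (hS : IsFace v S)
    (hSR : S ⊆ R) (hST : S ⊆ T) (hrk : rk v R ≤ rk v S + 1) (h : ¬ R ⊆ T) : R ∩ T = S := by
  have h1 : R ∩ T ⊂ R := ⟨inter_subset_left, fun h' => h fun i hi => (h' hi).2⟩
  have h2 := (hR.inter hT).rk_lt h1
  exact (hS.eq_of_rk_le (subset_inter hSR hST) (by omega)).symm

/-- The diamond property. -/
theorem IsFace.diamond (hS : IsFace v S) (hT : IsFace v T) (h : S ⊆ T)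
    (hr : rk v T = rk v S + 2) :
    ∃ R₁ R₂, R₁ ≠ R₂ ∧ ∀ R, R ∈ ivl v S T 1 ↔ R = R₁ ∨ R = R₂ := by
  have hss : S ⊂ T := h.ssubset_of_ne (by rintro rfl; omega)
  obtain ⟨R₁, hR₁, hS₁, h₁T, hrk₁⟩ := hS.exists_cover hT hss
  have hR₁' := hR₁
  obtain ⟨ψ, hψ, hψ₁⟩ := hR₁'
  have hne₁ : R₁ ⊂ T := h₁T.ssubset_of_ne (by rintro rfl; omega)
  obtain ⟨i, hiT, hi⟩ := exists_of_ssubset hne₁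
  obtain ⟨R₂, hR₂, hS₂, h₂T, hrk₂, hpos⟩ := hS.exists_improving (χ := ψ) hT h
    (fun j hj => (hψ₁ j).1 (hS₁.1 hj))
    ⟨i, hiT, lt_of_le_of_ne (hψ i) fun h => hi ((hψ₁ i).2 h.symm)⟩
  have hex : ∀ {A B : Set ι}, IsFace v A → IsFace v B → S ⊆ A → S ⊆ B → rk v A = rk v S + 1 →
      rk v B = rk v S + 1 → A ≠ B → ∃ i ∈ A, i ∉ B := by
    intro A B hA hB _ _ h1 h2 hne
    by_contra! hsub
    exact hne (hA.eq_of_rk_le hsub (by omega))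
  refine ⟨R₁, R₂, ?_, fun R => ⟨?_, ?_⟩⟩
  · rintro rfl
    obtain ⟨j, hj, hjS⟩ := exists_of_ssubset hS₁
    exact absurd ((hψ₁ j).1 hj) (hpos j hj hjS).ne'
  · rintro ⟨hR, hSR, hRT, hrk⟩
    by_contra! hne
    have hne12 : R₁ ≠ R₂ := by
      rintro rfl
      obtain ⟨j, hj, hjS⟩ := exists_of_ssubset hS₁
      exact absurd ((hψ₁ j).1 hj) (hpos j hj hjS).ne'
    have hS' := hS
    obtain ⟨φ, hφ, hφS⟩ := hS'
    have hφpos : ∀ i, i ∉ S → 0 < φ (v i) := fun i hi =>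
      lt_of_le_of_ne (hφ i) fun h => hi ((hφS i).2 h.symm)
    have hprop : ∀ {A}, IsFace v A → S ⊆ A → rk v A = rk v S + 1 →
        ∃ c : ℝ, ∀ i ∈ A, ψ (v i) = c * φ (v i) := fun hA hSA hrk =>
      proportional hSA hrk.le (fun i hi => (hφS i).1 hi)
        (fun i _ hi => (hφpos i hi).ne') (fun j hj => (hψ₁ j).1 (hS₁.1 hj))
    -- the functional of the smaller ratio changes sign
    have key : ∀ {A B}, IsFace v A → S ⊆ A → A ⊆ T → rk v A = rk v S + 1 → IsFace v B → S ⊆ B →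
        rk v B = rk v S + 1 → B ⊆ T → A ≠ B → A ≠ R₁ → ∀ a b : ℝ,
        (∀ i ∈ A, ψ (v i) = a * φ (v i)) → (∀ i ∈ B, ψ (v i) = b * φ (v i)) → a ≤ b → False := by
      intro A B hA hSA hAT hrA hB hSB hrB hBT hAB hA1 a b ha hb hab
      obtain ⟨i, hiA, hi1⟩ := hex hA hR₁ hSA hS₁.1 hrA hrk₁ hA1
      have hi0 : 0 < ψ (v i) := lt_of_le_of_ne (hψ i) fun h => hi1 ((hψ₁ i).2 h.symm)
      have hiS : i ∉ S := fun h => hi1 (hS₁.1 h)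
      have ha0 : 0 < a := by
        rw [ha i hiA] at hi0
        exact pos_of_mul_pos_left hi0 (hφ i)
      obtain ⟨j, hjB, hjA⟩ := hex hB hA hSB hSA hrB hrA hAB.symm
      obtain ⟨k, hk1, hkA⟩ := hex hR₁ hA hS₁.1 hSA hrk₁ hrA (Ne.symm hA1)
      have hA' := hA
      obtain ⟨θ, hθ, hθA⟩ := hA'
      obtain ⟨c, hc⟩ : ∃ c : ℝ, ∀ i ∈ T, (ψ - a • φ) (v i) = c * θ (v i) :=
        proportional hAT (by omega) (fun i hi => (hθA i).1 hi)
          (fun i _ hi h => hi ((hθA i).2 h)) (fun i hi => by simp [ha i hi])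
      have hθj : 0 < θ (v j) := lt_of_le_of_ne (hθ j) fun h => hjA ((hθA j).2 h.symm)
      have hθk : 0 < θ (v k) := lt_of_le_of_ne (hθ k) fun h => hkA ((hθA k).2 h.symm)
      have h1 := hc j (hBT hjB)
      have h2 := hc k (h₁T hk1)
      simp only [LinearMap.sub_apply, LinearMap.smul_apply, smul_eq_mul, hb j hjB,
        (hψ₁ k).1 hk1] at h1 h2
      have hφk := hφpos k fun h => hkA (hSA h)
      have hc0 : c < 0 := by
        by_contra! h0
        have := mul_nonneg h0 hθk.le
        have := mul_pos ha0 hφk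
        linarith
      have := mul_neg_of_neg_of_pos hc0 hθj
      have := mul_nonneg (sub_nonneg.2 hab) (hφ j)
      linarith
    obtain ⟨a, ha⟩ := hprop hR hSR hrk
    obtain ⟨b, hb⟩ := hprop hR₂ hS₂.1 hrk₂
    rcases le_total a b with hab | hab
    · exact key hR hSR hRT hrk hR₂ hS₂.1 hrk₂ h₂T hne.2 hne.1 a b ha hb hab
    · exact key hR₂ hS₂.1 h₂T hrk₂ hR hSR hrk hRT (Ne.symm hne.2) hne12.symm b a hb ha hab
  · rintro (rfl | rfl)
    · exact ⟨hR₁, hS₁.1, h₁T, hrk₁⟩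
    · exact ⟨hR₂, hS₂.1, h₂T, hrk₂⟩

/-- Atoms of an interval are connected through faces of relative rank two. -/
theorem IsFace.atoms_connected (hS : IsFace v S) (hG : IsFace v G) {𝒜 : Set (Set ι)}
    (hne : ∃ A ∈ 𝒜, A ∈ ivl v S G 1)
    (hcl : ∀ A ∈ 𝒜, ∀ B ∈ ivl v S G 1, ∀ R ∈ ivl v S G 2, A ⊆ R → B ⊆ R → B ∈ 𝒜) :
    ∀ B ∈ ivl v S G 1, B ∈ 𝒜 := by
  intro B hB
  have hS' := hS
  obtain ⟨φ, hφ, hφS⟩ := hS'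
  have hφpos : ∀ i, i ∉ S → 0 < φ (v i) := fun i hi =>
    lt_of_le_of_ne (hφ i) fun h => hi ((hφS i).2 h.symm)
  obtain ⟨hBf, hSB, hBG, hrB⟩ := hB
  have hBf' := hBf
  obtain ⟨ψ, hψ, hψB⟩ := hBf'
  have hprop : ∀ A, ∃ c : ℝ, A ∈ ivl v S G 1 → ∀ i ∈ A, ψ (v i) = c * φ (v i) := by
    intro A
    by_cases hA : A ∈ ivl v S G 1
    · obtain ⟨c, hc⟩ := proportional (χ := ψ) hA.2.1 hA.2.2.2.le (fun i hi => (hφS i).1 hi)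
        (fun i _ hi => (hφpos i hi).ne') (fun j hj => (hψB j).1 (hSB hj))
      exact ⟨c, fun _ => hc⟩
    · exact ⟨0, fun h => absurd h hA⟩
  choose c hc using hprop
  obtain ⟨A, ⟨hA𝒜, hA⟩, hmin⟩ := (Set.toFinite (𝒜 ∩ ivl v S G 1)).exists_minimalFor c _ hne
  have hA1 := hA
  obtain ⟨hAf, hSA, hAG, hrA⟩ := hA1
  have hssA : S ⊂ A := hSA.ssubset_of_ne (by rintro rfl; omega)
  obtain ⟨a, haA, haS⟩ := exists_of_ssubset hssA
  have hcA := hc A hA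
  by_cases hc0 : c A = 0
  · have : A ⊆ B := fun i hi => (hψB i).2 (by rw [hcA i hi, hc0, zero_mul])
    rwa [← hAf.eq_of_rk_le this (by omega)]
  · have hcpos : 0 < c A := by
      refine lt_of_le_of_ne ?_ (Ne.symm hc0)
      have := hψ a
      rw [hcA a haA] at this
      exact nonneg_of_mul_nonneg_left this (hφpos a haS)
    have hssB : S ⊂ B := hSB.ssubset_of_ne (by rintro rfl; omega)
    obtain ⟨b, hbB, hbS⟩ := exists_of_ssubset hssB
    obtain ⟨R, hR, hAR, hRG, hrR, hpos⟩ := hAf.exists_improving (χ := c A • φ - ψ) hG hAG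
      (fun i hi => by simp [hcA i hi])
      ⟨b, hBG hbB, by simpa [(hψB b).1 hbB] using mul_pos hcpos (hφpos b hbS)⟩
    obtain ⟨R₁, R₂, hne12, hiff⟩ := hS.diamond hR (hSA.trans hAR.1) (by omega)
    obtain ⟨A', hA'R, hA'ne⟩ : ∃ A' ∈ ivl v S R 1, A' ≠ A := by
      by_cases h : R₁ = A
      · exact ⟨R₂, (hiff R₂).2 (Or.inr rfl), fun h' => hne12 (h.trans h'.symm)⟩
      · exact ⟨R₁, (hiff R₁).2 (Or.inl rfl), h⟩
    have hA'G : A' ∈ ivl v S G 1 := ⟨hA'R.1, hA'R.2.1, hA'R.2.2.1.trans hRG, hA'R.2.2.2⟩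
    have hA'𝒜 := hcl A hA𝒜 A' hA'G R ⟨hR, hSA.trans hAR.1, hRG, by omega⟩ hAR.1 hA'R.2.2.1
    obtain ⟨k, hkA', hkA⟩ : ∃ k ∈ A', k ∉ A := by
      by_contra! hsub
      exact hA'ne (hA'R.1.eq_of_rk_le hsub (by rw [hA'R.2.2.2]; omega))
    have h1 := hpos k (hA'R.2.2.1 hkA') hkA
    simp only [LinearMap.sub_apply, LinearMap.smul_apply, smul_eq_mul, hc A' hA'G k hkA'] at h1
    have h2 : c A' < c A := by
      have : 0 < (c A - c A') * φ (v k) := by linarith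
      have := pos_of_mul_pos_left this (hφ k)
      linarith
    exact absurd (hmin ⟨hA'𝒜, hA'G⟩ h2.le) (not_le.2 h2)

/-- Facets of an interval are connected through ridges. -/
theorem IsFace.facets_connected (hS : IsFace v S) (hG : IsFace v G) (hSG : S ⊂ G)
    {𝒜 : Set (Set ι)}
    (hcl : ∀ A ∈ 𝒜, ∀ R B, IsFace v R → S ⊆ R → R ⊆ A → R ⊆ B → IsFace v A → IsFace v B →
      A ⊆ G → B ⊆ G → rk v A + 1 = rk v G → rk v B + 1 = rk v G → rk v R + 2 = rk v G → B ∈ 𝒜)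
    {A : Set ι} (hA𝒜 : A ∈ 𝒜) (hA : IsFace v A) (hSA : S ⊆ A) (hAG : A ⊆ G)
    (hrA : rk v A + 1 = rk v G) {B : Set ι} (hB : IsFace v B) (hSB : S ⊆ B) (hBG : B ⊆ G)
    (hrB : rk v B + 1 = rk v G) : B ∈ 𝒜 := by
  induction hk : rk v G - rk v S using Nat.strong_induction_on generalizing S A B with
  | _ k ih =>
  have hlt := hS.rk_lt hSG
  by_cases h1 : rk v S + 1 = rk v G
  · have e1 := hS.eq_of_rk_le hSA (by omega)
    have e2 := hS.eq_of_rk_le hSB (by omega)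
    rw [← e2, e1]; exact hA𝒜
  by_cases h2 : rk v S + 2 = rk v G
  · exact hcl A hA𝒜 S B hS le_rfl hSA hSB hA hB hAG hBG hrA hrB h2
  -- every atom of the interval has all facets above it in the class
  have hall : ∀ T ∈ ivl v S G 1, T ∈ {T | ∀ F, IsFace v F → T ⊆ F → F ⊆ G → rk v F + 1 = rk v G →
      F ∈ 𝒜} := by
    have step : ∀ T, IsFace v T → S ⊆ T → T ⊆ G → rk v T = rk v S + 1 → ∀ F₀ ∈ 𝒜, IsFace v F₀ →
        T ⊆ F₀ → F₀ ⊆ G → rk v F₀ + 1 = rk v G → ∀ F, IsFace v F → T ⊆ F → F ⊆ G →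
        rk v F + 1 = rk v G → F ∈ 𝒜 := by
      intro T hT hST hTG hrT F₀ hF₀ hF₀f hTF₀ hF₀G hrF₀ F hF hTF hFG hrF
      refine ih (rk v G - rk v T) (by omega) hT (hTG.ssubset_of_ne (by rintro rfl; omega)) ?_ hF₀
        hF₀f hTF₀ hF₀G hrF₀ hF hTF hFG hrF rfl
      intro A hA R B hR hTR
      exact hcl A hA R B hR (hST.trans hTR)
    refine hS.atoms_connected hG ?_ ?_
    · obtain ⟨T, hT, hST, hTA, hrT⟩ := hS.exists_cover hA (hSA.ssubset_of_ne (by rintro rfl; omega))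
      exact ⟨T, fun F hF hTF hFG hrF => step T hT hST.1 (hTA.trans hAG) hrT A hA𝒜 hA hTA hAG hrA F hF
        hTF hFG hrF, hT, hST.1, hTA.trans hAG, hrT⟩
    · intro T hT T' hT' R hR hTR hT'R
      obtain ⟨hRf, hSR, hRG, hrR⟩ := hR
      obtain ⟨F₀, hF₀, hRF₀, hF₀G, hrF₀⟩ := hRf.exists_cocover hG
        (hRG.ssubset_of_ne (by rintro rfl; omega))
      exact step T' hT'.1 hT'.2.1 hT'.2.2.1 hT'.2.2.2 F₀
        (hT F₀ hF₀ (hTR.trans hRF₀) hF₀G.1 hrF₀) hF₀ (hT'R.trans hRF₀) hF₀G.1 hrF₀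
  obtain ⟨T, hT, hST, hTB, hrT⟩ := hS.exists_cover hB (hSB.ssubset_of_ne (by rintro rfl; omega))
  exact hall T ⟨hT, hST.1, hTB.trans hBG, hrT⟩ B hB hTB hBG hrB

end ConeFaces

/-! ### Half of Euler's formula -/

section EulerCount

open Classical in
/-- At a vertex, the edges of positive slope are at most one more than the corners both of whose
edges have positive slope. -/
theorem card_up_edges_le {E F : Type*} (D : Finset E) (N : Finset F) (eF : E → F → Prop) (ρ : E → ℝ)
    (h2 : ∀ f ∈ N, (D.filter fun e => eF e f).card = 2)
    (himp : ∀ e ∈ D, ∀ e' ∈ D, ρ e < ρ e' → ∃ f ∈ N, eF e f ∧ ∃ e'' ∈ D, eF e'' f ∧ ρ e < ρ e'')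
    (hinj : ∀ e ∈ D, ∀ e' ∈ D, ρ e = ρ e' → e = e') :
    (D.filter fun e => 0 < ρ e).card ≤ (N.filter fun f => ∀ e ∈ D, eF e f → 0 < ρ e).card + 1 := by
  rcases (D.filter fun e => 0 < ρ e).eq_empty_or_nonempty with h0 | hne
  · simp [h0]
  obtain ⟨m, hm, hmax⟩ := Finset.exists_max_image _ ρ hne
  have hmD := (Finset.mem_filter.1 hm).1
  rw [← Finset.card_erase_add_one hm]
  refine Nat.add_le_add_right ?_ 1
  have two : ∀ f ∈ N, ∀ a ∈ D, ∀ b ∈ D, eF a f → eF b f → a ≠ b → ∀ c ∈ D, eF c f → c = a ∨ c = b := by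
    intro f hf a ha b hb haf hbf hab c hc hcf
    by_contra! h
    have : ({a, b, c} : Finset E) ⊆ D.filter fun e => eF e f := by
      intro x hx
      simp only [Finset.mem_insert, Finset.mem_singleton] at hx
      rcases hx with rfl | rfl | rfl <;> simp [*]
    have h3 := Finset.card_le_card this
    rw [h2 f hf, Finset.card_eq_three.2 ⟨a, b, c, hab, h.1.symm, h.2.symm, rfl⟩] at h3
    omega
  refine Finset.card_le_card_of_forall_subsingleton
    (fun e f => f ∈ N ∧ eF e f ∧ ∃ e'' ∈ D, eF e'' f ∧ ρ e < ρ e'') ?_ ?_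
  · intro e he
    have heD := Finset.mem_filter.1 (Finset.mem_of_mem_erase he)
    have hlt : ρ e < ρ m := lt_of_le_of_ne (hmax e (Finset.mem_of_mem_erase he)) fun h =>
      Finset.ne_of_mem_erase he (hinj e heD.1 m hmD h)
    obtain ⟨f, hf, hef, e'', he'', h1, h2⟩ := himp e heD.1 m hmD hlt
    refine ⟨f, Finset.mem_filter.2 ⟨hf, fun c hc hcf => ?_⟩, hf, hef, e'', he'', h1, h2⟩
    rcases two f hf e heD.1 e'' he'' hef h1 (by rintro rfl; exact lt_irrefl _ h2) c hc hcf with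
      rfl | rfl
    · exact heD.2
    · exact heD.2.trans h2
  · rintro f - a ⟨ha, hf, haf, a'', ha'', ha''f, hlta⟩ b ⟨hb, -, hbf, b'', hb'', hb''f, hltb⟩
    by_contra hab
    have haD := (Finset.mem_filter.1 (Finset.mem_of_mem_erase ha)).1
    have hbD := (Finset.mem_filter.1 (Finset.mem_of_mem_erase hb)).1
    rcases two f hf a haD b hbD haf hbf hab a'' ha'' ha''f with rfl | rfl
    · exact lt_irrefl _ hlta
    rcases two f hf a haD a'' hbD haf hbf hab b'' hb'' hb''f with rfl | rfl
    · exact lt_asymm hlta hltb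
    · exact lt_irrefl _ hltb

variable {V E F : Type*} [Fintype V] [Fintype E] [Fintype F]

open Classical in
theorem card_add_two_le_of_heights (vE : V → E → Prop) (eF : E → F → Prop) (vF : V → F → Prop)
    (h : V → ℝ) (ρ : V → E → ℝ) (e₀ : E)
    (hvE : ∀ e, (Finset.univ.filter fun v => vE v e).card = 2)
    (heF : ∀ e, (Finset.univ.filter fun f => eF e f).card = 2)
    (hc : ∀ v f, vF v f → (Finset.univ.filter fun e => vE v e ∧ eF e f).card = 2)
    (hvF : ∀ v e f, vE v e → eF e f → vF v f)
    (hinj : Function.Injective h)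
    (hρ0 : ∀ v e, vE v e → ρ v e ≠ 0)
    (hρ : ∀ v w e, vE v e → vE w e → w ≠ v → (0 < ρ v e ↔ h v < h w))
    (hρinj : ∀ v e e', vE v e → vE v e' → ρ v e = ρ v e' → e = e')
    (hup : ∀ v w f, vF v f → vF w f → h v < h w → ∃ e, vE v e ∧ eF e f ∧ 0 < ρ v e)
    (hdown : ∀ v w f, vF v f → vF w f → h w < h v → ∃ e, vE v e ∧ eF e f ∧ ρ v e < 0)
    (himp : ∀ v e e', vE v e → vE v e' → ρ v e < ρ v e' →
      ∃ f, eF e f ∧ ∃ e'', vE v e'' ∧ eF e'' f ∧ ρ v e < ρ v e'')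
    (himp' : ∀ v e e', vE v e → vE v e' → ρ v e' < ρ v e →
      ∃ f, eF e f ∧ ∃ e'', vE v e'' ∧ eF e'' f ∧ ρ v e'' < ρ v e) :
    Fintype.card E + 2 ≤ Fintype.card V + Fintype.card F := by
  set side : V → F → Prop := fun v f => vF v f ∧ (∃ e, vE v e ∧ eF e f ∧ 0 < ρ v e) ∧
    ∃ e, vE v e ∧ eF e f ∧ ρ v e < 0 with hside
  have hother : ∀ v e, vE v e → ∃ w, vE w e ∧ w ≠ v := by
    intro v e hv
    obtain ⟨a, b, hab, hE⟩ := Finset.card_eq_two.1 (hvE e)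
    have ha : vE a e := by
      have : a ∈ Finset.univ.filter fun v => vE v e := by simp [hE]
      simpa using this
    have hb : vE b e := by
      have : b ∈ Finset.univ.filter fun v => vE v e := by simp [hE]
      simpa using this
    by_cases h : a = v
    · exact ⟨b, hb, fun h' => hab (h.trans h'.symm)⟩
    · exact ⟨a, ha, h⟩
  -- double counting
  have hdeg : ∀ v, (Finset.univ.filter fun f => vF v f).card =
      (Finset.univ.filter fun e => vE v e).card := by
    intro v
    have := Finset.sum_card_bipartiteAbove_eq_sum_card_bipartiteBelow
      (s := Finset.univ.filter fun e => vE v e) (t := Finset.univ.filter fun f => vF v f) eF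
    have h1 : ∀ e ∈ Finset.univ.filter fun e => vE v e,
        (Finset.bipartiteAbove eF (Finset.univ.filter fun f => vF v f) e).card = 2 := by
      intro e he
      rw [← heF e]
      congr 1
      ext f
      simp only [Finset.bipartiteAbove, Finset.mem_filter, Finset.mem_univ, true_and]
      exact ⟨fun h => h.2, fun h => ⟨hvF v e f (Finset.mem_filter.1 he).2 h, h⟩⟩
    have h2 : ∀ f ∈ Finset.univ.filter fun f => vF v f,
        (Finset.bipartiteBelow eF (Finset.univ.filter fun e => vE v e) f).card = 2 := by
      intro f hf
      rw [← hc v f (Finset.mem_filter.1 hf).2]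
      congr 1
      ext e
      simp [Finset.bipartiteBelow]
    rw [Finset.sum_congr rfl h1, Finset.sum_congr rfl h2] at this
    simp only [Finset.sum_const, smul_eq_mul] at this
    omega
  have hEsum : ∑ v, (Finset.univ.filter fun e => vE v e).card = 2 * Fintype.card E := by
    have := Finset.sum_card_bipartiteAbove_eq_sum_card_bipartiteBelow
      (s := (Finset.univ : Finset V)) (t := (Finset.univ : Finset E)) vE
    simp only [Finset.bipartiteAbove, Finset.bipartiteBelow] at this
    rw [this, Finset.sum_congr rfl fun e _ => hvE e]
    simp [mul_comm]
  have hFsum : ∑ f, (Finset.univ.filter fun v => vF v f).card = 2 * Fintype.card E := by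
    rw [← hEsum, ← Finset.sum_congr rfl fun v _ => hdeg v]
    have := Finset.sum_card_bipartiteAbove_eq_sum_card_bipartiteBelow
      (s := (Finset.univ : Finset V)) (t := (Finset.univ : Finset F)) vF
    simpa only [Finset.bipartiteAbove, Finset.bipartiteBelow] using this.symm
  have hside_sum : ∑ f, (Finset.univ.filter fun v => side v f).card =
      ∑ v, (Finset.univ.filter fun f => side v f).card := by
    have := Finset.sum_card_bipartiteAbove_eq_sum_card_bipartiteBelow
      (s := (Finset.univ : Finset V)) (t := (Finset.univ : Finset F)) side
    simpa only [Finset.bipartiteAbove, Finset.bipartiteBelow] using this.symm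
  -- side corners of a face
  have hlow : ∀ f, (Finset.univ.filter fun v => vF v f).card ≤
      (Finset.univ.filter fun v => side v f).card + 2 := by
    intro f
    rcases (Finset.univ.filter fun v => vF v f).eq_empty_or_nonempty with h0 | hne
    · simp [h0]
    obtain ⟨a, ha, hamax⟩ := Finset.exists_max_image _ h hne
    obtain ⟨b, hb, hbmin⟩ := Finset.exists_min_image _ h hne
    have hsub : (Finset.univ.filter fun v => vF v f) ⊆
        (Finset.univ.filter fun v => side v f) ∪ {a, b} := by
      intro v hv
      by_cases hva : v = a
      · simp [hva]
      by_cases hvb : v = b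
      · simp [hvb]
      have hvf := (Finset.mem_filter.1 hv).2
      refine Finset.mem_union_left _ (Finset.mem_filter.2 ⟨Finset.mem_univ _, hvf, ?_, ?_⟩)
      · exact hup v a f hvf (Finset.mem_filter.1 ha).2
          (lt_of_le_of_ne (hamax v hv) fun h => hva (hinj h))
      · exact hdown v b f hvf (Finset.mem_filter.1 hb).2
          (lt_of_le_of_ne (hbmin v hv) fun h => hvb (hinj h).symm)
    exact (Finset.card_le_card hsub).trans
      ((Finset.card_union_le _ _).trans (Nat.add_le_add_left Finset.card_le_two _))
  -- side corners of a vertex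
  have hupp : ∀ v, (Finset.univ.filter fun f => side v f).card ≤ 2 := by
    intro v
    set D := Finset.univ.filter fun e => vE v e with hD
    set N := Finset.univ.filter fun f => vF v f with hN
    have hDN : ∀ f ∈ N, (D.filter fun e => eF e f).card = 2 := by
      intro f hf
      rw [← hc v f (Finset.mem_filter.1 hf).2, hD, Finset.filter_filter]
    have c1 : (D.filter fun e => 0 < ρ v e).card ≤
        (N.filter fun f => ∀ e ∈ D, eF e f → 0 < ρ v e).card + 1 := by
      convert card_up_edges_le D N eF (ρ v) hDN (by
        intro e he e' he' hlt
        simp only [hD, Finset.mem_filter, Finset.mem_univ, true_and] at he he'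
        obtain ⟨f, hf, e'', h1, h2, h3⟩ := himp v e e' he he' hlt
        exact ⟨f, by simpa [hN] using hvF v e f he hf, hf, e'', by simpa [hD] using h1, h2, h3⟩)
        (by
          intro e he e' he' h
          simp only [hD, Finset.mem_filter, Finset.mem_univ, true_and] at he he'
          exact hρinj v e e' he he' h)
    have c2 : (D.filter fun e => 0 < - ρ v e).card ≤
        (N.filter fun f => ∀ e ∈ D, eF e f → 0 < - ρ v e).card + 1 := by
      convert card_up_edges_le D N eF (fun e => - ρ v e) hDN (by
        intro e he e' he' hlt
        simp only [hD, Finset.mem_filter, Finset.mem_univ, true_and] at he he'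
        obtain ⟨f, hf, e'', h1, h2, h3⟩ := himp' v e e' he he' (by linarith)
        exact ⟨f, by simpa [hN] using hvF v e f he hf, hf, e'', by simpa [hD] using h1, h2,
          by linarith⟩)
        (by
          intro e he e' he' h
          simp only [hD, Finset.mem_filter, Finset.mem_univ, true_and] at he he'
          exact hρinj v e e' he he' (neg_injective h))
    have cD : (D.filter fun e => 0 < ρ v e).card + (D.filter fun e => 0 < - ρ v e).card =
        D.card := by
      rw [← Finset.card_filter_add_card_filter_not (s := D) (fun e => 0 < ρ v e)]
      congr 2
      ext e
      simp only [Finset.mem_filter, not_lt, Left.neg_pos_iff]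
      refine and_congr_right fun he => ⟨fun h => h.le, fun h => lt_of_le_of_ne h ?_⟩
      exact hρ0 v e (Finset.mem_filter.1 he).2
    have hpick : ∀ f ∈ N, ∃ e ∈ D, eF e f := by
      intro f hf
      have : 0 < (D.filter fun e => eF e f).card := by rw [hDN f hf]; norm_num
      obtain ⟨e, he⟩ := Finset.card_pos.1 this
      exact ⟨e, (Finset.mem_filter.1 he).1, (Finset.mem_filter.1 he).2⟩
    have hdisj1 : Disjoint (N.filter fun f => ∀ e ∈ D, eF e f → 0 < ρ v e)
        (N.filter fun f => ∀ e ∈ D, eF e f → 0 < - ρ v e) := by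
      rw [Finset.disjoint_left]
      intro f h1 h2
      obtain ⟨hf, h1⟩ := Finset.mem_filter.1 h1
      obtain ⟨e, he, hef⟩ := hpick f hf
      have a1 := h1 e he hef
      have a2 := (Finset.mem_filter.1 h2).2 e he hef
      linarith
    have hdisj2 : Disjoint (Finset.univ.filter fun f => side v f)
        ((N.filter fun f => ∀ e ∈ D, eF e f → 0 < ρ v e) ∪
        (N.filter fun f => ∀ e ∈ D, eF e f → 0 < - ρ v e)) := by
      rw [Finset.disjoint_left]
      intro f h1 h2
      obtain ⟨-, -, ⟨e, he, hef, hpos⟩, ⟨e', he', hef', hneg⟩⟩ := Finset.mem_filter.1 h1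
      rcases Finset.mem_union.1 h2 with h2 | h2
      · have := (Finset.mem_filter.1 h2).2 e' (by simpa [hD] using he') hef'
        linarith
      · have := (Finset.mem_filter.1 h2).2 e (by simpa [hD] using he) hef
        linarith
    have hsub : (Finset.univ.filter fun f => side v f) ∪
        ((N.filter fun f => ∀ e ∈ D, eF e f → 0 < ρ v e) ∪
        (N.filter fun f => ∀ e ∈ D, eF e f → 0 < - ρ v e)) ⊆ N := by
      intro f hf
      rcases Finset.mem_union.1 hf with h | h
      · simpa [hN] using (Finset.mem_filter.1 h).2.1
      · rcases Finset.mem_union.1 h with h | h <;> exact (Finset.mem_filter.1 h).1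
    have := Finset.card_le_card hsub
    rw [Finset.card_union_of_disjoint hdisj2, Finset.card_union_of_disjoint hdisj1] at this
    have hd := hdeg v
    change N.card = D.card at hd
    omega
  -- the highest and the lowest vertex
  have hV2 : ∃ a b : V, a ≠ b := by
    obtain ⟨a, b, hab, -⟩ := Finset.card_eq_two.1 (hvE e₀)
    exact ⟨a, b, hab⟩
  obtain ⟨a₀, b₀, hab₀⟩ := hV2
  obtain ⟨a, -, hamax⟩ := Finset.exists_max_image Finset.univ h ⟨a₀, Finset.mem_univ _⟩
  obtain ⟨b, -, hbmin⟩ := Finset.exists_min_image Finset.univ h ⟨a₀, Finset.mem_univ _⟩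
  have hab : a ≠ b := by
    rintro rfl
    refine hab₀ (hinj (le_antisymm ?_ ?_))
    · exact (hamax a₀ (Finset.mem_univ _)).trans (hbmin b₀ (Finset.mem_univ _))
    · exact (hamax b₀ (Finset.mem_univ _)).trans (hbmin a₀ (Finset.mem_univ _))
  have ha0 : (Finset.univ.filter fun f => side a f).card = 0 := by
    rw [Finset.card_eq_zero, Finset.filter_eq_empty_iff]
    rintro f - ⟨-, ⟨e, he, -, hpos⟩, -⟩
    obtain ⟨w, hw, hwa⟩ := hother a e he
    exact absurd ((hρ a w e he hw hwa).1 hpos) (not_lt.2 (hamax w (Finset.mem_univ _)))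
  have hb0 : (Finset.univ.filter fun f => side b f).card = 0 := by
    rw [Finset.card_eq_zero, Finset.filter_eq_empty_iff]
    rintro f - ⟨-, -, ⟨e, he, -, hneg⟩⟩
    obtain ⟨w, hw, hwb⟩ := hother b e he
    have := (hρ b w e he hw hwb).2 (lt_of_le_of_ne (hbmin w (Finset.mem_univ _))
      fun h => hwb (hinj h).symm)
    linarith
  have htot : ∑ v, (Finset.univ.filter fun f => side v f).card + 4 ≤ 2 * Fintype.card V := by
    have h1 : ∑ v, (Finset.univ.filter fun f => side v f).card =
        ∑ v ∈ (Finset.univ.erase a).erase b, (Finset.univ.filter fun f => side v f).card := by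
      rw [← Finset.add_sum_erase _ _ (Finset.mem_univ a),
        ← Finset.add_sum_erase _ _ (Finset.mem_erase.2 ⟨hab.symm, Finset.mem_univ b⟩), ha0, hb0]
      simp
    rw [h1]
    have h2 := Finset.sum_le_card_nsmul ((Finset.univ.erase a).erase b)
      (fun v => (Finset.univ.filter fun f => side v f).card) 2 fun v _ => hupp v
    rw [Finset.card_erase_of_mem (Finset.mem_erase.2 ⟨hab.symm, Finset.mem_univ b⟩),
      Finset.card_erase_of_mem (Finset.mem_univ a), Finset.card_univ] at h2
    have : 2 ≤ Fintype.card V := by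
      rw [← Finset.card_univ]
      exact Finset.one_lt_card.2 ⟨a, Finset.mem_univ _, b, Finset.mem_univ _, hab⟩
    simp only [smul_eq_mul] at h2
    omega
  have hFle : ∑ f, (Finset.univ.filter fun v => vF v f).card ≤
      ∑ f, (Finset.univ.filter fun v => side v f).card + 2 * Fintype.card F := by
    refine (Finset.sum_le_sum fun f _ => hlow f).trans ?_
    rw [Finset.sum_add_distrib]
    simp [mul_comm]
  omega

end EulerCount

/-! ### The combinatorics of intervals of length four -/

section Interval

variable {ι W : Type*} [Fintype ι] [AddCommGroup W] [Module ℝ W] [FiniteDimensional ℝ W]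
  {v : ι → W} {S T U G R : Set ι}

omit [FiniteDimensional ℝ W] in
instance (v : ι → W) (U G : Set ι) (k : ℕ) : Finite (ivl v U G k) :=
  Set.finite_coe_iff.2 (Set.toFinite _)

noncomputable instance (v : ι → W) (U G : Set ι) (k : ℕ) : Fintype (ivl v U G k) :=
  Fintype.ofFinite _

omit [Fintype ι] [FiniteDimensional ℝ W] in
theorem ivl_left (hU : IsFace v U) (h : U ⊆ G) : U ∈ ivl v U G 0 := ⟨hU, le_rfl, h, rfl⟩

omit [Fintype ι] [FiniteDimensional ℝ W] in
theorem ivl_right {k : ℕ} (hG : IsFace v G) (h : U ⊆ G) (hr : rk v G = rk v U + k) :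
    G ∈ ivl v U G k := ⟨hG, h, le_rfl, hr⟩

open Classical in
theorem ivl_card_two {k : ℕ} (hS : S ∈ ivl v U G k) (hT : T ∈ ivl v U G (k + 2)) (h : S ⊆ T) :
    (Finset.univ.filter fun R : ivl v U G (k + 1) => S ⊆ R.1 ∧ R.1 ⊆ T).card = 2 := by
  obtain ⟨R₁, R₂, hne, hiff⟩ := hS.1.diamond hT.1 h (by rw [hT.2.2.2, hS.2.2.2]; rfl)
  have hmem : ∀ R ∈ ivl v S T 1, R ∈ ivl v U G (k + 1) := fun R hR =>
    ⟨hR.1, hS.2.1.trans hR.2.1, hR.2.2.1.trans hT.2.2.1, by rw [hR.2.2.2, hS.2.2.2]; ring⟩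
  have h₁ := (hiff R₁).2 (Or.inl rfl)
  have h₂ := (hiff R₂).2 (Or.inr rfl)
  rw [Finset.card_eq_two]
  refine ⟨⟨R₁, hmem R₁ h₁⟩, ⟨R₂, hmem R₂ h₂⟩, fun h => hne (congrArg Subtype.val h), ?_⟩
  ext ⟨R, hR⟩
  simp only [Finset.mem_filter, Finset.mem_univ, true_and, Finset.mem_insert, Finset.mem_singleton,
    Subtype.mk.injEq]
  rw [← hiff]
  exact ⟨fun h => ⟨hR.1, h.1, h.2, by rw [hR.2.2.2, hS.2.2.2]; ring⟩, fun h => ⟨h.2.1, h.2.2.1⟩⟩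

omit [Fintype ι] in
theorem ivl_inter {k l : ℕ} {A B : Set ι} (hS : S ∈ ivl v U G k) (hA : A ∈ ivl v U G (k + 1))
    (hB : B ∈ ivl v U G l) (hSA : S ⊆ A) (hSB : S ⊆ B) (h : ¬ A ⊆ B) : A ∩ B = S :=
  hA.1.inter_eq_of_cover hB.1 hS.1 hSA hSB (by rw [hA.2.2.2, hS.2.2.2]; omega) h

omit [Fintype ι] in
theorem ivl_eq_of_subset {k : ℕ} {A B : Set ι} (hA : A ∈ ivl v U G k) (hB : B ∈ ivl v U G k)
    (h : A ⊆ B) : A = B := hA.1.eq_of_rk_le h (by rw [hA.2.2.2, hB.2.2.2])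

theorem card_edges_add_two_le (hU : IsFace v U) (hG : IsFace v G) (hUG : U ⊆ G)
    (hr : rk v G = rk v U + 4) :
    Fintype.card (ivl v U G 2) + 2 ≤ Fintype.card (ivl v U G 1) + Fintype.card (ivl v U G 3) := by
  classical
  have hU0 := ivl_left hU hUG
  have hG4 := ivl_right hG hUG hr
  obtain ⟨φ, hφ, hφU⟩ := id hU
  have hφpos : ∀ i, i ∉ U → 0 < φ (v i) := fun i hi =>
    lt_of_le_of_ne (hφ i) fun h => hi ((hφU i).2 h.symm)
  -- representatives
  have hrep : ∀ {k l : ℕ} (A : ivl v U G k) (B : ivl v U G l), k < l → ∃ i ∈ B.1, i ∉ A.1 := by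
    intro k l A B hkl
    by_contra! h
    have := rk_mono (v := v) h
    rw [A.2.2.2.2, B.2.2.2.2] at this
    omega
  choose i hiT hiU using fun T : ivl v U G 1 => hrep ⟨U, hU0⟩ T one_pos
  choose j hje hjT using fun (T : ivl v U G 1) (e : ivl v U G 2) => hrep T e one_lt_two
  choose φT hφT hφT0 using fun T : ivl v U G 1 => T.2.1
  have hφTpos : ∀ T : ivl v U G 1, ∀ i, i ∉ T.1 → 0 < φT T (v i) := fun T i hi =>
    lt_of_le_of_ne (hφT T i) fun h => hi ((hφT0 T i).2 h.symm)
  set h : (W →ₗ[ℝ] ℝ) → ivl v U G 1 → ℝ := fun H T => H (v (i T)) / φ (v (i T)) with hh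
  set ρ : (W →ₗ[ℝ] ℝ) → ivl v U G 1 → ivl v U G 2 → ℝ := fun H T e =>
    (H (v (j T e)) - h H T * φ (v (j T e))) / φT T (v (j T e)) with hρdef
  have hhT : ∀ H : W →ₗ[ℝ] ℝ, (∀ i ∈ U, H (v i) = 0) → ∀ T : ivl v U G 1, ∀ k ∈ T.1,
      H (v k) = h H T * φ (v k) := by
    intro H hH T k hk
    obtain ⟨c, hc⟩ := proportional (χ := H) T.2.2.1 T.2.2.2.2.le
      (fun i hi => (hφU i).1 hi) (fun i _ hi => (hφpos i hi).ne') hH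
    have h1 := hc (i T) (hiT T)
    have : h H T = c := by
      simp only [hh, h1]
      exact mul_div_cancel_right₀ c (hφpos _ (hiU T)).ne'
    rw [this, hc k hk]
  have hρe : ∀ H : W →ₗ[ℝ] ℝ, (∀ i ∈ U, H (v i) = 0) → ∀ (T : ivl v U G 1) (e : ivl v U G 2),
      T.1 ⊆ e.1 → ∀ k ∈ e.1, H (v k) - h H T * φ (v k) = ρ H T e * φT T (v k) := by
    intro H hH T e hTe k hk
    obtain ⟨c, hc⟩ := proportional (χ := H - h H T • φ) hTe
      (by rw [e.2.2.2.2, T.2.2.2.2])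
      (fun i hi => (hφT0 T i).1 hi) (fun i _ hi => (hφTpos T i hi).ne')
      (fun i hi => by simp [hhT H hH T i hi])
    have h1 := hc (j T e) (hje T e)
    simp only [LinearMap.sub_apply, LinearMap.smul_apply, smul_eq_mul] at h1 hc
    have : ρ H T e = c := by
      simp only [hρdef, h1]
      exact mul_div_cancel_right₀ c (hφTpos _ _ (hjT T e)).ne'
    rw [this, hc k hk]
  have hnotmem : ∀ T w : ivl v U G 1, w ≠ T → i w ∉ T.1 := by
    intro T w hwT hi
    have hsub : ¬ w.1 ⊆ T.1 := fun h => hwT (Subtype.ext (ivl_eq_of_subset w.2 T.2 h))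
    have := ivl_inter hU0 w.2 T.2 w.2.2.1 T.2.2.1 hsub
    exact hiU w (this.subset ⟨hiT w, hi⟩)
  -- slopes and heights
  have hsign : ∀ H : W →ₗ[ℝ] ℝ, (∀ i ∈ U, H (v i) = 0) → ∀ (T w : ivl v U G 1) (e : ivl v U G 2),
      T.1 ⊆ e.1 → w.1 ⊆ e.1 → w ≠ T →
      (h H w - h H T) * φ (v (i w)) = ρ H T e * φT T (v (i w)) := by
    intro H hH T w e hTe hwe hwT
    have := hρe H hH T e hTe (i w) (hwe (hiT w))
    rw [hhT H hH w (i w) (hiT w)] at this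
    linarith
  have hup : ∀ H : W →ₗ[ℝ] ℝ, (∀ i ∈ U, H (v i) = 0) → ∀ (T w : ivl v U G 1) (f : ivl v U G 3),
      T.1 ⊆ f.1 → w.1 ⊆ f.1 → h H T < h H w →
      ∃ e : ivl v U G 2, T.1 ⊆ e.1 ∧ e.1 ⊆ f.1 ∧ 0 < ρ H T e := by
    intro H hH T w f hTf hwf hlt
    obtain ⟨R, hR, hTR, hRf, hrk, hpos⟩ := T.2.1.exists_improving (χ := H - h H T • φ) f.2.1 hTf
      (fun k hk => by simp [hhT H hH T k hk])
      ⟨i w, hwf (hiT w), by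
        have := mul_pos (sub_pos.2 hlt) (hφpos _ (hiU w))
        simp only [LinearMap.sub_apply, LinearMap.smul_apply, smul_eq_mul, hhT H hH w _ (hiT w)]
        linarith⟩
    have hRm : R ∈ ivl v U G 2 := ⟨hR, T.2.2.1.trans hTR.1, hRf.trans f.2.2.2.1, by
      rw [hrk, T.2.2.2.2]⟩
    refine ⟨⟨R, hRm⟩, hTR.1, hRf, ?_⟩
    have h1 := hpos _ (hje T ⟨R, hRm⟩) (hjT T ⟨R, hRm⟩)
    exact div_pos (by simpa using h1) (hφTpos T _ (hjT T ⟨R, hRm⟩))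
  have himp : ∀ H : W →ₗ[ℝ] ℝ, (∀ i ∈ U, H (v i) = 0) → ∀ (T : ivl v U G 1) (e e' : ivl v U G 2),
      T.1 ⊆ e.1 → T.1 ⊆ e'.1 → ρ H T e < ρ H T e' →
      ∃ f : ivl v U G 3, e.1 ⊆ f.1 ∧ ∃ e'' : ivl v U G 2, T.1 ⊆ e''.1 ∧ e''.1 ⊆ f.1 ∧
        ρ H T e < ρ H T e'' := by
    intro H hH T e e' hTe hTe' hlt
    obtain ⟨R, hR, heR, hRG, hrk, hpos⟩ := e.2.1.exists_improving
      (χ := H - h H T • φ - ρ H T e • φT T) hG e.2.2.2.1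
      (fun k hk => by simp [hρe H hH T e hTe k hk])
      ⟨j T e', e'.2.2.2.1 (hje T e'), by
        have := mul_pos (sub_pos.2 hlt) (hφTpos T _ (hjT T e'))
        simp only [LinearMap.sub_apply, LinearMap.smul_apply, smul_eq_mul,
          hρe H hH T e' hTe' _ (hje T e')]
        linarith⟩
    have hRm : R ∈ ivl v U G 3 := ⟨hR, e.2.2.1.trans heR.1, hRG, by rw [hrk, e.2.2.2.2]⟩
    refine ⟨⟨R, hRm⟩, heR.1, ?_⟩
    obtain ⟨a, b, hab, hEq⟩ := Finset.card_eq_two.1 (ivl_card_two T.2 hRm (hTe.trans heR.1))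
    obtain ⟨e'', he'', hne⟩ : ∃ e'' : ivl v U G 2, (T.1 ⊆ e''.1 ∧ e''.1 ⊆ R) ∧ e'' ≠ e := by
      have ha : a ∈ ({a, b} : Finset _) := by simp
      have hb : b ∈ ({a, b} : Finset _) := by simp
      rw [← hEq] at ha hb
      by_cases hae : a = e
      · exact ⟨b, (Finset.mem_filter.1 hb).2, fun h' => hab (hae.trans h'.symm)⟩
      · exact ⟨a, (Finset.mem_filter.1 ha).2, hae⟩
    refine ⟨e'', he''.1, he''.2, ?_⟩
    have hnot : j T e'' ∉ e.1 := by
      intro hmem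
      have hsub : ¬ e''.1 ⊆ e.1 := fun h => hne (Subtype.ext (ivl_eq_of_subset e''.2 e.2 h))
      exact hjT T e'' ((ivl_inter T.2 e''.2 e.2 he''.1 hTe hsub).subset ⟨hje T e'', hmem⟩)
    have h1 := hpos _ (he''.2 (hje T e'')) hnot
    simp only [LinearMap.sub_apply, LinearMap.smul_apply, smul_eq_mul,
      hρe H hH T e'' he''.1 _ (hje T e'')] at h1
    have h2 : 0 < (ρ H T e'' - ρ H T e) * φT T (v (j T e'')) := by linarith
    have := pos_of_mul_pos_left h2 (hφT T _)
    linarith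
  -- a generic functional
  obtain ⟨H, hH, hHne⟩ : ∃ H : W →ₗ[ℝ] ℝ, (∀ i ∈ U, H (v i) = 0) ∧
      (∀ T w : ivl v U G 1, w ≠ T → h H w ≠ h H T) ∧
      ∀ (T : ivl v U G 1) (e e' : ivl v U G 2), T.1 ⊆ e.1 → T.1 ⊆ e'.1 → e ≠ e' →
        ρ H T e ≠ ρ H T e' := by
    let p : Submodule ℝ (W →ₗ[ℝ] ℝ) := 
      { carrier := {H | ∀ i ∈ U, H (v i) = 0}
        add_mem' := fun ha hb i hi => by simp [ha i hi, hb i hi]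
        zero_mem' := fun i _ => by simp
        smul_mem' := fun c x hx i hi => by simp [hx i hi] }
    let ev : W → ((W →ₗ[ℝ] ℝ) →ₗ[ℝ] ℝ) := fun w => Module.Dual.eval ℝ W w
    let lh : ivl v U G 1 → ((W →ₗ[ℝ] ℝ) →ₗ[ℝ] ℝ) := fun T => (φ (v (i T)))⁻¹ • ev (v (i T))
    let lρ : ivl v U G 1 → ivl v U G 2 → ((W →ₗ[ℝ] ℝ) →ₗ[ℝ] ℝ) := fun T e =>
      (φT T (v (j T e)))⁻¹ • (ev (v (j T e)) - φ (v (j T e)) • lh T)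
    have elh : ∀ H T, lh T H = h H T := fun H T => by
      simp [lh, ev, hh, div_eq_inv_mul]
    have elρ : ∀ H T e, lρ T e H = ρ H T e := fun H T e => by
      simp [lρ, ev, hρdef, elh, div_eq_inv_mul, mul_comm (φ _)]
    let f : {x : ivl v U G 1 × ivl v U G 1 // x.2 ≠ x.1} ⊕
        {x : ivl v U G 1 × ivl v U G 2 × ivl v U G 2 //
          x.1.1 ⊆ x.2.1.1 ∧ x.1.1 ⊆ x.2.2.1 ∧ x.2.1 ≠ x.2.2} → Module.Dual ℝ (W →ₗ[ℝ] ℝ) :=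
      Sum.elim (fun x => lh x.1.2 - lh x.1.1) (fun x => lρ x.1.1 x.1.2.1 - lρ x.1.1 x.1.2.2)
    obtain ⟨H, hHp, hHf⟩ := Module.Dual.exists_forall_mem_ne_zero_of_forall_exists p f (by
      rintro (⟨⟨T, w⟩, hne⟩ | ⟨⟨T, e, e'⟩, hTe, hTe', hne⟩)
      · refine ⟨φT T, fun i hi => (hφT0 T i).1 (T.2.2.1 hi), ?_⟩
        simp only [f, Sum.elim_inl, LinearMap.sub_apply, elh, hh, (hφT0 T _).1 (hiT T), zero_div,
          sub_zero]
        exact (div_pos (hφTpos T _ (hnotmem T w hne)) (hφpos _ (hiU w))).ne'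
      · obtain ⟨ψ, hψ, hψe⟩ := e.2.1
        refine ⟨ψ, fun i hi => (hψe i).1 (e.2.2.1 hi), ?_⟩
        have h0 : h ψ T = 0 := by simp [hh, (hψe _).1 (hTe (hiT T))]
        have hnot : j T e' ∉ e.1 := by
          intro hmem
          have hsub : ¬ e'.1 ⊆ e.1 := fun h => hne (Subtype.ext (ivl_eq_of_subset e'.2 e.2 h)).symm
          exact hjT T e' ((ivl_inter T.2 e'.2 e.2 hTe' hTe hsub).subset ⟨hje T e', hmem⟩)
        have hpos : 0 < ψ (v (j T e')) := lt_of_le_of_ne (hψ _) fun h => hnot ((hψe _).2 h.symm)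
        simp only [f, Sum.elim_inr, LinearMap.sub_apply, elρ, hρdef, h0, (hψe _).1 (hje T e),
          zero_mul, sub_zero, zero_div, zero_sub]
        exact (neg_neg_of_pos (div_pos hpos (hφTpos T _ (hjT T e')))).ne)
    refine ⟨H, hHp, fun T w hne => ?_, fun T e e' hTe hTe' hne => ?_⟩
    · have := hHf (Sum.inl ⟨(T, w), hne⟩)
      simpa [f, elh, sub_eq_zero] using this
    · have := hHf (Sum.inr ⟨(T, e, e'), hTe, hTe', hne⟩)
      simpa [f, elρ, sub_eq_zero] using this
  have hHneg : ∀ i ∈ U, (-H) (v i) = 0 := fun i hi => by simp [hH i hi]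
  have hneg : ∀ T, h (-H) T = - h H T := fun T => by simp [hh, neg_div]
  have ρneg : ∀ T e, ρ (-H) T e = - ρ H T e := fun T e => by
    simp only [hρdef, hneg, LinearMap.neg_apply]; ring
  have two_vertices : ∀ e : ivl v U G 2,
      (Finset.univ.filter fun T : ivl v U G 1 => T.1 ⊆ e.1).card = 2 := by
    intro e
    refine Eq.trans ?_ (ivl_card_two hU0 e.2 e.2.2.1)
    congr 1
    ext T
    simp [T.2.2.1]
  obtain ⟨e₀⟩ : Nonempty (ivl v U G 2) := by
    obtain ⟨A, hA, hUA, hAG, hrA⟩ := hU.exists_cover hG (hUG.ssubset_of_ne (by rintro rfl; omega))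
    obtain ⟨B, hB, hAB, hBG, hrB⟩ := hA.exists_cover hG (hAG.ssubset_of_ne (by rintro rfl; omega))
    exact ⟨⟨B, hB, hUA.1.trans hAB.1, hBG, by omega⟩⟩
  refine card_add_two_le_of_heights (fun (T : ivl v U G 1) (e : ivl v U G 2) => T.1 ⊆ e.1)
    (fun (e : ivl v U G 2) (f : ivl v U G 3) => e.1 ⊆ f.1)
    (fun (T : ivl v U G 1) (f : ivl v U G 3) => T.1 ⊆ f.1) (h H) (ρ H) e₀ ?_ ?_ ?_ ?_ ?_ ?_ ?_ ?_ ?_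
    ?_ ?_ ?_
  · intro e
    convert two_vertices e
  · intro e
    refine Eq.trans ?_ (ivl_card_two e.2 hG4 e.2.2.2.1)
    congr 1
    ext f
    simp [f.2.2.2.1]
  · intro T f hTf
    refine Eq.trans ?_ (ivl_card_two T.2 f.2 hTf)
    congr 1
  · intro T e f h1 h2
    exact h1.trans h2
  · intro T w hTw
    by_contra hne
    exact hHne.1 w T hne hTw
  · intro T e hTe h0
    obtain ⟨a, b, hab, hEq⟩ := Finset.card_eq_two.1 (two_vertices e)
    have ha : a ∈ ({a, b} : Finset _) := by simp
    have hb : b ∈ ({a, b} : Finset _) := by simp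
    rw [← hEq] at ha hb
    obtain ⟨w, hw, hne⟩ : ∃ w : ivl v U G 1, w.1 ⊆ e.1 ∧ w ≠ T := by
      by_cases haT : a = T
      · exact ⟨b, (Finset.mem_filter.1 hb).2, fun h' => hab (haT.trans h'.symm)⟩
      · exact ⟨a, (Finset.mem_filter.1 ha).2, haT⟩
    have := hsign H hH T w e hTe hw hne
    rw [h0, zero_mul] at this
    rcases mul_eq_zero.1 this with h1 | h1
    · exact hHne.1 T w hne (sub_eq_zero.1 h1)
    · exact (hφpos _ (hiU w)).ne' h1
  · intro T w e hTe hwe hne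
    have h1 := hsign H hH T w e hTe hwe hne
    have h2 := hφpos _ (hiU w)
    have h3 := hφTpos T _ (hnotmem T w hne)
    rw [← mul_pos_iff_of_pos_right h3, ← h1, mul_pos_iff_of_pos_right h2, sub_pos]
  · intro T e e' h1 h2 h3
    by_contra hne
    exact hHne.2 T e e' h1 h2 hne h3
  · exact hup H hH
  · intro T w f h1 h2 h3
    obtain ⟨e, he, hef, hpos⟩ := hup (-H) hHneg T w f h1 h2 (by rw [hneg, hneg]; linarith)
    rw [ρneg] at hpos
    exact ⟨e, he, hef, by linarith⟩
  · exact himp H hH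
  · intro T e e' h1 h2 h3
    obtain ⟨f, hf, e'', h4, h5, h6⟩ := himp (-H) hHneg T e e' h1 h2 (by rw [ρneg, ρneg]; linarith)
    rw [ρneg, ρneg] at h6
    exact ⟨f, hf, e'', h4, h5, by linarith⟩

end Interval

/-! ### Cyclic enumerations -/

section Cycles

variable {A B : Type*}

/-- A cyclic enumeration of a two-regular connected incidence relation. -/
structure CycleEnum (inc : A → B → Prop) (n : ℕ) (a : ℕ → A) (b : ℕ → B) : Prop where
  three_le : 3 ≤ n
  per_a : ∀ i, a (i + n) = a i
  per_b : ∀ i, b (i + n) = b i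
  inj_a : ∀ i j, i < j → j < i + n → a i ≠ a j
  inj_b : ∀ i j, i < j → j < i + n → b i ≠ b j
  surj_a : ∀ x, ∃ i < n, a i = x
  surj_b : ∀ y, ∃ i < n, b i = y
  inc_right : ∀ x i, inc x (b i) ↔ x = a i ∨ x = a (i + 1)
  inc_left : ∀ y i, inc (a (i + 1)) y ↔ y = b i ∨ y = b (i + 1)

theorem other_of_pair {X : Type*} {p : X → Prop} (h : ∃ x₁ x₂, x₁ ≠ x₂ ∧ ∀ x, p x ↔ x = x₁ ∨ x = x₂)
    {x : X} (hx : p x) : ∃ y, p y ∧ y ≠ x ∧ ∀ z, p z ↔ z = x ∨ z = y := by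
  obtain ⟨x₁, x₂, hne, h⟩ := h
  rcases (h x).1 hx with rfl | rfl
  · exact ⟨x₂, (h _).2 (Or.inr rfl), hne.symm, h⟩
  · exact ⟨x₁, (h _).2 (Or.inl rfl), hne, fun z => by rw [h, or_comm]⟩

theorem exists_cycleEnum [Finite A] [Finite B] {inc : A → B → Prop}
    (hA : ∀ x, ∃ y₁ y₂, y₁ ≠ y₂ ∧ ∀ y, inc x y ↔ y = y₁ ∨ y = y₂)
    (hB : ∀ y, ∃ x₁ x₂, x₁ ≠ x₂ ∧ ∀ x, inc x y ↔ x = x₁ ∨ x = x₂)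
    (hmeet : ∀ x x' y y', x ≠ x' → y ≠ y' → inc x y → inc x' y → inc x y' → ¬ inc x' y')
    (hne : Nonempty A)
    (hconn : ∀ 𝒜 : Set A, 𝒜.Nonempty → (∀ x ∈ 𝒜, ∀ x' y, inc x y → inc x' y → x' ∈ 𝒜) →
      ∀ x, x ∈ 𝒜) :
    ∃ n a b, CycleEnum inc n a b := by
  classical
  have hoA : ∀ x y, inc x y → ∃ y', inc x y' ∧ y' ≠ y ∧ ∀ z, inc x z ↔ z = y ∨ z = y' :=
    fun x y h => other_of_pair (hA x) h
  have hoB : ∀ x y, inc x y → ∃ x', inc x' y ∧ x' ≠ x ∧ ∀ z, inc z y ↔ z = x ∨ z = x' :=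
    fun x y h => other_of_pair (p := fun x => inc x y) (hB y) h
  let Fl := {p : A × B // inc p.1 p.2}
  have hstep : ∀ p : Fl, ∃ q : Fl, inc q.1.1 p.1.2 ∧ q.1.1 ≠ p.1.1 ∧ q.1.2 ≠ p.1.2 := by
    intro p
    obtain ⟨x', h1, h2, -⟩ := hoB _ _ p.2
    obtain ⟨y', h3, h4, -⟩ := hoA _ _ h1
    exact ⟨⟨(x', y'), h3⟩, h1, h2, h4⟩
  choose step hs1 hs2 hs3 using hstep
  have heqB : ∀ x y x₁ x₂, inc x y → inc x₁ y → inc x₂ y → x₁ ≠ x → x₂ ≠ x → x₁ = x₂ := by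
    intro x y x₁ x₂ h h1 h2 n1 n2
    obtain ⟨x', -, -, h3⟩ := hoB _ _ h
    rw [((h3 _).1 h1).resolve_left n1, ((h3 _).1 h2).resolve_left n2]
  have heqA : ∀ x y y₁ y₂, inc x y → inc x y₁ → inc x y₂ → y₁ ≠ y → y₂ ≠ y → y₁ = y₂ := by
    intro x y y₁ y₂ h h1 h2 n1 n2
    obtain ⟨y', -, -, h3⟩ := hoA _ _ h
    rw [((h3 _).1 h1).resolve_left n1, ((h3 _).1 h2).resolve_left n2]
  have hinj : Function.Injective step := by
    intro p q h
    have hp1 := hs1 p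
    have hp2 := hs2 p
    have hp3 := hs3 p
    have hq1 := hs1 q
    have hq2 := hs2 q
    have hq3 := hs3 q
    rw [← h] at hq1 hq2 hq3
    have e2 : p.1.2 = q.1.2 := heqA _ _ _ _ (step p).2 hp1 hq1 hp3.symm hq3.symm
    have e1 : p.1.1 = q.1.1 := heqB _ _ _ _ hp1 p.2 (by rw [e2]; exact q.2) hp2.symm hq2.symm
    exact Subtype.ext (Prod.ext e1 e2)
  obtain ⟨x0⟩ := hne
  obtain ⟨y0, _, _, hy0⟩ := hA x0
  let p0 : Fl := ⟨(x0, y0), (hy0 _).2 (Or.inl rfl)⟩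
  have hfin : Finite Fl := inferInstance
  have hper := hinj.mem_periodicPts p0
  have hn0 := Function.minimalPeriod_pos_of_mem_periodicPts hper
  set n := Function.minimalPeriod step p0 with hn
  let f : ℕ → Fl := fun i => step^[i] p0
  have hf : ∀ i, f (i + 1) = step (f i) := fun i => Function.iterate_succ_apply' _ _ _
  have hfper : ∀ i, f (i + n) = f i := by
    intro i
    show step^[i + n] p0 = step^[i] p0
    rw [Function.iterate_add_apply, hn, Function.iterate_minimalPeriod]
  have hfinj : ∀ i j, i < j → j < i + n → f i ≠ f j := by
    intro i j h1 h2 h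
    have : step^[i] p0 = step^[i] (step^[j - i] p0) := by
      rw [← Function.iterate_add_apply, show i + (j - i) = j by omega]; exact h
    have h3 := (hinj.iterate i) this
    exact Function.not_isPeriodicPt_of_pos_of_lt_minimalPeriod (n := j - i) (by omega)
      (by omega) h3.symm
  have ha1 : ∀ i, (f (i + 1)).1.1 ≠ (f i).1.1 := fun i => by rw [hf]; exact hs2 _
  have hb1 : ∀ i, (f (i + 1)).1.2 ≠ (f i).1.2 := fun i => by rw [hf]; exact hs3 _
  have hi1 : ∀ i, inc (f (i + 1)).1.1 (f i).1.2 := fun i => by rw [hf]; exact hs1 _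
  have hi0 : ∀ i, inc (f i).1.1 (f i).1.2 := fun i => (f i).2
  have hrefl : ∀ l i, (f i).1.1 = (f (i + l)).1.1 → (f i).1.2 ≠ (f (i + l)).1.2 → False := by
    intro l
    induction l using Nat.strong_induction_on with
    | _ l ih =>
      intro i h1 h2
      rcases l with _ | _ | l
      · exact h2 rfl
      · exact ha1 i h1.symm
      · have e1 : (f i).1.2 = (f (i + l + 1)).1.2 := by
          refine heqA (f i).1.1 (f (i + (l + 1 + 1))).1.2 _ _ ?_ (hi0 i) ?_ h2 ?_
          · rw [h1]; exact hi0 _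
          · rw [h1]; exact hi1 (i + l + 1)
          · exact (hb1 (i + l + 1)).symm
        rcases Nat.eq_zero_or_pos l with rfl | hl
        · exact hb1 i e1.symm
        · refine ih l (by omega) (i + 1) ?_ ?_
          · have h3 := hi0 (i + l + 1)
            rw [← e1] at h3
            rw [show i + 1 + l = i + l + 1 by omega]
            refine heqB (f i).1.1 (f i).1.2 _ _ (hi0 i) (hi1 i) h3 (ha1 i) ?_
            rw [h1]
            exact (ha1 (i + l + 1)).symm
          · rw [show i + 1 + l = i + l + 1 by omega, ← e1]
            exact hb1 i
  have hainj : ∀ i j, i < j → j < i + n → (f i).1.1 ≠ (f j).1.1 := by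
    intro i j h1 h2 h
    refine hrefl (j - i) i ?_ ?_
    · rw [show i + (j - i) = j by omega]; exact h
    · rw [show i + (j - i) = j by omega]
      exact fun h' => hfinj i j h1 h2 (Subtype.ext (Prod.ext h h'))
  have hbinj : ∀ i j, i < j → j < i + n → (f i).1.2 ≠ (f j).1.2 := by
    intro i j h1 h2 h
    have h3 : (f i).1.1 = (f (j + 1)).1.1 := by
      refine heqB (f j).1.1 (f j).1.2 _ _ (hi0 j) (by rw [← h]; exact hi0 i) (hi1 j)
        (hainj i j h1 h2) (ha1 j)
    rcases lt_or_ge (j + 1) (i + n) with h4 | h4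
    · exact hainj i (j + 1) (by omega) h4 h3
    · have : j + 1 = i + n := by omega
      have h5 := hb1 j
      rw [this, hfper] at h5
      exact h5 h
  have hright : ∀ x i, inc x (f i).1.2 ↔ x = (f i).1.1 ∨ x = (f (i + 1)).1.1 := by
    intro x i
    constructor
    · intro hx
      by_contra hcon
      push Not at hcon
      exact hcon.2 (heqB _ _ _ _ (hi0 i) hx (hi1 i) hcon.1 (ha1 i))
    · rintro (rfl | rfl)
      · exact hi0 i
      · exact hi1 i
  have hleft : ∀ y i, inc (f (i + 1)).1.1 y ↔ y = (f i).1.2 ∨ y = (f (i + 1)).1.2 := by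
    intro y i
    constructor
    · intro hx
      by_contra hcon
      push Not at hcon
      exact hcon.2 (heqA _ _ _ _ (hi1 i) hx (hi0 (i + 1)) hcon.1 (hb1 i))
    · rintro (rfl | rfl)
      · exact hi1 i
      · exact hi0 _
  have hmod : ∀ i, f i = f (i % n) := by
    intro i
    induction i using Nat.strong_induction_on with
    | _ i ih =>
      rcases lt_or_ge i n with h | h
      · rw [Nat.mod_eq_of_lt h]
      · rw [Nat.mod_eq_sub_mod h, ← ih (i - n) (by omega), ← hfper (i - n)]
        congr 1; omega
  have hsa : ∀ x, ∃ i < n, (f i).1.1 = x := by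
    have := hconn {x | ∃ i, (f i).1.1 = x} ⟨_, 0, rfl⟩ (by
      rintro _ ⟨i, rfl⟩ x' y h h'
      have h2 := hleft y (i + n - 1)
      rw [show i + n - 1 + 1 = i + n by omega, hfper] at h2
      rcases h2.1 h with rfl | rfl
      · rcases (hright _ _).1 h' with rfl | rfl
        · exact ⟨_, rfl⟩
        · exact ⟨_, rfl⟩
      · rcases (hright _ _).1 h' with rfl | rfl
        · exact ⟨_, rfl⟩
        · exact ⟨_, rfl⟩)
    intro x
    obtain ⟨i, hi⟩ := this x
    exact ⟨i % n, Nat.mod_lt _ hn0, by rw [← hmod]; exact hi⟩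
  have hsb : ∀ y, ∃ i < n, (f i).1.2 = y := by
    intro y
    obtain ⟨x, _, _, hx⟩ := hB y
    obtain ⟨i, -, hi⟩ := hsa x
    have h2 := hleft y (i + n - 1)
    rw [show i + n - 1 + 1 = i + n by omega, hfper, hi] at h2
    rcases h2.1 ((hx _).2 (Or.inl rfl)) with h | h
    · exact ⟨(i + n - 1) % n, Nat.mod_lt _ hn0, by rw [← hmod]; exact h.symm⟩
    · exact ⟨i % n, Nat.mod_lt _ hn0, by rw [← hmod]; exact h.symm⟩
  refine ⟨n, fun i => (f i).1.1, fun i => (f i).1.2, ?_, fun i => by simp only [hfper],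
    fun i => by simp only [hfper], hainj, hbinj, hsa, hsb, hright, hleft⟩
  by_contra h3
  have h12 : n = 1 ∨ n = 2 := by omega
  rcases h12 with h | h
  · have := hfper 0
    rw [h, zero_add] at this
    exact ha1 0 (by rw [zero_add, this])
  · have h2 := hfper 0
    rw [h, zero_add] at h2
    have h4 := hi1 1
    rw [show 1 + 1 = 2 from rfl, h2] at h4
    exact hmeet _ _ _ _ (ha1 0) (hb1 0) (hi0 1) h4 (hi1 0) (hi0 0)

end Cycles

/-! ### Counting sign changes -/

section SignCounting

/-- A combinatorial surface: each edge has two ends, and around each vertex the edges and faces are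
arranged in a cycle. -/
structure Surf (V E F : Type*) where
  vE : V → E → Prop
  eF : E → F → Prop
  n : V → ℕ
  ed : V → ℕ → E
  fa : V → ℕ → F
  n_pos : ∀ v, 0 < n v
  ed_per : ∀ v i, ed v (i + n v) = ed v i
  fa_per : ∀ v i, fa v (i + n v) = fa v i
  ed_inj : ∀ v i j, i < j → j < i + n v → ed v i ≠ ed v j
  ed_mem : ∀ v e, vE v e ↔ ∃ i < n v, ed v i = e
  fa_ne : ∀ v i, fa v i ≠ fa v (i + 1)
  ed_fa : ∀ v i f, eF (ed v (i + 1)) f ↔ f = fa v i ∨ f = fa v (i + 1)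
  ends : ∀ e, ∃ u w, u ≠ w ∧ ∀ v, vE v e ↔ v = u ∨ v = w
  vconn : ∀ 𝒱 : Set V, 𝒱.Nonempty → (∀ v ∈ 𝒱, ∀ e w, vE v e → vE w e → w ∈ 𝒱) → ∀ v, v ∈ 𝒱
  fconn : ∀ ℱ : Set F, ℱ.Nonempty → (∀ f ∈ ℱ, ∀ e g, eF e f → eF e g → g ∈ ℱ) → ∀ f, f ∈ ℱ

namespace Surf

variable {V E F : Type*} (M : Surf V E F)

theorem ed_per_mul (v : V) (i s : ℕ) : M.ed v (i + s * M.n v) = M.ed v i := by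
  induction s with
  | zero => simp
  | succ s ih => rw [← ih, ← M.ed_per v (i + s * M.n v)]; congr 1; ring

theorem fa_per_mul (v : V) (i s : ℕ) : M.fa v (i + s * M.n v) = M.fa v i := by
  induction s with
  | zero => simp
  | succ s ih => rw [← ih, ← M.fa_per v (i + s * M.n v)]; congr 1; ring

theorem ed_mod (v : V) (i : ℕ) : M.ed v (i % M.n v) = M.ed v i := by
  conv_rhs => rw [← Nat.mod_add_div' i (M.n v), M.ed_per_mul]

theorem fa_mod (v : V) (i : ℕ) : M.fa v (i % M.n v) = M.fa v i := by
  conv_rhs => rw [← Nat.mod_add_div' i (M.n v), M.fa_per_mul]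

theorem vE_ed (v : V) (i : ℕ) : M.vE v (M.ed v i) :=
  (M.ed_mem _ _).2 ⟨i % M.n v, Nat.mod_lt _ (M.n_pos v), M.ed_mod v i⟩

theorem mod_eq_of_ed_eq {v : V} {i j : ℕ} (h : M.ed v i = M.ed v j) :
    i % M.n v = j % M.n v := by
  have hi := Nat.mod_lt i (M.n_pos v)
  have hj := Nat.mod_lt j (M.n_pos v)
  rw [← M.ed_mod v i, ← M.ed_mod v j] at h
  by_contra hne
  rcases lt_or_gt_of_ne hne with h1 | h1
  · exact M.ed_inj v _ _ h1 (by omega) h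
  · exact M.ed_inj v _ _ h1 (by omega) h.symm

theorem fa_eq_of_ed_eq {v : V} {i j : ℕ} (h : M.ed v i = M.ed v j) : M.fa v i = M.fa v j := by
  rw [← M.fa_mod v i, ← M.fa_mod v j, M.mod_eq_of_ed_eq h]

theorem exists_next (lam : E → SignType) (v : V) (i : ℕ) (h : lam (M.ed v i) ≠ 0) :
    ∃ j, i < j ∧ lam (M.ed v j) ≠ 0 :=
  ⟨i + M.n v, by have := M.n_pos v; omega, by rwa [M.ed_per]⟩

/-- The next nonzero edge at a vertex, in the cyclic order. -/
def IsNext (lam : E → SignType) (v : V) (e e' : E) : Prop :=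
  ∃ i j, i < j ∧ j ≤ i + M.n v ∧ M.ed v i = e ∧ M.ed v j = e' ∧ lam e ≠ 0 ∧ lam e' ≠ 0 ∧
    ∀ k, i < k → k < j → lam (M.ed v k) = 0

theorem exists_isNext {lam : E → SignType} {v : V} {e : E} (hv : M.vE v e) (he : lam e ≠ 0) :
    ∃ e', M.IsNext lam v e e' := by
  classical
  obtain ⟨i, hi, rfl⟩ := (M.ed_mem _ _).1 hv
  have hex := M.exists_next lam v i he
  obtain ⟨h1, h2⟩ := Nat.find_spec hex
  refine ⟨_, i, Nat.find hex, h1, Nat.find_min' hex ⟨by have := M.n_pos v; omega, by rwa [M.ed_per]⟩,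
    rfl, rfl, he, h2, fun k hk1 hk2 => ?_⟩
  by_contra h3
  exact Nat.find_min hex hk2 ⟨hk1, h3⟩

theorem IsNext.shift {M : Surf V E F} {lam : E → SignType} {v : V} {e e' : E}
    (h : M.IsNext lam v e e') {i : ℕ} (hi : M.ed v i = e) :
    ∃ j, i < j ∧ j ≤ i + M.n v ∧ M.ed v j = e' ∧ ∀ k, i < k → k < j → lam (M.ed v k) = 0 := by
  obtain ⟨a, b, h1, h2, h3, h4, -, -, h5⟩ := h
  have hmod := M.mod_eq_of_ed_eq (h3.trans hi.symm)
  have e1 := Nat.mod_add_div' a (M.n v)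
  have e2 := Nat.mod_add_div' i (M.n v)
  set s := a / M.n v
  set t := i / M.n v
  have key : ∀ k, M.ed v (i + (k - a)) = M.ed v (a + (k - a)) := by
    intro k
    rw [← M.ed_per_mul v (i + (k - a)) s, ← M.ed_per_mul v (a + (k - a)) t]
    congr 1
    omega
  refine ⟨i + (b - a), by omega, by omega, ?_, fun k hk1 hk2 => ?_⟩
  · rw [key, show a + (b - a) = b by omega, h4]
  · have := key (k - i + a)
    rw [show i + (k - i + a - a) = k by omega] at this
    rw [this]
    exact h5 _ (by omega) (by omega)

theorem IsNext.unique {M : Surf V E F} {lam : E → SignType} {v : V} {e e₁ e₂ : E}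
    (h₁ : M.IsNext lam v e e₁) (h₂ : M.IsNext lam v e e₂) : e₁ = e₂ := by
  obtain ⟨i, j, hij, -, hi, hj, -, hne, hz⟩ := id h₁
  obtain ⟨j', h1, -, h3, h4⟩ := h₂.shift hi
  obtain ⟨_, _, _, _, _, _, _, hne', _⟩ := id h₂
  rcases lt_trichotomy j j' with h | rfl | h
  · exact absurd (h4 j hij h) (by rwa [hj])
  · rw [← hj, ← h3]
  · exact absurd (hz j' h1 h) (by rwa [h3])

theorem IsNext.inj {M : Surf V E F} {lam : E → SignType} {v : V} {e₁ e₂ e : E}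
    (h₁ : M.IsNext lam v e₁ e) (h₂ : M.IsNext lam v e₂ e) : e₁ = e₂ := by
  obtain ⟨i, j, hij, hjn, hi, hj, hn1, -, hz⟩ := h₁
  obtain ⟨a, b, hab, hbn, ha, hb, hn2, -, hz'⟩ := h₂
  have hmod := M.mod_eq_of_ed_eq (hj.trans hb.symm)
  have e1 := Nat.mod_add_div' j (M.n v)
  have e2 := Nat.mod_add_div' b (M.n v)
  set s := j / M.n v
  set t := b / M.n v
  have hz2 : ∀ k, i + t * M.n v < k → k < j + t * M.n v → lam (M.ed v k) = 0 := by
    intro k h1 h2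
    have := hz (k - t * M.n v) (by omega) (by omega)
    rwa [← M.ed_per_mul v _ t, show k - t * M.n v + t * M.n v = k by omega] at this
  have hz3 : ∀ k, a + s * M.n v < k → k < b + s * M.n v → lam (M.ed v k) = 0 := by
    intro k h1 h2
    have := hz' (k - s * M.n v) (by omega) (by omega)
    rwa [← M.ed_per_mul v _ s, show k - s * M.n v + s * M.n v = k by omega] at this
  rw [← M.ed_per_mul v i t] at hi
  rw [← M.ed_per_mul v a s] at ha
  rcases lt_trichotomy (i + t * M.n v) (a + s * M.n v) with h | h | h
  · exact absurd (hz2 _ h (by omega)) (by rwa [ha])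
  · rw [← hi, ← ha, h]
  · exact absurd (hz3 _ h (by omega)) (by rwa [hi])

theorem IsNext.ne {M : Surf V E F} {lam : E → SignType} {v : V} {e e' e'' : E}
    (h : M.IsNext lam v e e') (hv : M.vE v e'') (hne : e'' ≠ e) (hl : lam e'' ≠ 0) :
    e' ≠ e := by
  rintro rfl
  obtain ⟨i, j, hij, hjn, hi, hj, -, -, hz⟩ := h
  obtain ⟨k, hk, rfl⟩ := (M.ed_mem _ _).1 hv
  have hji : j = i + M.n v := by
    by_contra h
    exact M.ed_inj v i j hij (by omega) (hi.trans hj.symm)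
  subst hji
  have e1 := Nat.mod_add_div' i (M.n v)
  have e2 := Nat.mod_lt i (M.n_pos v)
  set s := i / M.n v
  have hki : k ≠ i % M.n v := by
    intro h
    apply hne
    rw [h, M.ed_mod, hi]
  rcases lt_or_gt_of_ne hki with h | h
  · have := hz (k + (s + 1) * M.n v) (by rw [add_mul, one_mul]; omega)
      (by rw [add_mul, one_mul]; omega)
    rw [M.ed_per_mul] at this
    exact hl this
  · have := hz (k + s * M.n v) (by omega) (by omega)
    rw [M.ed_per_mul] at this
    exact hl this

/-- Faces joined across zero edges. -/
def Joined (lam : E → SignType) (f g : F) : Prop := ∃ e, lam e = 0 ∧ M.eF e f ∧ M.eF e g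

theorem cls_of_isNext {lam : E → SignType} {v : V} {i j : ℕ} (hij : i < j)
    (hz : ∀ k, i < k → k < j → lam (M.ed v k) = 0) :
    Quot.mk (M.Joined lam) (M.fa v i) = Quot.mk (M.Joined lam) (M.fa v (j - 1)) := by
  induction j, hij using Nat.le_induction with
  | base => simp
  | succ j hij ih =>
    rw [ih fun k h1 h2 => hz k h1 (by omega)]
    refine Quot.sound ⟨M.ed v j, hz j hij (by omega), ?_, ?_⟩
    · obtain ⟨l, rfl⟩ : ∃ l, j = l + 1 := ⟨j - 1, by omega⟩
      exact (M.ed_fa _ _ _).2 (Or.inl rfl)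
    · obtain ⟨l, rfl⟩ : ∃ l, j = l + 1 := ⟨j - 1, by omega⟩
      exact (M.ed_fa _ _ _).2 (Or.inr rfl)

theorem ed_fa' {v : V} {i : ℕ} (hi : 0 < i) (f : F) :
    M.eF (M.ed v i) f ↔ f = M.fa v (i - 1) ∨ f = M.fa v i := by
  obtain ⟨l, rfl⟩ : ∃ l, i = l + 1 := ⟨i - 1, by omega⟩
  exact M.ed_fa _ _ _

theorem exists_ed {v : V} {e : E} (h : M.vE v e) : ∃ i, 0 < i ∧ M.ed v i = e := by
  obtain ⟨i, -, hi⟩ := (M.ed_mem _ _).1 h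
  exact ⟨i + M.n v, by have := M.n_pos v; omega, by rw [M.ed_per, hi]⟩

theorem sum_edges [Fintype E] [DecidableRel M.vE] {R : Type*} [AddCommMonoid R] (v : V) (g : E → R) :
    ∑ e with M.vE v e, g e = ∑ i ∈ Finset.range (M.n v), g (M.ed v (i + 1)) := by
  classical
  rw [← Finset.sum_image (s := Finset.range (M.n v)) (g := fun i => M.ed v (i + 1)) (f := g)]
  · congr 1
    ext e
    simp only [Finset.mem_filter, Finset.mem_univ, true_and, Finset.mem_image, Finset.mem_range]
    constructor
    · intro h
      obtain ⟨i, hi, rfl⟩ := (M.ed_mem _ _).1 h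
      rcases i.eq_zero_or_pos with rfl | h0
      · refine ⟨M.n v - 1, by omega, ?_⟩
        rw [show M.n v - 1 + 1 = 0 + M.n v by omega, M.ed_per]
      · exact ⟨i - 1, by omega, by rw [show i - 1 + 1 = i by omega]⟩
    · rintro ⟨i, -, rfl⟩
      exact M.vE_ed _ _
  · intro i hi j hj h
    simp only [Finset.coe_range, mem_Iio] at hi hj
    by_contra hne
    rcases lt_or_gt_of_ne hne with h1 | h1
    · exact M.ed_inj v _ _ (Nat.succ_lt_succ h1) (by omega) h
    · exact M.ed_inj v _ _ (Nat.succ_lt_succ h1) (by omega) h.symm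

theorem sum_fa_succ {R : Type*} [AddCommMonoid R] (v : V) (g : F → R) :
    ∑ i ∈ Finset.range (M.n v), g (M.fa v (i + 1)) = ∑ i ∈ Finset.range (M.n v), g (M.fa v i) := by
  obtain ⟨m, hm⟩ : ∃ m, M.n v = m + 1 := ⟨M.n v - 1, by have := M.n_pos v; omega⟩
  have h := M.fa_per v 0
  rw [zero_add] at h
  rw [hm, Finset.sum_range_succ, Finset.sum_range_succ', ← hm, h]

section Region

variable [Fintype V] [Fintype E] [Fintype F]

/-- The number of regions, by duality. -/
theorem card_regions (lam : E → SignType) (hE : ∃ e, lam e ≠ 0)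
    [Fintype (Quot (M.Joined lam))] [Fintype {e // lam e = 0}]
    [Fintype {v // ∀ e, M.vE v e → lam e = 0}] :
    Fintype.card F + Fintype.card {v // ∀ e, M.vE v e → lam e = 0} ≤
      Fintype.card (Quot (M.Joined lam)) + Fintype.card {e // lam e = 0} := by
  classical
  let A : (F → ZMod 2) →ₗ[ZMod 2] ({e // lam e = 0} → ZMod 2) :=
    LinearMap.pi fun e => ∑ f : F, if M.eF e.1 f then LinearMap.proj f else 0
  let B : ({e // lam e = 0} → ZMod 2) →ₗ[ZMod 2]
      ({v // ∀ e, M.vE v e → lam e = 0} → ZMod 2) :=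
    LinearMap.pi fun v => ∑ e : {e // lam e = 0}, if M.vE v.1 e.1 then LinearMap.proj e else 0
  have hA : ∀ x e, A x e = ∑ f : F, if M.eF e.1 f then x f else 0 := by
    intro x e
    simp only [A, LinearMap.pi_apply, LinearMap.sum_apply]
    refine Finset.sum_congr rfl fun f _ => ?_
    split_ifs <;> simp
  have hB : ∀ y v, B y v = ∑ e : {e // lam e = 0}, if M.vE v.1 e.1 then y e else 0 := by
    intro x e
    simp only [B, LinearMap.pi_apply, LinearMap.sum_apply]
    refine Finset.sum_congr rfl fun f _ => ?_
    split_ifs <;> simp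
  have htwo : ∀ (x : F → ZMod 2) (e : E) (f g : F), f ≠ g →
      (∀ h, M.eF e h ↔ h = f ∨ h = g) → (∑ h : F, if M.eF e h then x h else 0) = x f + x g := by
    intro x e f g hne h
    rw [← Finset.sum_filter, show (Finset.univ.filter fun h => M.eF e h) = {f, g} by
      ext k; simp [h], Finset.sum_pair hne]
  have hker : LinearMap.ker A ≤ LinearMap.range
      (LinearMap.funLeft (ZMod 2) (ZMod 2) (Quot.mk (M.Joined lam))) := by
    intro x hx
    have hxe : ∀ e, lam e = 0 → (∑ f : F, if M.eF e f then x f else 0) = 0 := by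
      intro e he
      have := congrFun (LinearMap.mem_ker.1 hx) ⟨e, he⟩
      rwa [hA] at this
    refine ⟨Quot.lift x ?_, rfl⟩
    rintro f g ⟨e, he, hf, hg⟩
    obtain ⟨u, w, -, hv⟩ := M.ends e
    obtain ⟨i, hi, rfl⟩ := M.exists_ed ((hv u).2 (Or.inl rfl))
    have h1 := hxe _ he
    rw [htwo x _ _ _ (by
      have := M.fa_ne u (i - 1)
      rwa [show i - 1 + 1 = i by omega] at this) (M.ed_fa' hi)] at h1
    have h2 : x (M.fa u (i - 1)) = x (M.fa u i) := by
      rw [eq_neg_of_add_eq_zero_left h1, ZMod.neg_eq_self_mod_two]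
    rcases (M.ed_fa' hi f).1 hf with rfl | rfl <;> rcases (M.ed_fa' hi g).1 hg with rfl | rfl
    · rfl
    · exact h2
    · exact h2.symm
    · rfl
  have hcomp : LinearMap.range A ≤ LinearMap.ker B := by
    rintro _ ⟨x, rfl⟩
    rw [LinearMap.mem_ker]
    ext v
    rw [hB, Pi.zero_apply]
    simp only [hA]
    rw [← Finset.sum_subtype (Finset.univ.filter fun e => lam e = 0) (by simp) fun e =>
      if M.vE v.1 e then ∑ f : F, if M.eF e f then x f else 0 else 0, ← Finset.sum_filter,
      show ((Finset.univ.filter fun e => lam e = 0).filter fun e => M.vE v.1 e) =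
        Finset.univ.filter fun e => M.vE v.1 e by
        ext e
        simp only [Finset.mem_filter, Finset.mem_univ, true_and, and_iff_right_iff_imp]
        exact v.2 e, M.sum_edges]
    rw [Finset.sum_congr rfl fun i _ => htwo x _ _ _ (M.fa_ne _ _) (M.ed_fa _ i),
      Finset.sum_add_distrib, M.sum_fa_succ]
    exact CharTwo.add_self_eq_zero _
  have hsurj : LinearMap.range B = ⊤ := by
    by_contra hne
    obtain ⟨z, hz0, hz⟩ := Submodule.exists_le_ker_of_lt_top _ (lt_top_iff_ne_top.2 hne)
    have hcol : ∀ e : {e // lam e = 0},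
        (∑ v : {v // ∀ e, M.vE v e → lam e = 0},
          if M.vE v.1 e.1 then z (Pi.single v 1) else 0) = 0 := by
      intro e
      have h1 : z (B (Pi.single e 1)) = 0 := hz ⟨_, rfl⟩
      have h2 : B (Pi.single e 1) = ∑ v : {v // ∀ e, M.vE v e → lam e = 0},
          if M.vE v.1 e.1 then Pi.single v 1 else 0 := by
        ext v
        rw [hB, Finset.sum_apply]
        rw [Finset.sum_eq_single e, Finset.sum_eq_single v]
        · split_ifs <;> simp
        · intro w _ hw
          split_ifs <;> simp [hw.symm]
        · simp
        · intro w _ hw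
          split_ifs <;> simp [hw]
        · simp
      rw [h2, map_sum] at h1
      refine Eq.trans (Finset.sum_congr rfl fun v _ => ?_) h1
      split_ifs <;> simp
    have hzv : ∃ v, z (Pi.single v 1) ≠ 0 := by
      by_contra! h
      apply hz0
      refine LinearMap.pi_ext' fun v => LinearMap.ext_ring ?_
      simpa using h v
    obtain ⟨e₀, he₀⟩ := hE
    obtain ⟨v₀, _, _, hv₀⟩ := M.ends e₀
    have hall := M.vconn {v | ∃ h : ∀ e, M.vE v e → lam e = 0, z (Pi.single ⟨v, h⟩ 1) ≠ 0}
      (let ⟨v, hv⟩ := hzv; ⟨v.1, v.2, hv⟩) ?_ v₀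
    · obtain ⟨h, -⟩ := hall
      exact he₀ (h e₀ ((hv₀ v₀).2 (Or.inl rfl)))
    rintro v ⟨hv, hzv⟩ e w hve hwe
    by_contra hw
    simp only [mem_ofPred_eq, not_exists, not_not] at hw
    have h1 := hcol ⟨e, hv e hve⟩
    rw [Finset.sum_eq_single ⟨v, hv⟩] at h1
    · rw [if_pos hve] at h1
      exact hzv h1
    · rintro ⟨u, hu⟩ - hne
      split_ifs with hue
      · obtain ⟨a, b, hab, hends⟩ := M.ends e
        have huv : u ≠ v := fun h => hne (Subtype.ext h)
        have huw : u ≠ w → w = v := by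
          rcases (hends u).1 hue with rfl | rfl <;> rcases (hends v).1 hve with rfl | rfl <;>
            rcases (hends w).1 hwe with rfl | rfl <;> simp_all
        by_cases h : u = w
        · subst h
          exact hw hu
        · obtain rfl := huw h
          exact absurd (hw hv) hzv
      · rfl
    · simp
  have r1 := LinearMap.finrank_range_add_finrank_ker A
  have r2 := LinearMap.finrank_range_add_finrank_ker B
  have r3 := Submodule.finrank_mono hcomp
  have r4 := Submodule.finrank_mono hker
  have r5 := LinearMap.finrank_range_le
    (LinearMap.funLeft (ZMod 2) (ZMod 2) (Quot.mk (M.Joined lam)))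
  rw [hsurj, finrank_top] at r2
  simp only [Module.finrank_fintype_fun_eq_card] at r1 r2 r5
  omega

end Region

end Surf

end SignCounting

section SignCountingFinal

namespace Surf

variable {V E F : Type*} (M : Surf V E F)

/-- The signs around a vertex change at least four times. -/
def Alternates (lam : E → SignType) (v : V) : Prop :=
  ∃ a b c d, a < b ∧ b < c ∧ c < d ∧ d < a + M.n v ∧ lam (M.ed v a) = 1 ∧ lam (M.ed v b) = -1 ∧
    lam (M.ed v c) = 1 ∧ lam (M.ed v d) = -1

/-- A vertex with exactly two nonzero edges, equal in sign and opposite in direction. -/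
def Straight {D : Type*} [AddCommGroup D] [Module ℝ D] (lam : E → SignType) (x : V → D) (v : V) :
    Prop :=
  ∃ e₁ e₂, M.vE v e₁ ∧ M.vE v e₂ ∧ e₁ ≠ e₂ ∧ (∀ e, M.vE v e → e ≠ e₁ → e ≠ e₂ → lam e = 0) ∧
    lam e₁ = lam e₂ ∧ lam e₁ ≠ 0 ∧ ∃ u w, u ≠ v ∧ w ≠ v ∧ M.vE u e₁ ∧ M.vE w e₂ ∧
      x v ∈ openSegment ℝ (x u) (x w)

theorem exists_change {lam : E → SignType} {v : V} {a b : ℕ} (hab : a < b)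
    (ha : lam (M.ed v a) ≠ 0) (hb : lam (M.ed v b) ≠ 0)
    (hne : lam (M.ed v a) ≠ lam (M.ed v b)) :
    ∃ k, a ≤ k ∧ k < b ∧ lam (M.ed v k) ≠ 0 ∧
      ∃ e', M.IsNext lam v (M.ed v k) e' ∧ lam (M.ed v k) ≠ lam e' := by
  induction h : b - a using Nat.strong_induction_on generalizing a with
  | _ m ih =>
    obtain ⟨e', he'⟩ := M.exists_isNext (M.vE_ed v a) ha
    obtain ⟨j, h1, h2, h3, h4⟩ := he'.shift rfl
    have hjb : j ≤ b := by
      by_contra hlt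
      exact hb (h4 b hab (by omega))
    have hj0 : lam (M.ed v j) ≠ 0 := by
      obtain ⟨_, _, _, _, _, _, _, hne', _⟩ := he'
      rwa [h3]
    by_cases hc : lam (M.ed v a) = lam e'
    · have hjb' : j ≠ b := by
        rintro rfl
        exact hne (by rw [hc, h3])
      obtain ⟨k, k1, k2, k3⟩ := ih (b - j) (by omega) (lt_of_le_of_ne hjb hjb') hj0
        (by rwa [h3, ← hc]) rfl
      exact ⟨k, by omega, k2, k3⟩
    · exact ⟨a, le_rfl, hab, ha, e', he', hc⟩

variable {M}

theorem Alternates.exists_ne {lam : E → SignType} {v : V} (h : M.Alternates lam v) :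
    ∃ e₁ e₂, M.vE v e₁ ∧ M.vE v e₂ ∧ e₁ ≠ e₂ ∧ lam e₁ ≠ 0 ∧ lam e₂ ≠ 0 := by
  obtain ⟨a, b, c, d, hab, hbc, hcd, hda, h1, h2, h3, h4⟩ := h
  exact ⟨M.ed v a, M.ed v b, M.vE_ed _ _, M.vE_ed _ _, M.ed_inj v a b hab (by omega),
    by rw [h1]; decide, by rw [h2]; decide⟩

variable (M)

/-- The region on the positive side of an edge at a vertex. -/
noncomputable def rpos (lam : E → SignType) (p : V × E) : Quot (M.Joined lam) :=
  open Classical in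
  if h : M.vE p.1 p.2 then Quot.mk _ (M.fa p.1 (M.exists_ed h).choose) else
    Quot.mk _ (M.fa p.1 0)

/-- The region on the negative side of an edge at a vertex. -/
noncomputable def rneg (lam : E → SignType) (p : V × E) : Quot (M.Joined lam) :=
  open Classical in
  if h : M.vE p.1 p.2 then Quot.mk _ (M.fa p.1 ((M.exists_ed h).choose - 1)) else
    Quot.mk _ (M.fa p.1 0)

/-- The next nonzero edge, as a map on flags. -/
noncomputable def nxt (lam : E → SignType) (p : V × E) : V × E :=
  open Classical in
  if h : ∃ e', M.IsNext lam p.1 p.2 e' then (p.1, h.choose) else p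

variable {M} {lam : E → SignType}

theorem rpos_ed (v : V) (i : ℕ) : M.rpos lam (v, M.ed v i) = Quot.mk _ (M.fa v i) := by
  have h := M.vE_ed v i
  rw [rpos, dif_pos h]
  exact congrArg _ (M.fa_eq_of_ed_eq (M.exists_ed h).choose_spec.2)

theorem rneg_ed (v : V) (i : ℕ) : M.rneg lam (v, M.ed v (i + 1)) = Quot.mk _ (M.fa v i) := by
  have h := M.vE_ed v (i + 1)
  rw [rneg, dif_pos h]
  have hs := (M.exists_ed h).choose_spec
  set j := (M.exists_ed h).choose
  have h2 := M.mod_eq_of_ed_eq hs.2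
  have h3 : M.fa v (j - 1) = M.fa v i := by
    rw [← M.fa_mod v (j - 1), ← M.fa_mod v i]
    congr 1
    refine Nat.ModEq.add_right_cancel' 1 ?_
    rwa [show j - 1 + 1 = j by omega]
  exact congrArg _ h3

theorem nxt_eq {v : V} {e e' : E} (h : M.IsNext lam v e e') : M.nxt lam (v, e) = (v, e') := by
  have hex : ∃ e', M.IsNext lam (v, e).1 (v, e).2 e' := ⟨e', h⟩
  rw [nxt, dif_pos hex]
  exact congrArg _ (hex.choose_spec.unique h)

theorem IsNext.vE_right {v : V} {e e' : E} (h : M.IsNext lam v e e') : M.vE v e' := by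
  obtain ⟨_, j, _, _, _, rfl, _⟩ := h
  exact M.vE_ed _ _

theorem IsNext.ne_zero_right {v : V} {e e' : E} (h : M.IsNext lam v e e') : lam e' ≠ 0 := by
  obtain ⟨_, _, _, _, _, _, _, h, _⟩ := h
  exact h

theorem IsNext.rneg {v : V} {e e' : E} (h : M.IsNext lam v e e') :
    M.rneg lam (v, e') = M.rpos lam (v, e) := by
  obtain ⟨i, j, hij, -, rfl, rfl, -, -, hz⟩ := h
  rw [rpos_ed, M.cls_of_isNext hij hz]
  obtain ⟨l, rfl⟩ : ∃ l, j = l + 1 := ⟨j - 1, by omega⟩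
  rw [rneg_ed]
  rfl

variable [Fintype V] [Fintype E] [Fintype F]

open Classical in
/-- Pairs of a vertex and a nonzero edge there. -/
noncomputable def flags (M : Surf V E F) (lam : E → SignType) : Finset (V × E) :=
  Finset.univ.filter fun p => M.vE p.1 p.2 ∧ lam p.2 ≠ 0

omit [Fintype F] in
theorem mem_flags {p : V × E} : p ∈ M.flags lam ↔ M.vE p.1 p.2 ∧ lam p.2 ≠ 0 := by
  simp [flags]

omit [Fintype F] in
theorem exists_isNext_of_mem {v : V} {e : E} (h : (v, e) ∈ M.flags lam) :
    ∃ e', M.IsNext lam v e e' := by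
  rw [mem_flags] at h
  exact M.exists_isNext h.1 h.2

omit [Fintype F] in
theorem nxt_mem {p : V × E} (h : p ∈ M.flags lam) : M.nxt lam p ∈ M.flags lam := by
  obtain ⟨v, e⟩ := p
  obtain ⟨e', he'⟩ := exists_isNext_of_mem h
  rw [nxt_eq he', mem_flags]
  exact ⟨he'.vE_right, he'.ne_zero_right⟩

omit [Fintype F] in
theorem nxt_injOn : Set.InjOn (M.nxt lam) (M.flags lam) := by
  rintro ⟨v, e⟩ h ⟨w, f⟩ h' heq
  obtain ⟨e', he'⟩ := exists_isNext_of_mem h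
  obtain ⟨f', hf'⟩ := exists_isNext_of_mem h'
  rw [nxt_eq he', nxt_eq hf', Prod.mk.injEq] at heq
  obtain ⟨rfl, rfl⟩ := heq
  rw [he'.inj hf']

omit [Fintype F] in
theorem nxt_surjOn : Set.SurjOn (M.nxt lam) (M.flags lam) (M.flags lam) :=
  Finset.surjOn_of_injOn_of_card_le _ (fun _ h => nxt_mem h) nxt_injOn le_rfl

omit [Fintype F] in
theorem sum_nxt {R : Type*} [AddCommMonoid R] (g : V × E → R) :
    ∑ p ∈ M.flags lam, g (M.nxt lam p) = ∑ p ∈ M.flags lam, g p :=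
  Finset.sum_bij (fun p _ => M.nxt lam p) (fun _ h => nxt_mem h) (fun _ h _ h' e => nxt_injOn h h' e)
    (fun _ h => let ⟨q, hq, h⟩ := nxt_surjOn h; ⟨q, hq, h⟩) (fun _ _ => rfl)

omit [Fintype F] in
theorem sum_flags {R : Type*} [AddCommMonoid R] (g : E → R) :
    ∑ p ∈ M.flags lam, g p.2 = 2 • ∑ e with lam e ≠ 0, g e := by
  classical
  rw [Finset.smul_sum, ← Finset.sum_fiberwise_of_maps_to (s := M.flags lam)
    (t := Finset.univ.filter fun e => lam e ≠ 0) (g := Prod.snd)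
    (fun _ hp => by simpa using (mem_flags.1 hp).2)]
  refine Finset.sum_congr rfl fun e he => ?_
  obtain ⟨u, w, huw, h⟩ := M.ends e
  rw [Finset.sum_congr rfl (g := fun _ => g e) (fun _ hp => by rw [(Finset.mem_filter.1 hp).2]),
    Finset.sum_const]
  congr 1
  rw [show (M.flags lam).filter (fun p => p.2 = e) = {(u, e), (w, e)} by
    ext ⟨v, e'⟩
    simp only [Finset.mem_filter, mem_flags, Finset.mem_insert, Finset.mem_singleton, Prod.mk.injEq]
    constructor
    · rintro ⟨⟨h1, h2⟩, rfl⟩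
      exact ((h v).1 h1).imp (⟨·, rfl⟩) (⟨·, rfl⟩)
    · rintro (⟨rfl, rfl⟩ | ⟨rfl, rfl⟩)
      · exact ⟨⟨(h _).2 (Or.inl rfl), by simpa using he⟩, rfl⟩
      · exact ⟨⟨(h _).2 (Or.inr rfl), by simpa using he⟩, rfl⟩]
  exact Finset.card_pair (by simp [huw])

open Classical in
theorem even_changes (R : Quot (M.Joined lam)) :
    Even ((M.flags lam).filter fun p =>
      M.rpos lam p = R ∧ lam p.2 ≠ lam (M.nxt lam p).2).card := by
  rw [← ZMod.natCast_eq_zero_iff_even, Finset.card_filter]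
  push_cast
  let χ : SignType → ZMod 2 := fun s => if s = 1 then 1 else 0
  have hχ : ∀ s t : SignType, s ≠ 0 → t ≠ 0 → (if s ≠ t then (1 : ZMod 2) else 0) = χ s + χ t := by
    decide
  have h1 : ∀ p ∈ M.flags lam,
      (if M.rpos lam p = R ∧ lam p.2 ≠ lam (M.nxt lam p).2 then (1 : ZMod 2) else 0) =
      (if M.rpos lam p = R then χ (lam p.2) else 0) +
      (if M.rneg lam (M.nxt lam p) = R then χ (lam (M.nxt lam p).2) else 0) := by
    rintro ⟨v, e⟩ hp
    obtain ⟨e', he'⟩ := exists_isNext_of_mem hp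
    rw [nxt_eq he', he'.rneg]
    have := hχ (lam e) (lam e') (mem_flags.1 hp).2 he'.ne_zero_right
    by_cases hR : M.rpos lam (v, e) = R
    · simpa [hR] using this
    · simp [hR]
  rw [Finset.sum_congr rfl h1, Finset.sum_add_distrib,
    sum_nxt (fun p => if M.rneg lam p = R then χ (lam p.2) else 0), ← Finset.sum_add_distrib]
  have h2 : ∀ p ∈ M.flags lam,
      (if M.rpos lam p = R then χ (lam p.2) else 0) + (if M.rneg lam p = R then χ (lam p.2) else 0) =
      ∑ f with M.eF p.2 f, if Quot.mk (M.Joined lam) f = R then χ (lam p.2) else 0 := by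
    rintro ⟨v, e⟩ hp
    obtain ⟨i, hi, he⟩ := M.exists_ed (mem_flags.1 hp).1
    obtain ⟨j, rfl⟩ : ∃ j, i = j + 1 := ⟨i - 1, by omega⟩
    dsimp only at he
    subst he
    rw [rpos_ed, rneg_ed, show (Finset.univ.filter fun f => M.eF (v, M.ed v (j + 1)).2 f) =
      {M.fa v j, M.fa v (j + 1)} by ext f; simp [M.ed_fa], Finset.sum_pair (M.fa_ne v j), add_comm]
  rw [Finset.sum_congr rfl h2, sum_flags (M := M) (lam := lam) (fun e => ∑ f with M.eF e f,
    if Quot.mk (M.Joined lam) f = R then χ (lam e) else 0), two_nsmul]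
  exact CharTwo.add_self_eq_zero _

end Surf

end SignCountingFinal

section SignCountingTheorem

namespace Surf

variable {V E F : Type*} [Fintype V] [Fintype E] [Fintype F] {M : Surf V E F} {lam : E → SignType}

/-- The vertices on the boundary of a region. -/
def regionVerts (M : Surf V E F) (lam : E → SignType) (R : Quot (M.Joined lam)) : Set V :=
  {v | ∃ e f, M.vE v e ∧ lam e ≠ 0 ∧ M.eF e f ∧ Quot.mk _ f = R}

omit [Fintype V] [Fintype E] [Fintype F] in
theorem regionVerts_nonempty (hE : ∃ e, lam e ≠ 0) (R : Quot (M.Joined lam)) :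
    (M.regionVerts lam R).Nonempty := by
  by_contra hne
  have hno : ∀ e f, M.eF e f → Quot.mk _ f = R → lam e = 0 := by
    intro e f hef hf
    by_contra hl
    obtain ⟨u, w, -, h⟩ := M.ends e
    exact hne ⟨u, e, f, (h u).2 (Or.inl rfl), hl, hef, hf⟩
  obtain ⟨f₀, hf₀⟩ := Quot.exists_rep R
  have hall := M.fconn {f | Quot.mk _ f = R} ⟨f₀, hf₀⟩ (by
    intro f hf e g hef heg
    rw [← show Quot.mk _ f = R from hf]
    exact (Quot.sound ⟨e, hno e f hef hf, hef, heg⟩).symm)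
  obtain ⟨e, he⟩ := hE
  obtain ⟨u, w, -, h⟩ := M.ends e
  obtain ⟨i, hi, rfl⟩ := M.exists_ed ((h u).2 (Or.inl rfl))
  exact he (hno _ _ ((M.ed_fa' hi _).2 (Or.inr rfl)) (hall _))

omit [Fintype V] [Fintype E] [Fintype F] in
theorem other_mem {R : Quot (M.Joined lam)} {e : E} {u : V} {f : F} (hl : lam e ≠ 0)
    (hf : M.eF e f) (hR : Quot.mk _ f = R) (hu : M.vE u e) : u ∈ M.regionVerts lam R :=
  ⟨e, f, hu, hl, hf, hR⟩

omit [Fintype V] [Fintype E] [Fintype F] in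
theorem exists_face_rpos {v : V} {e : E} (h : M.vE v e) :
    ∃ f, M.eF e f ∧ Quot.mk _ f = M.rpos lam (v, e) := by
  obtain ⟨i, hi, rfl⟩ := M.exists_ed h
  exact ⟨_, (M.ed_fa' hi _).2 (Or.inr rfl), by rw [rpos_ed]⟩

omit [Fintype V] [Fintype E] [Fintype F] in
theorem exists_face_rneg {v : V} {e : E} (h : M.vE v e) :
    ∃ f, M.eF e f ∧ Quot.mk _ f = M.rneg lam (v, e) := by
  obtain ⟨i, hi, rfl⟩ := M.exists_ed h
  obtain ⟨j, rfl⟩ : ∃ j, i = j + 1 := ⟨i - 1, by omega⟩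
  exact ⟨_, (M.ed_fa' hi _).2 (Or.inl rfl), by rw [rneg_ed]; rfl⟩

omit [Fintype F] in
/-- Each boundary vertex of a region has an angle in it. -/
theorem exists_angle {R : Quot (M.Joined lam)} {v : V} (hv : v ∈ M.regionVerts lam R) :
    ∃ e e', (v, e) ∈ M.flags lam ∧ M.IsNext lam v e e' ∧ M.rpos lam (v, e) = R ∧
      (∀ u, M.vE u e → u ∈ M.regionVerts lam R) ∧ ∀ u, M.vE u e' → u ∈ M.regionVerts lam R := by
  obtain ⟨e, f, hve, hl, hef, hf⟩ := hv
  have hfl : (v, e) ∈ M.flags lam := mem_flags.2 ⟨hve, hl⟩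
  have key : ∃ e, (v, e) ∈ M.flags lam ∧ M.rpos lam (v, e) = R := by
    obtain ⟨i, hi, rfl⟩ := M.exists_ed hve
    obtain ⟨j, rfl⟩ : ∃ j, i = j + 1 := ⟨i - 1, by omega⟩
    rcases (M.ed_fa _ _ _).1 hef with rfl | rfl
    · obtain ⟨⟨w, e₀⟩, hq, hn⟩ := nxt_surjOn hfl
      obtain ⟨e', he'⟩ := exists_isNext_of_mem hq
      rw [nxt_eq he', Prod.mk.injEq] at hn
      obtain ⟨rfl, rfl⟩ := hn
      exact ⟨e₀, hq, by rw [← he'.rneg, rneg_ed, hf]⟩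
    · exact ⟨_, hfl, by rw [rpos_ed, hf]⟩
  obtain ⟨e₁, h1, h2⟩ := key
  obtain ⟨e₂, h3⟩ := exists_isNext_of_mem h1
  refine ⟨e₁, e₂, h1, h3, h2, fun u hu => ?_, fun u hu => ?_⟩
  · obtain ⟨g, hg, hg'⟩ := exists_face_rpos (lam := lam) (mem_flags.1 h1).1
    exact other_mem (mem_flags.1 h1).2 hg (hg'.trans h2) hu
  · obtain ⟨g, hg, hg'⟩ := exists_face_rneg (lam := lam) h3.vE_right
    exact other_mem h3.ne_zero_right hg (hg'.trans (h3.rneg.trans h2)) hu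

variable {D : Type*} [NormedAddCommGroup D] [NormedSpace ℝ D] {x : V → D}

omit [Fintype E] [Fintype F] in
theorem image_subset_segment {Y A : Set V} {a b : V} (hY : Y.Nonempty)
    (hA : ∀ v ∈ Y, v ∉ A → ∃ u ∈ Y, ∃ w ∈ Y, x u ≠ x v ∧ x v ∈ openSegment ℝ (x u) (x w))
    (hab : ∀ v ∈ Y, v ∈ A → v = a ∨ v = b) :
    x '' Y ⊆ segment ℝ (x a) (x b) ∧ ∃ v ∈ Y, v ∈ A := by
  have hfin : (x '' Y).Finite := Set.toFinite _
  have hcomp : IsCompact (convexHull ℝ (x '' Y)) := hfin.isCompact_convexHull (𝕜 := ℝ)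
  have hext : ∀ y ∈ (convexHull ℝ (x '' Y)).extremePoints ℝ, ∃ v ∈ Y, v ∈ A ∧ x v = y := by
    intro y hy
    obtain ⟨v, hv, rfl⟩ := extremePoints_convexHull_subset hy
    refine ⟨v, hv, ?_, rfl⟩
    by_contra hvA
    obtain ⟨u, hu, w, hw, hne, hseg⟩ := hA v hv hvA
    exact hne (((mem_extremePoints.1 hy).2 _ (subset_convexHull _ _ ⟨u, hu, rfl⟩) _
      (subset_convexHull _ _ ⟨w, hw, rfl⟩) hseg).1)
  constructor
  · refine (subset_convexHull ℝ _).trans ?_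
    rw [← closure_convexHull_extremePoints hcomp (convex_convexHull _ _)]
    refine closure_minimal (convexHull_min ?_ (convex_segment _ _)) ?_
    · intro y hy
      obtain ⟨v, hv, hvA, rfl⟩ := hext y hy
      rcases hab v hv hvA with rfl | rfl
      · exact left_mem_segment _ _ _
      · exact right_mem_segment _ _ _
    · rw [segment_eq_image_lineMap]
      exact (isCompact_Icc.image (by fun_prop)).isClosed
  · obtain ⟨y, hy⟩ := hcomp.extremePoints_nonempty ((hY.image x).convexHull)
    obtain ⟨v, hv, hvA, -⟩ := hext y hy
    exact ⟨v, hv, hvA⟩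

open Classical in
/-- The flags at alternating vertices in a region. -/
noncomputable def regionFlags (M : Surf V E F) (lam : E → SignType) (R : Quot (M.Joined lam)) :
    Finset (V × E) :=
  (M.flags lam).filter fun p => M.rpos lam p = R ∧ M.Alternates lam p.1

omit [Fintype F] in
theorem three_le_card_regionFlags (hE : ∃ e, lam e ≠ 0)
    (hx : ∀ u v e, u ≠ v → M.vE u e → M.vE v e → lam e ≠ 0 → x u ≠ x v)
    (hcar : ∀ v e₁ e₂ u₁ u₂, M.vE v e₁ → M.vE v e₂ → lam e₁ ≠ 0 → lam e₂ ≠ 0 → u₁ ≠ v → u₂ ≠ v →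
      M.vE u₁ e₁ → M.vE u₂ e₂ → (∃ s : ℝ, 0 < s ∧ x u₁ - x v = s • (x u₂ - x v)) → e₁ = e₂)
    (htype : ∀ v, (∀ e, M.vE v e → lam e = 0) ∨ M.Alternates lam v ∨ M.Straight lam x v)
    (R : Quot (M.Joined lam)) : 3 ≤ (M.regionFlags lam R).card := by
  classical
  by_contra hlt
  push Not at hlt
  have hmem : ∀ v ∈ M.regionVerts lam R, M.Alternates lam v →
      v ∈ (M.regionFlags lam R).image Prod.fst := by
    intro v hv hA
    obtain ⟨e, e', h1, -, h3, -⟩ := exists_angle hv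
    exact Finset.mem_image.2 ⟨(v, e), Finset.mem_filter.2 ⟨h1, h3, hA⟩, rfl⟩
  have hcard : ((M.regionFlags lam R).image Prod.fst).card ≤ 2 :=
    Finset.card_image_le.trans (by omega)
  have hst : ∀ v ∈ M.regionVerts lam R, v ∉ {v | M.Alternates lam v} →
      ∃ u ∈ M.regionVerts lam R, ∃ w ∈ M.regionVerts lam R, x u ≠ x v ∧
        x v ∈ openSegment ℝ (x u) (x w) := by
    intro v hv hA
    obtain ⟨e, e', h1, h2, h3, h4, h5⟩ := exists_angle hv
    rcases htype v with h0 | h0 | h0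
    · exact absurd (h0 e (mem_flags.1 h1).1) (mem_flags.1 h1).2
    · exact absurd h0 hA
    · obtain ⟨e₁, e₂, k1, k2, k3, k4, k5, k6, u, w, hu, hw, hue, hwe, hseg⟩ := h0
      have key : ∀ e₁ e₂, M.vE v e₁ → M.vE v e₂ → e₁ ≠ e₂ →
          (∀ e, M.vE v e → e ≠ e₁ → e ≠ e₂ → lam e = 0) → lam e₂ ≠ 0 → e = e₁ → e' = e₂ := by
        rintro e₁ e₂ k1 k2 k3 k4 k5 rfl
        by_contra hne
        exact h2.ne_zero_right (k4 e' h2.vE_right (h2.ne k2 (Ne.symm k3) k5) hne)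
      have hor : (e = e₁ ∧ e' = e₂) ∨ (e = e₂ ∧ e' = e₁) := by
        by_cases he : e = e₁
        · exact Or.inl ⟨he, key e₁ e₂ k1 k2 k3 k4 (k5 ▸ k6) he⟩
        by_cases he2 : e = e₂
        · exact Or.inr ⟨he2, key e₂ e₁ k2 k1 k3.symm (fun e a b c => k4 e a c b) k6 he2⟩
        exact absurd (k4 e (mem_flags.1 h1).1 he he2) (mem_flags.1 h1).2
      refine ⟨u, ?_, w, ?_, hx u v e₁ hu hue k1 k6, hseg⟩
      · rcases hor with ⟨rfl, rfl⟩ | ⟨rfl, rfl⟩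
        exacts [h4 u hue, h5 u hue]
      · rcases hor with ⟨rfl, rfl⟩ | ⟨rfl, rfl⟩
        exacts [h5 w hwe, h4 w hwe]
  obtain ⟨y₀, hy₀⟩ := regionVerts_nonempty hE R
  obtain ⟨a, haY, haA⟩ : ∃ a ∈ M.regionVerts lam R, M.Alternates lam a := by
    by_contra! hno
    obtain ⟨-, v, hv, hvA⟩ := image_subset_segment (a := y₀) (b := y₀) ⟨y₀, hy₀⟩ hst
      (fun v hv hvA => absurd hvA (hno v hv))
    exact hno v hv hvA
  obtain ⟨b, hb⟩ : ∃ b, ∀ v ∈ M.regionVerts lam R, M.Alternates lam v → v = a ∨ v = b := by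
    by_cases h : ∀ v ∈ M.regionVerts lam R, M.Alternates lam v → v = a
    · exact ⟨a, fun v hv hA => Or.inl (h v hv hA)⟩
    · push Not at h
      obtain ⟨b, hbY, hbA, hba⟩ := h
      refine ⟨b, fun v hv hA => ?_⟩
      by_contra! hne
      have := Finset.two_lt_card.2 ⟨a, hmem a haY haA, b, hmem b hbY hbA, v, hmem v hv hA,
        hba.symm, hne.1.symm, hne.2.symm⟩
      omega
  obtain ⟨hseg, -⟩ := image_subset_segment ⟨y₀, hy₀⟩ hst hb
  obtain ⟨e, e', h1, h2, h3, h4, h5⟩ := exists_angle haY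
  have hend : ∀ e, M.vE a e → lam e ≠ 0 → (∀ u, M.vE u e → u ∈ M.regionVerts lam R) →
      ∃ u, u ≠ a ∧ M.vE u e ∧ ∃ s : ℝ, 0 < s ∧ x u - x a = s • (x b - x a) := by
    intro e hae hl hY
    obtain ⟨p, q, hpq, hends⟩ := M.ends e
    obtain ⟨u, hua, hue⟩ : ∃ u, u ≠ a ∧ M.vE u e := by
      rcases (hends a).1 hae with rfl | rfl
      exacts [⟨q, hpq.symm, (hends _).2 (Or.inr rfl)⟩, ⟨p, hpq, (hends _).2 (Or.inl rfl)⟩]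
    refine ⟨u, hua, hue, ?_⟩
    have hmem := hseg ⟨u, hY u hue, rfl⟩
    rw [segment_eq_image'] at hmem
    obtain ⟨s, hs, hsu⟩ := hmem
    dsimp only at hsu
    refine ⟨s, lt_of_le_of_ne hs.1 ?_, by rw [← hsu]; abel⟩
    rintro rfl
    exact hx u a e hua hue hae hl (by rw [← hsu]; simp)
  obtain ⟨h1a, h1b⟩ := mem_flags.1 h1
  obtain ⟨u, hu, hue, s, hs, hsu⟩ := hend e h1a h1b h4
  obtain ⟨w, hw, hwe, t, ht, htw⟩ := hend e' h2.vE_right h2.ne_zero_right h5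
  have hne : e' ≠ e := by
    obtain ⟨e₁, e₂, k1, k2, k3, k4, k5⟩ := haA.exists_ne
    by_cases he : e₁ = e
    · exact h2.ne k2 (fun h => k3 (he.trans h.symm)) k5
    · exact h2.ne k1 he k4
  refine hne (hcar a e e' u w h1a h2.vE_right h1b h2.ne_zero_right hu hw hue hwe
    ⟨s / t, div_pos hs ht, ?_⟩).symm
  rw [hsu, htw, smul_smul, div_mul_cancel₀ _ ht.ne']

open Classical in
omit [Fintype F] in
theorem four_le_changes {v : V} (h : M.Alternates lam v) :
    4 ≤ (((M.flags lam).filter fun p => lam p.2 ≠ lam (M.nxt lam p).2).filter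
      fun p => p.1 = v).card := by
  obtain ⟨a, b, c, d, hab, hbc, hcd, hda, h1, h2, h3, h4⟩ := h
  have h5 : lam (M.ed v (a + M.n v)) = 1 := by rw [M.ed_per, h1]
  obtain ⟨k₁, p1, p2, p3, e₁, p4, p5⟩ := M.exists_change (lam := lam) hab (by rw [h1]; decide)
    (by rw [h2]; decide) (by rw [h1, h2]; decide)
  obtain ⟨k₂, q1, q2, q3, e₂, q4, q5⟩ := M.exists_change (lam := lam) hbc (by rw [h2]; decide)
    (by rw [h3]; decide) (by rw [h2, h3]; decide)
  obtain ⟨k₃, r1, r2, r3, e₃, r4, r5⟩ := M.exists_change (lam := lam) hcd (by rw [h3]; decide)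
    (by rw [h4]; decide) (by rw [h3, h4]; decide)
  obtain ⟨k₄, s1, s2, s3, e₄, s4, s5⟩ := M.exists_change (lam := lam) hda (by rw [h4]; decide)
    (by rw [h5]; decide) (by rw [h4, h5]; decide)
  have hmem : ∀ k e, M.IsNext lam v (M.ed v k) e → lam (M.ed v k) ≠ 0 → lam (M.ed v k) ≠ lam e →
      (v, M.ed v k) ∈ ((M.flags lam).filter fun p => lam p.2 ≠ lam (M.nxt lam p).2).filter
      fun p => p.1 = v := by
    intro k e t1 t2 t3
    rw [Finset.mem_filter, Finset.mem_filter, mem_flags, nxt_eq t1]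
    exact ⟨⟨⟨M.vE_ed _ _, t2⟩, t3⟩, rfl⟩
  have hsub : ({(v, M.ed v k₁), (v, M.ed v k₂), (v, M.ed v k₃), (v, M.ed v k₄)} :
      Finset (V × E)) ⊆ ((M.flags lam).filter fun p => lam p.2 ≠ lam (M.nxt lam p).2).filter
      fun p => p.1 = v := by
    intro p hp
    simp only [Finset.mem_insert, Finset.mem_singleton] at hp
    rcases hp with rfl | rfl | rfl | rfl
    exacts [hmem _ _ p4 p3 p5, hmem _ _ q4 q3 q5, hmem _ _ r4 r3 r5, hmem _ _ s4 s3 s5]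
  refine le_trans (le_of_eq ?_) (Finset.card_le_card hsub)
  have hne : ∀ i j, i < j → j < i + M.n v → (v, M.ed v i) ≠ (v, M.ed v j) := fun i j h1 h2 h =>
    M.ed_inj v i j h1 h2 (Prod.mk.inj h).2
  rw [Finset.card_insert_of_notMem, Finset.card_insert_of_notMem, Finset.card_pair]
  · exact hne _ _ (by omega) (by omega)
  · simp only [Finset.mem_insert, Finset.mem_singleton, not_or]
    exact ⟨hne _ _ (by omega) (by omega), hne _ _ (by omega) (by omega)⟩
  · simp only [Finset.mem_insert, Finset.mem_singleton, not_or]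
    exact ⟨hne _ _ (by omega) (by omega), hne _ _ (by omega) (by omega),
      hne _ _ (by omega) (by omega)⟩

/-- Cauchy's counting argument, allowing straight vertices. -/
theorem eq_zero (hEuler : Fintype.card E + 2 ≤ Fintype.card V + Fintype.card F)
    (hx : ∀ u v e, u ≠ v → M.vE u e → M.vE v e → lam e ≠ 0 → x u ≠ x v)
    (hcar : ∀ v e₁ e₂ u₁ u₂, M.vE v e₁ → M.vE v e₂ → lam e₁ ≠ 0 → lam e₂ ≠ 0 → u₁ ≠ v → u₂ ≠ v →
      M.vE u₁ e₁ → M.vE u₂ e₂ → (∃ s : ℝ, 0 < s ∧ x u₁ - x v = s • (x u₂ - x v)) → e₁ = e₂)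
    (htype : ∀ v, (∀ e, M.vE v e → lam e = 0) ∨ M.Alternates lam v ∨ M.Straight lam x v) :
    ∀ e, lam e = 0 := by
  classical
  by_contra hE
  push Not at hE
  have := Fintype.ofFinite (Quot (M.Joined lam))
  have hreg := M.card_regions lam hE
  have hdisj : ∀ v, M.Alternates lam v → ¬ M.Straight lam x v := by
    rintro v ⟨a, b, c, d, hab, hbc, hcd, hda, h1, h2, h3, h4⟩ ⟨e₁, e₂, k1, k2, k3, k4, k5, k6, -⟩
    have key : ∀ k, lam (M.ed v k) ≠ 0 → lam (M.ed v k) = lam e₁ := by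
      intro k hk
      by_cases g1 : M.ed v k = e₁
      · rw [g1]
      by_cases g2 : M.ed v k = e₂
      · rw [g2, k5]
      exact absurd (k4 _ (M.vE_ed _ _) g1 g2) hk
    have g1 := key a (by rw [h1]; decide)
    have g2 := key b (by rw [h2]; decide)
    rw [h1] at g1
    rw [h2, ← g1] at g2
    exact absurd g2 (by decide)
  have hdisj0 : ∀ v, (∀ e, M.vE v e → lam e = 0) → ¬ M.Alternates lam v ∧ ¬ M.Straight lam x v := by
    intro v h
    refine ⟨fun hA => ?_, ?_⟩
    · obtain ⟨e₁, e₂, k1, k2, k3, k4, k5⟩ := hA.exists_ne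
      exact k4 (h _ k1)
    · rintro ⟨e₁, e₂, k1, k2, k3, k4, k5, k6, -⟩
      exact k6 (h _ k1)
  have hVsum : Fintype.card V = Fintype.card {v // ∀ e, M.vE v e → lam e = 0} +
      (Finset.univ.filter fun v => M.Alternates lam v).card +
      (Finset.univ.filter fun v => M.Straight lam x v).card := by
    rw [Fintype.card_subtype, ← Finset.card_univ, ← Finset.card_union_of_disjoint,
      ← Finset.card_union_of_disjoint]
    · congr 1
      ext v
      simpa [or_assoc] using htype v
    · rw [Finset.disjoint_left]
      intro v hv hv'
      simp only [Finset.mem_union, Finset.mem_filter, Finset.mem_univ, true_and] at hv hv'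
      exact hv.elim (fun h => (hdisj0 v h).2 hv') (fun h => hdisj v h hv')
    · rw [Finset.disjoint_left]
      intro v hv hv'
      simp only [Finset.mem_filter, Finset.mem_univ, true_and] at hv hv'
      exact (hdisj0 v hv).1 hv'
  have hEsum : Fintype.card E = Fintype.card {e // lam e = 0} +
      (Finset.univ.filter fun e => lam e ≠ 0).card := by
    rw [Fintype.card_subtype, ← Finset.card_univ,
      ← Finset.card_filter_add_card_filter_not (fun e => lam e = 0)]
  have hfl : (M.flags lam).card = 2 * (Finset.univ.filter fun e => lam e ≠ 0).card := by
    have := sum_flags (M := M) (lam := lam) (fun _ => 1)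
    simpa using this
  have hsplit : (M.flags lam).card = ((M.flags lam).filter fun p => M.Alternates lam p.1).card +
      2 * (Finset.univ.filter fun v => M.Straight lam x v).card := by
    rw [← Finset.card_filter_add_card_filter_not (s := M.flags lam)
      (fun p => M.Alternates lam p.1)]
    congr 1
    rw [Finset.card_eq_sum_card_fiberwise (f := Prod.fst)
      (t := Finset.univ.filter fun v => M.Straight lam x v)]
    · rw [Finset.sum_const_nat (m := 2), mul_comm]
      intro v hv
      obtain ⟨e₁, e₂, k1, k2, k3, k4, k5, k6, -⟩ := (Finset.mem_filter.1 hv).2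
      rw [show (((M.flags lam).filter fun p => ¬ M.Alternates lam p.1).filter fun p => p.1 = v) =
        {(v, e₁), (v, e₂)} by
        ext ⟨w, e⟩
        simp only [Finset.mem_filter, mem_flags, Finset.mem_insert, Finset.mem_singleton,
          Prod.mk.injEq]
        constructor
        · rintro ⟨⟨⟨h1, h2⟩, h3⟩, rfl⟩
          by_contra! hne
          exact h2 (k4 e h1 (hne.1 rfl) (hne.2 rfl))
        · have hnA : ¬ M.Alternates lam v := fun h => hdisj v h (Finset.mem_filter.1 hv).2
          rintro (⟨rfl, rfl⟩ | ⟨rfl, rfl⟩)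
          · exact ⟨⟨⟨k1, k6⟩, hnA⟩, rfl⟩
          · exact ⟨⟨⟨k2, k5 ▸ k6⟩, hnA⟩, rfl⟩]
      exact Finset.card_pair (by simp [k3])
    · rintro ⟨v, e⟩ hp
      simp only [Finset.coe_filter, mem_flags, Finset.mem_univ, true_and, mem_ofPred_eq] at hp ⊢
      rcases htype v with h | h | h
      · exact absurd (h e hp.1.1) hp.1.2
      · exact absurd h hp.2
      · exact h
  have hA4 : 4 * (Finset.univ.filter fun v => M.Alternates lam v).card ≤
      ((M.flags lam).filter fun p => lam p.2 ≠ lam (M.nxt lam p).2).card := by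
    have hsub : (((M.flags lam).filter fun p => lam p.2 ≠ lam (M.nxt lam p).2).filter fun p =>
      M.Alternates lam p.1).card ≤ _ := Finset.card_le_card (Finset.filter_subset _ _)
    refine le_trans ?_ hsub
    rw [Finset.card_eq_sum_card_fiberwise (f := Prod.fst)
      (t := Finset.univ.filter fun v => M.Alternates lam v), mul_comm, ← smul_eq_mul]
    · refine Finset.card_nsmul_le_sum _ _ _ fun v hv => ?_
      have hv' := (Finset.mem_filter.1 hv).2
      refine (four_le_changes hv').trans (Finset.card_le_card ?_)
      intro p hp
      rw [Finset.mem_filter] at hp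
      exact Finset.mem_filter.2 ⟨Finset.mem_filter.2 ⟨hp.1, by rw [hp.2]; exact hv'⟩, hp.2⟩
    · intro p hp
      simp only [Finset.coe_filter, Finset.mem_filter, mem_ofPred_eq] at hp ⊢
      exact ⟨Finset.mem_univ _, hp.2⟩
  have hchA : ∀ p ∈ M.flags lam, lam p.2 ≠ lam (M.nxt lam p).2 → M.Alternates lam p.1 := by
    rintro ⟨v, e⟩ hp hne
    obtain ⟨e', he'⟩ := exists_isNext_of_mem hp
    rw [nxt_eq he'] at hne
    rcases htype v with h | h | h
    · exact absurd (h e (mem_flags.1 hp).1) (mem_flags.1 hp).2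
    · exact h
    · obtain ⟨e₁, e₂, k1, k2, k3, k4, k5, k6, -⟩ := h
      have key : ∀ e, M.vE v e → lam e ≠ 0 → lam e = lam e₁ := by
        intro e hv hk
        by_cases g1 : e = e₁
        · rw [g1]
        by_cases g2 : e = e₂
        · rw [g2, k5]
        exact absurd (k4 _ hv g1 g2) hk
      exact absurd ((key e (mem_flags.1 hp).1 (mem_flags.1 hp).2).trans
        (key e' he'.vE_right he'.ne_zero_right).symm) hne
  have hR : ∀ R : Quot (M.Joined lam), ((M.flags lam).filter fun p =>
      M.rpos lam p = R ∧ lam p.2 ≠ lam (M.nxt lam p).2).card + 4 ≤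
      2 * (M.regionFlags lam R).card := by
    intro R
    have h3 := three_le_card_regionFlags hE hx hcar htype R
    have hle : ((M.flags lam).filter fun p =>
        M.rpos lam p = R ∧ lam p.2 ≠ lam (M.nxt lam p).2).card ≤ (M.regionFlags lam R).card := by
      refine Finset.card_le_card fun p hp => ?_
      rw [Finset.mem_filter] at hp
      exact Finset.mem_filter.2 ⟨hp.1, hp.2.1, hchA p hp.1 hp.2.2⟩
    obtain ⟨m, hm⟩ := even_changes (M := M) (lam := lam) R
    omega
  have hsum : ∑ R, (((M.flags lam).filter fun p =>
      M.rpos lam p = R ∧ lam p.2 ≠ lam (M.nxt lam p).2).card + 4) ≤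
      ∑ R, 2 * (M.regionFlags lam R).card := Finset.sum_le_sum fun R _ => hR R
  rw [Finset.sum_add_distrib, ← Finset.mul_sum, Finset.sum_const, Finset.card_univ,
    smul_eq_mul] at hsum
  have hs1 : ∑ R, ((M.flags lam).filter fun p =>
      M.rpos lam p = R ∧ lam p.2 ≠ lam (M.nxt lam p).2).card =
      ((M.flags lam).filter fun p => lam p.2 ≠ lam (M.nxt lam p).2).card := by
    rw [Finset.card_eq_sum_card_fiberwise (f := M.rpos lam) (t := Finset.univ) (by simp)]
    refine Finset.sum_congr rfl fun R _ => ?_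
    rw [Finset.filter_filter]
    simp only [and_comm]
  have hs2 : ∑ R, (M.regionFlags lam R).card =
      ((M.flags lam).filter fun p => M.Alternates lam p.1).card := by
    rw [Finset.card_eq_sum_card_fiberwise (f := M.rpos lam) (t := Finset.univ) (by simp)]
    refine Finset.sum_congr rfl fun R _ => ?_
    rw [Finset.filter_filter, regionFlags]
    simp only [and_comm]
  rw [hs1, hs2] at hsum
  omega

end Surf

end SignCountingTheorem

/-! ### Polygonal cones in three-space and the arm lemma -/

section Arms

/-- Three-dimensional Euclidean space. -/
abbrev E3 := EuclideanSpace ℝ (Fin 3)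

/-- The determinant of three vectors. -/
def det3 (a b c : E3) : ℝ :=
  a 0 * (b 1 * c 2 - b 2 * c 1) - a 1 * (b 0 * c 2 - b 2 * c 0) + a 2 * (b 0 * c 1 - b 1 * c 0)

theorem det3_cycle (a b c : E3) : det3 a b c = det3 b c a := by simp only [det3]; ring
@[simp] theorem det3_self_right (a b : E3) : det3 b a a = 0 := by simp only [det3]; ring
@[simp] theorem det3_self_outer (a b : E3) : det3 a b a = 0 := by simp only [det3]; ring
theorem det3_comb (a b c d : E3) (s t : ℝ) :
    det3 a b (s • c + t • d) = s * det3 a b c + t * det3 a b d := by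
  simp only [det3, PiLp.add_apply, PiLp.smul_apply, smul_eq_mul]; ring
theorem det3_smul_right (a b c : E3) (s : ℝ) : det3 a b (s • c) = s * det3 a b c := by
  simp only [det3, PiLp.smul_apply, smul_eq_mul]; ring
theorem det3_sum_right {α : Type*} (s : Finset α) (a b : E3) (f : α → E3) :
    det3 a b (∑ i ∈ s, f i) = ∑ i ∈ s, det3 a b (f i) := by
  classical
  induction s using Finset.induction_on with
  | empty => simp [det3]
  | insert i s hi ih =>
    rw [Finset.sum_insert hi, Finset.sum_insert hi, ← ih]
    have := det3_comb a b (f i) (∑ j ∈ s, f j) 1 1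
    simpa using this

theorem det3_exchange (u v o x y z : E3) : det3 u v o * det3 x y z =
    det3 u v x * det3 o y z + det3 u v y * det3 x o z + det3 u v z * det3 x y o := by
  simp only [det3]; ring

theorem det3_grassmann (a b c d : E3) :
    det3 b c d • a - det3 a c d • b + det3 a b d • c - det3 a b c • d = 0 := by
  ext i
  fin_cases i <;>
  · simp [det3]
    ring

theorem inner_comb4 {V : Type*} [NormedAddCommGroup V] [InnerProductSpace ℝ V] (a b c d e : V)
    (s t u w : ℝ) : ⟪s • a + t • b + u • c + w • d, e⟫ =
      s * ⟪a, e⟫ + t * ⟪b, e⟫ + u * ⟪c, e⟫ + w * ⟪d, e⟫ := by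
  simp only [inner_add_left, real_inner_smul_left]

theorem inner_self_comb4 {V : Type*} [NormedAddCommGroup V] [InnerProductSpace ℝ V] (a b c d : V)
    (s t u w : ℝ) :
    ⟪s • a + t • b + u • c + w • d, s • a + t • b + u • c + w • d⟫ =
      s ^ 2 * ⟪a, a⟫ + t ^ 2 * ⟪b, b⟫ + u ^ 2 * ⟪c, c⟫ + w ^ 2 * ⟪d, d⟫ +
      2 * (s * t * ⟪a, b⟫ + s * u * ⟪a, c⟫ + s * w * ⟪a, d⟫ + t * u * ⟪b, c⟫ +
        t * w * ⟪b, d⟫ + u * w * ⟪c, d⟫) := by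
  simp only [inner_add_left, inner_add_right, real_inner_smul_left, real_inner_smul_right]
  rw [real_inner_comm a b, real_inner_comm a c, real_inner_comm a d, real_inner_comm b c,
    real_inner_comm b d, real_inner_comm c d]
  ring

/-- A closed polygonal cone `P 0, …, P (n-1)`, listed cyclically, lying on the left of each of its
sides. -/
structure IsCone (n : ℕ) (P : ℕ → E3) : Prop where
  three_le : 3 ≤ n
  per : ∀ i, P (i + n) = P i
  nonneg : ∀ i j, 0 ≤ det3 (P i) (P (i + 1)) (P j)
  exists_interior : ∃ o, ∀ i, 0 < det3 (P i) (P (i + 1)) o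
  ne : ∀ i j, i < j → j < i + n → ∀ t : ℝ, 0 < t → P j ≠ t • P i

/-- Two sequences of vectors with the same lengths and the same consecutive inner products. -/
structure Compat (P Q : ℕ → E3) : Prop where
  self : ∀ i, ⟪P i, P i⟫ = ⟪Q i, Q i⟫
  succ : ∀ i, ⟪P i, P (i + 1)⟫ = ⟪Q i, Q (i + 1)⟫

/-- The change of the inner product of the two neighbours of the vertex `k + 1`. -/
noncomputable def turn (P Q : ℕ → E3) (k : ℕ) : ℝ := ⟪Q k, Q (k + 2)⟫ - ⟪P k, P (k + 2)⟫

variable {n : ℕ} {P Q : ℕ → E3}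

theorem Compat.symm (h : Compat P Q) : Compat Q P where
  self i := (h.self i).symm
  succ i := (h.succ i).symm

theorem Compat.shift (h : Compat P Q) (s : ℕ) :
    Compat (fun i => P (s + i)) (fun i => Q (s + i)) where
  self i := h.self (s + i)
  succ i := h.succ (s + i)

theorem turn_swap (P Q : ℕ → E3) (k : ℕ) : turn Q P k = - turn P Q k := by
  simp [turn]

theorem turn_shift (P Q : ℕ → E3) (s k : ℕ) :
    turn (fun i => P (s + i)) (fun i => Q (s + i)) k = turn P Q (s + k) := rfl

theorem IsCone.per_mul (h : IsCone n P) (i k : ℕ) : P (i + k * n) = P i := by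
  induction k with
  | zero => simp
  | succ k ih => rw [← ih, ← h.per (i + k * n)]; congr 1; ring

theorem IsCone.shift (h : IsCone n P) (s : ℕ) : IsCone n fun i => P (s + i) where
  three_le := h.three_le
  per i := by
    show P (s + (i + n)) = P (s + i)
    rw [← add_assoc, h.per]
  nonneg i j := h.nonneg (s + i) (s + j)
  exists_interior := by
    obtain ⟨o, ho⟩ := h.exists_interior
    exact ⟨o, fun i => ho (s + i)⟩
  ne i j hij hj t ht := h.ne (s + i) (s + j) (by omega) (by omega) t ht

theorem IsCone.turn_per (h : IsCone n P) (h' : IsCone n Q) (k : ℕ) :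
    turn P Q (k + n) = turn P Q k := by
  have e : k + n + 2 = k + 2 + n := by omega
  simp only [turn, e, h.per, h'.per]

/-- The vertex `k + 1` is flat. -/
theorem IsCone.flat (h : IsCone n P) {k : ℕ} (hk : det3 (P k) (P (k + 1)) (P (k + 2)) = 0) :
    ∃ a b : ℝ, 0 < a ∧ P (k + 2) + a • P k = b • P (k + 1) := by
  obtain ⟨o, ho⟩ := h.exists_interior
  have h1 := ho k
  have h2 := ho (k + 1)
  have g := det3_grassmann (P k) (P (k + 1)) (P (k + 2)) o
  rw [hk, zero_smul, sub_zero] at g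
  set u := det3 (P k) (P (k + 1)) o
  set v := det3 (P (k + 1)) (P (k + 2)) o
  set w := det3 (P k) (P (k + 2)) o
  refine ⟨v / u, w / u, div_pos h2 h1, ?_⟩
  have g' : u⁻¹ • (v • P k - w • P (k + 1) + u • P (k + 2)) = 0 := by rw [g, smul_zero]
  rw [smul_add, smul_sub, smul_smul, smul_smul, smul_smul, inv_mul_cancel₀ h1.ne', one_smul] at g'
  rw [div_eq_inv_mul, div_eq_inv_mul]
  rw [← sub_eq_zero, ← g']
  abel

theorem Compat.turn_of_flat (hc : Compat P Q) {k : ℕ} {a b : ℝ} (ha : 0 < a)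
    (e : P (k + 2) + a • P k = b • P (k + 1)) :
    0 ≤ turn P Q k ∧ (turn P Q k = 0 → Q (k + 2) + a • Q k = b • Q (k + 1)) := by
  have hP : (1 : ℝ) • P (k + 2) + a • P k + (-b) • P (k + 1) + (0 : ℝ) • P k = 0 := by
    rw [one_smul, e]; simp
  have hp := inner_self_comb4 (P (k + 2)) (P k) (P (k + 1)) (P k) 1 a (-b) 0
  have hq := inner_self_comb4 (Q (k + 2)) (Q k) (Q (k + 1)) (Q k) 1 a (-b) 0
  rw [hP, inner_zero_left] at hp
  have c1 := hc.succ k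
  have c2 := hc.succ (k + 1)
  have e2 : k + 1 + 1 = k + 2 := rfl
  rw [e2] at c2
  have key : ⟪(1 : ℝ) • Q (k + 2) + a • Q k + (-b) • Q (k + 1) + (0 : ℝ) • Q k,
      (1 : ℝ) • Q (k + 2) + a • Q k + (-b) • Q (k + 1) + (0 : ℝ) • Q k⟫ = 2 * a * turn P Q k := by
    rw [hq, turn, ← hc.self, ← hc.self, ← hc.self, real_inner_comm (Q k) (Q (k + 2)),
      real_inner_comm (Q (k + 1)) (Q (k + 2)), ← c2, ← c1]
    rw [real_inner_comm (P k) (P (k + 2)), real_inner_comm (P (k + 1)) (P (k + 2))] at hp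
    linarith
  have h0 := real_inner_self_nonneg (x := (1 : ℝ) • Q (k + 2) + a • Q k + (-b) • Q (k + 1) +
    (0 : ℝ) • Q k)
  refine ⟨by rw [key] at h0; by_contra hneg; push Not at hneg; nlinarith, fun h => ?_⟩
  rw [h, mul_zero, inner_self_eq_zero] at key
  rw [← sub_eq_zero, ← key]
  simp [sub_eq_add_neg]

/-- The change of an inner product. -/
noncomputable def chg (P Q : ℕ → E3) (i j : ℕ) : ℝ := ⟪Q i, Q j⟫ - ⟪P i, P j⟫

/-- Signed height of a vertex over the plane supporting the cone along the ray of `P 0`. -/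
def hgt (n : ℕ) (P : ℕ → E3) (v : E3) : ℝ := det3 (P 0) (P 1) v + det3 (P (n - 1)) (P 0) v

theorem hgt_comb (u v : E3) (s t : ℝ) :
    hgt n P (s • u + t • v) = s * hgt n P u + t * hgt n P v := by
  simp only [hgt, det3_comb]; ring

theorem hgt_zero : hgt n P (P 0) = 0 := by simp [hgt]

theorem IsCone.prev_nonneg (h : IsCone n P) (j : ℕ) : 0 ≤ det3 (P (n - 1)) (P 0) (P j) := by
  have hn := h.three_le
  have := h.nonneg (n - 1) j
  rw [show n - 1 + 1 = 0 + n by omega, h.per] at this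
  exact this

theorem IsCone.hgt_pos (h : IsCone n P) (h0 : 0 < det3 (P (n - 1)) (P 0) (P 1))
    (hpar : ∀ j, 0 < j → j < n → ∀ t : ℝ, P j ≠ t • P 0) {j : ℕ} (hj0 : 0 < j) (hj : j < n) :
    0 < hgt n P (P j) := by
  have a := h.nonneg 0 j
  have b := h.prev_nonneg j
  rw [zero_add] at a
  refine lt_of_le_of_ne (add_nonneg a b) fun e => ?_
  have ha : det3 (P 0) (P 1) (P j) = 0 := by rw [hgt] at e; linarith
  have hb : det3 (P (n - 1)) (P 0) (P j) = 0 := by rw [hgt] at e; linarith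
  have g := det3_grassmann (P (n - 1)) (P 0) (P 1) (P j)
  rw [ha, hb, zero_smul, zero_smul, zero_sub, add_zero, sub_eq_zero, neg_eq_iff_eq_neg] at g
  refine hpar j hj0 hj (- (det3 (P (n - 1)) (P 1) (P j)) / det3 (P (n - 1)) (P 0) (P 1)) ?_
  rw [div_eq_inv_mul, ← smul_smul, neg_smul, g, neg_neg, smul_smul, inv_mul_cancel₀ h0.ne',
    one_smul]

theorem Compat.degenerate_comb (hP : IsCone n P) (hc : Compat P Q)
    (h0 : 0 < det3 (P (n - 1)) (P 0) (P 1))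
    (hpar : ∀ j, 0 < j → j < n → ∀ t : ℝ, P j ≠ t • P 0) {m : ℕ} (hm : m + 1 ≤ n)
    (hy : ∀ k, k + 1 < m → turn P Q k ≤ 0) (k : ℕ) (hk : k + 1 ≤ m) :
    ∀ t s : ℝ, 0 < t → P 0 = t • P k + s • P (k + 1) → Q 0 = t • Q k + s • Q (k + 1) := by
  induction k with
  | zero =>
    intro t s ht e
    have hd : det3 (P (n - 1)) (P 0) (P 0) =
        t * det3 (P (n - 1)) (P 0) (P 0) + s * det3 (P (n - 1)) (P 0) (P 1) := by
      conv_lhs => rw [show det3 (P (n-1)) (P 0) (P 0) = det3 (P (n-1)) (P 0) (t • P 0 + s • P 1)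
        from congrArg _ e]
      rw [det3_comb]
    rw [det3_self_right, mul_zero, zero_add] at hd
    have hs : s = 0 := by
      rcases mul_eq_zero.1 hd.symm with h | h
      · exact h
      · exact absurd h h0.ne'
    subst hs
    rw [zero_smul, add_zero] at e ⊢
    have hP0 : P 0 ≠ 0 := by
      intro h
      rw [h] at h0
      simp [det3] at h0
    have : (t - 1) • P 0 = 0 := by rw [sub_smul, one_smul, ← e, sub_self]
    rcases smul_eq_zero.1 this with h | h
    · rw [show t = 1 by linarith, one_smul]
    · exact absurd h hP0
  | succ k ih =>
    intro t s ht e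
    rw [show k + 1 + 1 = k + 2 from rfl] at e ⊢
    have z1 := hP.hgt_pos h0 hpar (j := k + 1) (by omega) (by omega)
    have z2 := hP.hgt_pos h0 hpar (j := k + 2) (by omega) (by omega)
    have hz := hgt_comb (n := n) (P := P) (P (k + 1)) (P (k + 2)) t s
    rw [← e, hgt_zero] at hz
    have hs : s < 0 := by
      by_contra hs
      push Not at hs
      nlinarith [mul_pos ht z1, mul_nonneg hs z2.le]
    have hflat : det3 (P k) (P (k + 1)) (P (k + 2)) = 0 := by
      have c0 := hP.nonneg k (k + 2)
      have b0 := hP.nonneg k 0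
      rw [e, det3_comb, det3_self_right, mul_zero, zero_add] at b0
      nlinarith
    obtain ⟨a, b, ha, hab⟩ := hP.flat hflat
    have hyk := hc.turn_of_flat ha hab
    have hQ := hyk.2 (le_antisymm (hy k (by omega)) hyk.1)
    have hP2 : P (k + 2) = b • P (k + 1) - a • P k := by rw [← hab]; abel
    have hQ2 : Q (k + 2) = b • Q (k + 1) - a • Q k := by rw [← hQ]; abel
    have := ih (by omega) (-(s * a)) (t + s * b) (by nlinarith) (by
      rw [e, hP2]; module)
    rw [this, hQ2]
    module

set_option maxHeartbeats 1000000 in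
/-- One step of the arm lemma. -/
theorem Compat.arm_step (hP : IsCone n P) (hc : Compat P Q)
    (h0 : 0 < det3 (P (n - 1)) (P 0) (P 1))
    (hpar : ∀ j, 0 < j → j < n → ∀ t : ℝ, P j ≠ t • P 0) {m : ℕ} (hm : m + 1 ≤ n)
    (hy : ∀ k, k + 1 < m → turn P Q k ≤ 0) (k : ℕ) (hk0 : 0 < k) (hk : k + 1 < m)
    (hW : chg P Q 0 (k + 1) * hgt n P (P k) - chg P Q 0 k * hgt n P (P (k + 1)) ≤ 0) :
    chg P Q 0 (k + 2) * hgt n P (P (k + 1)) - chg P Q 0 (k + 1) * hgt n P (P (k + 2)) ≤ 0 ∧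
    (chg P Q 0 k = 0 → chg P Q 0 (k + 1) = 0 → chg P Q 0 (k + 2) = 0 → turn P Q k = 0) := by
  have c1 := hc.succ k
  have c2 : ⟪P (k + 1), P (k + 2)⟫ = ⟪Q (k + 1), Q (k + 2)⟫ := hc.succ (k + 1)
  have s1 := hc.self k
  have s2 := hc.self (k + 1)
  have s3 := hc.self (k + 2)
  have s0 := hc.self 0
  have z0 := hP.hgt_pos h0 hpar (j := k) (by omega) (by omega)
  have z1 := hP.hgt_pos h0 hpar (j := k + 1) (by omega) (by omega)
  have z2 := hP.hgt_pos h0 hpar (j := k + 2) (by omega) (by omega)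
  have hyk := hy k hk
  have hcn : 0 ≤ det3 (P k) (P (k + 1)) (P (k + 2)) := hP.nonneg k (k + 2)
  rcases eq_or_lt_of_le hcn with hflat | hc0
  · obtain ⟨a, b, ha, hab⟩ := hP.flat hflat.symm
    have hyk' := hc.turn_of_flat ha hab
    have hy0 := le_antisymm hyk hyk'.1
    have hQ := hyk'.2 hy0
    have hP2 : P (k + 2) = (-a) • P k + b • P (k + 1) := by rw [← hab]; module
    have hQ2 : Q (k + 2) = (-a) • Q k + b • Q (k + 1) := by rw [← hQ]; module
    refine ⟨?_, fun _ _ _ => hy0⟩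
    have hx : chg P Q 0 (k + 2) = (-a) * chg P Q 0 k + b * chg P Q 0 (k + 1) := by
      simp only [chg, hP2, hQ2, inner_add_right, real_inner_smul_right]; ring
    have hz : hgt n P (P (k + 2)) = (-a) * hgt n P (P k) + b * hgt n P (P (k + 1)) := by
      rw [hP2, hgt_comb]
    rw [hx, hz]
    nlinarith [mul_nonpos_of_nonneg_of_nonpos ha.le hW]
  · have g := det3_grassmann (P 0) (P k) (P (k + 1)) (P (k + 2))
    have hα : 0 ≤ det3 (P 0) (P (k + 1)) (P (k + 2)) := by
      rw [det3_cycle]; exact hP.nonneg (k + 1) 0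
    have hβ : 0 ≤ det3 (P 0) (P k) (P (k + 1)) := by rw [det3_cycle]; exact hP.nonneg k 0
    set c := det3 (P k) (P (k + 1)) (P (k + 2))
    set α := det3 (P 0) (P (k + 1)) (P (k + 2))
    set β := det3 (P 0) (P k) (P (k + 1))
    set γ := det3 (P 0) (P k) (P (k + 2))
    rcases eq_or_lt_of_le hβ with hβ0 | hβ0
    · rw [← hβ0, zero_smul, sub_zero] at g
      have e : P 0 = (α / c) • P k + (-(γ / c)) • P (k + 1) := by
        have : c⁻¹ • (c • P 0 - α • P k + γ • P (k + 1)) = 0 := by rw [g, smul_zero]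
        rw [smul_add, smul_sub, smul_smul, smul_smul, smul_smul, inv_mul_cancel₀ hc0.ne',
          one_smul] at this
        rw [div_eq_inv_mul, div_eq_inv_mul, ← sub_eq_zero, ← this]
        module
      have ht : 0 < α / c := by
        refine lt_of_le_of_ne (div_nonneg hα hc0.le) fun h => ?_
        rw [← h, zero_smul, zero_add] at e
        by_cases hs : -(γ / c) = 0
        · rw [hs, zero_smul] at e
          rw [e] at h0
          simp [det3] at h0
        · refine hpar (k + 1) (by omega) (by omega) (-(γ / c))⁻¹ ?_
          rw [e, smul_smul, inv_mul_cancel₀ hs, one_smul]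
      have eQ := hc.degenerate_comb hP h0 hpar hm hy k hk.le _ _ ht e
      set t := α / c
      set s := -(γ / c)
      have x1 : chg P Q 0 (k + 1) = 0 := by
        rw [chg, e, eQ, inner_add_left, inner_add_left, real_inner_smul_left,
          real_inner_smul_left, real_inner_smul_left, real_inner_smul_left, c1, s2]
        ring
      have x2 : chg P Q 0 (k + 2) = t * turn P Q k := by
        rw [chg, e, eQ, inner_add_left, inner_add_left, real_inner_smul_left,
          real_inner_smul_left, real_inner_smul_left, real_inner_smul_left, c2, turn]
        ring
      refine ⟨?_, fun _ _ h2 => ?_⟩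
      · rw [x1, x2]
        have := mul_nonpos_of_nonneg_of_nonpos (mul_pos ht z1).le hyk
        linarith
      · rw [x2] at h2
        exact (mul_eq_zero.1 h2).resolve_left ht.ne'
    · have g' : c • P 0 + (-α) • P k + γ • P (k + 1) + (-β) • P (k + 2) = 0 := by
        rw [← g]; module
      have hz : α * hgt n P (P k) - γ * hgt n P (P (k + 1)) + β * hgt n P (P (k + 2)) = 0 := by
        have e1 : (1 : ℝ) • (c • P 0) + (1 : ℝ) • ((-α) • P k + (1 : ℝ) • (γ • P (k + 1) +
          (-β) • P (k + 2))) = (0 : ℝ) • P 0 + (0 : ℝ) • P 0 := by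
          rw [zero_smul, add_zero, ← g']; module
        have e2 := congrArg (hgt n P) e1
        have er : hgt n P ((0 : ℝ) • P 0 + (0 : ℝ) • P 0) = 0 := by simp [hgt, det3]
        have e3 : ∀ (s : ℝ) (u : E3), hgt n P (s • u) = s * hgt n P u := fun s u => by
          simp [hgt, det3_smul_right, mul_add]
        rw [er, hgt_comb, hgt_comb, e3, hgt_zero, hgt_comb] at e2
        linarith
      have hp := inner_self_comb4 (P 0) (P k) (P (k + 1)) (P (k + 2)) c (-α) γ (-β)
      have hq := inner_self_comb4 (Q 0) (Q k) (Q (k + 1)) (Q (k + 2)) c (-α) γ (-β)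
      rw [g', inner_zero_left] at hp
      have key : ⟪c • Q 0 + (-α) • Q k + γ • Q (k + 1) + (-β) • Q (k + 2),
          c • Q 0 + (-α) • Q k + γ • Q (k + 1) + (-β) • Q (k + 2)⟫ =
          2 * (α * β * turn P Q k - c * (α * chg P Q 0 k - γ * chg P Q 0 (k + 1) +
            β * chg P Q 0 (k + 2))) := by
        rw [hq, turn, chg, chg, chg, ← s0, ← s1, ← s2, ← s3, ← c1, ← c2]
        linarith
      have hnn := real_inner_self_nonneg (x := c • Q 0 + (-α) • Q k + γ • Q (k + 1) +
        (-β) • Q (k + 2))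
      have hαβ : α * β * turn P Q k ≤ 0 :=
        mul_nonpos_of_nonneg_of_nonpos (mul_nonneg hα hβ) hyk
      refine ⟨?_, fun h1 h2 h3 => ?_⟩
      · have hlin : α * chg P Q 0 k - γ * chg P Q 0 (k + 1) + β * chg P Q 0 (k + 2) ≤ 0 := by
          rw [key] at hnn
          by_contra hcon
          push Not at hcon
          nlinarith [mul_pos hc0 hcon]
        have hfin : β * (chg P Q 0 (k + 2) * hgt n P (P (k + 1)) -
            chg P Q 0 (k + 1) * hgt n P (P (k + 2))) ≤ 0 := by
          have e1 : β * hgt n P (P (k + 2)) = γ * hgt n P (P (k + 1)) - α * hgt n P (P k) := by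
            linarith
          have e2 : β * (chg P Q 0 (k + 2) * hgt n P (P (k + 1)) -
            chg P Q 0 (k + 1) * hgt n P (P (k + 2))) = (α * chg P Q 0 k -
            γ * chg P Q 0 (k + 1) + β * chg P Q 0 (k + 2)) * hgt n P (P (k + 1)) +
            α * (chg P Q 0 (k + 1) * hgt n P (P k) - chg P Q 0 k * hgt n P (P (k + 1))) := by
            linear_combination (-chg P Q 0 (k + 1)) * e1
          rw [e2]
          have := mul_nonpos_of_nonpos_of_nonneg hlin z1.le
          have := mul_nonpos_of_nonneg_of_nonpos hα hW
          linarith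
        by_contra hcon
        push Not at hcon
        nlinarith [mul_pos hβ0 hcon]
      · rw [h1, h2, h3] at key
        have hD : c • Q 0 + (-α) • Q k + γ • Q (k + 1) + (-β) • Q (k + 2) = 0 := by
          rw [← inner_self_eq_zero (𝕜 := ℝ)]
          refine le_antisymm ?_ hnn
          rw [key]; linarith
        have i1 := inner_comb4 (P 0) (P k) (P (k + 1)) (P (k + 2)) (P k) c (-α) γ (-β)
        have i2 := inner_comb4 (Q 0) (Q k) (Q (k + 1)) (Q (k + 2)) (Q k) c (-α) γ (-β)
        rw [g', inner_zero_left] at i1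
        rw [hD, inner_zero_left, ← s1, real_inner_comm (Q k) (Q (k + 1)), ← c1,
          real_inner_comm (Q k) (Q (k + 2))] at i2
        rw [real_inner_comm (P k) (P (k + 1)), real_inner_comm (P k) (P (k + 2))] at i1
        rw [chg] at h1
        have : β * turn P Q k = 0 := by rw [turn]; linear_combination i2 - i1 + c * h1
        exact (mul_eq_zero.1 this).resolve_left hβ0.ne'

/-- Arm lemma at the vertex `0`. -/
theorem Compat.arm_zero (hP : IsCone n P) (hc : Compat P Q)
    (h0 : 0 < det3 (P (n - 1)) (P 0) (P 1))
    (hpar : ∀ j, 0 < j → j < n → ∀ t : ℝ, P j ≠ t • P 0) {m : ℕ} (hm : m + 1 ≤ n)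
    (hm1 : 1 ≤ m) (hy : ∀ k, k + 1 < m → turn P Q k ≤ 0) :
    chg P Q 0 m ≤ 0 ∧ (chg P Q 0 m = 0 → ∀ k, k + 1 < m → turn P Q k = 0) := by
  have hz : ∀ j, 0 < j → j < n → 0 < hgt n P (P j) := fun j a b => hP.hgt_pos h0 hpar a b
  have x1 : chg P Q 0 1 = 0 := by
    have := hc.succ 0
    rw [zero_add] at this
    rw [chg, this, sub_self]
  have hW : ∀ k, k + 1 < m → chg P Q 0 (k + 2) * hgt n P (P (k + 1)) -
      chg P Q 0 (k + 1) * hgt n P (P (k + 2)) ≤ 0 := by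
    intro k
    induction k with
    | zero =>
      intro hk
      rw [zero_add, x1, zero_mul, sub_zero]
      exact mul_nonpos_of_nonpos_of_nonneg (hy 0 hk) (hz 1 (by omega) (by omega)).le
    | succ k ih =>
      intro hk
      exact (hc.arm_step hP h0 hpar hm hy (k + 1) (by omega) hk (ih (by omega))).1
  have hx : ∀ j, j + 1 ≤ m → chg P Q 0 (j + 1) ≤ 0 := by
    intro j
    induction j with
    | zero => intro _; rw [zero_add, x1]
    | succ j ih =>
      intro hj
      have a := ih (by omega)
      have b := hW j (by omega)
      have z1 := hz (j + 1) (by omega) (by omega)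
      have z2 := hz (j + 2) (by omega) (by omega)
      rw [show j + 1 + 1 = j + 2 from rfl]
      by_contra hcon
      push Not at hcon
      nlinarith [mul_pos hcon z1, mul_nonpos_of_nonpos_of_nonneg a z2.le]
  refine ⟨?_, fun hm0 => ?_⟩
  · obtain ⟨j, rfl⟩ : ∃ j, m = j + 1 := ⟨m - 1, by omega⟩
    exact hx j le_rfl
  · have hx0 : ∀ i, i < m → chg P Q 0 (m - i) = 0 := by
      intro i
      induction i with
      | zero => intro _; exact hm0
      | succ i ih =>
        intro hi
        have a := ih (by omega)
        obtain ⟨j, hj⟩ : ∃ j, m = j + i + 2 := ⟨m - i - 2, by omega⟩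
        have e1 : m - (i + 1) = j + 1 := by omega
        have e2 : m - i = j + 2 := by omega
        rw [e2] at a
        rw [e1]
        have b := hW j (by omega)
        rw [a, zero_mul, zero_sub] at b
        have z2 := hz (j + 2) (by omega) (by omega)
        refine le_antisymm (hx j (by omega)) ?_
        by_contra hcon
        push Not at hcon
        nlinarith [mul_neg_of_neg_of_pos hcon z2]
    have hx0' : ∀ i, 0 < i → i ≤ m → chg P Q 0 i = 0 := fun i a b => by
      have := hx0 (m - i) (by omega)
      rwa [show m - (m - i) = i by omega] at this
    intro k hk
    rcases Nat.eq_zero_or_pos k with rfl | hk0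
    · exact hx0' 2 (by omega) (by omega)
    · obtain ⟨j, rfl⟩ : ∃ j, k = j + 1 := ⟨k - 1, by omega⟩
      exact (hc.arm_step hP h0 hpar hm hy (j + 1) (by omega) hk (hW j (by omega))).2
        (hx0' _ (by omega) (by omega)) (hx0' _ (by omega) (by omega))
        (hx0' _ (by omega) (by omega))

/-- Arm lemma: if the vertex `a + 1` is strictly convex, and the turns strictly between `a` and
`a + m` do not increase, then the inner product of the vertices `a + 1` and `a + m + 1` does not
increase. -/
theorem Compat.arm (hP : IsCone n P) (hc : Compat P Q) (a : ℕ)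
    (h0 : 0 < det3 (P a) (P (a + 1)) (P (a + 2)))
    (hpar : ∀ j, 0 < j → j < n → ∀ t : ℝ, P (a + 1 + j) ≠ t • P (a + 1)) {m : ℕ}
    (hm : m < n) (hm1 : 1 ≤ m) (hy : ∀ k, a < k → k < a + m → turn P Q k ≤ 0) :
    chg P Q (a + 1) (a + 1 + m) ≤ 0 ∧
      (chg P Q (a + 1) (a + 1 + m) = 0 → ∀ k, a < k → k < a + m → turn P Q k = 0) := by
  have hn := hP.three_le
  have := (hc.shift (a + 1)).arm_zero (hP.shift (a + 1)) (m := m) ?_ ?_ hm hm1 ?_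
  · refine ⟨this.1, fun h k h1 h2 => ?_⟩
    have h3 := this.2 h (k - (a + 1)) (by omega)
    rwa [turn_shift, show a + 1 + (k - (a + 1)) = k by omega] at h3
  · show 0 < det3 (P (a + 1 + (n - 1))) (P (a + 1)) (P (a + 2))
    rw [show a + 1 + (n - 1) = a + n by omega, hP.per]
    exact h0
  · exact hpar
  · intro k hk
    rw [turn_shift]
    exact hy _ (by omega) (by omega)

end Arms

/-! ### The sign changes at one vertex -/

section LocalSigns

variable {n : ℕ} {P Q : ℕ → E3}

theorem chg_comm (i j : ℕ) : chg P Q i j = chg P Q j i := by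
  rw [chg, chg, real_inner_comm, real_inner_comm (P i)]

theorem chg_swap (i j : ℕ) : chg Q P i j = - chg P Q i j := by simp [chg]

theorem Compat.chg_self (hc : Compat P Q) (i : ℕ) : chg P Q i i = 0 := by
  rw [chg, hc.self, sub_self]

theorem Compat.chg_succ (hc : Compat P Q) (i : ℕ) : chg P Q i (i + 1) = 0 := by
  rw [chg, hc.succ, sub_self]

theorem chg_comb {i j k l : ℕ} {x y : ℝ} (hP : P j = x • P k + y • P l)
    (hQ : Q j = x • Q k + y • Q l) : chg P Q i j = x * chg P Q i k + y * chg P Q i l := by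
  simp only [chg, hP, hQ, inner_add_right, real_inner_smul_right]; ring

/-- No other ray is on the line of the ray of the vertex `a + 1`. -/
def NoPar (n : ℕ) (P : ℕ → E3) (a : ℕ) : Prop :=
  ∀ j, 0 < j → j < n → ∀ t : ℝ, P (a + 1 + j) ≠ t • P (a + 1)

/-- The vertices `a + 1` and `b + 1` are on opposite rays. -/
def Antipodal (P : ℕ → E3) (a b : ℕ) : Prop := ∃ t : ℝ, 0 < t ∧ P (a + 1) = (-t) • P (b + 1)

/-- The vertex `k + 1` is strictly convex. -/
def StrictAt (P : ℕ → E3) (k : ℕ) : Prop := 0 < det3 (P k) (P (k + 1)) (P (k + 2))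

theorem IsCone.flat_of_not_strict (h : IsCone n P) {k : ℕ} (hk : ¬ StrictAt P k) :
    det3 (P k) (P (k + 1)) (P (k + 2)) = 0 :=
  le_antisymm (not_lt.1 hk) (h.nonneg k (k + 2))

theorem IsCone.strict_of_neg (h : IsCone n P) (hc : Compat P Q) {k : ℕ} (hk : turn P Q k < 0) :
    StrictAt P k := by
  by_contra hs
  obtain ⟨a, b, ha, hab⟩ := h.flat (h.flat_of_not_strict hs)
  exact absurd (hc.turn_of_flat ha hab).1 (not_le.2 hk)

theorem IsCone.ne_zero (h : IsCone n P) (k : ℕ) : P k ≠ 0 := by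
  intro hk
  obtain ⟨o, ho⟩ := h.exists_interior
  have := ho k
  rw [hk] at this
  simp [det3] at this

theorem IsCone.noPar (h : IsCone n P) {a : ℕ}
    (hA : ∀ b, a < b → b < a + n → ¬ Antipodal P a b) : NoPar n P a := by
  intro j hj0 hj t e
  rcases lt_trichotomy t 0 with ht | rfl | ht
  · refine hA (a + j) (by omega) (by omega) ⟨-t⁻¹, by simpa using ht, ?_⟩
    rw [show a + j + 1 = a + 1 + j by omega, e, smul_smul, neg_neg, inv_mul_cancel₀ ht.ne,
      one_smul]
  · rw [zero_smul] at e
    exact h.ne_zero _ e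
  · exact h.ne _ _ (by omega) (by omega) t ht e

theorem IsCone.chg_per (hP : IsCone n P) (hQ : IsCone n Q) (i j : ℕ) :
    chg P Q i (j + n) = chg P Q i j := by
  rw [chg, hP.per, hQ.per, chg]

theorem Compat.arm_left (hP : IsCone n P) (hc : Compat P Q) {a b : ℕ} (hab : a < b)
    (hb : b < a + n) (h0 : StrictAt P a) (hpar : NoPar n P a)
    (hy : ∀ k, a < k → k < b → turn P Q k ≤ 0) :
    chg P Q (a + 1) (b + 1) ≤ 0 ∧
      (0 ≤ chg P Q (a + 1) (b + 1) → ∀ k, a < k → k < b → turn P Q k = 0) := by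
  have := hc.arm hP a h0 hpar (m := b - a) (by omega) (by omega)
    (fun k h1 h2 => hy k h1 (by omega))
  rw [show a + 1 + (b - a) = b + 1 by omega] at this
  exact ⟨this.1, fun h k h1 h2 => this.2 (le_antisymm this.1 h) k h1 (by omega)⟩

theorem Compat.arm_right (hQ : IsCone n Q) (hc : Compat P Q) {a b : ℕ} (hab : a < b)
    (hb : b < a + n) (h0 : StrictAt Q a) (hpar : NoPar n Q a)
    (hy : ∀ k, a < k → k < b → 0 ≤ turn P Q k) :
    0 ≤ chg P Q (a + 1) (b + 1) ∧
      (chg P Q (a + 1) (b + 1) ≤ 0 → ∀ k, a < k → k < b → turn P Q k = 0) := by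
  have := hc.symm.arm_left hQ hab hb h0 hpar
    (fun k h1 h2 => by rw [turn_swap]; linarith [hy k h1 h2])
  rw [chg_swap] at this
  refine ⟨by linarith [this.1], fun h k h1 h2 => ?_⟩
  have := this.2 (by linarith) k h1 h2
  rw [turn_swap] at this
  linarith

/-- Along flat vertices with unchanged turn all rays stay in one plane, with the same
coordinates. -/
theorem Compat.chain (hP : IsCone n P) (hc : Compat P Q) {a b : ℕ}
    (hf : ∀ k, a < k → k < b → ¬ StrictAt P k ∧ turn P Q k = 0) (j : ℕ) :
    (a + j ≤ b → ∃ x y : ℝ, P (a + j + 1) = x • P (a + 1) + y • P (a + 2) ∧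
      Q (a + j + 1) = x • Q (a + 1) + y • Q (a + 2)) ∧
    (a + j + 1 ≤ b → ∃ x y : ℝ, P (a + j + 2) = x • P (a + 1) + y • P (a + 2) ∧
      Q (a + j + 2) = x • Q (a + 1) + y • Q (a + 2)) := by
  induction j with
  | zero => exact ⟨fun _ => ⟨1, 0, by simp, by simp⟩, fun _ => ⟨0, 1, by simp, by simp⟩⟩
  | succ j ih =>
    refine ⟨fun h => ih.2 (by omega), fun h => ?_⟩
    obtain ⟨x, y, h1, h2⟩ := ih.1 (by omega)
    obtain ⟨x', y', h1', h2'⟩ := ih.2 (by omega)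
    obtain ⟨hs, hy⟩ := hf (a + j + 1) (by omega) (by omega)
    obtain ⟨s, t, hs0, e⟩ := hP.flat (hP.flat_of_not_strict hs)
    have eQ := (hc.turn_of_flat hs0 e).2 hy
    rw [show a + j + 1 + 1 = a + j + 2 by omega] at e eQ
    refine ⟨t * x' - s * x, t * y' - s * y, ?_, ?_⟩
    · rw [show a + (j + 1) + 2 = a + j + 1 + 2 by omega, eq_sub_of_add_eq e, h1, h1']
      module
    · rw [show a + (j + 1) + 2 = a + j + 1 + 2 by omega, eq_sub_of_add_eq eQ, h2, h2']
      module

theorem Compat.chain' (hP : IsCone n P) (hc : Compat P Q) {a b : ℕ}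
    (hf : ∀ k, a < k → k < b → ¬ StrictAt P k ∧ turn P Q k = 0) {j : ℕ} (haj : a ≤ j)
    (hjb : j ≤ b) :
    ∃ x y : ℝ, P (j + 1) = x • P (a + 1) + y • P (a + 2) ∧
      Q (j + 1) = x • Q (a + 1) + y • Q (a + 2) := by
  have := (hc.chain hP hf (j - a)).1 (by omega)
  rwa [show a + (j - a) = j by omega] at this

theorem IsCone.antipodal_flat (hP : IsCone n P) {a b : ℕ} (hab : a < b) (hb : b < a + n)
    (hA : Antipodal P a b) {k : ℕ} (hak : a < k) (hk : k < a + n) (hkb : k ≠ b) :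
    ¬ StrictAt P k := by
  intro hs
  obtain ⟨t, ht, e⟩ := hA
  have hz : ∀ i, det3 (P i) (P (i + 1)) (P (a + 1)) = 0 := by
    intro i
    refine le_antisymm ?_ (hP.nonneg _ _)
    rw [e, det3_smul_right]
    nlinarith [hP.nonneg i (b + 1)]
  have g := det3_grassmann (P k) (P (k + 1)) (P (k + 2)) (P (a + 1))
  have z2 : det3 (P (k + 1)) (P (k + 2)) (P (a + 1)) = 0 := hz (k + 1)
  rw [hz k, z2, zero_smul, zero_smul, zero_sub, add_zero] at g
  set c := det3 (P k) (P (k + 1)) (P (k + 2))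
  set δ := det3 (P k) (P (k + 2)) (P (a + 1))
  have hc : c ≠ 0 := ne_of_gt hs
  have e2 : P (a + 1) = (-(δ / c)) • P (k + 1) := by
    have : c⁻¹ • (-(δ • P (k + 1)) - c • P (a + 1)) = 0 := by rw [g, smul_zero]
    rw [smul_sub, smul_neg, smul_smul, smul_smul, inv_mul_cancel₀ hc, one_smul, sub_eq_zero]
      at this
    rw [← this, neg_smul, div_eq_inv_mul]
  set s := -(δ / c)
  have hs0 : s ≠ 0 := fun h => hP.ne_zero (a + 1) (by rw [e2, h, zero_smul])
  have e3 : P (k + 1) = s⁻¹ • P (a + 1) := by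
    rw [e2, smul_smul, inv_mul_cancel₀ hs0, one_smul]
  rcases lt_or_gt_of_ne hs0 with h | h
  · have h4 : P (k + 1) = (s⁻¹ * (-t)) • P (b + 1) := by rw [e3, e, smul_smul]
    have hpos : 0 < s⁻¹ * (-t) := mul_pos_of_neg_of_neg (inv_lt_zero.2 h) (by linarith)
    rcases lt_or_gt_of_ne hkb with hlt | hlt
    · refine hP.ne (k + 1) (b + 1) (by omega) (by omega) (s⁻¹ * (-t))⁻¹ (inv_pos.2 hpos) ?_
      rw [h4, smul_smul, inv_mul_cancel₀ hpos.ne', one_smul]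
    · exact hP.ne (b + 1) (k + 1) (by omega) (by omega) _ hpos h4
  · exact hP.ne (a + 1) (k + 1) (by omega) (by omega) _ (inv_pos.2 h) e3

theorem IsCone.antipodal_turn (hP : IsCone n P) (hc : Compat P Q) {a b : ℕ} (hab : a < b)
    (hb : b < a + n) (hA : Antipodal P a b) {k : ℕ} (hak : a < k) (hk : k < a + n)
    (hkb : k ≠ b) : 0 ≤ turn P Q k := by
  by_contra h
  exact hP.antipodal_flat hab hb hA hak hk hkb (hP.strict_of_neg hc (not_le.1 h))

theorem IsCone.indep (hP : IsCone n P) {k : ℕ} {x y : ℝ} (h : x • P k + y • P (k + 1) = 0) :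
    x = 0 ∧ y = 0 := by
  obtain ⟨o, ho⟩ := hP.exists_interior
  have h1 : det3 (P (k + 1)) o (x • P k + y • P (k + 1)) = 0 := by rw [h]; simp [det3]
  have h2 : det3 o (P k) (x • P k + y • P (k + 1)) = 0 := by rw [h]; simp [det3]
  rw [det3_comb] at h1 h2
  rw [det3_self_outer, mul_zero, add_zero, ← det3_cycle] at h1
  rw [det3_self_right, mul_zero, zero_add, det3_cycle] at h2
  exact ⟨(mul_eq_zero.1 h1).resolve_right (ho k).ne', (mul_eq_zero.1 h2).resolve_right (ho k).ne'⟩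

theorem Compat.antipodal_of_chain (hP : IsCone n P) (hc : Compat P Q) {a b : ℕ} (hab : a < b)
    (hA : Antipodal P a b)
    (hf : ∀ k, a < k → k < b → ¬ StrictAt P k ∧ turn P Q k = 0) : Antipodal Q a b := by
  obtain ⟨x, y, h1, h2⟩ := hc.chain' hP hf hab.le le_rfl
  obtain ⟨t, ht, e⟩ := hA
  have h3 : (1 + t * x) • P (a + 1) + (t * y) • P (a + 1 + 1) = 0 := by
    have : P (a + 1) + t • P (b + 1) = 0 := by rw [e]; module
    rw [h1] at this
    rw [← this]
    module
  obtain ⟨hx, hy⟩ := hP.indep h3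
  have hy0 : y = 0 := (mul_eq_zero.1 hy).resolve_left ht.ne'
  refine ⟨t, ht, ?_⟩
  rw [h2, hy0, zero_smul, add_zero, smul_smul]
  rw [show -t * x = 1 by linarith, one_smul]

/-- Possible sign behaviour of the turns around a vertex. -/
def LocalOutcome (n : ℕ) (P Q : ℕ → E3) : Prop :=
  (∀ k, turn P Q k = 0) ∨
  (∃ a b c d, a < b ∧ b < c ∧ c < d ∧ d < a + n ∧ 0 < turn P Q a ∧ turn P Q b < 0 ∧
    0 < turn P Q c ∧ turn P Q d < 0) ∨
  (∃ a b, a < b ∧ b < a + n ∧ (∀ k, a < k → k < b → turn P Q k = 0) ∧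
    (∀ k, b < k → k < a + n → turn P Q k = 0) ∧ 0 < turn P Q a * turn P Q b ∧
    ∃ t : ℝ, 0 < t ∧ P (a + 1) = (-t) • P (b + 1) ∧ Q (a + 1) = (-t) • Q (b + 1))

theorem exists_rep (n : ℕ) (hn : 0 < n) (a j : ℕ) :
    ∃ i, a ≤ i ∧ i < a + n ∧ ∃ s t, i + s * n = j + t * n := by
  refine ⟨a + (j + a * n - a) % n, by omega, by have := Nat.mod_lt (j + a * n - a) hn; omega,
    (j + a * n - a) / n, a, ?_⟩
  have h1 : a ≤ a * n := Nat.le_mul_of_pos_right a hn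
  have h2 := Nat.mod_add_div' (j + a * n - a) n
  omega

theorem IsCone.turn_per_mul (h : IsCone n P) (h' : IsCone n Q) (k s : ℕ) :
    turn P Q (k + s * n) = turn P Q k := by
  have e : k + s * n + 2 = k + 2 + s * n := by omega
  simp only [turn, e, h.per_mul, h'.per_mul]

theorem IsCone.exists_turn (hP : IsCone n P) (hQ : IsCone n Q) (a j : ℕ) :
    ∃ i, a ≤ i ∧ i < a + n ∧ turn P Q i = turn P Q j := by
  have hn := hP.three_le
  obtain ⟨i, h1, h2, s, t, e⟩ := exists_rep n (by omega) a j
  refine ⟨i, h1, h2, ?_⟩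
  rw [← hP.turn_per_mul hQ i s, e, hP.turn_per_mul hQ]

theorem IsCone.exists_vertex (hP : IsCone n P) (a j : ℕ) :
    ∃ i, a ≤ i ∧ i < a + n ∧ P (i + 1) = P (j + 1) := by
  have hn := hP.three_le
  obtain ⟨i, h1, h2, s, t, e⟩ := exists_rep n (by omega) a j
  refine ⟨i, h1, h2, ?_⟩
  rw [← hP.per_mul (i + 1) s, show i + 1 + s * n = j + 1 + t * n by omega, hP.per_mul]

theorem Compat.outcome_of_antipodal_both (hP : IsCone n P) (hQ : IsCone n Q) (hc : Compat P Q)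
    {a b : ℕ} (hab : a < b) (hb : b < a + n) (hA : Antipodal P a b) (hA' : Antipodal Q a b) :
    LocalOutcome n P Q := by
  have hn := hP.three_le
  have hzero : ∀ k, a < k → k < a + n → k ≠ b → turn P Q k = 0 := by
    intro k h1 h2 h3
    have e1 := hP.antipodal_turn hc hab hb hA h1 h2 h3
    have e2 := hQ.antipodal_turn hc.symm hab hb hA' h1 h2 h3
    rw [turn_swap] at e2
    linarith
  obtain ⟨o, ho⟩ := hP.exists_interior
  have hchain1 : ∀ k, a < k → k < b → ¬ StrictAt P k ∧ turn P Q k = 0 := fun k h1 h2 =>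
    ⟨hP.antipodal_flat hab hb hA h1 (by omega) (by omega), hzero k h1 (by omega) (by omega)⟩
  have hchain2 : ∀ k, b < k → k < a + n → ¬ StrictAt P k ∧ turn P Q k = 0 := fun k h1 h2 =>
    ⟨hP.antipodal_flat hab hb hA (by omega) h2 (by omega), hzero k (by omega) h2 (by omega)⟩
  obtain ⟨t, ht, eP⟩ := hA
  obtain ⟨t', ht', eQ⟩ := hA'
  have htt : t = t' := by
    have h1 := hc.self (a + 1)
    have h2 := hc.self (b + 1)
    rw [eP, eQ, real_inner_smul_left, real_inner_smul_right, real_inner_smul_left,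
      real_inner_smul_right, ← h2] at h1
    have h3 : ⟪P (b + 1), P (b + 1)⟫ ≠ 0 := by
      rw [inner_self_ne_zero]; exact hP.ne_zero _
    have h4 : t ^ 2 = t' ^ 2 := mul_right_cancel₀ h3 (by linarith)
    nlinarith
  subst htt
  have eb : P (b + 1) = (-t⁻¹) • P (a + 1) := by
    rw [eP, smul_smul, neg_mul_neg, inv_mul_cancel₀ ht.ne', one_smul]
  have hb1 : a + 1 < b := by
    by_contra h
    have : b = a + 1 := by omega
    subst this
    have := hP.indep (k := a + 1) (x := 1) (y := t) (by rw [eP]; module)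
    exact one_ne_zero this.1
  have hb2 : b + 1 < a + n := by
    by_contra h
    have e1 : a + n = b + 1 := by omega
    have e2 : P (b + 1 + 1) = P (a + 1) := by
      rw [← e1, show a + n + 1 = a + 1 + n by omega, hP.per]
    have := hP.indep (k := b + 1) (x := t) (y := 1) (by rw [e2, eP]; module)
    exact one_ne_zero this.2
  obtain ⟨x, y, hx1, hx2⟩ := hc.chain' hP hchain1 (j := b - 1) (by omega) (by omega)
  obtain ⟨u, w, hu1, hu2⟩ := hc.chain' hP hchain2 (j := a + n - 1) (by omega) (by omega)
  rw [show b - 1 + 1 = b by omega] at hx1 hx2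
  rw [show a + n - 1 + 1 = a + n by omega, hP.per] at hu1
  rw [show a + n - 1 + 1 = a + n by omega, hQ.per] at hu2
  have hy : 0 < y := by
    have h1 := ho b
    have h2 := ho (a + 1)
    have e1 : det3 (P b) (P (b + 1)) o = y * (t⁻¹ * det3 (P (a + 1)) (P (a + 2)) o) := by
      rw [eb, hx1]
      simp only [det3, PiLp.smul_apply, PiLp.add_apply, smul_eq_mul]; ring
    rw [e1] at h1
    have h3 : 0 < t⁻¹ * det3 (P (a + 1)) (P (a + 2)) o := mul_pos (inv_pos.2 ht) h2
    exact (pos_iff_pos_of_mul_pos h1).2 h3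
  have hw : 0 < w := by
    have h1 := ho a
    have h2 := ho (b + 1)
    have e2 : det3 (P a) (P (a + 1)) o = (w * t) * det3 (P (b + 1)) (P (b + 1 + 1)) o := by
      rw [hu1, eP]
      simp only [det3, PiLp.smul_apply, PiLp.add_apply, smul_eq_mul]; ring
    rw [e2] at h1
    have := (pos_iff_pos_of_mul_pos h1).2 h2
    exact (pos_iff_pos_of_mul_pos this).2 ht
  have hrel : y * turn P Q a = w * turn P Q (b - 1 + 1) := by
    have h1 : chg P Q a b = x * chg P Q a (a + 1) + y * chg P Q a (a + 2) := chg_comb hx1 hx2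
    have h2 : chg P Q b a = u * chg P Q b (b + 1) + w * chg P Q b (b + 2) := chg_comb hu1 hu2
    rw [hc.chg_succ, mul_zero, zero_add] at h1 h2
    have h3 : y * chg P Q a (a + 2) = w * chg P Q b (b + 2) := by rw [← h1, ← h2, chg_comm]
    rw [show b - 1 + 1 = b by omega]
    exact h3
  rw [show b - 1 + 1 = b by omega] at hrel
  by_cases h0 : turn P Q a = 0
  · left
    have hb0 : turn P Q b = 0 := by
      rw [h0, mul_zero] at hrel
      exact (mul_eq_zero.1 hrel.symm).resolve_left hw.ne'
    intro k
    obtain ⟨i, h1, h2, e⟩ := hP.exists_turn hQ a k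
    rw [← e]
    rcases eq_or_lt_of_le h1 with rfl | h1
    · exact h0
    · by_cases h3 : i = b
      · rw [h3, hb0]
      · exact hzero i h1 h2 h3
  · right; right
    refine ⟨a, b, hab, hb, fun k h1 h2 => (hchain1 k h1 h2).2,
      fun k h1 h2 => (hchain2 k h1 h2).2, ?_, t, ht, eP, eQ⟩
    have h3 : turn P Q b = y / w * turn P Q a := by
      field_simp; linarith
    rw [h3]
    have : 0 < turn P Q a ^ 2 := by positivity
    have h4 : 0 < y / w := div_pos hy hw
    nlinarith [mul_pos h4 this]

theorem IsCone.antipodal_rotate (hP : IsCone n P) {a b : ℕ} (hA : Antipodal P a b) :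
    Antipodal P b (a + n) := by
  obtain ⟨t, ht, e⟩ := hA
  refine ⟨t⁻¹, inv_pos.2 ht, ?_⟩
  rw [show a + n + 1 = a + 1 + n by omega, hP.per, e, smul_smul, neg_mul_neg,
    inv_mul_cancel₀ ht.ne', one_smul]

theorem IsCone.antipodal_unrotate (hP : IsCone n P) {a b : ℕ} (hA : Antipodal P b (a + n)) :
    Antipodal P a b := by
  obtain ⟨t, ht, e⟩ := hA
  rw [show a + n + 1 = a + 1 + n by omega, hP.per] at e
  refine ⟨t⁻¹, inv_pos.2 ht, ?_⟩
  rw [e, smul_smul, neg_mul_neg, inv_mul_cancel₀ ht.ne', one_smul]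

theorem Compat.outcome_of_antipodal_nonneg (hP : IsCone n P) (hQ : IsCone n Q)
    (hc : Compat P Q) {a b : ℕ} (hab : a < b) (hb : b < a + n) (hA : Antipodal P a b)
    (hYb : 0 ≤ turn P Q b) : LocalOutcome n P Q := by
  classical
  have hflat : ∀ k, a < k → k < a + n → k ≠ b → ¬ StrictAt P k := fun k h1 h2 h3 =>
    hP.antipodal_flat hab hb hA h1 h2 h3
  have hnn : ∀ k, a < k → k < a + n → 0 ≤ turn P Q k := by
    intro k h1 h2
    by_cases h3 : k = b
    · rw [h3]; exact hYb
    · exact hP.antipodal_turn hc hab hb hA h1 h2 h3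
  by_cases hz1 : ∀ k, a < k → k < b → turn P Q k = 0
  · exact hc.outcome_of_antipodal_both hP hQ hab hb hA (hc.antipodal_of_chain hP hab hA
      fun k h1 h2 => ⟨hflat k h1 (by omega) (by omega), hz1 k h1 h2⟩)
  by_cases hz2 : ∀ k, b < k → k < a + n → turn P Q k = 0
  · refine hc.outcome_of_antipodal_both hP hQ hab hb hA (hQ.antipodal_unrotate ?_)
    exact hc.antipodal_of_chain hP hb (hP.antipodal_rotate hA)
      fun k h1 h2 => ⟨hflat k (by omega) h2 (by omega), hz2 k h1 h2⟩
  push Not at hz1 hz2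
  obtain ⟨l, hl1, hl2, hl3⟩ := hz2
  have hl4 : 0 < turn P Q l := lt_of_le_of_ne (hnn l (by omega) hl2) (Ne.symm hl3)
  have hex : ∃ k, a < k ∧ k < b ∧ turn P Q k ≠ 0 := hz1
  obtain ⟨hk1, hk2, hk3⟩ := Nat.find_spec hex
  have hmin : ∀ j, a < j → j < Nat.find hex → turn P Q j = 0 := by
    intro j h1 h2
    by_contra h3
    exact Nat.find_min hex h2 ⟨h1, by omega, h3⟩
  set k := Nat.find hex
  have hk4 : 0 < turn P Q k := lt_of_le_of_ne (hnn k hk1 (by omega)) (Ne.symm hk3)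
  have hsQ : StrictAt Q k := hQ.strict_of_neg hc.symm (by rw [turn_swap]; linarith)
  by_cases hAQ : ∃ j, k < j ∧ j < k + n ∧ Antipodal Q k j
  · obtain ⟨j, hj1, hj2, hj3⟩ := hAQ
    have hnp : ∀ i, k < i → i < k + n → i ≠ j → turn P Q i ≤ 0 := by
      intro i h1 h2 h3
      have := hQ.antipodal_turn hc.symm hj1 hj2 hj3 h1 h2 h3
      rw [turn_swap] at this
      linarith
    have hlj : l = j := by
      by_contra h
      exact absurd (hnp l (by omega) (by omega) h) (not_le.2 hl4)
    subst hlj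
    have hAP : Antipodal P k l := by
      refine hc.symm.antipodal_of_chain hQ hj1 hj3 fun i h1 h2 => ⟨?_, ?_⟩
      · exact hQ.antipodal_flat hj1 hj2 hj3 h1 (by omega) (by omega)
      · rw [turn_swap, le_antisymm (hnp i h1 (by omega) (by omega)) (hnn i (by omega) (by omega)),
          neg_zero]
    exact hc.outcome_of_antipodal_both hP hQ hj1 hj2 hAP hj3
  · push Not at hAQ
    exfalso
    have h1 := hc.arm_right hQ (a := k) (b := a + n) (by omega) (by omega) hsQ
      (hQ.noPar hAQ) (fun i h1 h2 => hnn i (by omega) h2)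
    have h2 : chg P Q (k + 1) (a + n + 1) = 0 := by
      rw [show a + n + 1 = a + 1 + n by omega, hP.chg_per hQ, chg_comm]
      obtain ⟨x, y, e1, e2⟩ := hc.chain' hP (a := a) (b := k) (fun i h1 h2 =>
        ⟨hflat i h1 (by omega) (by omega), hmin i h1 h2⟩) hk1.le le_rfl
      rw [chg_comb e1 e2, hc.chg_self, hc.chg_succ (a + 1)]
      ring
    exact hl3 (h1.2 h2.le l (by omega) hl2)

theorem Compat.outcome_of_antipodal (hP : IsCone n P) (hQ : IsCone n Q) (hc : Compat P Q)
    {a b : ℕ} (hab : a < b) (hb : b < a + n) (hA : Antipodal P a b) : LocalOutcome n P Q := by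
  by_cases h1 : 0 ≤ turn P Q b
  · exact hc.outcome_of_antipodal_nonneg hP hQ hab hb hA h1
  by_cases h2 : 0 ≤ turn P Q a
  · exact hc.outcome_of_antipodal_nonneg hP hQ hb (by omega) (hP.antipodal_rotate hA)
      (by rw [hP.turn_per hQ]; exact h2)
  push Not at h1 h2
  have hflat : ∀ k, a < k → k < a + n → k ≠ b → ¬ StrictAt P k := fun k h1 h2 h3 =>
    hP.antipodal_flat hab hb hA h1 h2 h3
  have hnn : ∀ k, a < k → k < a + n → k ≠ b → 0 ≤ turn P Q k := fun k h1 h2 h3 =>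
    hP.antipodal_turn hc hab hb hA h1 h2 h3
  by_cases hz1 : ∀ k, a < k → k < b → turn P Q k = 0
  · exact hc.outcome_of_antipodal_both hP hQ hab hb hA (hc.antipodal_of_chain hP hab hA
      fun k h1 h2 => ⟨hflat k h1 (by omega) (by omega), hz1 k h1 h2⟩)
  by_cases hz2 : ∀ k, b < k → k < a + n → turn P Q k = 0
  · refine hc.outcome_of_antipodal_both hP hQ hab hb hA (hQ.antipodal_unrotate ?_)
    exact hc.antipodal_of_chain hP hb (hP.antipodal_rotate hA)
      fun k h1 h2 => ⟨hflat k (by omega) h2 (by omega), hz2 k h1 h2⟩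
  push Not at hz1 hz2
  obtain ⟨l, hl1, hl2, hl3⟩ := hz2
  obtain ⟨k, hk1, hk2, hk3⟩ := hz1
  right; left
  exact ⟨k, b, l, a + n, hk2, hl1, hl2, by omega,
    lt_of_le_of_ne (hnn k hk1 (by omega) (by omega)) (Ne.symm hk3), h1,
    lt_of_le_of_ne (hnn l (by omega) hl2 (by omega)) (Ne.symm hl3),
    by rw [hP.turn_per hQ]; exact h2⟩

theorem IsCone.exists_strict (hP : IsCone n P) {a b : ℕ} (hab : a < b) (hb : b < a + n)
    (hpar : NoPar n P a) (hS : ∃ k, StrictAt P k) : ∃ c, a < c ∧ c < a + n ∧ c ≠ b ∧ StrictAt P c := by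
  by_contra hcon
  push Not at hcon
  have hc : Compat P P := ⟨fun _ => rfl, fun _ => rfl⟩
  have ht : ∀ k, turn P P k = 0 := fun k => by simp [turn]
  have hch1 := fun j h1 h2 => hc.chain' hP (a := a) (b := b) (j := j)
    (fun k h1 h2 => ⟨hcon k h1 (by omega) (by omega), ht k⟩) h1 h2
  have hch2 := fun j h1 h2 => hc.chain' hP (a := b) (b := a + n) (j := j)
    (fun k h1 h2 => ⟨hcon k (by omega) h2 (by omega), ht k⟩) h1 h2
  have hz1 : ∀ j, a ≤ j → j ≤ b → det3 (P (a + 1)) (P (a + 1 + 1)) (P (j + 1)) = 0 := by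
    intro j h1 h2
    obtain ⟨x, y, e, -⟩ := hch1 j h1 h2
    rw [e, det3_comb, det3_self_outer, det3_self_right, mul_zero, mul_zero, add_zero]
  have hzb := hz1 b hab.le le_rfl
  have hzb' : det3 (P (a + 1)) (P (a + 1 + 1)) (P (b + 2)) = 0 := by
    obtain ⟨u, w, e, -⟩ := hch2 (a + n) hb.le le_rfl
    rw [show a + n + 1 = a + 1 + n by omega, hP.per] at e
    have h1 : det3 (P (a + 1)) (P (a + 1 + 1)) (u • P (b + 1) + w • P (b + 2)) = 0 := by
      rw [← e, det3_self_outer]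
    rw [det3_comb, hzb, mul_zero, zero_add] at h1
    refine (mul_eq_zero.1 h1).resolve_left fun hw => ?_
    rw [hw, zero_smul, add_zero] at e
    have hu : u ≠ 0 := fun h => hP.ne_zero (a + 1) (by rw [e, h, zero_smul])
    refine hpar (b - a) (by omega) (by omega) u⁻¹ ?_
    rw [show a + 1 + (b - a) = b + 1 by omega, e, smul_smul, inv_mul_cancel₀ hu, one_smul]
  have hz : ∀ j, det3 (P (a + 1)) (P (a + 1 + 1)) (P j) = 0 := by
    intro j
    obtain ⟨i, h1, h2, e⟩ := hP.exists_vertex a (j + n - 1)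
    have hn := hP.three_le
    rw [show j + n - 1 + 1 = j + n by omega, hP.per] at e
    rw [← e]
    rcases le_total i b with h | h
    · exact hz1 i h1 h
    · obtain ⟨x, y, e', -⟩ := hch2 i h h2.le
      rw [e', det3_comb, hzb, hzb', mul_zero, mul_zero, add_zero]
  obtain ⟨o, ho⟩ := hP.exists_interior
  obtain ⟨k, hk⟩ := hS
  have hex := det3_exchange (P (a + 1)) (P (a + 1 + 1)) o (P k) (P (k + 1)) (P (k + 2))
  rw [hz, hz, hz] at hex
  have := mul_pos (ho (a + 1)) hk
  linarith

theorem Compat.outcome_of_nonpos (hP : IsCone n P) (hQ : IsCone n Q) (hc : Compat P Q)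
    (hpar : ∀ a, NoPar n P a) (hy : ∀ k, turn P Q k ≤ 0) (a : ℕ) : turn P Q a = 0 := by
  by_contra h
  have hn := hP.three_le
  have hS : ∃ k, StrictAt P k := by
    by_contra hns
    push Not at hns
    obtain ⟨s, t, hs, e⟩ := hP.flat (hP.flat_of_not_strict (hns a))
    exact h (le_antisymm (hy a) (hc.turn_of_flat hs e).1)
  obtain ⟨c, h1, h2, h3, hs⟩ := hP.exists_strict (a := a) (b := a + 1) (by omega) (by omega)
    (hpar a) hS
  have h4 := hc.arm_left hP (a := c) (b := c + n - 1) (by omega) (by omega) hs (hpar c)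
    (fun k _ _ => hy k)
  have h5 : chg P Q (c + 1) (c + n - 1 + 1) = 0 := by
    rw [show c + n - 1 + 1 = c + n by omega, hP.chg_per hQ, chg_comm, hc.chg_succ]
  have := h4.2 h5.ge (a + n) (by omega) (by omega)
  rw [hP.turn_per hQ] at this
  exact h this

theorem sign_blocks {n : ℕ} {Y : ℕ → ℝ} (hper : ∀ k, Y (k + n) = Y k) (hn : 0 < n)
    (hpos : ∃ k, 0 < Y k) (hneg : ∃ k, Y k < 0)
    (hpat : ¬ ∃ a b c d, a < b ∧ b < c ∧ c < d ∧ d < a + n ∧ 0 < Y a ∧ Y b < 0 ∧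
      0 < Y c ∧ Y d < 0) :
    ∃ a b, a < b ∧ b < a + n ∧ 0 < Y a ∧ Y b < 0 ∧ (∀ k, a ≤ k → k < b → 0 ≤ Y k) ∧
      (∀ k, b ≤ k → k < a + n → Y k ≤ 0) := by
  classical
  have hmul : ∀ k s, Y (k + s * n) = Y k := by
    intro k s
    induction s with
    | zero => simp
    | succ s ih => rw [← ih, ← hper (k + s * n)]; congr 1; ring
  have hrep : ∀ a j, ∃ i, a ≤ i ∧ i < a + n ∧ Y i = Y j := by
    intro a j
    obtain ⟨i, h1, h2, s, t, e⟩ := exists_rep n hn a j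
    exact ⟨i, h1, h2, by rw [← hmul i s, e, hmul]⟩
  obtain ⟨p, hp⟩ := hpos
  obtain ⟨q, hq⟩ := hneg
  have hb : ∃ b, p ≤ b ∧ Y b < 0 := by
    obtain ⟨i, h1, -, e⟩ := hrep p q
    exact ⟨i, h1, by rw [e]; exact hq⟩
  obtain ⟨hb1, hb2⟩ := Nat.find_spec hb
  have hbmin : ∀ j, p ≤ j → j < Nat.find hb → 0 ≤ Y j := by
    intro j h1 h2
    by_contra h3
    exact Nat.find_min hb h2 ⟨h1, not_le.1 h3⟩
  have hbn : Nat.find hb < p + n := by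
    obtain ⟨i, h1, h2, e⟩ := hrep p q
    exact lt_of_le_of_lt (Nat.find_min' hb ⟨h1, by rw [e]; exact hq⟩) h2
  set b := Nat.find hb
  have hpb : p ≠ b := fun h => by rw [← h] at hb2; linarith
  have ha : ∃ a, b ≤ a ∧ 0 < Y a := ⟨p + n, hbn.le, by rw [hper]; exact hp⟩
  obtain ⟨ha1, ha2⟩ := Nat.find_spec ha
  have hamin : ∀ j, b ≤ j → j < Nat.find ha → Y j ≤ 0 := by
    intro j h1 h2
    by_contra h3
    exact Nat.find_min ha h2 ⟨h1, not_le.1 h3⟩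
  have han : Nat.find ha ≤ p + n := Nat.find_min' ha ⟨hbn.le, by rw [hper]; exact hp⟩
  set a := Nat.find ha
  have hba : b ≠ a := fun h => by rw [h] at hb2; linarith
  refine ⟨a, b + n, by omega, by omega, ha2, by rw [hper]; exact hb2, fun k h1 h2 => ?_,
    fun k h1 h2 => ?_⟩
  · rcases le_or_gt (p + n) k with h3 | h3
    · obtain ⟨j, rfl⟩ : ∃ j, k = j + n := ⟨k - n, by omega⟩
      rw [hper]
      exact hbmin j (by omega) (by omega)
    · by_contra h4
      push Not at h4
      have hak : a ≠ k := fun h => by rw [← h] at h4; linarith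
      exact hpat ⟨a, k, p + n, b + n, by omega, h3, by omega, by omega, ha2, h4,
        by rw [hper]; exact hp, by rw [hper]; exact hb2⟩
  · obtain ⟨j, rfl⟩ : ∃ j, k = j + n := ⟨k - n, by omega⟩
    rw [hper]
    exact hamin j (by omega) (by omega)

theorem LocalOutcome.swap (hP : IsCone n P) (hQ : IsCone n Q) (h : LocalOutcome n P Q) :
    LocalOutcome n Q P := by
  rcases h with h | ⟨a, b, c, d, h1, h2, h3, h4, ha, hb, hc, hd⟩ |
    ⟨a, b, h1, h2, hz1, hz2, hp, t, ht, e1, e2⟩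
  · left
    intro k
    rw [turn_swap, h, neg_zero]
  · right; left
    refine ⟨b, c, d, a + n, h2, h3, h4, by omega, ?_, ?_, ?_, ?_⟩
    · rw [turn_swap]; linarith
    · rw [turn_swap]; linarith
    · rw [turn_swap]; linarith
    · rw [turn_swap, hP.turn_per hQ]; linarith
  · right; right
    refine ⟨a, b, h1, h2, fun k h1 h2 => ?_, fun k h1 h2 => ?_, ?_, t, ht, e2, e1⟩
    · rw [turn_swap, hz1 k h1 h2, neg_zero]
    · rw [turn_swap, hz2 k h1 h2, neg_zero]
    · rw [turn_swap P Q a, turn_swap P Q b, neg_mul_neg]; exact hp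

/-- The possible behaviour of the turns of two polygonal cones with the same side angles. -/
theorem Compat.localOutcome (hP : IsCone n P) (hQ : IsCone n Q) (hc : Compat P Q) :
    LocalOutcome n P Q := by
  have hn := hP.three_le
  by_cases hAP : ∃ a b, a < b ∧ b < a + n ∧ Antipodal P a b
  · obtain ⟨a, b, h1, h2, h3⟩ := hAP
    exact hc.outcome_of_antipodal hP hQ h1 h2 h3
  by_cases hAQ : ∃ a b, a < b ∧ b < a + n ∧ Antipodal Q a b
  · obtain ⟨a, b, h1, h2, h3⟩ := hAQ
    exact (hc.symm.outcome_of_antipodal hQ hP h1 h2 h3).swap hQ hP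
  push Not at hAP hAQ
  have hparP : ∀ a, NoPar n P a := fun a => hP.noPar (hAP a)
  have hparQ : ∀ a, NoPar n Q a := fun a => hQ.noPar (hAQ a)
  by_cases hpat : ∃ a b c d, a < b ∧ b < c ∧ c < d ∧ d < a + n ∧ 0 < turn P Q a ∧
    turn P Q b < 0 ∧ 0 < turn P Q c ∧ turn P Q d < 0
  · exact Or.inr (Or.inl hpat)
  left
  by_cases hpos : ∃ k, 0 < turn P Q k
  swap
  · push Not at hpos
    exact hc.outcome_of_nonpos hP hQ hparP hpos
  by_cases hneg : ∃ k, turn P Q k < 0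
  swap
  · push Not at hneg
    intro k
    have := hc.symm.outcome_of_nonpos hQ hP hparQ
      (fun k => by rw [turn_swap]; linarith [hneg k]) k
    rw [turn_swap] at this
    linarith
  exfalso
  obtain ⟨a, b, hab, hb, hYa, hYb, hnn, hnp⟩ :=
    sign_blocks (hP.turn_per hQ) (by omega) hpos hneg hpat
  have hsb : StrictAt P b := hP.strict_of_neg hc hYb
  have hsa : StrictAt Q a := hQ.strict_of_neg hc.symm (by rw [turn_swap]; linarith)
  have hwrap : ∀ i j, chg P Q (i + 1) (j + n + 1) = chg P Q (j + 1) (i + 1) := fun i j => by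
    rw [show j + n + 1 = j + 1 + n by omega, hP.chg_per hQ, chg_comm]
  have A1 := hc.arm_right hQ hab hb hsa (hparQ a) (fun k h1 h2 => hnn k h1.le h2)
  have A2 := hc.arm_left hP (a := b) (b := a + n) (by omega) (by omega) hsb (hparP b)
    (fun k h1 h2 => hnp k h1.le h2)
  rw [hwrap] at A2
  have Z1 := A1.2 A2.1
  have Z2 := A2.2 A1.1
  obtain ⟨j, hj1, hj2, hj3, hjs⟩ := hP.exists_strict hab hb (hparP a) ⟨b, hsb⟩
  have hYj : turn P Q j = 0 := by
    rcases lt_or_gt_of_ne hj3 with h | h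
    · exact Z1 j hj1 h
    · exact Z2 j h hj2
  have hjsQ : StrictAt Q j := by
    by_contra hs
    obtain ⟨s, t, hs0, e⟩ := hQ.flat (hQ.flat_of_not_strict hs)
    have := (hc.symm.turn_of_flat hs0 e).2 (by rw [turn_swap, hYj, neg_zero])
    have h2 : P (j + 2) = (-s) • P j + t • P (j + 1) := by
      rw [← sub_eq_of_eq_add this.symm]; module
    rw [StrictAt, h2, det3_comb, det3_self_outer, det3_self_right] at hjs
    simp at hjs
  rcases lt_or_gt_of_ne hj3 with h | h
  · have B1 := hc.arm_left hP (a := j) (b := a + n) (by omega) (by omega) hjs (hparP j)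
      (fun k h1 h2 => by
        rcases lt_or_ge k b with h3 | h3
        · exact (Z1 k (by omega) h3).le
        · exact hnp k h3 h2)
    have B2 := hc.arm_right hQ (a := a) (b := j) hj1 hj2 hsa (hparQ a)
      (fun k h1 h2 => hnn k h1.le (by omega))
    rw [hwrap] at B1
    exact hYb.ne (B1.2 B2.1 b h hb)
  · have B1 := hc.arm_right hQ (a := j) (b := b + n) (by omega) (by omega) hjsQ (hparQ j)
      (fun k h1 h2 => by
        rcases lt_or_ge k (a + n) with h3 | h3
        · exact (Z2 k (by omega) h3).ge
        · obtain ⟨i, rfl⟩ : ∃ i, k = i + n := ⟨k - n, by omega⟩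
          rw [hP.turn_per hQ]
          exact hnn i (by omega) (by omega))
    have B2 := hc.arm_left hP (a := b) (b := j) h (by omega) hsb (hparP b)
      (fun k h1 h2 => hnp k h1.le (by omega))
    rw [hwrap] at B1
    have := B1.2 B2.1 (a + n) hj2 (by omega)
    rw [hP.turn_per hQ] at this
    exact hYa.ne' this

end LocalSigns

/-! ### Faces of regular subdivisions of point configurations -/

section Lifts

open Filter Topology

theorem rk_eq_of_isFace_iff {ι W W' : Type*} [Fintype ι] [AddCommGroup W] [Module ℝ W]
    [FiniteDimensional ℝ W] [AddCommGroup W'] [Module ℝ W'] [FiniteDimensional ℝ W']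
    {v : ι → W} {v' : ι → W'} (h : ∀ S, IsFace v S ↔ IsFace v' S) (h0 : IsFace v ∅) {S : Set ι}
    (hS : IsFace v S) : rk v S = rk v' S := by
  induction hn : S.ncard using Nat.strong_induction_on generalizing S with
  | _ n ih =>
    rcases S.eq_empty_or_nonempty with rfl | hne
    · rw [rk, rk, image_empty, image_empty, Submodule.span_empty, Submodule.span_empty, finrank_bot,
        finrank_bot]
    obtain ⟨R, hR, -, hRS, hr⟩ := h0.exists_cocover hS (empty_ssubset.2 hne)
    have e := ih _ (hn ▸ ncard_lt_ncard hRS) hR rfl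
    have h1 := ((h R).1 hR).rk_lt hRS
    by_contra hcon
    obtain ⟨R', hR', h2, h3⟩ := ((h R).1 hR).exists_between ((h S).1 hS) hRS.1 (by omega)
    have h4 := hR.rk_lt h2
    have h5 := ((h R').2 hR').rk_lt h3
    omega

variable {ι E : Type*} [NormedAddCommGroup E]

/-- The points `p i` in the hyperplane of height one, pushed down by `ε` times their square norm. -/
noncomputable def lift (p : ι → E) (ε : ℝ) (i : ι) : WithLp 2 (E × ℝ) :=
  WithLp.toLp 2 (p i, 1 - ε * ‖p i‖ ^ 2)

@[simp] theorem lift_fst (p : ι → E) (ε : ℝ) (i : ι) : (lift p ε i).fst = p i := rfl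

@[simp] theorem lift_snd (p : ι → E) (ε : ℝ) (i : ι) :
    (lift p ε i).snd = 1 - ε * ‖p i‖ ^ 2 := rfl

variable [InnerProductSpace ℝ E]

/-- The linear functional `(x, h) ↦ ⟪n, x⟫ + s * h`. -/
noncomputable def pairing (n : E) (s : ℝ) : WithLp 2 (E × ℝ) →ₗ[ℝ] ℝ :=
  (innerSL ℝ (WithLp.toLp 2 (n, s))).toLinearMap

@[simp] theorem pairing_apply (n : E) (s : ℝ) (w : WithLp 2 (E × ℝ)) :
    pairing n s w = ⟪n, w.fst⟫ + s * w.snd := by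
  simp [pairing, WithLp.prod_inner_apply, mul_comm]

theorem pairing_lift (n : E) (s : ℝ) (p : ι → E) (ε : ℝ) (i : ι) :
    pairing n s (lift p ε i) = ⟪n, p i⟫ + s * (1 - ε * ‖p i‖ ^ 2) := by
  simp [lift]

variable [FiniteDimensional ℝ E]

theorem exists_pairing (φ : WithLp 2 (E × ℝ) →ₗ[ℝ] ℝ) : ∃ n s, φ = pairing n s := by
  let f := LinearMap.toContinuousLinearMap φ
  refine ⟨((InnerProductSpace.toDual ℝ _).symm f).fst, ((InnerProductSpace.toDual ℝ _).symm f).snd,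
    LinearMap.ext fun w => ?_⟩
  have : φ w = ⟪(InnerProductSpace.toDual ℝ _).symm f, w⟫ := by
    rw [InnerProductSpace.toDual_symm_apply]; rfl
  rw [this, pairing_apply, WithLp.prod_inner_apply]
  simp [mul_comm]

variable [Fintype ι]

/-- The family `𝓛` is the face lattice of the regular subdivision of the points `p i` induced by
the heights `-‖p i‖ ^ 2`, and the points are centered, affinely spanning, and all used. -/
structure Config (p : ι → E) (𝓛 : Set (Set ι)) : Prop where
  cent : ∑ i, p i = 0
  span : Submodule.span ℝ (range (lift p 0)) = ⊤
  singles : ∀ i, {i} ∈ 𝓛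
  rep : ∀ᶠ ε in 𝓝[>] (0 : ℝ), ∀ S, S ∈ 𝓛 ↔ IsFace (lift p ε) S

/-- A parameter which represents the family `𝓛`. -/
structure Good (p : ι → E) (𝓛 : Set (Set ι)) (ε : ℝ) : Prop where
  pos : 0 < ε
  small : ∀ i, ε * ‖p i‖ ^ 2 < 1
  rep : ∀ S, S ∈ 𝓛 ↔ IsFace (lift p ε) S
  rk : ∀ S ∈ 𝓛, rk (lift p ε) S = rk (lift p 0) S

variable {p p' : ι → E} {𝓛 : Set (Set ι)} {ε : ℝ}

omit [FiniteDimensional ℝ E] in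
theorem Config.nonempty (h : Config p 𝓛) : Nonempty ι := by
  by_contra hι
  rw [not_nonempty_iff] at hι
  have h1 := h.span
  rw [range_eq_empty, Submodule.span_empty] at h1
  have h2 : (WithLp.toLp 2 (0, 1) : WithLp 2 (E × ℝ)) ∈ (⊥ : Submodule ℝ (WithLp 2 (E × ℝ))) := by
    rw [h1]; trivial
  rw [Submodule.mem_bot] at h2
  have := congrArg (fun w : WithLp 2 (E × ℝ) => w.snd) h2
  simp at this

omit [FiniteDimensional ℝ E] in
theorem Config.sum_pairing (h : Config p 𝓛) (n : E) (s ε : ℝ) :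
    ∑ i, pairing n s (lift p ε i) = s * ∑ i, (1 - ε * ‖p i‖ ^ 2) := by
  simp only [pairing_lift, Finset.sum_add_distrib, ← Finset.mul_sum]
  rw [← inner_sum, h.cent, inner_zero_right, zero_add]

omit [FiniteDimensional ℝ E] in
theorem Config.sum_pos (h : Config p 𝓛) (hs : ∀ i, ε * ‖p i‖ ^ 2 < 1) :
    0 < ∑ i, (1 - ε * ‖p i‖ ^ 2) := by
  have := h.nonempty
  exact Finset.sum_pos (fun i _ => by linarith [hs i]) Finset.univ_nonempty

theorem Config.functional (h : Config p 𝓛) (hs : ∀ i, ε * ‖p i‖ ^ 2 < 1) {S : Set ι}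
    (hS : IsFace (lift p ε) S) (hS' : S ≠ univ) :
    ∃ n, (∀ i, 0 ≤ ⟪n, p i⟫ + (1 - ε * ‖p i‖ ^ 2)) ∧
      ∀ i, i ∈ S ↔ ⟪n, p i⟫ + (1 - ε * ‖p i‖ ^ 2) = 0 := by
  obtain ⟨φ, hφ, hS⟩ := hS
  obtain ⟨n, s, rfl⟩ := exists_pairing φ
  obtain ⟨j, hj⟩ := (ne_univ_iff_exists_notMem S).1 hS'
  have hs0 : 0 < s := by
    have h1 := h.sum_pairing n s ε
    have h2 : 0 < ∑ i, pairing n s (lift p ε i) :=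
      Finset.sum_pos' (fun i _ => hφ i) ⟨j, Finset.mem_univ _,
        lt_of_le_of_ne (hφ j) fun e => hj ((hS j).2 e.symm)⟩
    rw [h1] at h2
    exact pos_of_mul_pos_left h2 (h.sum_pos hs).le
  have key : ∀ i, ⟪s⁻¹ • n, p i⟫ + (1 - ε * ‖p i‖ ^ 2) = s⁻¹ * pairing n s (lift p ε i) := by
    intro i
    rw [pairing_lift, real_inner_smul_left, mul_add, ← mul_assoc, inv_mul_cancel₀ hs0.ne', one_mul]
  refine ⟨s⁻¹ • n, fun i => ?_, fun i => ?_⟩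
  · rw [key]; exact mul_nonneg (inv_pos.2 hs0).le (hφ i)
  · rw [key, hS, mul_eq_zero, or_iff_right (inv_pos.2 hs0).ne']

omit [InnerProductSpace ℝ E] [FiniteDimensional ℝ E] in
theorem eventually_small (p : ι → E) : ∀ᶠ ε in 𝓝[>] (0 : ℝ), ∀ i, ε * ‖p i‖ ^ 2 < 1 := by
  refine eventually_all.2 fun i => ?_
  have : Tendsto (fun ε : ℝ => ε * ‖p i‖ ^ 2) (𝓝[>] 0) (𝓝 (0 * ‖p i‖ ^ 2)) :=
    ((continuous_mul_const _).tendsto 0).mono_left nhdsWithin_le_nhds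
  rw [zero_mul] at this
  exact this.eventually_lt_const one_pos

theorem Config.spherical (h : Config p 𝓛) {S : Set ι} (hS : S ∈ 𝓛) (hS' : S ≠ univ) :
    ∃ (μ : E) (ν : ℝ), ∀ i ∈ S, ‖p i‖ ^ 2 = ⟪μ, p i⟫ + ν := by
  obtain ⟨ε, ⟨h1, h2⟩, h3⟩ := ((h.rep.and (eventually_small p)).and self_mem_nhdsWithin).exists
  have hε : (0 : ℝ) < ε := h3
  obtain ⟨n, -, hn⟩ := h.functional h2 ((h1 S).1 hS) hS'
  refine ⟨ε⁻¹ • n, ε⁻¹, fun i hi => ?_⟩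
  have := (hn i).1 hi
  rw [real_inner_smul_left]
  field_simp
  linarith

omit [Fintype ι] in
theorem rk_le_of_map {W W' : Type*} [AddCommGroup W] [Module ℝ W] [FiniteDimensional ℝ W]
    [AddCommGroup W'] [Module ℝ W'] {v : ι → W} {v' : ι → W'} {S : Set ι} (L : W →ₗ[ℝ] W')
    (hL : ∀ i ∈ S, v' i = L (v i)) : rk v' S ≤ rk v S := by
  have : Set.image v' S = L '' (v '' S) := by
    rw [image_image]
    exact image_congr hL
  rw [rk, this, ← Submodule.map_span]
  exact Submodule.finrank_map_le L _

omit [Fintype ι] in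
/-- On a cospherical set, the lift is a linear image of the flat lift. -/
theorem rk_lift_eq {S : Set ι} {μ : E} {ν : ℝ} (h : ∀ i ∈ S, ‖p i‖ ^ 2 = ⟪μ, p i⟫ + ν)
    (hε : ε * ν < 1) : rk (lift p ε) S = rk (lift p 0) S := by
  let L : ℝ → ℝ → WithLp 2 (E × ℝ) →ₗ[ℝ] WithLp 2 (E × ℝ) := fun a b =>
    (WithLp.linearEquiv 2 ℝ (E × ℝ)).symm.toLinearMap ∘ₗ
      LinearMap.prod (WithLp.fstₗ 2 ℝ E ℝ) (a • pairing μ 0 + b • pairing 0 1)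
  have hLf : ∀ a b w, (L a b w).fst = w.fst := fun a b w => rfl
  have hLs : ∀ a b w, (L a b w).snd = a * ⟪μ, w.fst⟫ + b * w.snd := fun a b w => by
    simp [L]
  have hext : ∀ w w' : WithLp 2 (E × ℝ), w.fst = w'.fst → w.snd = w'.snd → w = w' := by
    intro w w' h1 h2
    exact (WithLp.equiv 2 (E × ℝ)).injective (Prod.ext h1 h2)
  have h1 : (0 : ℝ) < 1 - ε * ν := by linarith
  refine le_antisymm (rk_le_of_map (L (-ε) (1 - ε * ν)) fun i hi => hext _ _ ?_ ?_)
    (rk_le_of_map (L (ε / (1 - ε * ν)) (1 / (1 - ε * ν))) fun i hi => hext _ _ ?_ ?_)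
  · rw [hLf]; rfl
  · rw [hLs]
    simp only [lift_fst, lift_snd]
    rw [h i hi]; ring
  · rw [hLf]; rfl
  · rw [hLs]
    simp only [lift_fst, lift_snd]
    rw [h i hi, div_mul_eq_mul_div, div_mul_eq_mul_div, ← add_div, eq_div_iff h1.ne']; ring

theorem Config.span_lift (h : Config p 𝓛) (hs : ∀ i, ε * ‖p i‖ ^ 2 < 1) :
    Submodule.span ℝ (range (lift p ε)) = ⊤ := by
  by_contra hne
  obtain ⟨φ, hφ, hle⟩ := Submodule.exists_le_ker_of_lt_top _ (lt_top_iff_ne_top.2 hne)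
  refine hφ ?_
  have hz : ∀ i, φ (lift p ε i) = 0 := fun i => hle (Submodule.subset_span ⟨i, rfl⟩)
  obtain ⟨n, s, rfl⟩ := exists_pairing φ
  have h1 := h.sum_pairing n s ε
  simp only [hz, Finset.sum_const_zero] at h1
  have hs0 : s = 0 := (mul_eq_zero.1 h1.symm).resolve_right (h.sum_pos hs).ne'
  subst hs0
  have h2 : Submodule.span ℝ (range (lift p 0)) ≤ LinearMap.ker (pairing n 0) := by
    rw [Submodule.span_le]
    rintro _ ⟨i, rfl⟩
    have := hz i
    rw [pairing_lift] at this
    simp only [SetLike.mem_coe, LinearMap.mem_ker, pairing_lift]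
    linarith
  rw [h.span, top_le_iff] at h2
  exact LinearMap.ker_eq_top.1 h2

theorem Config.eventually_good (h : Config p 𝓛) : ∀ᶠ ε in 𝓝[>] (0 : ℝ), Good p 𝓛 ε := by
  have hrk : ∀ᶠ ε in 𝓝[>] (0 : ℝ), ∀ S, S ∈ 𝓛 → rk (lift p ε) S = rk (lift p 0) S := by
    refine eventually_all.2 fun S => ?_
    by_cases hS : S ∈ 𝓛
    swap
    · exact Eventually.of_forall fun ε h => absurd h hS
    by_cases hu : S = univ
    · subst hu
      filter_upwards [eventually_small p] with ε hε _
      rw [rk, rk, image_univ, image_univ, h.span, h.span_lift hε]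
    · obtain ⟨μ, ν, hν⟩ := h.spherical hS hu
      have : Tendsto (fun ε : ℝ => ε * ν) (𝓝[>] 0) (𝓝 (0 * ν)) :=
        ((continuous_mul_const _).tendsto 0).mono_left nhdsWithin_le_nhds
      rw [zero_mul] at this
      filter_upwards [this.eventually_lt_const one_pos] with ε hε _
      exact rk_lift_eq hν hε
  filter_upwards [h.rep, hrk, eventually_small p, self_mem_nhdsWithin] with ε h1 h2 h3 h4
  exact ⟨h4, h3, h1, h2⟩

theorem Config.exists_good (h : Config p 𝓛) : ∃ ε, Good p 𝓛 ε := h.eventually_good.exists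

omit [FiniteDimensional ℝ E] [Fintype ι] in
theorem Good.empty_mem (h : Good p 𝓛 ε) : IsFace (lift p ε) ∅ := by
  refine ⟨pairing 0 1, fun i => ?_, fun i => ?_⟩
  · rw [pairing_lift, inner_zero_left]; linarith [h.small i]
  · rw [pairing_lift, inner_zero_left]
    simp only [mem_empty_iff_false, false_iff]
    linarith [h.small i]

/-- Two proper faces are separated by a linear functional on the flat lift. -/
theorem Config.exists_sep (h : Config p 𝓛) {S₁ S₂ : Set ι} (h1 : S₁ ∈ 𝓛) (h2 : S₂ ∈ 𝓛)
    (h1' : S₁ ≠ univ) (h2' : S₂ ≠ univ) : ∃ D : WithLp 2 (E × ℝ) →ₗ[ℝ] ℝ,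
      (∀ i ∈ S₁, i ∉ S₂ → 0 < D (lift p 0 i)) ∧ (∀ i ∈ S₂, i ∉ S₁ → D (lift p 0 i) < 0) ∧
      ∀ i ∈ S₁, i ∈ S₂ → D (lift p 0 i) = 0 := by
  obtain ⟨ε, hε⟩ := h.exists_good
  obtain ⟨n₁, a1, b1⟩ := h.functional hε.small ((hε.rep _).1 h1) h1'
  obtain ⟨n₂, a2, b2⟩ := h.functional hε.small ((hε.rep _).1 h2) h2'
  have hD : ∀ i, pairing (n₂ - n₁) 0 (lift p 0 i) = ⟪n₂, p i⟫ - ⟪n₁, p i⟫ := fun i => by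
    rw [pairing_lift, inner_sub_left]; ring
  refine ⟨pairing (n₂ - n₁) 0, fun i hi hi' => ?_, fun i hi hi' => ?_, fun i hi hi' => ?_⟩
  · rw [hD]
    have := (b1 i).1 hi
    have := lt_of_le_of_ne (a2 i) fun e => hi' ((b2 i).2 e.symm)
    linarith
  · rw [hD]
    have := (b2 i).1 hi
    have := lt_of_le_of_ne (a1 i) fun e => hi' ((b1 i).2 e.symm)
    linarith
  · rw [hD]
    have := (b1 i).1 hi
    have := (b2 i).1 hi'
    linarith

theorem Config.rk_eq (h : Config p 𝓛) (h' : Config p' 𝓛) {S : Set ι} (hS : S ∈ 𝓛) :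
    rk (lift p 0) S = rk (lift p' 0) S := by
  obtain ⟨ε, hε⟩ := h.exists_good
  obtain ⟨ε', hε'⟩ := h'.exists_good
  rw [← hε.rk S hS, ← hε'.rk S hS]
  exact rk_eq_of_isFace_iff (fun S => (hε.rep S).symm.trans (hε'.rep S)) hε.empty_mem
    ((hε.rep S).1 hS)

end Lifts

section Distortion

open Filter Topology

variable {ι E : Type*} [NormedAddCommGroup E]

/-- The change of the squared distance between the points of index `a` and `b`. -/
def distortion (p p' : ι → E) (a b : ι) : ℝ := ‖p' a - p' b‖ ^ 2 - ‖p a - p b‖ ^ 2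

theorem distortion_comm (p p' : ι → E) (a b : ι) : distortion p p' a b = distortion p p' b a := by
  rw [distortion, distortion, norm_sub_rev (p' a), norm_sub_rev (p a)]

theorem distortion_self (p p' : ι → E) (a : ι) : distortion p p' a a = 0 := by
  simp [distortion]

variable [InnerProductSpace ℝ E] [Fintype ι] {p p' : ι → E}

theorem inner_sum_sub_inner_sum (p p' : ι → E) {γ δ : ι → ℝ} (hγ : ∑ i, γ i = 0)
    (hδ : ∑ i, δ i = 0) :
    ⟪∑ i, γ i • p' i, ∑ i, δ i • p' i⟫ - ⟪∑ i, γ i • p i, ∑ i, δ i • p i⟫ =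
      -(∑ i, ∑ j, γ i * δ j * distortion p p' i j) / 2 := by
  rw [inner_sum_smul_sum_smul_of_sum_eq_zero p' hγ p' hδ,
    inner_sum_smul_sum_smul_of_sum_eq_zero p hγ p hδ]
  have : ∑ i, ∑ j, γ i * δ j * distortion p p' i j =
      (∑ i, ∑ j, γ i * δ j * (‖p' i - p' j‖ * ‖p' i - p' j‖)) -
        ∑ i, ∑ j, γ i * δ j * (‖p i - p j‖ * ‖p i - p j‖) := by
    rw [← Finset.sum_sub_distrib]
    refine Finset.sum_congr rfl fun i _ => ?_
    rw [← Finset.sum_sub_distrib]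
    refine Finset.sum_congr rfl fun j _ => ?_
    rw [distortion]; ring
  rw [this]; ring

theorem sum_smul_lift_eq_zero (γ : ι → ℝ) :
    ∑ i, γ i • lift p 0 i = 0 ↔ ∑ i, γ i • p i = 0 ∧ ∑ i, γ i = 0 := by
  have hf : (∑ i, γ i • lift p 0 i).fst = ∑ i, γ i • p i := by
    change WithLp.fstₗ 2 ℝ E ℝ _ = _
    rw [map_sum]; rfl
  have hs : (∑ i, γ i • lift p 0 i).snd = ∑ i, γ i := by
    change WithLp.sndₗ 2 ℝ E ℝ _ = _
    rw [map_sum]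
    refine Finset.sum_congr rfl fun i _ => ?_
    rw [map_smul]
    change γ i • (lift p 0 i).snd = _
    simp
  constructor
  · intro h
    rw [← hf, ← hs, h]
    exact ⟨rfl, rfl⟩
  · rintro ⟨h1, h2⟩
    exact (WithLp.equiv 2 (E × ℝ)).injective (Prod.ext (hf.trans h1) (hs.trans h2))

/-- Linear relations on a set where all distances are preserved carry over. -/
theorem relation_transfer {F : Set ι} (h : ∀ a ∈ F, ∀ b ∈ F, distortion p p' a b = 0) {γ : ι → ℝ}
    (hγ : ∀ i ∉ F, γ i = 0) (h0 : ∑ i, γ i • lift p 0 i = 0) : ∑ i, γ i • lift p' 0 i = 0 := by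
  rw [sum_smul_lift_eq_zero] at h0 ⊢
  refine ⟨?_, h0.2⟩
  have := inner_sum_sub_inner_sum p p' h0.2 h0.2
  rw [h0.1, inner_zero_left, sub_zero] at this
  have h2 : ∑ i, ∑ j, γ i * γ j * distortion p p' i j = 0 := by
    refine Finset.sum_eq_zero fun i _ => Finset.sum_eq_zero fun j _ => ?_
    by_cases hi : i ∈ F
    · by_cases hj : j ∈ F
      · rw [h i hi j hj, mul_zero]
      · rw [hγ j hj]; ring
    · rw [hγ i hi]; ring
  rw [h2, neg_zero, zero_div] at this
  exact inner_self_eq_zero.1 this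

theorem sum_mul_distortion {F : Set ι} (h : ∀ a ∈ F, ∀ b ∈ F, distortion p p' a b = 0) {γ : ι → ℝ}
    (hγ : ∀ i ∉ F, γ i = 0) (h0 : ∑ i, γ i • lift p 0 i = 0) (b : ι) :
    ∑ i, γ i * distortion p p' i b = 0 := by
  have h0' := relation_transfer h hγ h0
  rw [sum_smul_lift_eq_zero] at h0 h0'
  have key : ∀ b, ∑ i, γ i * distortion p p' i b = ∑ i, γ i * (‖p' i‖ ^ 2 - ‖p i‖ ^ 2) := by
    intro b
    have e : ∀ i, γ i * distortion p p' i b = γ i * (‖p' i‖ ^ 2 - ‖p i‖ ^ 2) -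
        2 * ⟪γ i • p' i, p' b⟫ + 2 * ⟪γ i • p i, p b⟫ + γ i * (‖p' b‖ ^ 2 - ‖p b‖ ^ 2) := by
      intro i
      rw [distortion, norm_sub_sq_real, norm_sub_sq_real, real_inner_smul_left,
        real_inner_smul_left]
      ring
    simp only [e, Finset.sum_add_distrib, Finset.sum_sub_distrib, ← Finset.mul_sum, ← sum_inner,
      h0.1, h0'.1, inner_zero_left, ← Finset.sum_mul, h0.2]
    ring
  rcases F.eq_empty_or_nonempty with rfl | ⟨c, hc⟩
  · exact Finset.sum_eq_zero fun i _ => by rw [hγ i (notMem_empty i), zero_mul]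
  · rw [key b, ← key c]
    refine Finset.sum_eq_zero fun i _ => ?_
    by_cases hi : i ∈ F
    · rw [h i hi c hc, mul_zero]
    · rw [hγ i hi, zero_mul]

theorem exists_functional_of_relations {W : Type*} [AddCommGroup W] [Module ℝ W] {v : ι → W}
    {F : Set ι} {f : ι → ℝ}
    (h : ∀ γ : ι → ℝ, (∀ i ∉ F, γ i = 0) → ∑ i, γ i • v i = 0 → ∑ i, γ i * f i = 0) :
    ∃ χ : W →ₗ[ℝ] ℝ, ∀ a ∈ F, χ (v a) = f a := by
  classical
  let L : (ι → ℝ) →ₗ[ℝ] (ι → ℝ) :=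
    LinearMap.pi fun i => if i ∈ F then LinearMap.proj i else 0
  have hL : ∀ γ i, L γ i = if i ∈ F then γ i else 0 := by
    intro γ i
    by_cases hi : i ∈ F <;> simp [L, hi]
  let A : (ι → ℝ) →ₗ[ℝ] W := Fintype.linearCombination ℝ v ∘ₗ L
  let g : (ι → ℝ) →ₗ[ℝ] ℝ := Fintype.linearCombination ℝ f ∘ₗ L
  have hg : g ∈ LinearMap.range A.dualMap := by
    rw [LinearMap.range_dualMap_eq_dualAnnihilator_ker, Submodule.mem_dualAnnihilator]
    intro γ hγ
    have := h (L γ) (fun i hi => by rw [hL, if_neg hi]) (by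
      have := LinearMap.mem_ker.1 hγ
      simpa [A, Fintype.linearCombination_apply] using this)
    simpa [g, Fintype.linearCombination_apply] using this
  obtain ⟨χ, hχ⟩ := hg
  refine ⟨χ, fun a ha => ?_⟩
  have hs : L (Pi.single a 1) = Pi.single a 1 := by
    ext i
    rw [hL]
    by_cases hi : i = a
    · subst hi; rw [if_pos ha]
    · rw [Pi.single_eq_of_ne hi, ite_self]
  have := LinearMap.congr_fun hχ (Pi.single a 1)
  simpa [A, g, hs, Fintype.linearCombination_apply_single] using this

/-- On a set with preserved distances, the distortion to a fixed point is linear. -/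
theorem exists_functional_distortion {F : Set ι}
    (h : ∀ a ∈ F, ∀ b ∈ F, distortion p p' a b = 0) (b : ι) :
    ∃ χ : WithLp 2 (E × ℝ) →ₗ[ℝ] ℝ, ∀ a ∈ F, χ (lift p 0 a) = distortion p p' a b :=
  exists_functional_of_relations fun _ hγ h0 => sum_mul_distortion h hγ h0 b

variable [FiniteDimensional ℝ E] {𝓛 : Set (Set ι)}

/-- If `R` is a facet of `F` and the distortion between `F` and `b` vanishes on `R`, then it is a
multiple of a linear functional that is positive on `F \ R`. -/
theorem Config.exists_mul_eq_distortion (hp : Config p 𝓛) {R F : Set ι} (hR : R ∈ 𝓛) (hF : F ∈ 𝓛)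
    (hRF : R ⊆ F) (hF' : F ≠ univ) (hrk : rk (lift p 0) F = rk (lift p 0) R + 1)
    (h : ∀ a ∈ F, ∀ b ∈ F, distortion p p' a b = 0) {b : ι}
    (hb : ∀ a ∈ R, distortion p p' a b = 0) :
    ∃ (c : ℝ) (ψ : WithLp 2 (E × ℝ) →ₗ[ℝ] ℝ), (∀ a ∈ F, a ∉ R → 0 < ψ (lift p 0 a)) ∧
      ∀ a ∈ F, distortion p p' a b = c * ψ (lift p 0 a) := by
  have hR' : R ≠ univ := fun e => hF' (univ_subset_iff.1 (e ▸ hRF))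
  obtain ⟨ψ, h1, -, h2⟩ := hp.exists_sep hF hR hF' hR'
  obtain ⟨χ, hχ⟩ := exists_functional_distortion h b
  obtain ⟨c, hc⟩ := proportional hRF hrk.le (fun i hi => h2 i (hRF hi) hi)
    (fun i hi hi' => (h1 i hi hi').ne') (χ := χ) (fun i hi => by rw [hχ i (hRF hi), hb i hi])
  exact ⟨c, ψ, h1, fun a ha => by rw [← hχ a ha, hc a ha]⟩

/-- Perturbations of the flat lift, relative to `T`, which represent the faces between
`T` and `G`. -/
theorem Config.exists_approx (hp : Config p 𝓛) {T G : Set ι} (hT : T ∈ 𝓛) (hG : G ∈ 𝓛)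
    (hTG : T ⊂ G) : ∃ w : ℝ → ι → WithLp 2 (E × ℝ),
      (∀ b, Tendsto (fun ε => w ε b) (𝓝[>] 0) (𝓝 (lift p 0 b))) ∧
      (∀ ε, ∀ b ∈ T, w ε b = lift p 0 b) ∧
      (∀ ε, ∀ b ∈ G, w ε b ∈ Submodule.span ℝ (lift p 0 '' G)) ∧
      ∀ᶠ ε in 𝓝[>] (0 : ℝ), ∀ F ∈ 𝓛, T ⊆ F → F ⊂ G → ∃ φ : WithLp 2 (E × ℝ) →ₗ[ℝ] ℝ,
        ∀ b ∈ G, 0 ≤ φ (w ε b) ∧ (b ∈ F ↔ φ (w ε b) = 0) := by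
  by_cases hGu : G = univ
  · subst hGu
    obtain ⟨μ, ν, hμ⟩ := hp.spherical hT hTG.ne
    let w : ℝ → ι → WithLp 2 (E × ℝ) := fun ε b =>
      lift p 0 b + (-(ε / (1 - ε * ν) * (‖p b‖ ^ 2 - ⟪μ, p b⟫ - ν))) • WithLp.toLp 2 (0, 1)
    have hw1 : ∀ ε b, (w ε b).fst = p b := fun ε b => by
      simp [w]
    have hw2 : ∀ ε b, (w ε b).snd = 1 - ε / (1 - ε * ν) * (‖p b‖ ^ 2 - ⟪μ, p b⟫ - ν) :=
      fun ε b => by simp [w, sub_eq_add_neg]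
    refine ⟨w, fun b => ?_, fun ε b hb => ?_, fun ε b _ => ?_, ?_⟩
    · have hc : ContinuousAt (fun ε : ℝ => w ε b) 0 := by
        have : (1 : ℝ) - 0 * ν ≠ 0 := by simp
        dsimp only [w]
        fun_prop (disch := assumption)
      have := hc.tendsto.mono_left (nhdsWithin_le_nhds (s := Ioi 0))
      simpa [w] using this
    · have : ‖p b‖ ^ 2 - ⟪μ, p b⟫ - ν = 0 := by rw [hμ b hb]; ring
      simp [w, this]
    · rw [image_univ, hp.span]; trivial
    · have h0 : Tendsto (fun ε : ℝ => ε * ν) (𝓝[>] 0) (𝓝 (0 * ν)) :=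
        ((continuous_mul_const _).tendsto 0).mono_left nhdsWithin_le_nhds
      rw [zero_mul] at h0
      filter_upwards [hp.eventually_good, h0.eventually_lt_const one_pos] with ε hε hν F hF _ hFu
      obtain ⟨n, h1, h2⟩ := hp.functional hε.small ((hε.rep F).1 hF) hFu.ne
      have hν' : 1 - ε * ν ≠ 0 := by linarith
      have key : ∀ b, pairing (n - ε • μ) (1 - ε * ν) (w ε b) =
          ⟪n, p b⟫ + (1 - ε * ‖p b‖ ^ 2) := by
        intro b
        rw [pairing_apply, hw1, hw2, inner_sub_left, real_inner_smul_left, mul_sub, ← mul_assoc,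
          mul_div_cancel₀ _ hν']
        ring
      exact ⟨pairing (n - ε • μ) (1 - ε * ν), fun b _ => by rw [key]; exact ⟨h1 b, h2 b⟩⟩
  · refine ⟨fun _ => lift p 0, fun b => tendsto_const_nhds, fun _ _ _ => rfl,
      fun ε b hb => Submodule.subset_span (mem_image_of_mem _ hb), Eventually.of_forall ?_⟩
    intro ε F hF _ hFG
    have hF' : F ≠ univ := fun e => hGu (univ_subset_iff.1 (e ▸ hFG.1))
    obtain ⟨D, h1, -, h2⟩ := hp.exists_sep hG hF hGu hF'
    refine ⟨D, fun b hb => ?_⟩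
    by_cases hbF : b ∈ F
    · have := h2 b hb hbF
      exact ⟨this.ge, iff_of_true hbF this⟩
    · have := h1 b hb hbF
      exact ⟨this.le, iff_of_false hbF this.ne'⟩

end Distortion

section Transversal

open Filter Topology

variable {ι E : Type*} [NormedAddCommGroup E] [InnerProductSpace ℝ E] [FiniteDimensional ℝ E]

/-- The component of `(x, h)` transversal to the points `p i`, `i ∈ T`, where `t ∈ T`. -/
noncomputable def transversal (p : ι → E) (T : Set ι) (t : ι) : WithLp 2 (E × ℝ) →ₗ[ℝ] E :=
  (vectorSpan ℝ (p '' T))ᗮ.starProjection.toLinearMap ∘ₗ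
    (WithLp.fstₗ 2 ℝ E ℝ - (WithLp.sndₗ 2 ℝ E ℝ).smulRight (p t))

theorem transversal_apply (p : ι → E) (T : Set ι) (t : ι) (w : WithLp 2 (E × ℝ)) :
    transversal p T t w = (vectorSpan ℝ (p '' T))ᗮ.starProjection (w.fst - w.snd • p t) := rfl

variable {p p' : ι → E} {T : Set ι} {t : ι}

theorem transversal_mem (w : WithLp 2 (E × ℝ)) :
    transversal p T t w ∈ (vectorSpan ℝ (p '' T))ᗮ := by
  rw [transversal_apply]; exact Submodule.starProjection_apply_mem _ _

theorem sub_transversal_mem (w : WithLp 2 (E × ℝ)) :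
    w.fst - w.snd • p t - transversal p T t w ∈ vectorSpan ℝ (p '' T) := by
  rw [transversal_apply, Submodule.starProjection_orthogonal_val, sub_sub_cancel]
  exact Submodule.starProjection_apply_mem _ _

theorem eq_transversal {w : WithLp 2 (E × ℝ)} {q : E} (hq : q ∈ (vectorSpan ℝ (p '' T))ᗮ)
    (h : w.fst - w.snd • p t - q ∈ vectorSpan ℝ (p '' T)) : transversal p T t w = q := by
  have h1 : transversal p T t w - q ∈ (vectorSpan ℝ (p '' T))ᗮ :=
    Submodule.sub_mem _ (transversal_mem w) hq
  have h2 : transversal p T t w - q ∈ vectorSpan ℝ (p '' T) := by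
    have := Submodule.sub_mem _ h (sub_transversal_mem (p := p) (T := T) (t := t) w)
    rwa [sub_sub_sub_cancel_left] at this
  exact sub_eq_zero.1 (inner_self_eq_zero.1 ((Submodule.mem_orthogonal _ _).1 h1 _ h2))

theorem transversal_lift_eq_zero (ht : t ∈ T) {a : ι} (ha : a ∈ T) :
    transversal p T t (lift p 0 a) = 0 := by
  refine eq_transversal (Submodule.zero_mem _) ?_
  simpa using vsub_mem_vectorSpan ℝ (mem_image_of_mem p ha) (mem_image_of_mem p ht)

omit [FiniteDimensional ℝ E] in
theorem toLp_mem_span_of_mem_vectorSpan {x : E} (hx : x ∈ vectorSpan ℝ (p '' T)) :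
    (WithLp.toLp 2 (x, 0) : WithLp 2 (E × ℝ)) ∈ Submodule.span ℝ (lift p 0 '' T) := by
  have hle : vectorSpan ℝ (p '' T) ≤ (Submodule.span ℝ (lift p 0 '' T)).comap
      ((WithLp.linearEquiv 2 ℝ (E × ℝ)).symm.toLinearMap ∘ₗ LinearMap.inl ℝ E ℝ) := by
    rw [vectorSpan, Submodule.span_le]
    rintro _ ⟨_, ⟨i, hi, rfl⟩, _, ⟨j, hj, rfl⟩, rfl⟩
    have h1 : lift p 0 i - lift p 0 j = WithLp.toLp 2 (p i - p j, 0) := by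
      apply (WithLp.equiv 2 (E × ℝ)).injective
      exact Prod.ext rfl (by change (lift p 0 i).snd - (lift p 0 j).snd = 0; simp)
    change (WithLp.toLp 2 (p i - p j, 0) : WithLp 2 (E × ℝ)) ∈
      Submodule.span ℝ (lift p 0 '' T)
    rw [← h1]
    exact Submodule.sub_mem _ (Submodule.subset_span (mem_image_of_mem _ hi))
      (Submodule.subset_span (mem_image_of_mem _ hj))
  exact hle hx

theorem ker_transversal (ht : t ∈ T) :
    LinearMap.ker (transversal p T t) = Submodule.span ℝ (lift p 0 '' T) := by
  refine le_antisymm (fun w hw => ?_) (Submodule.span_le.2 ?_)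
  · have h1 := sub_transversal_mem (p := p) (T := T) (t := t) w
    rw [LinearMap.mem_ker.1 hw, sub_zero] at h1
    have h2 : w = w.snd • lift p 0 t + WithLp.toLp 2 (w.fst - w.snd • p t, 0) := by
      apply (WithLp.equiv 2 (E × ℝ)).injective
      refine Prod.ext ?_ ?_
      · change w.fst = w.snd • (lift p 0 t).fst + (w.fst - w.snd • p t)
        rw [lift_fst]; abel
      · change w.snd = w.snd • (lift p 0 t).snd + 0
        simp
    rw [h2]
    exact Submodule.add_mem _ (Submodule.smul_mem _ _ (Submodule.subset_span
      (mem_image_of_mem _ ht))) (toLp_mem_span_of_mem_vectorSpan h1)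
  · rintro _ ⟨a, ha, rfl⟩
    exact transversal_lift_eq_zero ht ha

variable [Fintype ι]

omit [FiniteDimensional ℝ E] in
theorem exists_weights_of_mem_vectorSpan {x : E} (hx : x ∈ vectorSpan ℝ (p '' T)) :
    ∃ γ : ι → ℝ, (∀ i ∉ T, γ i = 0) ∧ ∑ i, γ i = 0 ∧ x = ∑ i, γ i • p i := by
  classical
  rw [vectorSpan] at hx
  induction hx using Submodule.span_induction with
  | mem x hx =>
    obtain ⟨_, ⟨i, hi, rfl⟩, _, ⟨j, hj, rfl⟩, rfl⟩ := hx
    refine ⟨Pi.single i 1 - Pi.single j 1, fun k hk => ?_, by simp, ?_⟩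
    · have h1 : k ≠ i := by rintro rfl; exact hk hi
      have h2 : k ≠ j := by rintro rfl; exact hk hj
      simp [h1, h2]
    · simp [sub_smul, Finset.sum_sub_distrib, Pi.single_apply]
  | zero => exact ⟨0, fun _ _ => rfl, by simp, by simp⟩
  | add x y _ _ hx hy =>
    obtain ⟨γ, h1, h2, rfl⟩ := hx
    obtain ⟨δ, h3, h4, rfl⟩ := hy
    refine ⟨γ + δ, fun i hi => by simp [h1 i hi, h3 i hi], ?_, ?_⟩
    · simp [Finset.sum_add_distrib, h2, h4]
    · simp [Finset.sum_add_distrib, add_smul]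
  | smul c x _ hx =>
    obtain ⟨γ, h1, h2, rfl⟩ := hx
    refine ⟨c • γ, fun i hi => by simp [h1 i hi], ?_, ?_⟩
    · simp [← Finset.mul_sum, h2]
    · simp [Finset.smul_sum, smul_smul]

theorem exists_weights_transversal (ht : t ∈ T) (a : ι) : ∃ τ : ι → ℝ, (∀ i ∉ T, τ i = 0) ∧
    ∑ i, τ i = -1 ∧ transversal p T t (lift p 0 a) = p a + ∑ i, τ i • p i := by
  classical
  obtain ⟨γ, h1, h2, h3⟩ := exists_weights_of_mem_vectorSpan
    (sub_transversal_mem (p := p) (T := T) (t := t) (lift p 0 a))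
  refine ⟨-γ - Pi.single t 1, fun i hi => ?_, by simp [h2], ?_⟩
  · have h1' : i ≠ t := by rintro rfl; exact hi ht
    simp [h1 i hi, h1']
  · have : ∑ i, (-γ - Pi.single t 1 : ι → ℝ) i • p i = -∑ i, γ i • p i - p t := by
      simp [sub_smul, Finset.sum_sub_distrib, Pi.single_apply]
    rw [this, ← h3]
    simp only [lift_fst, lift_snd, zero_mul, sub_zero, one_smul]
    abel

omit [FiniteDimensional ℝ E] in
theorem add_sum_smul_eq [DecidableEq ι] (p : ι → E) (τ : ι → ℝ) (a : ι) :
    p a + ∑ i, τ i • p i = ∑ i, (Pi.single a 1 + τ : ι → ℝ) i • p i := by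
  simp [add_smul, Finset.sum_add_distrib, Pi.single_apply]

theorem transversal_transfer (ht : t ∈ T) (h : ∀ a ∈ T, ∀ b ∈ T, distortion p p' a b = 0) {a : ι}
    (ha : ∀ i ∈ T, distortion p p' i a = 0) {τ : ι → ℝ} (hτ : ∀ i ∉ T, τ i = 0)
    (hs : ∑ i, τ i = -1) (hq : transversal p T t (lift p 0 a) = p a + ∑ i, τ i • p i) :
    transversal p' T t (lift p' 0 a) = p' a + ∑ i, τ i • p' i := by
  classical
  refine eq_transversal ?_ ?_
  · rw [Submodule.mem_orthogonal']
    intro x hx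
    obtain ⟨δ, h1, h2, rfl⟩ := exists_weights_of_mem_vectorSpan hx
    have h0 : ∑ i, (Pi.single a 1 + τ : ι → ℝ) i = 0 := by
      simp [Finset.sum_add_distrib, hs]
    have key := inner_sum_sub_inner_sum p p' h0 h2
    rw [← add_sum_smul_eq, ← add_sum_smul_eq, ← hq] at key
    have hz : ⟪transversal p T t (lift p 0 a), ∑ i, δ i • p i⟫ = 0 := by
      refine (Submodule.mem_orthogonal' _ _).1 (transversal_mem _) _ ?_
      have : ∑ i, δ i • p i = ∑ i, δ i • (p i - p t) := by
        simp only [smul_sub, Finset.sum_sub_distrib, ← Finset.sum_smul, h2, zero_smul, sub_zero]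
      rw [this]
      refine Submodule.sum_mem _ fun i _ => ?_
      by_cases hi : i ∈ T
      · exact Submodule.smul_mem _ _
          (vsub_mem_vectorSpan ℝ (mem_image_of_mem p hi) (mem_image_of_mem p ht))
      · rw [h1 i hi, zero_smul]; exact Submodule.zero_mem _
    rw [hz, sub_zero] at key
    rw [key, neg_div, neg_eq_zero, div_eq_zero_iff]
    refine Or.inl (Finset.sum_eq_zero fun i _ => Finset.sum_eq_zero fun j _ => ?_)
    by_cases hj : j ∈ T
    · by_cases hi : i ∈ T
      · rw [h i hi j hj, mul_zero]
      · by_cases hia : i = a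
        · rw [hia, distortion_comm, ha j hj, mul_zero]
        · simp [hia, hτ i hi]
    · rw [h1 j hj]; ring
  · have : (lift p' 0 a).fst - (lift p' 0 a).snd • p' t - (p' a + ∑ i, τ i • p' i) =
        ∑ i, -(τ i) • (p' i - p' t) := by
      simp only [smul_sub, neg_smul, Finset.sum_sub_distrib, Finset.sum_neg_distrib,
        ← Finset.sum_smul, hs]
      simp
      abel
    rw [this]
    refine Submodule.sum_mem _ fun i _ => ?_
    by_cases hi : i ∈ T
    · exact Submodule.smul_mem _ _
        (vsub_mem_vectorSpan ℝ (mem_image_of_mem p' hi) (mem_image_of_mem p' ht))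
    · rw [hτ i hi, neg_zero, zero_smul]; exact Submodule.zero_mem _

/-- Transversal components of points with preserved distances to `T`. -/
theorem inner_transversal_sub (ht : t ∈ T) (h : ∀ a ∈ T, ∀ b ∈ T, distortion p p' a b = 0)
    {a b : ι} (ha : ∀ i ∈ T, distortion p p' i a = 0) (hb : ∀ i ∈ T, distortion p p' i b = 0) :
    ⟪transversal p' T t (lift p' 0 a), transversal p' T t (lift p' 0 b)⟫ -
      ⟪transversal p T t (lift p 0 a), transversal p T t (lift p 0 b)⟫ =
      -distortion p p' a b / 2 := by
  classical
  obtain ⟨τ, h1, h2, h3⟩ := exists_weights_transversal (p := p) ht a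
  obtain ⟨σ, h4, h5, h6⟩ := exists_weights_transversal (p := p) ht b
  rw [transversal_transfer ht h ha h1 h2 h3, transversal_transfer ht h hb h4 h5 h6, h3, h6,
    add_sum_smul_eq, add_sum_smul_eq, add_sum_smul_eq, add_sum_smul_eq,
    inner_sum_sub_inner_sum p p' (by simp [Finset.sum_add_distrib, h2])
      (by simp [Finset.sum_add_distrib, h5])]
  congr 2
  have e : ∀ i j, (Pi.single a 1 + τ : ι → ℝ) i * (Pi.single b 1 + σ : ι → ℝ) j *
      distortion p p' i j = (Pi.single a 1 : ι → ℝ) i * ((Pi.single b 1 : ι → ℝ) j *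
        distortion p p' i j) := by
    intro i j
    by_cases hi : i ∈ T
    · have hd : (Pi.single b 1 + σ : ι → ℝ) j * distortion p p' i j = 0 ∧
          (Pi.single b 1 : ι → ℝ) j * distortion p p' i j = 0 := by
        by_cases hj : j ∈ T
        · rw [h i hi j hj, mul_zero, mul_zero]; exact ⟨rfl, rfl⟩
        · by_cases hjb : j = b
          · rw [hjb, hb i hi, mul_zero, mul_zero]; exact ⟨rfl, rfl⟩
          · simp [hjb, h4 j hj]
      rw [mul_assoc, hd.1, hd.2, mul_zero, mul_zero]
    · by_cases hia : i = a
      · subst hia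
        have hd : σ j * distortion p p' i j = 0 := by
          by_cases hj : j ∈ T
          · rw [distortion_comm, ha j hj, mul_zero]
          · rw [h4 j hj, zero_mul]
        simp only [Pi.add_apply, h1 i hi, add_zero, Pi.single_eq_same]
        linear_combination hd
      · simp [hia, h1 i hi]
  simp only [e, Pi.single_apply, ite_mul, one_mul, zero_mul, Finset.sum_ite_eq',
    Finset.mem_univ, if_true, mul_ite, mul_zero]

omit [Fintype ι] in
/-- A linear map to `EuclideanSpace ℝ (Fin k)` realizing the transversal components of the points
of `G` relative to `T`. -/
theorem exists_transversal_coords {G : Set ι} (ht : t ∈ T) (hTG : T ⊆ G) {k : ℕ}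
    (hk : rk (lift p 0) G = rk (lift p 0) T + k) :
    ∃ Θ : WithLp 2 (E × ℝ) →ₗ[ℝ] EuclideanSpace ℝ (Fin k),
      (∀ a ∈ G, ∀ b ∈ G, ⟪Θ (lift p 0 a), Θ (lift p 0 b)⟫ =
        ⟪transversal p T t (lift p 0 a), transversal p T t (lift p 0 b)⟫) ∧
      (∀ a ∈ T, Θ (lift p 0 a) = 0) ∧
      (∀ φ : WithLp 2 (E × ℝ) →ₗ[ℝ] ℝ, (∀ a ∈ T, φ (lift p 0 a) = 0) →
        ∃ m, ∀ x ∈ Submodule.span ℝ (lift p 0 '' G), φ x = ⟪m, Θ x⟫) ∧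
      (Submodule.span ℝ (lift p 0 '' G)).map Θ = ⊤ := by
  let A := Submodule.span ℝ (lift p 0 '' G)
  let M := A.map (transversal p T t)
  have hker : LinearMap.ker (transversal p T t) ≤ A := by
    rw [ker_transversal ht]
    exact Submodule.span_mono (image_mono hTG)
  have hM : Module.finrank ℝ M = k := by
    have h1 := LinearMap.finrank_range_add_finrank_ker ((transversal p T t).domRestrict A)
    rw [LinearMap.range_domRestrict, LinearMap.ker_domRestrict] at h1
    have h2 : Module.finrank ℝ (LinearMap.ker (transversal p T t)|>.submoduleOf A) =
        rk (lift p 0) T := by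
      rw [(Submodule.submoduleOfEquivOfLe hker).finrank_eq, ker_transversal ht, rk]
    change _ + Module.finrank ℝ ((LinearMap.ker (transversal p T t)).submoduleOf A) = _ at h1
    rw [h2] at h1
    change Module.finrank ℝ M + _ = rk (lift p 0) G at h1
    omega
  let κ := ((stdOrthonormalBasis ℝ M).reindex (finCongr hM)).repr
  let Θ : WithLp 2 (E × ℝ) →ₗ[ℝ] EuclideanSpace ℝ (Fin k) :=
    κ.toLinearEquiv.toLinearMap ∘ₗ M.orthogonalProjectionOnto.toLinearMap ∘ₗ transversal p T t
  have hΘ : ∀ (x : WithLp 2 (E × ℝ)) (hx : x ∈ A),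
      Θ x = κ ⟨transversal p T t x, Submodule.mem_map_of_mem hx⟩ := by
    intro x hx
    change κ (M.orthogonalProjectionOnto (transversal p T t x)) = _
    congr 1
    exact Submodule.orthogonalProjectionOnto_mem_subspace_eq_self
      (⟨transversal p T t x, Submodule.mem_map_of_mem hx⟩ : M)
  have hA : ∀ a ∈ G, lift p 0 a ∈ A := fun a ha => Submodule.subset_span (mem_image_of_mem _ ha)
  have hz : ∀ x ∈ A, Θ x = 0 → transversal p T t x = 0 := by
    intro x hx h0
    rw [hΘ x hx, map_eq_zero_iff κ κ.injective] at h0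
    exact congrArg Subtype.val h0
  refine ⟨Θ, fun a ha b hb => ?_, fun a ha => ?_, fun φ hφ => ?_, ?_⟩
  · rw [hΘ _ (hA a ha), hΘ _ (hA b hb), LinearIsometryEquiv.inner_map_map]; rfl
  · change κ (M.orthogonalProjectionOnto (transversal p T t (lift p 0 a))) = 0
    rw [transversal_lift_eq_zero ht ha, map_zero, map_zero]
  · have hφ' : φ.domRestrict A ∈ LinearMap.range (Θ.domRestrict A).dualMap := by
      rw [LinearMap.range_dualMap_eq_dualAnnihilator_ker, Submodule.mem_dualAnnihilator]
      rintro ⟨x, hx⟩ h0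
      have h1 := hz x hx h0
      rw [← LinearMap.mem_ker, ker_transversal ht] at h1
      have h2 : Submodule.span ℝ (lift p 0 '' T) ≤ LinearMap.ker φ := by
        rw [Submodule.span_le]
        rintro _ ⟨a, ha, rfl⟩
        exact hφ a ha
      exact h2 h1
    obtain ⟨ψ, hψ⟩ := hφ'
    refine ⟨(InnerProductSpace.toDual ℝ _).symm (LinearMap.toContinuousLinearMap ψ),
      fun x hx => ?_⟩
    rw [InnerProductSpace.toDual_symm_apply]
    exact (LinearMap.congr_fun hψ ⟨x, hx⟩).symm
  · rw [eq_top_iff]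
    intro y _
    obtain ⟨x, hx, hxy⟩ := (κ.symm y).2
    refine ⟨x, hx, ?_⟩
    rw [hΘ x hx]
    have : (⟨transversal p T t x, Submodule.mem_map_of_mem hx⟩ : M) = κ.symm y := Subtype.ext hxy
    rw [this, LinearIsometryEquiv.apply_symm_apply]

variable {𝓛 : Set (Set ι)}

theorem Config.inner_facet_nonneg (hp : Config p 𝓛) {F G : Set ι} (hF : F ∈ 𝓛) (hG : G ∈ 𝓛)
    (hFG : F ⊂ G) {Θ : WithLp 2 (E × ℝ) →ₗ[ℝ] EuclideanSpace ℝ (Fin 1)}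
    (hΘF : ∀ a ∈ F, Θ (lift p 0 a) = 0)
    (hΘ : ∀ φ : WithLp 2 (E × ℝ) →ₗ[ℝ] ℝ, (∀ a ∈ F, φ (lift p 0 a) = 0) →
        ∃ m, ∀ x ∈ Submodule.span ℝ (lift p 0 '' G), φ x = ⟪m, Θ x⟫) {b c : ι}
    (hb : b ∈ G) (hc : c ∈ G) : 0 ≤ ⟪Θ (lift p 0 b), Θ (lift p 0 c)⟫ := by
  obtain ⟨w, h1, h2, h3, h4⟩ := hp.exists_approx hF hG hFG
  have hcont : Continuous Θ := LinearMap.continuous_of_finiteDimensional Θ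
  have hlim : Tendsto (fun ε => ⟪Θ (w ε b), Θ (w ε c)⟫) (𝓝[>] 0)
      (𝓝 ⟪Θ (lift p 0 b), Θ (lift p 0 c)⟫) :=
    ((hcont.tendsto _).comp (h1 b)).inner ((hcont.tendsto _).comp (h1 c))
  refine ge_of_tendsto hlim ?_
  filter_upwards [h4] with ε hε
  obtain ⟨φ, hφ⟩ := hε F hF subset_rfl hFG
  obtain ⟨m, hm⟩ := hΘ φ fun a ha => by
    rw [← h2 ε a ha]; exact ((hφ a (hFG.1 ha)).2.1 ha)
  by_cases hbF : b ∈ F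
  · rw [h2 ε b hbF, hΘF b hbF, inner_zero_left]
  by_cases hcF : c ∈ F
  · rw [h2 ε c hcF, hΘF c hcF, inner_zero_right]
  have hb' := lt_of_le_of_ne (hφ b hb).1 fun e => hbF ((hφ b hb).2.2 e.symm)
  have hc' := lt_of_le_of_ne (hφ c hc).1 fun e => hcF ((hφ c hc).2.2 e.symm)
  rw [hm _ (h3 ε b hb)] at hb'
  rw [hm _ (h3 ε c hc)] at hc'
  simp only [PiLp.inner_apply, Fin.sum_univ_one, RCLike.inner_apply, conj_trivial] at hb' hc' ⊢
  have h5 := mul_pos hb' hc'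
  have h6 : 0 ≤ m 0 ^ 2 := sq_nonneg _
  by_contra hneg
  push Not at hneg
  nlinarith

theorem abs_real_inner_of_dim_one (x y : EuclideanSpace ℝ (Fin 1)) :
    |⟪x, y⟫| = √(⟪x, x⟫ * ⟪y, y⟫) := by
  simp only [PiLp.inner_apply, Fin.sum_univ_one, RCLike.inner_apply, conj_trivial]
  rw [← Real.sqrt_sq_eq_abs]
  congr 1
  ring

/-- If all distances between a facet `F` of `G` and `b`, `c` are preserved, so is the distance
between `b` and `c`. -/
theorem Config.distortion_eq_zero_of_facet (hp : Config p 𝓛) (hp' : Config p' 𝓛) {F G : Set ι}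
    (hF : F ∈ 𝓛) (hG : G ∈ 𝓛) (hFG : F ⊂ G) (hne : F.Nonempty)
    (hrk : rk (lift p 0) G = rk (lift p 0) F + 1)
    (h : ∀ a ∈ F, ∀ b ∈ F, distortion p p' a b = 0) {b c : ι} (hb : b ∈ G) (hc : c ∈ G)
    (hFb : ∀ a ∈ F, distortion p p' a b = 0) (hFc : ∀ a ∈ F, distortion p p' a c = 0) :
    distortion p p' b c = 0 := by
  obtain ⟨t, ht⟩ := hne
  obtain ⟨Θ, h1, h2, h3, -⟩ := exists_transversal_coords ht hFG.1 hrk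
  have hrk' := hrk
  rw [hp.rk_eq hp' hG, hp.rk_eq hp' hF] at hrk'
  obtain ⟨Θ', h1', h2', h3', -⟩ := exists_transversal_coords ht hFG.1 hrk'
  have hn := abs_of_nonneg (hp.inner_facet_nonneg hF hG hFG h2 h3 hb hc)
  have hn' := abs_of_nonneg (hp'.inner_facet_nonneg hF hG hFG h2' h3' hb hc)
  rw [abs_real_inner_of_dim_one] at hn hn'
  have kb := inner_transversal_sub ht h hFb hFb
  have kc := inner_transversal_sub ht h hFc hFc
  have kbc := inner_transversal_sub ht h hFb hFc
  rw [distortion_self, neg_zero, zero_div, ← h1 b hb b hb, ← h1' b hb b hb, sub_eq_zero] at kb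
  rw [distortion_self, neg_zero, zero_div, ← h1 c hc c hc, ← h1' c hc c hc, sub_eq_zero] at kc
  rw [← h1 b hb c hc, ← h1' b hb c hc, ← hn, ← hn', kb, kc] at kbc
  linarith

end Transversal

section Links

open Filter Topology

theorem det3_mul_inner {u v m : E3} (hu : ⟪m, u⟫ = 0) (hv : ⟪m, v⟫ = 0) (x y : E3) :
    det3 u v x * ⟪m, y⟫ = det3 u v y * ⟪m, x⟫ := by
  simp only [PiLp.inner_apply, Fin.sum_univ_three, RCLike.inner_apply, conj_trivial] at hu hv ⊢
  simp only [det3]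
  linear_combination
    (v 0 * (x 1 * y 2 - x 2 * y 1) - v 1 * (x 0 * y 2 - x 2 * y 0) +
      v 2 * (x 0 * y 1 - x 1 * y 0)) * hu -
    (u 0 * (x 1 * y 2 - x 2 * y 1) - u 1 * (x 0 * y 2 - x 2 * y 0) +
      u 2 * (x 0 * y 1 - x 1 * y 0)) * hv

theorem exists_det3_ne_zero {u v m m' : E3} (h1 : ⟪m, u⟫ = 0) (h2 : ⟪m, v⟫ ≠ 0)
    (h3 : ⟪m', u⟫ ≠ 0) : ∃ x, det3 u v x ≠ 0 := by
  by_contra! h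
  have e0 := h (EuclideanSpace.single 0 1)
  have e1 := h (EuclideanSpace.single 1 1)
  have e2 := h (EuclideanSpace.single 2 1)
  simp [det3] at e0 e1 e2
  refine mul_ne_zero h2 h3 ?_
  simp only [PiLp.inner_apply, Fin.sum_univ_three, RCLike.inner_apply, conj_trivial] at h1 ⊢
  linear_combination (v 0 * m' 0 + v 1 * m' 1 + v 2 * m' 2) * h1 +
    (m 1 * m' 0 - m 0 * m' 1) * e2 + (m 0 * m' 2 - m 2 * m' 0) * e1 +
    (m 2 * m' 1 - m 1 * m' 2) * e0

theorem continuous_det3 : Continuous fun x : E3 × E3 × E3 => det3 x.1 x.2.1 x.2.2 := by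
  simp only [det3]
  fun_prop

theorem det3_smul_smul_smul (σ : ℝ) (x y z : E3) :
    det3 (σ • x) (σ • y) (σ • z) = σ * σ * (σ * det3 x y z) := by
  simp only [det3, PiLp.smul_apply, smul_eq_mul]; ring

variable {ι E : Type*}

/-- The cyclic arrangement of the faces `R i` and `F i` strictly between `T` and `G`, with points
`c i` in `R i` but not in `T`. -/
structure Link (𝓛 : Set (Set ι)) (T G : Set ι) (n : ℕ) (R F : ℕ → Set ι) (c : ℕ → ι) : Prop where
  three_le : 3 ≤ n
  per : ∀ i, c (i + n) = c i
  memR : ∀ i, R i ∈ 𝓛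
  memF : ∀ i, F i ∈ 𝓛
  TR : ∀ i, T ⊆ R i
  FG : ∀ i, F i ⊂ G
  RF : ∀ i, R i ⊆ F i
  RF' : ∀ i, R (i + 1) ⊆ F i
  mem : ∀ i, c i ∈ R i
  notMem : ∀ i j, i < j → j < i + n → c j ∉ R i ∧ c i ∉ R j ∧ ∀ a ∈ R i, a ∈ R j → a ∈ T
  notMem_next : ∀ i, c (i + 2) ∉ F i
  notMem_prev : ∀ i, c i ∉ F (i + 1)

variable [NormedAddCommGroup E] [InnerProductSpace ℝ E] [FiniteDimensional ℝ E] [Fintype ι]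
  {p p' : ι → E} {𝓛 : Set (Set ι)} {T G : Set ι} {n : ℕ} {R F : ℕ → Set ι} {c : ℕ → ι}

theorem Config.link_weak (hp : Config p 𝓛) (hL : Link 𝓛 T G n R F c) (hT : T ∈ 𝓛) (hG : G ∈ 𝓛)
    (hTG : T ⊂ G) {Θ : WithLp 2 (E × ℝ) →ₗ[ℝ] E3}
    (hΘ : ∀ φ : WithLp 2 (E × ℝ) →ₗ[ℝ] ℝ, (∀ a ∈ T, φ (lift p 0 a) = 0) →
      ∃ m, ∀ x ∈ Submodule.span ℝ (lift p 0 '' G), φ x = ⟪m, Θ x⟫) :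
    ∃ σ : ℝ, (σ = 1 ∨ σ = -1) ∧ ∀ i, ∀ b ∈ G,
      0 ≤ σ * det3 (Θ (lift p 0 (c i))) (Θ (lift p 0 (c (i + 1)))) (Θ (lift p 0 b)) := by
  obtain ⟨w, h1, h2, h3, h4⟩ := hp.exists_approx hT hG hTG
  have hcG : ∀ i, c i ∈ G := fun i => (hL.FG i).1 (hL.RF i (hL.mem i))
  have hev : ∀ᶠ ε in 𝓝[>] (0 : ℝ),
      (∀ i, ∀ b ∈ G, 0 ≤ 1 * det3 (Θ (w ε (c i))) (Θ (w ε (c (i + 1)))) (Θ (w ε b))) ∨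
      ∀ i, ∀ b ∈ G, 0 ≤ -1 * det3 (Θ (w ε (c i))) (Θ (w ε (c (i + 1)))) (Θ (w ε b)) := by
    filter_upwards [h4] with ε hε
    have hm : ∀ i, ∃ m : E3, ∀ b ∈ G, 0 ≤ ⟪m, Θ (w ε b)⟫ ∧ (b ∈ F i ↔ ⟪m, Θ (w ε b)⟫ = 0) := by
      intro i
      obtain ⟨φ, hφ⟩ := hε (F i) (hL.memF i) ((hL.TR i).trans (hL.RF i)) (hL.FG i)
      obtain ⟨m, hm⟩ := hΘ φ fun a ha => by
        rw [← h2 ε a ha]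
        exact (hφ a (hTG.1 ha)).2.1 ((hL.TR i).trans (hL.RF i) ha)
      exact ⟨m, fun b hb => by rw [← hm _ (h3 ε b hb)]; exact hφ b hb⟩
    choose m hm using hm
    have hm0 : ∀ i, ⟪m i, Θ (w ε (c i))⟫ = 0 := fun i =>
      (hm i _ (hcG i)).2.1 (hL.RF i (hL.mem i))
    have hm1 : ∀ i, ⟪m i, Θ (w ε (c (i + 1)))⟫ = 0 := fun i =>
      (hm i _ (hcG _)).2.1 (hL.RF' i (hL.mem _))
    have hpos : ∀ i j, c j ∉ F i → 0 < ⟪m i, Θ (w ε (c j))⟫ := fun i j h =>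
      lt_of_le_of_ne (hm i _ (hcG j)).1 fun e => h ((hm i _ (hcG j)).2.2 e.symm)
    have key : ∀ i b, det3 (Θ (w ε (c i))) (Θ (w ε (c (i + 1)))) (Θ (w ε b)) *
        ⟪m i, Θ (w ε (c (i + 2)))⟫ =
        det3 (Θ (w ε (c i))) (Θ (w ε (c (i + 1)))) (Θ (w ε (c (i + 2)))) * ⟪m i, Θ (w ε b)⟫ :=
      fun i b => det3_mul_inner (hm0 i) (hm1 i) _ _
    have hall : ∀ σ : ℝ,
        0 ≤ σ * det3 (Θ (w ε (c 0))) (Θ (w ε (c 1))) (Θ (w ε (c 2))) →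
        ∀ i, ∀ b ∈ G, 0 ≤ σ * det3 (Θ (w ε (c i))) (Θ (w ε (c (i + 1)))) (Θ (w ε b)) := by
      intro σ h0
      have hD : ∀ i, 0 ≤ σ * det3 (Θ (w ε (c i))) (Θ (w ε (c (i + 1)))) (Θ (w ε (c (i + 2)))) := by
        intro i
        induction i with
        | zero => exact h0
        | succ i ih =>
          have hk := key (i + 1) (c i)
          rw [← det3_cycle] at hk
          have hp1 := hpos (i + 1) (i + 1 + 2) (hL.notMem_next _)
          have hp2 := hpos (i + 1) i (hL.notMem_prev _)
          have := mul_nonneg ih hp1.le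
          rw [mul_assoc, hk, ← mul_assoc] at this
          exact nonneg_of_mul_nonneg_left this hp2
      intro i b hb
      have := mul_nonneg (hD i) (hm i b hb).1
      rw [mul_assoc, ← key, ← mul_assoc] at this
      exact nonneg_of_mul_nonneg_left this (hpos i _ (hL.notMem_next i))
    rcases le_total 0 (det3 (Θ (w ε (c 0))) (Θ (w ε (c 1))) (Θ (w ε (c 2)))) with h | h
    · exact Or.inl (hall 1 (by linarith))
    · exact Or.inr (hall (-1) (by linarith))
  have hcont : Continuous Θ := LinearMap.continuous_of_finiteDimensional Θ
  have hlim : ∀ (σ : ℝ) (x y z : ι), Tendsto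
      (fun ε => σ * det3 (Θ (w ε x)) (Θ (w ε y)) (Θ (w ε z))) (𝓝[>] 0)
      (𝓝 (σ * det3 (Θ (lift p 0 x)) (Θ (lift p 0 y)) (Θ (lift p 0 z)))) := fun σ x y z =>
    ((continuous_det3.tendsto (_, _, _)).comp (((hcont.tendsto _).comp (h1 x)).prodMk_nhds
      (((hcont.tendsto _).comp (h1 y)).prodMk_nhds ((hcont.tendsto _).comp (h1 z))))).const_mul σ
  rcases frequently_or_distrib.1 hev.frequently with h | h
  · exact ⟨1, Or.inl rfl, fun i b hb =>
      ge_of_tendsto_of_frequently (hlim _ _ _ _) (h.mono fun ε hε => hε i b hb)⟩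
  · exact ⟨-1, Or.inr rfl, fun i b hb =>
      ge_of_tendsto_of_frequently (hlim _ _ _ _) (h.mono fun ε hε => hε i b hb)⟩

/-- The link of a face is a polygonal cone. -/
theorem Config.link_isCone (hp : Config p 𝓛) (hL : Link 𝓛 T G n R F c) (hT : T ∈ 𝓛) (hG : G ∈ 𝓛)
    (hTG : T ⊂ G) {Θ : WithLp 2 (E × ℝ) →ₗ[ℝ] E3}
    (hΘ : ∀ φ : WithLp 2 (E × ℝ) →ₗ[ℝ] ℝ, (∀ a ∈ T, φ (lift p 0 a) = 0) →
      ∃ m, ∀ x ∈ Submodule.span ℝ (lift p 0 '' G), φ x = ⟪m, Θ x⟫)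
    (htop : (Submodule.span ℝ (lift p 0 '' G)).map Θ = ⊤) :
    ∃ σ : ℝ, (σ = 1 ∨ σ = -1) ∧ IsCone n fun i => σ • Θ (lift p 0 (c i)) := by
  classical
  obtain ⟨σ, hσ, hw⟩ := hp.link_weak hL hT hG hTG hΘ
  have hσ2 : σ * σ = 1 := by rcases hσ with rfl | rfl <;> norm_num
  have hcG : ∀ i, c i ∈ G := fun i => (hL.FG i).1 (hL.RF i (hL.mem i))
  have hA : ∀ a ∈ G, lift p 0 a ∈ Submodule.span ℝ (lift p 0 '' G) := fun a ha =>
    Submodule.subset_span (mem_image_of_mem _ ha)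
  have hFu : ∀ i, F i ≠ univ := fun i e => (hL.FG i).2 (e ▸ subset_univ G)
  have hRu : ∀ i, R i ≠ univ := fun i e => hFu i (univ_subset_iff.1 (e ▸ hL.RF i))
  have hn := hL.three_le
  have hnm := fun i => hL.notMem i (i + 1) (by omega) (by omega)
  refine ⟨σ, hσ, hn, fun i => by simp only [hL.per], fun i j => ?_, ?_, fun i j hij hji t ht e => ?_⟩
  · rw [det3_smul_smul_smul, hσ2, one_mul]
    exact hw i _ (hcG j)
  · refine ⟨σ • ∑ b with b ∈ G, Θ (lift p 0 b), fun i => ?_⟩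
    rw [det3_smul_smul_smul, hσ2, one_mul, det3_sum_right, Finset.mul_sum]
    refine lt_of_le_of_ne (Finset.sum_nonneg fun b hb => hw i b (by simpa using hb)) fun h0 => ?_
    have hz := (Finset.sum_eq_zero_iff_of_nonneg
      (fun b hb => hw i b (by simpa using hb))).1 h0.symm
    have hz' : ∀ b ∈ G, det3 (Θ (lift p 0 (c i))) (Θ (lift p 0 (c (i + 1)))) (Θ (lift p 0 b)) = 0 :=
      fun b hb => (mul_eq_zero.1 (hz b (by simpa using hb))).resolve_left
        (left_ne_zero_of_mul_eq_one hσ2)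
    obtain ⟨D, d1, -, d2⟩ := hp.exists_sep (hL.memF i) (hL.memR i) (hFu i) (hRu i)
    obtain ⟨m, hm⟩ := hΘ D fun a ha => d2 a (hL.RF i (hL.TR i ha)) (hL.TR i ha)
    obtain ⟨D', d1', -, d2'⟩ := hp.exists_sep (hL.memF i) (hL.memR (i + 1)) (hFu i) (hRu _)
    obtain ⟨m', hm'⟩ := hΘ D' fun a ha => d2' a (hL.RF i (hL.TR i ha)) (hL.TR _ ha)
    obtain ⟨x, hx⟩ := exists_det3_ne_zero
      (u := Θ (lift p 0 (c i))) (v := Θ (lift p 0 (c (i + 1)))) (m := m) (m' := m')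
      (by rw [← hm _ (hA _ (hcG i))]; exact d2 _ (hL.RF i (hL.mem i)) (hL.mem i))
      (by
        rw [← hm _ (hA _ (hcG _))]
        exact (d1 _ (hL.RF' i (hL.mem _)) (hnm i).1).ne')
      (by
        rw [← hm' _ (hA _ (hcG _))]
        exact (d1' _ (hL.RF i (hL.mem _)) (hnm i).2.1).ne')
    obtain ⟨y, hy, rfl⟩ : x ∈ (Submodule.span ℝ (lift p 0 '' G)).map Θ := htop ▸ trivial
    refine hx ?_
    induction hy using Submodule.span_induction with
    | mem y hy => obtain ⟨b, hb, rfl⟩ := hy; exact hz' b hb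
    | zero => simp [det3]
    | add y z _ _ hy hz =>
      by_contra hne
      have := det3_comb (Θ (lift p 0 (c i))) (Θ (lift p 0 (c (i + 1)))) (Θ y) (Θ z) 1 1
      rw [one_smul, one_smul] at this
      by_cases h1 : det3 (Θ (lift p 0 (c i))) (Θ (lift p 0 (c (i + 1)))) (Θ y) = 0
      · by_cases h2 : det3 (Θ (lift p 0 (c i))) (Θ (lift p 0 (c (i + 1)))) (Θ z) = 0
        · rw [map_add, this, h1, h2] at hne
          norm_num at hne
        · exact h2 (hz h2)
      · exact h1 (hy h1)
    | smul s y _ hy =>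
      by_contra hne
      rw [map_smul, det3_smul_right] at hne
      exact (right_ne_zero_of_mul hne) (hy (right_ne_zero_of_mul hne))
  · obtain ⟨h1, h2, h3⟩ := hL.notMem i j hij hji
    obtain ⟨D, d1, d2, d3⟩ := hp.exists_sep (hL.memR i) (hL.memR j) (hRu i) (hRu j)
    obtain ⟨m, hm⟩ := hΘ D fun a ha => d3 a (hL.TR i ha) (hL.TR j ha)
    have k1 := d1 _ (hL.mem i) h2
    have k2 := d2 _ (hL.mem j) h1
    rw [hm _ (hA _ (hcG _))] at k1 k2
    rw [smul_comm t σ] at e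
    have e' : Θ (lift p 0 (c j)) = t • Θ (lift p 0 (c i)) :=
      smul_right_injective _ (left_ne_zero_of_mul_eq_one hσ2) e
    rw [e', real_inner_smul_right] at k2
    nlinarith

end Links

section LinkCycles

variable {ι W : Type*} [Fintype ι] [AddCommGroup W] [Module ℝ W] [FiniteDimensional ℝ W]
  {v : ι → W} {U T G : Set ι}

omit [Fintype ι] [FiniteDimensional ℝ W] in
theorem ivl_trans {A : Set ι} {j k : ℕ} (hT : T ∈ ivl v U G j) (hA : A ∈ ivl v T G k) :
    A ∈ ivl v U G (j + k) :=
  ⟨hA.1, hT.2.1.trans hA.2.1, hA.2.2.1, by rw [hA.2.2.2, hT.2.2.2]; ring⟩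

omit [Fintype ι] [FiniteDimensional ℝ W] in
theorem ivl_of_trans {A : Set ι} {j k : ℕ} (hT : T ∈ ivl v U G j) (hA : A ∈ ivl v U G (j + k))
    (h : T ⊆ A) : A ∈ ivl v T G k :=
  ⟨hA.1, h, hA.2.2.1, by rw [hA.2.2.2, hT.2.2.2]; ring⟩

theorem IsFace.link_cycle (hT : IsFace v T) (hG : IsFace v G) (h : T ⊆ G)
    (hr : rk v G = rk v T + 3) :
    ∃ n a b, CycleEnum (fun (x : ivl v T G 1) (y : ivl v T G 2) => x.1 ⊆ y.1) n a b := by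
  have hT0 := ivl_left hT h
  have hG3 := ivl_right hG h hr
  have hss : T ⊂ G := h.ssubset_of_ne (by rintro rfl; omega)
  have hA1 : ∃ A, A ∈ ivl v T G 1 := by
    obtain ⟨R, h1, h2, h3, h4⟩ := hT.exists_cover hG hss
    exact ⟨R, h1, h2.1, h3, h4⟩
  refine exists_cycleEnum ?_ ?_ ?_ ?_ ?_
  · rintro ⟨x, hx⟩
    obtain ⟨R₁, R₂, hne, hiff⟩ := hx.1.diamond hG hx.2.2.1 (by rw [hr, hx.2.2.2])
    have hm1 := ivl_trans hx ((hiff R₁).2 (Or.inl rfl))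
    have hm2 := ivl_trans hx ((hiff R₂).2 (Or.inr rfl))
    refine ⟨⟨R₁, hm1⟩, ⟨R₂, hm2⟩, fun e => hne (congrArg Subtype.val e), fun y => ?_⟩
    rw [Subtype.ext_iff, Subtype.ext_iff, ← hiff]
    exact ⟨fun e => ivl_of_trans hx y.2 e, fun e => e.2.1⟩
  · rintro ⟨y, hy⟩
    obtain ⟨R₁, R₂, hne, hiff⟩ := hT.diamond hy.1 hy.2.1 hy.2.2.2
    have hm : ∀ R, R ∈ ivl v T y 1 → R ∈ ivl v T G 1 := fun R hR =>
      ⟨hR.1, hR.2.1, hR.2.2.1.trans hy.2.2.1, hR.2.2.2⟩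
    refine ⟨⟨R₁, hm _ ((hiff R₁).2 (Or.inl rfl))⟩, ⟨R₂, hm _ ((hiff R₂).2 (Or.inr rfl))⟩,
      fun e => hne (congrArg Subtype.val e), fun x => ?_⟩
    rw [Subtype.ext_iff, Subtype.ext_iff, ← hiff]
    exact ⟨fun e => ⟨x.2.1, x.2.2.1, e, x.2.2.2.2⟩, fun e => e.2.2.1⟩
  · rintro ⟨x, hx⟩ ⟨x', hx'⟩ ⟨y, hy⟩ ⟨y', hy'⟩ hxx hyy h1 h2 h3 h4
    have hny : ¬ y ⊆ y' := fun e => hyy (Subtype.ext (ivl_eq_of_subset hy hy' e))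
    have e1 := ivl_inter hx hy hy' h1 h3 hny
    have e2 := ivl_inter hx' hy hy' h2 h4 hny
    exact hxx (Subtype.ext (e1.symm.trans e2))
  · exact ⟨⟨_, hA1.choose_spec⟩⟩
  · rintro 𝒜 ⟨⟨A, hA⟩, hA𝒜⟩ hcl ⟨x, hx⟩
    obtain ⟨_, h'⟩ := hT.atoms_connected hG (𝒜 := {A | ∃ h : A ∈ ivl v T G 1, ⟨A, h⟩ ∈ 𝒜})
      ⟨A, ⟨hA, hA𝒜⟩, hA⟩ (fun A ⟨h, hA𝒜⟩ B hB R hR hAR hBR =>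
        ⟨hB, hcl _ hA𝒜 ⟨B, hB⟩ ⟨R, hR⟩ hAR hBR⟩) x hx
    exact h'

variable {E : Type*} [NormedAddCommGroup E] [InnerProductSpace ℝ E] [FiniteDimensional ℝ E]
  {p p' : ι → E} {𝓛 : Set (Set ι)} {ε : ℝ}

omit [FiniteDimensional ℝ E] [Fintype ι] in
theorem Good.mem_ivl (h : Good p 𝓛 ε) (hT : T ∈ 𝓛) {k : ℕ} {R : Set ι} :
    R ∈ ivl (lift p ε) T G k ↔ R ∈ 𝓛 ∧ T ⊆ R ∧ R ⊆ G ∧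
      _root_.rk (lift p 0) R = _root_.rk (lift p 0) T + k := by
  simp only [ivl, mem_ofPred_eq, ← h.rep]
  exact and_congr_right fun hR => by rw [h.rk R hR, h.rk T hT]

omit [Fintype ι] [FiniteDimensional ℝ W] in
theorem exists_mem_notMem_of_ivl {A : Set ι} {k : ℕ} (hA : A ∈ ivl v T G (k + 1)) :
    ∃ a ∈ A, a ∉ T := by
  by_contra! h
  have := hA.2.2.2
  rw [(Subset.antisymm h hA.2.1 : A = T)] at this
  omega

omit [Fintype ι] in
/-- A cyclic enumeration of the faces between `T` and `G` is a link, for every choice of points. -/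
theorem CycleEnum.link (hε : Good p 𝓛 ε) (hT : T ∈ 𝓛) (hTG : T ⊆ G)
    (hr : rk (lift p ε) G = rk (lift p ε) T + 3)
    {n : ℕ} {a : ℕ → ivl (lift p ε) T G 1} {b : ℕ → ivl (lift p ε) T G 2}
    (h : CycleEnum (fun x y => x.1 ⊆ y.1) n a b) {c : Set ι → ι}
    (hc : ∀ R ∈ ivl (lift p ε) T G 1, c R ∈ R ∧ c R ∉ T) :
    Link 𝓛 T G n (fun i => (a i).1) (fun i => (b i).1) (fun i => c (a i).1) := by
  have hT0 := ivl_left ((hε.rep _).1 hT) hTG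
  have hcap : ∀ x y : ivl (lift p ε) T G 1, x ≠ y → x.1 ∩ y.1 = T := fun x y hxy =>
    ivl_inter hT0 x.2 y.2 x.2.2.1 y.2.2.1 fun e => hxy (Subtype.ext (ivl_eq_of_subset x.2 y.2 e))
  have hcap' : ∀ (x : ivl (lift p ε) T G 1) (y : ivl (lift p ε) T G 2), ¬ x.1 ⊆ y.1 →
      x.1 ∩ y.1 = T := fun x y hxy => ivl_inter hT0 x.2 y.2 x.2.2.1 y.2.2.1 hxy
  have hn := h.three_le
  refine ⟨hn, fun i => by simp only [h.per_a], fun i => (hε.rep _).2 (a i).2.1,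
    fun i => (hε.rep _).2 (b i).2.1, fun i => (a i).2.2.1, fun i => ?_,
    fun i => (h.inc_right _ i).2 (Or.inl rfl), fun i => (h.inc_right _ i).2 (Or.inr rfl),
    fun i => (hc _ (a i).2).1, fun i j hij hji => ?_, fun i hi => ?_, fun i hi => ?_⟩
  · refine (b i).2.2.2.1.ssubset_of_ne fun e => ?_
    have := (b i).2.2.2.2
    rw [e] at this
    omega
  · have e := hcap _ _ (h.inj_a i j hij hji)
    refine ⟨fun hm => (hc _ (a j).2).2 (e.subset ⟨hm, (hc _ (a j).2).1⟩),
      fun hm => (hc _ (a i).2).2 (e.subset ⟨(hc _ (a i).2).1, hm⟩), fun x h1 h2 => e.subset ⟨h1, h2⟩⟩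
  · have e := hcap' (a (i + 2)) (b i) fun h' => by
      rcases (h.inc_right _ i).1 h' with h' | h'
      · exact h.inj_a i (i + 2) (by omega) (by omega) h'.symm
      · exact h.inj_a (i + 1) (i + 2) (by omega) (by omega) h'.symm
    exact (hc _ (a (i + 2)).2).2 (e.subset ⟨(hc _ (a (i + 2)).2).1, hi⟩)
  · have e := hcap' (a i) (b (i + 1)) fun h' => by
      rcases (h.inc_right _ (i + 1)).1 h' with h' | h'
      · exact h.inj_a i (i + 1) (by omega) (by omega) h'
      · exact h.inj_a i (i + 1 + 1) (by omega) (by omega) h'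
    exact (hc _ (a i).2).2 (e.subset ⟨(hc _ (a i).2).1, hi⟩)

end LinkCycles

section RidgeSigns

variable {ι E : Type*} [NormedAddCommGroup E] [InnerProductSpace ℝ E] [FiniteDimensional ℝ E]
  [Fintype ι] {p p' : ι → E} {𝓛 : Set (Set ι)} {G R F₁ F₂ : Set ι} {a a' b b' : ι}

/-- The points `a` and `b` lie on different facets of `G` which meet in `R`. -/
def IsPair (p : ι → E) (𝓛 : Set (Set ι)) (G R : Set ι) (a b : ι) : Prop :=
  ∃ F₁ F₂, F₁ ∈ 𝓛 ∧ F₂ ∈ 𝓛 ∧ F₁ ≠ F₂ ∧ R ⊆ F₁ ∧ R ⊆ F₂ ∧ F₁ ⊂ G ∧ F₂ ⊂ G ∧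
    rk (lift p 0) F₁ = rk (lift p 0) R + 1 ∧ rk (lift p 0) F₂ = rk (lift p 0) R + 1 ∧
    a ∈ F₁ ∧ a ∉ R ∧ b ∈ F₂ ∧ b ∉ R

open Classical in
/-- The sign of the change of the distances between the two facets of `G` containing `R`. -/
noncomputable def ridgeSign (p p' : ι → E) (𝓛 : Set (Set ι)) (G R : Set ι) : SignType :=
  if h : ∃ ab : ι × ι, IsPair p 𝓛 G R ab.1 ab.2 then
    SignType.sign (distortion p p' h.choose.1 h.choose.2) else 0

theorem Config.sign_distortion_left (hp : Config p 𝓛)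
    (hΔ : ∀ F ∈ 𝓛, F ⊂ G → ∀ a ∈ F, ∀ b ∈ F, distortion p p' a b = 0)
    (hR : R ∈ 𝓛) (h₁ : F₁ ∈ 𝓛) (h₂ : F₂ ∈ 𝓛) (hR₁ : R ⊆ F₁) (hR₂ : R ⊆ F₂) (hG₁ : F₁ ⊂ G)
    (hG₂ : F₂ ⊂ G) (hrk : rk (lift p 0) F₁ = rk (lift p 0) R + 1) (ha : a ∈ F₁) (ha' : a ∉ R)
    (hb : a' ∈ F₁) (hb' : a' ∉ R) (hc : b ∈ F₂) :
    SignType.sign (distortion p p' a b) = SignType.sign (distortion p p' a' b) := by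
  obtain ⟨c, ψ, h3, h4⟩ := hp.exists_mul_eq_distortion hR h₁ hR₁
    (fun e => hG₁.2 (e ▸ subset_univ _)) hrk (hΔ _ h₁ hG₁) (b := b)
    (fun r hr => hΔ _ h₂ hG₂ _ (hR₂ hr) _ hc)
  rw [h4 a ha, h4 a' hb, sign_mul, sign_mul, sign_pos (h3 a ha ha'), sign_pos (h3 a' hb hb')]

theorem Config.ridgeSign_eq (hp : Config p 𝓛) (hG : G ∈ 𝓛)
    (hΔ : ∀ F ∈ 𝓛, F ⊂ G → ∀ a ∈ F, ∀ b ∈ F, distortion p p' a b = 0)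
    (hR : R ∈ 𝓛) (hRG : R ⊆ G) (hrk : rk (lift p 0) G = rk (lift p 0) R + 2)
    (hab : IsPair p 𝓛 G R a b) :
    ridgeSign p p' 𝓛 G R = SignType.sign (distortion p p' a b) := by
  have hex : ∃ ab : ι × ι, IsPair p 𝓛 G R ab.1 ab.2 := ⟨(a, b), hab⟩
  rw [ridgeSign, dif_pos hex]
  generalize hex.choose_spec = hs
  revert hs
  generalize hex.choose = xy
  obtain ⟨x, y⟩ := xy
  rintro ⟨A, B, hA, hB, hAB, hRA, hRB, hAG, hBG, hA', hB', hx, hx', hy, hy'⟩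
  obtain ⟨A₁, B₁, hA₁, hB₁, hAB₁, hRA₁, hRB₁, hAG₁, hBG₁, hA₁', hB₁', ha, ha', hb, hb'⟩ := hab
  obtain ⟨ε, hε⟩ := hp.exists_good
  obtain ⟨X, Y, hXY, hiff⟩ := IsFace.diamond ((hε.rep R).1 hR) ((hε.rep G).1 hG) hRG
    (by rw [hε.rk _ hG, hε.rk _ hR, hrk])
  have hm : ∀ F ∈ 𝓛, R ⊆ F → F ⊂ G → rk (lift p 0) F = rk (lift p 0) R + 1 → F = X ∨ F = Y :=
    fun F h1 h2 h3 h4 => (hiff F).1 ((hε.mem_ivl hR).2 ⟨h1, h2, h3.1, h4⟩)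
  have key : (A₁ = A ∧ B₁ = B) ∨ (A₁ = B ∧ B₁ = A) := by
    rcases hm A hA hRA hAG hA' with rfl | rfl <;> rcases hm B hB hRB hBG hB' with rfl | rfl <;>
      rcases hm A₁ hA₁ hRA₁ hAG₁ hA₁' with rfl | rfl <;>
      rcases hm B₁ hB₁ hRB₁ hBG₁ hB₁' with rfl | rfl <;> simp_all
  have hmain : ∀ {A B : Set ι} {a x b y : ι}, A ∈ 𝓛 → B ∈ 𝓛 → R ⊆ A → R ⊆ B → A ⊂ G → B ⊂ G →
      rk (lift p 0) A = rk (lift p 0) R + 1 → rk (lift p 0) B = rk (lift p 0) R + 1 →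
      a ∈ A → a ∉ R → x ∈ A → x ∉ R → b ∈ B → b ∉ R → y ∈ B → y ∉ R →
      SignType.sign (distortion p p' x y) = SignType.sign (distortion p p' a b) := by
    intro A B a x b y hA hB hRA hRB hAG hBG hA' hB' ha ha' hx hx' hb hb' hy hy'
    rw [hp.sign_distortion_left hΔ hR hA hB hRA hRB hAG hBG hA' hx hx' ha ha' hy,
      distortion_comm, hp.sign_distortion_left hΔ hR hB hA hRB hRA hBG hAG hB' hy hy' hb hb' ha,
      distortion_comm]
  rcases key with ⟨rfl, rfl⟩ | ⟨rfl, rfl⟩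
  · exact hmain hA hB hRA hRB hAG hBG hA' hB' ha ha' hx hx' hb hb' hy hy'
  · rw [distortion_comm p p' x y]
    exact hmain hB hA hRB hRA hBG hAG hB' hA' ha ha' hy hy' hb hb' hx hx'

end RidgeSigns

section VertexTypes

variable {ι E : Type*} [NormedAddCommGroup E] [InnerProductSpace ℝ E] [FiniteDimensional ℝ E]
  [Fintype ι] {p p' : ι → E} {𝓛 : Set (Set ι)} {T G : Set ι} {ε : ℝ}

theorem Config.vertex_type (hp : Config p 𝓛) (hp' : Config p' 𝓛) (hG : G ∈ 𝓛)
    (hΔ : ∀ F ∈ 𝓛, F ⊂ G → ∀ a ∈ F, ∀ b ∈ F, distortion p p' a b = 0)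
    (hT : T ∈ 𝓛) (hne : T.Nonempty) (hTG : T ⊆ G)
    (hr : rk (lift p 0) G = rk (lift p 0) T + 3) (hε : Good p 𝓛 ε)
    {n : ℕ} {a : ℕ → ivl (lift p ε) T G 1} {b : ℕ → ivl (lift p ε) T G 2}
    (h : CycleEnum (fun x y => x.1 ⊆ y.1) n a b) {c : Set ι → ι}
    (hc : ∀ R ∈ ivl (lift p ε) T G 1, c R ∈ R ∧ c R ∉ T) :
    (∀ i, ridgeSign p p' 𝓛 G (a i).1 = 0) ∨
    (∃ i j k l, i < j ∧ j < k ∧ k < l ∧ l < i + n ∧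
      ridgeSign p p' 𝓛 G (a i).1 = 1 ∧ ridgeSign p p' 𝓛 G (a j).1 = -1 ∧
      ridgeSign p p' 𝓛 G (a k).1 = 1 ∧ ridgeSign p p' 𝓛 G (a l).1 = -1) ∨
    (∃ i j, i < j ∧ j < i + n ∧ (∀ k, i < k → k < j → ridgeSign p p' 𝓛 G (a k).1 = 0) ∧
      (∀ k, j < k → k < i + n → ridgeSign p p' 𝓛 G (a k).1 = 0) ∧
      ridgeSign p p' 𝓛 G (a i).1 = ridgeSign p p' 𝓛 G (a j).1 ∧
      ridgeSign p p' 𝓛 G (a i).1 ≠ 0 ∧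
      ∃ t : ℝ, 0 < t ∧ ∀ φ : WithLp 2 (E × ℝ) →ₗ[ℝ] ℝ, (∀ x ∈ T, φ (lift p 0 x) = 0) →
        φ (lift p 0 (c (a i).1)) = -t * φ (lift p 0 (c (a j).1))) := by
  obtain ⟨t, ht⟩ := hne
  have hss : T ⊂ G := hTG.ssubset_of_ne (by rintro rfl; omega)
  have hL := h.link hε hT hTG (by rw [hε.rk _ hG, hε.rk _ hT, hr]) hc
  obtain ⟨Θ, h1, h2, h3, h4⟩ := exists_transversal_coords (p := p) ht hTG hr
  obtain ⟨Θ', h1', h2', h3', h4'⟩ := exists_transversal_coords (p := p') ht hTG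
    (k := 3) (by rw [← hp.rk_eq hp' hG, ← hp.rk_eq hp' hT, hr])
  obtain ⟨σ, hσ, hP⟩ := hp.link_isCone hL hT hG hss h3 h4
  obtain ⟨σ', hσ', hQ⟩ := hp'.link_isCone hL hT hG hss h3' h4'
  have hσ2 : σ * σ = 1 := by rcases hσ with rfl | rfl <;> norm_num
  have hσ2' : σ' * σ' = 1 := by rcases hσ' with rfl | rfl <;> norm_num
  have hσ0 : σ ≠ 0 := by rintro rfl; simp at hσ2
  have hcF : ∀ i, c (a i).1 ∈ (b i).1 := fun i => hL.RF i (hL.mem i)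
  have hcF' : ∀ i, c (a (i + 1)).1 ∈ (b i).1 := fun i => hL.RF' i (hL.mem (i + 1))
  have hcG : ∀ i, c (a i).1 ∈ G := fun i => (hL.FG i).1 (hcF i)
  have hΔF : ∀ i, ∀ x ∈ (b i).1, ∀ y ∈ (b i).1, distortion p p' x y = 0 := fun i =>
    hΔ _ (hL.memF i) (hL.FG i)
  have hΔT : ∀ i, ∀ x ∈ T, distortion p p' x (c (a i).1) = 0 := fun i x hx =>
    hΔF i _ (hL.RF i (hL.TR i hx)) _ (hcF i)
  have hkey : ∀ i j, ⟪σ' • Θ' (lift p' 0 (c (a i).1)), σ' • Θ' (lift p' 0 (c (a j).1))⟫ -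
      ⟪σ • Θ (lift p 0 (c (a i).1)), σ • Θ (lift p 0 (c (a j).1))⟫ =
      -distortion p p' (c (a i).1) (c (a j).1) / 2 := by
    intro i j
    simp only [real_inner_smul_left, real_inner_smul_right, ← mul_assoc]
    rw [hσ2, hσ2', one_mul, one_mul, h1 _ (hcG i) _ (hcG j), h1' _ (hcG i) _ (hcG j)]
    exact inner_transversal_sub ht (fun x hx y hy => hΔ T hT hss x hx y hy) (hΔT i) (hΔT j)
  have hcompat : Compat (fun i => σ • Θ (lift p 0 (c (a i).1)))
      (fun i => σ' • Θ' (lift p' 0 (c (a i).1))) := by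
    refine ⟨fun i => ?_, fun i => ?_⟩
    · have := hkey i i
      rw [hΔF i _ (hcF i) _ (hcF i)] at this
      linarith
    · have := hkey i (i + 1)
      rw [hΔF i _ (hcF i) _ (hcF' i)] at this
      linarith
  have hlam : ∀ k, ridgeSign p p' 𝓛 G (a (k + 1)).1 =
      -SignType.sign (turn (fun i => σ • Θ (lift p 0 (c (a i).1)))
        (fun i => σ' • Θ' (lift p' 0 (c (a i).1))) k) := by
    intro k
    have hn := h.three_le
    have hrA : ∀ i, rk (lift p 0) (a i).1 = rk (lift p 0) T + 1 := fun i =>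
      ((hε.mem_ivl hT).1 (a i).2).2.2.2
    have hrB : ∀ i, rk (lift p 0) (b i).1 = rk (lift p 0) T + 2 := fun i =>
      ((hε.mem_ivl hT).1 (b i).2).2.2.2
    have hpair : IsPair p 𝓛 G (a (k + 1)).1 (c (a k).1) (c (a (k + 2)).1) :=
      ⟨(b k).1, (b (k + 1)).1, hL.memF _, hL.memF _,
        fun e => h.inj_b k (k + 1) (by omega) (by omega) (Subtype.ext e), hL.RF' _, hL.RF _,
        hL.FG _, hL.FG _, by rw [hrA, hrB], by rw [hrA, hrB], hcF _,
        (hL.notMem k (k + 1) (by omega) (by omega)).2.1, hcF' _,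
        (hL.notMem (k + 1) (k + 2) (by omega) (by omega)).1⟩
    rw [hp.ridgeSign_eq hG hΔ (hL.memR _) ((hL.RF _).trans (hL.FG _).1) (by rw [hr, hrA]) hpair,
      turn, hkey k (k + 2), ← Left.sign_neg]
    rw [show -(-distortion p p' (c (a k).1) (c (a (k + 2)).1) / 2) =
      distortion p p' (c (a k).1) (c (a (k + 2)).1) * (1 / 2) by ring, sign_mul,
      sign_pos (by norm_num : (0 : ℝ) < 1 / 2), mul_one]
  have hn := h.three_le
  rcases hcompat.localOutcome hP hQ with h0 | ⟨i, j, k, l, hij, hjk, hkl, hli, h5, h6, h7, h8⟩ |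
    ⟨i, j, hij, hji, h5, h6, h7, t, ht0, h8, h9⟩
  · refine Or.inl fun i => ?_
    rw [← h.per_a i, show i + n = (i + n - 1) + 1 by omega, hlam, h0, sign_zero, neg_zero]
  · refine Or.inr (Or.inl ⟨j + 1, k + 1, l + 1, i + 1 + n, by omega, by omega, by omega, by omega,
      ?_, ?_, ?_, ?_⟩)
    · rw [hlam, sign_neg h6, neg_neg]
    · rw [hlam, sign_pos h7]
    · rw [hlam, sign_neg h8, neg_neg]
    · rw [h.per_a, hlam, sign_pos h5]
  · refine Or.inr (Or.inr ⟨i + 1, j + 1, by omega, by omega, fun k h10 h11 => ?_,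
      fun k h10 h11 => ?_, ?_, ?_, t, ht0, fun φ hφ => ?_⟩)
    · obtain ⟨k, rfl⟩ : ∃ m, k = m + 1 := ⟨k - 1, by omega⟩
      rw [hlam, h5 k (by omega) (by omega), sign_zero, neg_zero]
    · obtain ⟨k, rfl⟩ : ∃ m, k = m + 1 := ⟨k - 1, by omega⟩
      rw [hlam, h6 k (by omega) (by omega), sign_zero, neg_zero]
    · rw [hlam, hlam]
      rcases pos_and_pos_or_neg_and_neg_of_mul_pos h7 with ⟨h10, h11⟩ | ⟨h10, h11⟩
      · rw [sign_pos h10, sign_pos h11]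
      · rw [sign_neg h10, sign_neg h11]
    · rw [hlam]
      intro e
      have hneg : ∀ s : SignType, -s = 0 → s = 0 := by decide
      rw [sign_eq_zero_iff.1 (hneg _ e), zero_mul] at h7
      exact h7.false
    · obtain ⟨m, hm⟩ := h3 φ hφ
      have hA : ∀ i, lift p 0 (c (a i).1) ∈ Submodule.span ℝ (lift p 0 '' G) := fun i =>
        Submodule.subset_span (mem_image_of_mem _ (hcG i))
      have e : Θ (lift p 0 (c (a (i + 1)).1)) = (-t) • Θ (lift p 0 (c (a (j + 1)).1)) := by
        have : σ • Θ (lift p 0 (c (a (i + 1)).1)) = (-t) • σ • Θ (lift p 0 (c (a (j + 1)).1)) := h8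
        rw [smul_comm] at this
        exact smul_right_injective _ hσ0 this
      rw [hm _ (hA _), hm _ (hA _), e, real_inner_smul_right]

end VertexTypes

section Bases

open Filter Topology

variable {ι E : Type*} [NormedAddCommGroup E] [InnerProductSpace ℝ E] [FiniteDimensional ℝ E]
  [Fintype ι] {p p' : ι → E} {𝓛 : Set (Set ι)} {ε : ℝ}

theorem Config.of_restrict (hp : Config p 𝓛) {R : Set ι} (hR : R ∈ 𝓛) (hR' : R ≠ univ)
    (φ : WithLp 2 (E × ℝ) →ₗ[ℝ] ℝ) (hφ : ∀ i ∈ R, 0 ≤ φ (lift p 0 i)) :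
    {i | i ∈ R ∧ φ (lift p 0 i) = 0} ∈ 𝓛 := by
  obtain ⟨μ, ν, hν⟩ := hp.spherical hR hR'
  have hlim : Tendsto (fun ε : ℝ => ε * ν) (𝓝[>] 0) (𝓝 (0 * ν)) :=
    ((continuous_mul_const _).tendsto 0).mono_left nhdsWithin_le_nhds
  rw [zero_mul] at hlim
  obtain ⟨ε, hε, h1⟩ := (hp.eventually_good.and (hlim.eventually_lt_const one_pos)).exists
  obtain ⟨n, s, rfl⟩ := exists_pairing φ
  have key : ∀ i ∈ R, pairing (n + (s / (1 - ε * ν) * ε) • μ) (s / (1 - ε * ν)) (lift p ε i) =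
      pairing n s (lift p 0 i) := fun i hi => by
    rw [pairing_lift, pairing_lift, inner_add_left, real_inner_smul_left, hν i hi]
    have : 1 - ε * ν ≠ 0 := by linarith
    field_simp
    ring
  have h2 := ((hε.rep R).1 hR).of_restrict
    (pairing (n + (s / (1 - ε * ν) * ε) • μ) (s / (1 - ε * ν))) fun i hi => by
      rw [key i hi]; exact hφ i hi
  rw [hε.rep]
  convert h2 using 3 with i
  exact and_congr_right fun hi => by rw [key i hi]

theorem Config.exists_base (hp : Config p 𝓛) {ℛ : Set (Set ι)} (hne : ℛ.Nonempty) {m : ℕ}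
    (hℛ : ∀ R ∈ ℛ, R ∈ 𝓛 ∧ R ≠ univ ∧ m < rk (lift p 0) R) {k : ℕ} (hk : k ≤ m) :
    ∃ U ∈ 𝓛, ∃ g : WithLp 2 (E × ℝ) →ₗ[ℝ] ℝ, rk (lift p 0) U = k ∧ (∃ R ∈ ℛ, U ⊆ R) ∧
      (∀ i ∈ U, g (lift p 0 i) = 0) ∧
      ∀ R ∈ ℛ, U ⊆ R → ∀ i ∈ R, i ∉ U → 0 < g (lift p 0 i) := by
  classical
  induction k with
  | zero =>
    obtain ⟨ε, hε⟩ := hp.exists_good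
    obtain ⟨R, hR⟩ := hne
    exact ⟨∅, (hε.rep _).2 hε.empty_mem, pairing 0 1, by simp [rk], ⟨R, hR, empty_subset _⟩,
      by simp, fun R _ _ i _ _ => by simp⟩
  | succ k ih =>
    obtain ⟨U, hU, g, hUk, ⟨R₀, hR₀, hUR₀⟩, hg0, hg⟩ := ih (by omega)
    let K := Submodule.span ℝ (lift p 0 '' U)
    let Z : Set ι := {a | ∃ R ∈ ℛ, U ⊆ R ∧ a ∈ R ∧ a ∉ U}
    let π : WithLp 2 (E × ℝ) →ₗ[ℝ] WithLp 2 (E × ℝ) := (Kᗮ.starProjection).toLinearMap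
    have hπU : ∀ i ∈ U, π (lift p 0 i) = 0 := fun i hi => by
      refine (Submodule.starProjection_apply_eq_zero_iff _).2 ?_
      rw [Submodule.orthogonal_orthogonal]
      exact Submodule.subset_span (mem_image_of_mem _ hi)
    have hπK : ∀ x, x - π x ∈ K := fun x => by
      have := Submodule.sub_starProjection_mem_orthogonal (K := Kᗮ) x
      rwa [Submodule.orthogonal_orthogonal] at this
    let y : ι → WithLp 2 (E × ℝ) := fun a => (g (lift p 0 a))⁻¹ • π (lift p 0 a)
    have hgZ : ∀ a ∈ Z, 0 < g (lift p 0 a) := fun a ⟨R, hR, hUR, h1, h2⟩ => hg R hR hUR a h1 h2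
    have hπy : ∀ a ∈ Z, π (lift p 0 a) = g (lift p 0 a) • y a := fun a ha => by
      simp only [y, smul_smul]
      rw [mul_inv_cancel₀ (hgZ a ha).ne', one_smul]
    have hZne : Z.Nonempty := by
      by_contra hZ
      have : R₀ ⊆ U := fun a ha => by
        by_contra haU
        exact hZ ⟨a, R₀, hR₀, hUR₀, ha, haU⟩
      have := rk_mono (v := lift p 0) this
      have := (hℛ R₀ hR₀).2.2
      omega
    obtain ⟨a, haZ, hmax⟩ := (toFinite Z).exists_maximalFor (fun a => ‖y a‖) Z hZne
    replace hmax : ∀ b ∈ Z, ‖y b‖ ≤ ‖y a‖ := fun b hb => by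
      rcases le_total ‖y b‖ ‖y a‖ with h | h
      · exact h
      · exact hmax hb h
    let g' : WithLp 2 (E × ℝ) →ₗ[ℝ] ℝ := (‖y a‖ ^ 2) • g - (innerSL ℝ (y a)).toLinearMap ∘ₗ π
    have hg'Z : ∀ b ∈ Z, g' (lift p 0 b) = g (lift p 0 b) * (‖y a‖ ^ 2 - ⟪y a, y b⟫) :=
      fun b hb => by
        simp only [g', LinearMap.sub_apply, LinearMap.smul_apply, LinearMap.comp_apply,
          ContinuousLinearMap.coe_coe, innerSL_apply_apply, smul_eq_mul]
        rw [hπy b hb, real_inner_smul_right]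
        ring
    have hg'U : ∀ b ∈ U, g' (lift p 0 b) = 0 := fun b hb => by
      simp [g', hg0 b hb, hπU b hb]
    have hle : ∀ b ∈ Z, 0 ≤ ‖y a‖ ^ 2 - ⟪y a, y b⟫ := fun b hb => by
      have h1 := real_inner_le_norm (y a) (y b)
      have h2 := mul_le_mul_of_nonneg_left (hmax b hb) (norm_nonneg (y a))
      nlinarith
    have heq : ∀ b ∈ Z, g' (lift p 0 b) = 0 → y b = y a := fun b hb h => by
      rw [hg'Z b hb] at h
      have h1 := (mul_eq_zero.1 h).resolve_left (hgZ b hb).ne'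
      have h2 := norm_sub_sq_real (y b) (y a)
      rw [real_inner_comm] at h2
      have h3 : ‖y b‖ ^ 2 ≤ ‖y a‖ ^ 2 := pow_le_pow_left₀ (norm_nonneg _) (hmax b hb) 2
      have h4 : ‖y b - y a‖ ^ 2 ≤ 0 := by linarith
      have h5 : ‖y b - y a‖ = 0 := by nlinarith [norm_nonneg (y b - y a)]
      exact sub_eq_zero.1 (norm_eq_zero.1 h5)
    have haa : g' (lift p 0 a) = 0 := by
      rw [hg'Z a haZ, real_inner_self_eq_norm_sq, sub_self, mul_zero]
    let T : Set ι → Set ι := fun R => {i | i ∈ R ∧ g' (lift p 0 i) = 0}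
    have hnn : ∀ R ∈ ℛ, U ⊆ R → ∀ i ∈ R, 0 ≤ g' (lift p 0 i) := fun R hR hUR i hi => by
      by_cases hiU : i ∈ U
      · exact (hg'U i hiU).ge
      · have hZ : i ∈ Z := ⟨R, hR, hUR, hi, hiU⟩
        rw [hg'Z i hZ]
        exact mul_nonneg (hgZ i hZ).le (hle i hZ)
    have hTL : ∀ R ∈ ℛ, U ⊆ R → T R ∈ 𝓛 := fun R hR hUR =>
      hp.of_restrict (hℛ R hR).1 (hℛ R hR).2.1 g' (hnn R hR hUR)
    have hUT : ∀ R ∈ ℛ, U ⊆ R → U ⊆ T R := fun R hR hUR i hi => ⟨hUR hi, hg'U i hi⟩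
    have hTk : ∀ R ∈ ℛ, U ⊆ R → a ∈ R → rk (lift p 0) (T R) = k + 1 := by
      intro R hR hUR haR
      have h1 : k < rk (lift p 0) (T R) := by
        rw [← hUk]
        exact rk_lt_of_ne_zero (hUT R hR hUR) hg0 ⟨haR, haa⟩ (hgZ a haZ).ne'
      have h2 : rk (lift p 0) (T R) ≤ rk (lift p 0) U + 1 := by
        have hsub : Submodule.span ℝ (lift p 0 '' (T R)) ≤
            K ⊔ Submodule.span ℝ {π (lift p 0 a)} := by
          rw [Submodule.span_le]
          rintro _ ⟨b, ⟨hbR, hb0⟩, rfl⟩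
          by_cases hbU : b ∈ U
          · exact Submodule.mem_sup_left (Submodule.subset_span (mem_image_of_mem _ hbU))
          · have hbZ : b ∈ Z := ⟨R, hR, hUR, hbR, hbU⟩
            have h3 := hπK (lift p 0 b)
            have h4 : π (lift p 0 b) ∈ Submodule.span ℝ {π (lift p 0 a)} := by
              rw [hπy b hbZ, heq b hbZ hb0]
              exact Submodule.smul_mem _ _
                (Submodule.smul_mem _ _ (Submodule.mem_span_singleton_self _))
            rw [SetLike.mem_coe, ← sub_add_cancel (lift p 0 b) (π (lift p 0 b))]
            exact Submodule.add_mem_sup h3 h4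
        refine (Submodule.finrank_mono hsub).trans
          ((Submodule.finrank_add_le_finrank_add_finrank _ _).trans ?_)
        exact Nat.add_le_add_left ((finrank_span_le_card _).trans (by simp)) _
      omega
    obtain ⟨R, hR, hUR, haR, haU⟩ := id haZ
    refine ⟨T R, hTL R hR hUR, g', hTk R hR hUR haR, ⟨R, hR, fun i hi => hi.1⟩,
      fun i hi => hi.2, fun R' hR' hTR' i hi hiT => ?_⟩
    have hUR' : U ⊆ R' := (hUT R hR hUR).trans hTR'
    have haR' : a ∈ R' := hTR' ⟨haR, haa⟩
    refine lt_of_le_of_ne (hnn R' hR' hUR' i hi) fun e => hiT ?_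
    obtain ⟨ε, hε⟩ := hp.exists_good
    have hsub : T R ⊆ T R' := fun j hj => ⟨hTR' hj, hj.2⟩
    have hTT := ((hε.rep _).1 (hTL R hR hUR)).eq_of_rk_le hsub
      (by rw [hε.rk _ (hTL R hR hUR), hε.rk _ (hTL R' hR' hUR'), hTk R hR hUR haR,
        hTk R' hR' hUR' haR'])
    rw [hTT]
    exact ⟨hi, e.symm⟩

end Bases

section LinkSurface

variable {ι W : Type*} [Fintype ι] [AddCommGroup W] [Module ℝ W] [FiniteDimensional ℝ W]
  {v : ι → W} {U G : Set ι}

/-- The faces between `U` and `G`, of rank four over `U`, form a combinatorial surface. -/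
theorem IsFace.exists_surf (hU : IsFace v U) (hG : IsFace v G) (hUG : U ⊆ G)
    (hr : rk v G = rk v U + 4) :
    ∃ M : Surf (ivl v U G 1) (ivl v U G 2) (ivl v U G 3),
      (∀ T R, M.vE T R ↔ T.1 ⊆ R.1) ∧
      ∀ T, ∃ a b, CycleEnum (fun (x : ivl v T.1 G 1) (y : ivl v T.1 G 2) => x.1 ⊆ y.1) (M.n T) a b ∧
        ∀ i, (M.ed T i).1 = (a i).1 := by
  have hcyc := fun T : ivl v U G 1 =>
    T.2.1.link_cycle hG T.2.2.2.1 (by rw [T.2.2.2.2, hr])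
  choose n a b h using hcyc
  have hss : U ⊂ G := hUG.ssubset_of_ne (by rintro rfl; omega)
  refine ⟨{
    vE := fun T R => T.1 ⊆ R.1
    eF := fun R F => R.1 ⊆ F.1
    n := n
    ed := fun T i => ⟨(a T i).1, ivl_trans T.2 (a T i).2⟩
    fa := fun T i => ⟨(b T i).1, ivl_trans T.2 (b T i).2⟩
    n_pos := fun T => by have := (h T).three_le; omega
    ed_per := fun T i => by simp only [(h T).per_a]
    fa_per := fun T i => by simp only [(h T).per_b]
    ed_inj := fun T i j h1 h2 e =>
      (h T).inj_a i j h1 h2 (Subtype.ext (Subtype.mk.inj e))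
    ed_mem := fun T R => ?_
    fa_ne := fun T i e => (h T).inj_b i (i + 1) (by omega) (by have := (h T).three_le; omega)
      (Subtype.ext (Subtype.mk.inj e))
    ed_fa := fun T i F => ?_
    ends := fun R => ?_
    vconn := fun 𝒱 hne hcl T => ?_
    fconn := fun ℱ hne hcl F => ?_ }, fun _ _ => Iff.rfl, fun T => ⟨a T, b T, h T, fun _ => rfl⟩⟩
  · constructor
    · intro hTR
      obtain ⟨i, hi, e⟩ := (h T).surj_a ⟨R.1, ivl_of_trans T.2 R.2 hTR⟩
      exact ⟨i, hi, Subtype.ext (by rw [e])⟩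
    · rintro ⟨i, -, rfl⟩
      exact (a T i).2.2.1
  · constructor
    · intro hRF
      have hTF : T.1 ⊆ F.1 := (a T (i + 1)).2.2.1.trans hRF
      rcases ((h T).inc_left ⟨F.1, ivl_of_trans T.2 F.2 hTF⟩ i).1 hRF with e | e
      · exact Or.inl (Subtype.ext (by rw [← e]))
      · exact Or.inr (Subtype.ext (by rw [← e]))
    · rintro (rfl | rfl)
      · exact ((h T).inc_left (b T i) i).2 (Or.inl rfl)
      · exact ((h T).inc_left (b T (i + 1)) i).2 (Or.inr rfl)
  · obtain ⟨R₁, R₂, hne, hiff⟩ := hU.diamond R.2.1 R.2.2.1 R.2.2.2.2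
    have hm : ∀ {A : Set ι}, A ∈ ivl v U R.1 1 → A ∈ ivl v U G 1 := fun hA =>
      ⟨hA.1, hA.2.1, hA.2.2.1.trans R.2.2.2.1, hA.2.2.2⟩
    refine ⟨⟨R₁, hm ((hiff R₁).2 (Or.inl rfl))⟩, ⟨R₂, hm ((hiff R₂).2 (Or.inr rfl))⟩,
      fun e => hne (congrArg Subtype.val e), fun T => ?_⟩
    rw [Subtype.ext_iff, Subtype.ext_iff, ← hiff]
    exact ⟨fun hTR => ⟨T.2.1, T.2.2.1, hTR, T.2.2.2.2⟩, fun hT => hT.2.2.1⟩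
  · have := hU.atoms_connected hG (𝒜 := Subtype.val '' 𝒱) ?_ ?_ T.1 T.2
    · obtain ⟨T', hT', e⟩ := this
      exact Subtype.ext e ▸ hT'
    · obtain ⟨T', hT'⟩ := hne
      exact ⟨T'.1, mem_image_of_mem _ hT', T'.2⟩
    · rintro _ ⟨A, hA, rfl⟩ B hB R hR h1 h2
      exact ⟨⟨B, hB⟩, hcl A hA ⟨R, hR⟩ ⟨B, hB⟩ h1 h2, rfl⟩
  · obtain ⟨F', hF'⟩ := hne
    have key := hU.facets_connected hG hss (𝒜 := Subtype.val '' ℱ) ?_ (mem_image_of_mem _ hF')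
      F'.2.1 F'.2.2.1 F'.2.2.2.1 (by have := F'.2.2.2.2; omega) F.2.1 F.2.2.1 F.2.2.2.1
      (by have := F.2.2.2.2; omega)
    · obtain ⟨F'', hF'', e⟩ := key
      exact Subtype.ext e ▸ hF''
    · rintro _ ⟨A, hA, rfl⟩ R B hR hUR hRA hRB - hB - hBG - hrB hrR
      have hBm : B ∈ ivl v U G 3 := ⟨hB, hUR.trans hRB, hBG, by omega⟩
      have hRm : R ∈ ivl v U G 2 := ⟨hR, hUR, hRB.trans hBG, by omega⟩
      exact ⟨⟨B, hBm⟩, hcl A hA ⟨R, hRm⟩ ⟨B, hBm⟩ hRA hRB, rfl⟩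

end LinkSurface

section RidgeSigns

variable {ι E : Type*} [NormedAddCommGroup E] [InnerProductSpace ℝ E] [FiniteDimensional ℝ E]
  [Fintype ι] {p p' : ι → E} {𝓛 : Set (Set ι)} {G U : Set ι}

/-- The central projection of a point from the span of `U` to the hyperplane `g = 1`. -/
noncomputable def centralProj (p : ι → E) (U : Set ι) (g : WithLp 2 (E × ℝ) →ₗ[ℝ] ℝ) (a : ι) :
    WithLp 2 (E × ℝ) :=
  (g (lift p 0 a))⁻¹ • ((Submodule.span ℝ (lift p 0 '' U))ᗮ).starProjection (lift p 0 a)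

omit [Fintype ι] in
theorem map_centralProj {g D : WithLp 2 (E × ℝ) →ₗ[ℝ] ℝ} (hD : ∀ i ∈ U, D (lift p 0 i) = 0) (a : ι) :
    D (centralProj p U g a) = (g (lift p 0 a))⁻¹ * D (lift p 0 a) := by
  have h := Submodule.sub_starProjection_mem_orthogonal
    (K := (Submodule.span ℝ (lift p 0 '' U))ᗮ) (lift p 0 a)
  rw [Submodule.orthogonal_orthogonal] at h
  have h1 := eq_zero_of_mem_span hD h
  rw [map_sub, sub_eq_zero] at h1
  rw [centralProj, map_smul, smul_eq_mul, h1]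

omit [Fintype ι] in
theorem centralProj_mem_openSegment {g : WithLp 2 (E × ℝ) →ₗ[ℝ] ℝ} {T : Set ι} {a b c : ι} {t : ℝ}
    (hUT : U ⊆ T) (hrk : rk (lift p 0) T ≤ rk (lift p 0) U + 1)
    (hgU : ∀ i ∈ U, g (lift p 0 i) = 0) (hgT : ∀ i ∈ T, i ∉ U → 0 < g (lift p 0 i))
    (ha : a ∈ T) (haU : a ∉ U) (hb : 0 < g (lift p 0 b)) (hc : 0 < g (lift p 0 c)) (ht : 0 < t)
    (h : ∀ φ : WithLp 2 (E × ℝ) →ₗ[ℝ] ℝ, (∀ x ∈ T, φ (lift p 0 x) = 0) →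
      φ (lift p 0 b) = -t * φ (lift p 0 c)) :
    centralProj p U g a ∈ openSegment ℝ (centralProj p U g b) (centralProj p U g c) := by
  have hga := hgT a ha haU
  have hpos : 0 < g (lift p 0 b) + t * g (lift p 0 c) := by positivity
  refine ⟨g (lift p 0 b) / (g (lift p 0 b) + t * g (lift p 0 c)),
    t * g (lift p 0 c) / (g (lift p 0 b) + t * g (lift p 0 c)), by positivity, by positivity,
    by field_simp, ?_⟩
  refine ext_inner_left ℝ fun w => ?_
  let π : WithLp 2 (E × ℝ) →ₗ[ℝ] WithLp 2 (E × ℝ) :=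
    (((Submodule.span ℝ (lift p 0 '' U))ᗮ).starProjection).toLinearMap
  let φ : WithLp 2 (E × ℝ) →ₗ[ℝ] ℝ := (innerSL ℝ w).toLinearMap ∘ₗ π
  have hφU : ∀ i ∈ U, φ (lift p 0 i) = 0 := fun i hi => by
    have : π (lift p 0 i) = 0 := by
      refine (Submodule.starProjection_apply_eq_zero_iff _).2 ?_
      rw [Submodule.orthogonal_orthogonal]
      exact Submodule.subset_span (mem_image_of_mem _ hi)
    simp [φ, this]
  have hφ : ∀ i, ⟪w, centralProj p U g i⟫ = (g (lift p 0 i))⁻¹ * φ (lift p 0 i) := fun i => by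
    rw [centralProj, real_inner_smul_right]
    rfl
  obtain ⟨k, hk⟩ := proportional hUT hrk hgU (fun i hi hi' => (hgT i hi hi').ne') hφU
  have h1 := h (φ - k • g) fun x hx => by simp [hk x hx]
  simp only [LinearMap.sub_apply, LinearMap.smul_apply, smul_eq_mul] at h1
  rw [inner_add_right, real_inner_smul_right, real_inner_smul_right, hφ, hφ, hφ, hk a ha]
  field_simp
  linarith

theorem Config.ridgeSign_eq_zero (hp : Config p 𝓛) (hp' : Config p' 𝓛) (hG : G ∈ 𝓛)
    (hΔ : ∀ F ∈ 𝓛, F ⊂ G → ∀ a ∈ F, ∀ b ∈ F, distortion p p' a b = 0)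
    (hr : 4 ≤ rk (lift p 0) G) {R₁ : Set ι} (hR₁ : R₁ ∈ 𝓛) (hR₁G : R₁ ⊆ G)
    (hrR₁ : rk (lift p 0) R₁ + 2 = rk (lift p 0) G) : ridgeSign p p' 𝓛 G R₁ = 0 := by
  classical
  by_contra hcon
  obtain ⟨m, hm⟩ := Nat.exists_eq_add_of_le' hr
  let ℛ : Set (Set ι) := {R | R ∈ 𝓛 ∧ R ⊆ G ∧ rk (lift p 0) R + 2 = rk (lift p 0) G ∧
    ridgeSign p p' 𝓛 G R ≠ 0}
  have hne_univ : ∀ {R : Set ι}, R ⊆ G → rk (lift p 0) R < rk (lift p 0) G → R ≠ univ := by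
    rintro _ hRG hlt rfl
    rw [univ_subset_iff.1 hRG] at hlt
    exact lt_irrefl _ hlt
  obtain ⟨U, hU, g, hUm, ⟨R₀, hR₀, hUR₀⟩, hgU, hg⟩ := hp.exists_base (ℛ := ℛ) (m := m)
    ⟨R₁, hR₁, hR₁G, hrR₁, hcon⟩
    (fun R hR => ⟨hR.1, hne_univ hR.2.1 (by have := hR.2.2.1; omega), by have := hR.2.2.1; omega⟩)
    (le_refl m)
  obtain ⟨ε, hε⟩ := hp.exists_good
  have hUG : U ⊆ G := hUR₀.trans hR₀.2.1
  have hUf := (hε.rep _).1 hU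
  have hGf := (hε.rep _).1 hG
  obtain ⟨M, hM, hMc⟩ := hUf.exists_surf hGf hUG (by rw [hε.rk _ hG, hε.rk _ hU]; omega)
  have hU0 := ivl_left hUf hUG
  let V := ivl (lift p ε) U G 1
  have hV : ∀ T : V, T.1 ∈ 𝓛 ∧ U ⊆ T.1 ∧ T.1 ⊆ G ∧ rk (lift p 0) T.1 = m + 1 := fun T => by
    have := (hε.mem_ivl hU).1 T.2
    rwa [hUm] at this
  have hE : ∀ R : ivl (lift p ε) U G 2, R.1 ∈ 𝓛 ∧ U ⊆ R.1 ∧ R.1 ⊆ G ∧ rk (lift p 0) R.1 = m + 2 :=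
    fun R => by
      have := (hε.mem_ivl hU).1 R.2
      rwa [hUm] at this
  have hch : ∀ T : V, ∃ a ∈ T.1, a ∉ U := fun T => exists_mem_notMem_of_ivl T.2
  choose ch hchT hchU using hch
  have hcap : ∀ {S T : V}, S ≠ T → S.1 ∩ T.1 = U := fun {S T} h =>
    ivl_inter hU0 S.2 T.2 S.2.2.1 T.2.2.1 fun e => h (Subtype.ext (ivl_eq_of_subset S.2 T.2 e))
  have hchne : ∀ {S T : V}, S ≠ T → ch S ∉ T.1 := fun {S T} h hS =>
    hchU S ((hcap h).subset ⟨hchT S, hS⟩)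
  let lam : ivl (lift p ε) U G 2 → SignType := fun R => ridgeSign p p' 𝓛 G R.1
  have hgR : ∀ R : ivl (lift p ε) U G 2, lam R ≠ 0 → ∀ i ∈ R.1, i ∉ U → 0 < g (lift p 0 i) :=
    fun R hR => hg R.1 ⟨(hE R).1, (hE R).2.2.1, by rw [(hE R).2.2.2, hm], hR⟩ (hE R).2.1
  let x : V → WithLp 2 (E × ℝ) := fun T => centralProj p U g (ch T)
  have hnu : ∀ R : ivl (lift p ε) U G 2, R.1 ≠ univ := fun R =>
    hne_univ (hE R).2.2.1 (by rw [(hE R).2.2.2]; omega)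
  have hnu' : ∀ T : V, T.1 ≠ univ := fun T =>
    hne_univ (hV T).2.2.1 (by rw [(hV T).2.2.2]; omega)
  refine hR₀.2.2.2 (M.eq_zero (lam := lam) (x := x)
    (card_edges_add_two_le hUf hGf hUG (by rw [hε.rk _ hG, hε.rk _ hU]; omega)) ?_ ?_ ?_
    ⟨R₀, (hε.mem_ivl hU).2 ⟨hR₀.1, hUR₀, hR₀.2.1, by have := hR₀.2.2.1; omega⟩⟩)
  · intro S T R hne hS hT hR he
    rw [hM] at hS hT
    obtain ⟨D, h1, -, h3⟩ := hp.exists_sep (hE R).1 (hV T).1 (hnu R) (hnu' T)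
    have hDU : ∀ i ∈ U, D (lift p 0 i) = 0 := fun i hi => h3 i ((hE R).2.1 hi) ((hV T).2.1 hi)
    have h4 := congrArg D he
    rw [map_centralProj hDU, map_centralProj hDU, h3 _ (hT (hchT T)) (hchT T), mul_zero] at h4
    have h5 := h1 _ (hS (hchT S)) (hchne hne)
    have h6 := hgR R hR _ (hS (hchT S)) (hchU S)
    exact (mul_pos (inv_pos.2 h6) h5).ne' h4
  · rintro T R₁ R₂ S₁ S₂ hT₁ hT₂ hR₁ hR₂ hne₁ hne₂ hS₁ hS₂ ⟨s, hs, he⟩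
    rw [hM] at hT₁ hT₂ hS₁ hS₂
    by_contra hne
    have hinter : R₁.1 ∩ R₂.1 = T.1 := ivl_inter T.2 R₁.2 R₂.2 hT₁ hT₂ fun e =>
      hne (Subtype.ext (ivl_eq_of_subset R₁.2 R₂.2 e))
    obtain ⟨D, h1, h2, h3⟩ := hp.exists_sep (hE R₁).1 (hE R₂).1 (hnu _) (hnu _)
    have hDU : ∀ i ∈ U, D (lift p 0 i) = 0 := fun i hi => h3 i ((hE R₁).2.1 hi) ((hE R₂).2.1 hi)
    have h4 := congrArg D he
    simp only [x] at h4
    rw [map_smul, map_sub, map_sub, map_centralProj hDU, map_centralProj hDU, map_centralProj hDU,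
      h3 _ (hT₁ (hchT T)) (hT₂ (hchT T)), mul_zero, sub_zero, sub_zero, smul_eq_mul] at h4
    have h5 := h1 _ (hS₁ (hchT S₁)) fun h => hchne hne₁ (hinter.subset ⟨hS₁ (hchT S₁), h⟩)
    have h6 := h2 _ (hS₂ (hchT S₂)) fun h => hchne hne₂ (hinter.subset ⟨h, hS₂ (hchT S₂)⟩)
    have h7 := mul_pos (inv_pos.2 (hgR R₁ hR₁ _ (hS₁ (hchT S₁)) (hchU S₁))) h5
    have h8 := mul_neg_of_pos_of_neg (inv_pos.2 (hgR R₂ hR₂ _ (hS₂ (hchT S₂)) (hchU S₂))) h6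
    have h9 := mul_neg_of_pos_of_neg hs h8
    linarith
  · intro T
    obtain ⟨a, b, hcyc, hed⟩ := hMc T
    have hoth : ∀ R : Set ι, ∃ S : V, R ∈ ivl (lift p ε) T.1 G 1 → S ≠ T ∧ S.1 ⊆ R := fun R => by
      by_cases hR : R ∈ ivl (lift p ε) T.1 G 1
      · obtain ⟨S₁, S₂, hne, hiff⟩ := M.ends ⟨R, ivl_trans T.2 hR⟩
        have h1 := (hM _ _).1 ((hiff S₁).2 (Or.inl rfl))
        have h2 := (hM _ _).1 ((hiff S₂).2 (Or.inr rfl))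
        by_cases h : S₁ = T
        · exact ⟨S₂, fun _ => ⟨fun h' => hne (h.trans h'.symm), h2⟩⟩
        · exact ⟨S₁, fun _ => ⟨h, h1⟩⟩
      · exact ⟨T, fun h => absurd h hR⟩
    choose o ho using hoth
    have hlam : ∀ i, lam (M.ed T i) = ridgeSign p p' 𝓛 G (a i).1 := fun i => by
      simp only [lam, hed]
    rcases hp.vertex_type hp' hG hΔ (hV T).1 ⟨_, hchT T⟩ (hV T).2.2.1 (by rw [(hV T).2.2.2, hm]) hε
      hcyc (c := fun R => ch (o R)) (fun R hR => ⟨(ho R hR).2 (hchT _), hchne (ho R hR).1⟩) with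
      h | ⟨i, j, k, l, hij, hjk, hkl, hli, h1, h2, h3, h4⟩ |
        ⟨i, j, hij, hji, h1, h2, h3, h4, t, ht, h5⟩
    · refine Or.inl fun R hR => ?_
      obtain ⟨i, -, rfl⟩ := (M.ed_mem _ _).1 hR
      rw [hlam, h]
    · exact Or.inr (Or.inl ⟨i, j, k, l, hij, hjk, hkl, hli, by rw [hlam, h1], by rw [hlam, h2],
        by rw [hlam, h3], by rw [hlam, h4]⟩)
    · have hi0 : lam (M.ed T i) ≠ 0 := by rwa [hlam]
      have hj0 : lam (M.ed T j) ≠ 0 := by rwa [hlam, ← h3]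
      have hTi : T.1 ⊆ (M.ed T i).1 := (hM _ _).1 (M.vE_ed T i)
      have hoi : ∀ i, (o (a i).1).1 ⊆ (M.ed T i).1 := fun i => by
        rw [hed]; exact (ho _ (a i).2).2
      refine Or.inr (Or.inr ⟨M.ed T i, M.ed T j, M.vE_ed _ _, M.vE_ed _ _,
        M.ed_inj T i j hij hji, fun R hR hRi hRj => ?_, by rw [hlam, hlam, h3], hi0,
        o (a i).1, o (a j).1, (ho _ (a i).2).1, (ho _ (a j).2).1, (hM _ _).2 (hoi i),
        (hM _ _).2 (hoi j), ?_⟩)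
      · obtain ⟨k, -, rfl⟩ := (M.ed_mem _ _).1 hR
        obtain ⟨k', hk, hk', s, t, hst⟩ := exists_rep (M.n T) (M.n_pos T) i k
        have he : M.ed T k' = M.ed T k := by
          rw [← M.ed_per_mul T k' s, hst, M.ed_per_mul]
        rw [← he] at hRi hRj ⊢
        rw [hlam]
        rcases lt_trichotomy k' j with h | h | h
        · exact h1 k' (lt_of_le_of_ne hk fun e => hRi (by rw [e])) h
        · exact absurd (by rw [h]) hRj
        · exact h2 k' h hk'
      · exact centralProj_mem_openSegment (hV T).2.1 (by rw [(hV T).2.2.2, hUm]) hgU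
          (fun i hi => hgR _ hi0 i (hTi hi)) (hchT T) (hchU T)
          (hgR _ hi0 _ (hoi i (hchT _)) (hchU _)) (hgR _ hj0 _ (hoi j (hchT _)) (hchU _)) ht h5

end RidgeSigns

section Gluing

variable {ι E : Type*} [NormedAddCommGroup E] [InnerProductSpace ℝ E] [FiniteDimensional ℝ E]
  [Fintype ι] {p p' : ι → E} {𝓛 : Set (Set ι)} {G : Set ι}

theorem Config.distortion_eq_zero_of_adjacent (hp : Config p 𝓛) (hp' : Config p' 𝓛) (hG : G ∈ 𝓛)
    (hΔ : ∀ F ∈ 𝓛, F ⊂ G → ∀ a ∈ F, ∀ b ∈ F, distortion p p' a b = 0)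
    (hr : 4 ≤ rk (lift p 0) G) {R A B : Set ι} (hR : R ∈ 𝓛) (hA : A ∈ 𝓛) (hB : B ∈ 𝓛)
    (hRA : R ⊆ A) (hRB : R ⊆ B) (hAG : A ⊂ G) (hBG : B ⊂ G)
    (hrR : rk (lift p 0) R + 2 = rk (lift p 0) G) (hrA : rk (lift p 0) A + 1 = rk (lift p 0) G)
    (hrB : rk (lift p 0) B + 1 = rk (lift p 0) G) {a b : ι} (ha : a ∈ A) (hb : b ∈ B) :
    distortion p p' a b = 0 := by
  by_cases hAB : A = B
  · exact hΔ A hA hAG a ha b (hAB ▸ hb)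
  by_cases haR : a ∈ R
  · exact hΔ B hB hBG a (hRB haR) b hb
  by_cases hbR : b ∈ R
  · exact hΔ A hA hAG a ha b (hRA hbR)
  have h := hp.ridgeSign_eq hG hΔ hR (hRA.trans hAG.1) hrR.symm
    ⟨A, B, hA, hB, hAB, hRA, hRB, hAG, hBG, by omega, by omega, ha, haR, hb, hbR⟩
  rw [hp.ridgeSign_eq_zero hp' hG hΔ hr hR (hRA.trans hAG.1) hrR] at h
  exact sign_eq_zero_iff.1 h.symm

/-- A face of rank at least four is rigid as soon as its proper faces are. -/
theorem Config.distortion_eq_zero_of_proper (hp : Config p 𝓛) (hp' : Config p' 𝓛) (hG : G ∈ 𝓛)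
    (hΔ : ∀ F ∈ 𝓛, F ⊂ G → ∀ a ∈ F, ∀ b ∈ F, distortion p p' a b = 0)
    (hr : 4 ≤ rk (lift p 0) G) {a b : ι} (ha : a ∈ G) (hb : b ∈ G) : distortion p p' a b = 0 := by
  obtain ⟨ε, hε⟩ := hp.exists_good
  have hGf := (hε.rep _).1 hG
  have hss : ∀ i ∈ G, {i} ⊂ G := fun i hi => by
    refine (singleton_subset_iff.2 hi).ssubset_of_ne fun e => ?_
    have h1 : rk (lift p 0) {i} ≤ 1 := by
      rw [rk, image_singleton]; exact (finrank_span_le_card _).trans (by simp)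
    rw [e] at h1
    omega
  obtain ⟨A, hA, haA, hAG, hrA⟩ := ((hε.rep _).1 (hp.singles a)).exists_cocover hGf (hss a ha)
  obtain ⟨B, hB, hbB, hBG, hrB⟩ := ((hε.rep _).1 (hp.singles b)).exists_cocover hGf (hss b hb)
  have hAne : A.Nonempty := ⟨a, haA rfl⟩
  have key : B ∈ {B : Set ι | ∀ a ∈ A, ∀ b ∈ B, distortion p p' a b = 0} := by
    refine hε.empty_mem.facets_connected hGf (empty_ssubset.2 ⟨a, ha⟩)
      (𝒜 := {B : Set ι | ∀ a ∈ A, ∀ b ∈ B, distortion p p' a b = 0}) ?_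
      (hΔ A ((hε.rep _).2 hA) hAG) hA (empty_subset _) hAG.1 hrA hB (empty_subset _) hBG.1 hrB
    rintro B hB𝒜 R B' hR - hRB hRB' hB hB' hBG hB'G hrB hrB' hrR x hx y hy
    have hBL := (hε.rep _).2 hB
    have hBL' := (hε.rep _).2 hB'
    have hRL := (hε.rep _).2 hR
    rw [hε.rk _ hBL, hε.rk _ hG] at hrB
    rw [hε.rk _ hBL', hε.rk _ hG] at hrB'
    rw [hε.rk _ hRL, hε.rk _ hG] at hrR
    have hBss : B ⊂ G := hBG.ssubset_of_ne (by rintro rfl; omega)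
    have hBss' : B' ⊂ G := hB'G.ssubset_of_ne (by rintro rfl; omega)
    have hBne : B.Nonempty := by
      rw [nonempty_iff_ne_empty]
      rintro rfl
      have : rk (lift p 0) ∅ = 0 := by simp [rk]
      omega
    refine hp.distortion_eq_zero_of_facet hp' hBL hG hBss hBne hrB.symm (hΔ B hBL hBss)
      (hAG.1 hx) (hB'G hy) (fun z hz => ?_) fun z hz =>
        hp.distortion_eq_zero_of_adjacent hp' hG hΔ hr hRL hBL hBL' hRB hRB' hBss hBss' hrR hrB
          hrB' hz hy
    rw [distortion_comm]
    exact hB𝒜 x hx z hz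
  exact key a (haA rfl) b (hbB rfl)

end Gluing

/-! ### Inscribed polygons -/

section Inscribed

/-- A polygonal cone over a polygon inscribed in a horizontal circle. -/
structure IsInscribed (n : ℕ) (P : ℕ → E3) (h τ : ℝ) : Prop where
  isCone : IsCone n P
  height : ∀ i, P i 2 = h
  height_ne : h ≠ 0
  norm : ∀ i, ⟪P i, P i⟫ = τ

variable {n : ℕ} {P Q : ℕ → E3} {h h' τ : ℝ}

theorem IsInscribed.circle (hP : IsInscribed n P h τ) (i : ℕ) :
    P i 0 * P i 0 + P i 1 * P i 1 = τ - h * h := by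
  have := hP.norm i
  simp only [PiLp.inner_apply, Fin.sum_univ_three, RCLike.inner_apply, conj_trivial,
    hP.height] at this
  linarith

theorem eq_zero_of_sum_sq {x y : ℝ} (h : x ^ 2 + y ^ 2 = 0) : x = 0 ∧ y = 0 := by
  have h1 := sq_nonneg x
  have h2 := sq_nonneg y
  exact ⟨pow_eq_zero_iff two_ne_zero |>.1 (by linarith),
    pow_eq_zero_iff two_ne_zero |>.1 (by linarith)⟩

theorem eq_of_sum_sq_sub {x y z w : ℝ} (h : (x - y) ^ 2 + (z - w) ^ 2 = 0) : y = x ∧ w = z :=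
  ⟨(sub_eq_zero.1 (eq_zero_of_sum_sq h).1).symm, (sub_eq_zero.1 (eq_zero_of_sum_sq h).2).symm⟩

theorem cross_ne_zero_of_circle {ρ a₁ a₂ b₁ b₂ c₁ c₂ : ℝ} (ha : a₁ * a₁ + a₂ * a₂ = ρ)
    (hb : b₁ * b₁ + b₂ * b₂ = ρ) (hc : c₁ * c₁ + c₂ * c₂ = ρ)
    (h0 : (b₁ - a₁) * (c₂ - a₂) - (b₂ - a₂) * (c₁ - a₁) = 0) :
    (a₁ = b₁ ∧ a₂ = b₂) ∨ (a₁ = c₁ ∧ a₂ = c₂) ∨ (b₁ = c₁ ∧ b₂ = c₂) := by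
  have key : ((b₁ - a₁) ^ 2 + (b₂ - a₂) ^ 2) * ((c₁ - a₁) ^ 2 + (c₂ - a₂) ^ 2) *
      ((c₁ - b₁) ^ 2 + (c₂ - b₂) ^ 2) = 0 := by
    have e1 : (b₁ - a₁) ^ 2 + (b₂ - a₂) ^ 2 = -2 * (a₁ * (b₁ - a₁) + a₂ * (b₂ - a₂)) := by
      linear_combination hb - ha
    have e2 : (c₁ - a₁) ^ 2 + (c₂ - a₂) ^ 2 = -2 * (a₁ * (c₁ - a₁) + a₂ * (c₂ - a₂)) := by
      linear_combination hc - ha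
    by_contra hne
    have hu : (b₁ - a₁) ^ 2 + (b₂ - a₂) ^ 2 ≠ 0 := fun h => hne (by rw [h]; ring)
    have hw : (c₁ - b₁) ^ 2 + (c₂ - b₂) ^ 2 ≠ 0 := fun h => hne (by rw [h]; ring)
    set u := b₁ - a₁
    set v := b₂ - a₂
    set x := c₁ - a₁
    set y := c₂ - a₂
    set U := u ^ 2 + v ^ 2
    have k1 : U * x = (u * x + v * y) * u := by
      simp only [U]; linear_combination (-v) * h0
    have k2 : U * y = (u * x + v * y) * v := by
      simp only [U]; linear_combination u * h0
    have k3 : U * (x ^ 2 + y ^ 2) = (u * x + v * y) ^ 2 := by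
      linear_combination x * k1 + y * k2
    have k4 : U * (x ^ 2 + y ^ 2) = (u * x + v * y) * U := by
      linear_combination U * e2 - 2 * a₁ * k1 - 2 * a₂ * k2 - (u * x + v * y) * e1
    have k5 : (u * x + v * y) * (u * x + v * y - U) = 0 := by linear_combination k4 - k3
    rcases mul_eq_zero.1 k5 with h | h
    · rw [h] at k3
      refine hne ?_
      rw [k3]; ring
    · have : x = u ∧ y = v := by
        have h' : u * x + v * y = U := by linarith
        rw [h'] at k1 k2
        exact ⟨mul_left_cancel₀ hu k1, mul_left_cancel₀ hu k2⟩
      refine hw ?_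
      have e3 : c₁ - b₁ = x - u := by simp only [x, u]; ring
      have e4 : c₂ - b₂ = y - v := by simp only [y, v]; ring
      rw [e3, e4, this.1, this.2]; ring
  rcases mul_eq_zero.1 key with h | h
  · rcases mul_eq_zero.1 h with h | h
    · exact Or.inl (eq_of_sum_sq_sub h)
    · exact Or.inr (Or.inl (eq_of_sum_sq_sub h))
  · exact Or.inr (Or.inr (eq_of_sum_sq_sub h))

theorem IsInscribed.ne (hP : IsInscribed n P h τ) {i j : ℕ} (h1 : i < j) (h2 : j < i + n) :
    P i ≠ P j := fun e => hP.isCone.ne i j h1 h2 1 one_pos (by rw [one_smul, e])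

theorem IsInscribed.ext (hP : IsInscribed n P h τ) {i j : ℕ} (h0 : P i 0 = P j 0)
    (h1 : P i 1 = P j 1) : P i = P j := by
  ext k
  fin_cases k
  · exact h0
  · exact h1
  · exact (hP.height i).trans (hP.height j).symm

theorem IsInscribed.pos (hP : IsInscribed n P h τ) {i j : ℕ} (h1 : i + 1 < j) (h2 : j < i + n) :
    0 < det3 (P i) (P (i + 1)) (P j) := by
  refine lt_of_le_of_ne (hP.isCone.nonneg i j) fun h0 => ?_
  have hd : h * ((P (i + 1) 0 - P i 0) * (P j 1 - P i 1) -
      (P (i + 1) 1 - P i 1) * (P j 0 - P i 0)) = 0 := by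
    rw [h0]
    simp only [det3, hP.height]
    ring
  rcases cross_ne_zero_of_circle (hP.circle i) (hP.circle (i + 1)) (hP.circle j)
    ((mul_eq_zero.1 hd).resolve_left hP.height_ne) with e | e | e
  · exact hP.ne (by omega) (by omega) (hP.ext e.1 e.2)
  · exact hP.ne (by omega) (by omega) (hP.ext e.1 e.2)
  · exact hP.ne h1 (by omega) (hP.ext e.1 e.2)

theorem IsInscribed.strictAt (hP : IsInscribed n P h τ) (i : ℕ) : StrictAt P i := by
  have := hP.isCone.three_le
  exact hP.pos (by omega) (by omega)

theorem IsInscribed.noPar (hP : IsInscribed n P h τ) (i : ℕ) : NoPar n P i := by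
  refine hP.isCone.noPar ?_
  rintro b - - ⟨t, ht, e⟩
  have := congrArg (fun v : E3 => v 2) e
  simp only [PiLp.smul_apply, smul_eq_mul, hP.height] at this
  have h2 : h * (1 + t) = 0 := by linarith
  rcases mul_eq_zero.1 h2 with h2 | h2
  · exact hP.height_ne h2
  · linarith

/-- The point of the axis at the height of an inscribed polygon. -/
noncomputable def axis (h : ℝ) : E3 := EuclideanSpace.single 2 h

theorem IsInscribed.inner_axis (hP : IsInscribed n P h τ) (i : ℕ) (x : ℝ) :
    ⟪axis x, P i⟫ = x * h := by
  simp [axis, hP.height, mul_comm, EuclideanSpace.inner_single_left]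

/-- The center of the circle cannot lie on the wrong side of two sides. -/
theorem center_exclusion {ρ h a₁ a₂ b₁ b₂ c₁ c₂ d₁ d₂ : ℝ} (ha : a₁ * a₁ + a₂ * a₂ = ρ)
    (hb : b₁ * b₁ + b₂ * b₂ = ρ) (hc : c₁ * c₁ + c₂ * c₂ = ρ) (hd : d₁ * d₁ + d₂ * d₂ = ρ)
    (h1 : h * (a₁ * b₂ - a₂ * b₁) ≤ 0) (h2 : h * (c₁ * d₂ - c₂ * d₁) ≤ 0)
    (h3 : 0 < h * ((a₂ - b₂) * (c₁ + d₁) + (b₁ - a₁) * (c₂ + d₂) + 2 * (a₁ * b₂ - a₂ * b₁)))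
    (h4 : 0 < h * ((c₂ - d₂) * (a₁ + b₁) + (d₁ - c₁) * (a₂ + b₂) + 2 * (c₁ * d₂ - c₂ * d₁))) :
    False := by
  set u := -(h * (a₁ * b₂ - a₂ * b₁)) with hu
  set v := -(h * (c₁ * d₂ - c₂ * d₁)) with hv
  set A := (h * (a₂ - b₂)) ^ 2 + (h * (b₁ - a₁)) ^ 2 with hA
  set B := (h * (c₂ - d₂)) ^ 2 + (h * (d₁ - c₁)) ^ 2 with hB
  set k := h * (a₂ - b₂) * (h * (c₂ - d₂)) + h * (b₁ - a₁) * (h * (d₁ - c₁)) with hk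
  have ea1 : (a₁ + b₁) * A = 2 * u * (h * (a₂ - b₂)) := by
    rw [hA, hu]
    linear_combination h ^ 2 * (a₁ - b₁) * (ha - hb)
  have ea2 : (a₂ + b₂) * A = 2 * u * (h * (b₁ - a₁)) := by
    rw [hA, hu]
    linear_combination h ^ 2 * (a₂ - b₂) * (ha - hb)
  have ec1 : (c₁ + d₁) * B = 2 * v * (h * (c₂ - d₂)) := by
    rw [hB, hv]
    linear_combination h ^ 2 * (c₁ - d₁) * (hc - hd)
  have ec2 : (c₂ + d₂) * B = 2 * v * (h * (d₁ - c₁)) := by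
    rw [hB, hv]
    linear_combination h ^ 2 * (c₂ - d₂) * (hc - hd)
  have hA0 : 0 < A := by
    refine lt_of_le_of_ne (by positivity) fun e => ?_
    obtain ⟨e1, e2⟩ := eq_zero_of_sum_sq e.symm
    have : 0 < -2 * u := by
      calc (0 : ℝ) < _ := h3
        _ = h * (a₂ - b₂) * (c₁ + d₁) + h * (b₁ - a₁) * (c₂ + d₂) - 2 * u := by rw [hu]; ring
        _ = -2 * u := by rw [e1, e2]; ring
    linarith
  have hB0 : 0 < B := by
    refine lt_of_le_of_ne (by positivity) fun e => ?_
    obtain ⟨e1, e2⟩ := eq_zero_of_sum_sq e.symm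
    have : 0 < -2 * v := by
      calc (0 : ℝ) < _ := h4
        _ = h * (c₂ - d₂) * (a₁ + b₁) + h * (d₁ - c₁) * (a₂ + b₂) - 2 * v := by rw [hv]; ring
        _ = -2 * v := by rw [e1, e2]; ring
    linarith
  have g1 : u * B < v * k := by
    have := mul_pos h3 hB0
    have e : h * ((a₂ - b₂) * (c₁ + d₁) + (b₁ - a₁) * (c₂ + d₂) + 2 * (a₁ * b₂ - a₂ * b₁)) * B =
        2 * (v * k - u * B) := by
      rw [hk]
      linear_combination (h * (a₂ - b₂)) * ec1 + (h * (b₁ - a₁)) * ec2 + 2 * B * hu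
    linarith
  have g2 : v * A < u * k := by
    have := mul_pos h4 hA0
    have e : h * ((c₂ - d₂) * (a₁ + b₁) + (d₁ - c₁) * (a₂ + b₂) + 2 * (c₁ * d₂ - c₂ * d₁)) * A =
        2 * (u * k - v * A) := by
      rw [hk]
      linear_combination (h * (c₂ - d₂)) * ea1 + (h * (d₁ - c₁)) * ea2 + 2 * A * hv
    linarith
  have hu0 : 0 ≤ u := by linarith
  have hv0 : 0 ≤ v := by linarith
  have hcs : k ^ 2 ≤ A * B := by
    have : A * B - k ^ 2 =
        (h * (a₂ - b₂) * (h * (d₁ - c₁)) - h * (b₁ - a₁) * (h * (c₂ - d₂))) ^ 2 := by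
      rw [hA, hB, hk]; ring
    exact sub_nonneg.1 (this ▸ sq_nonneg _)
  have hvk : 0 < v * k := lt_of_le_of_lt (mul_nonneg hu0 hB0.le) g1
  have huk : 0 < u * k := lt_of_le_of_lt (mul_nonneg hv0 hA0.le) g2
  have hv1 : 0 < v := lt_of_le_of_ne hv0 fun e => by rw [← e] at hvk; simp at hvk
  have hu1 : 0 < u := lt_of_le_of_ne hu0 fun e => by rw [← e] at huk; simp at huk
  have : u * B * (v * A) < v * k * (u * k) :=
    mul_lt_mul g1 g2.le (mul_pos hv1 hA0) hvk.le
  have := mul_le_mul_of_nonneg_left hcs (mul_pos hu1 hv1).le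
  linarith

theorem IsInscribed.exceptional_unique (hP : IsInscribed n P h τ) {i j : ℕ} (hij : i < j)
    (hji : j < i + n) (hi : det3 (P i) (P (i + 1)) (axis h) ≤ 0) :
    0 < det3 (P j) (P (j + 1)) (axis h) := by
  by_contra! hj
  have hn := hP.isCone.three_le
  have h3 : 0 < det3 (P i) (P (i + 1)) (P j) + det3 (P i) (P (i + 1)) (P (j + 1)) := by
    rcases (show i + 1 < j ∨ j = i + 1 by omega) with hh | rfl
    · exact add_pos_of_pos_of_nonneg (hP.pos hh hji) (hP.isCone.nonneg _ _)
    · exact add_pos_of_nonneg_of_pos (hP.isCone.nonneg _ _) (hP.pos (by omega) (by omega))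
  have h4 : 0 < det3 (P j) (P (j + 1)) (P i) + det3 (P j) (P (j + 1)) (P (i + 1)) := by
    rw [← hP.isCone.per i, ← hP.isCone.per (i + 1)]
    rcases (show j + 1 < i + n ∨ i + n = j + 1 by omega) with hh | hh
    · exact add_pos_of_pos_of_nonneg (hP.pos hh (by omega)) (hP.isCone.nonneg _ _)
    · exact add_pos_of_nonneg_of_pos (hP.isCone.nonneg _ _) (hP.pos (by omega) (by omega))
  simp only [det3, axis, hP.height, PiLp.single_apply] at hi hj h3 h4
  simp at hi hj
  refine center_exclusion (h := h) (hP.circle i) (hP.circle (i + 1)) (hP.circle j)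
    (hP.circle (j + 1)) ?_ ?_ ?_ ?_ <;> nlinarith

theorem IsInscribed.turn_nonpos (hP : IsInscribed n P h τ) (hQ : IsInscribed n Q h' τ)
    (hc : Compat P Q) (hh : h' * h' ≤ h * h) {k : ℕ}
    (h1 : 0 < det3 (Q k) (Q (k + 1)) (axis h'))
    (h2 : 0 < det3 (Q (k + 1)) (Q (k + 2)) (axis h')) : turn P Q k ≤ 0 := by
  set α := det3 (Q (k + 1)) (Q (k + 2)) (axis h')
  set γ := det3 (Q k) (Q (k + 2)) (axis h')
  set β := det3 (Q k) (Q (k + 1)) (axis h')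
  set δ := det3 (Q k) (Q (k + 1)) (Q (k + 2))
  have hg := det3_grassmann (Q k) (Q (k + 1)) (Q (k + 2)) (axis h')
  have e0 : α • Q k + (-γ) • Q (k + 1) + β • Q (k + 2) + (0 : ℝ) • Q k = δ • axis h' := by
    rw [sub_eq_zero] at hg
    rw [← hg]; module
  have e1 := inner_self_comb4 (Q k) (Q (k + 1)) (Q (k + 2)) (Q k) α (-γ) β 0
  have e2 := inner_self_comb4 (P k) (P (k + 1)) (P (k + 2)) (P k) α (-γ) β 0
  have hz := congrArg (fun v : E3 => v 2) e0
  simp only [PiLp.add_apply, PiLp.smul_apply, smul_eq_mul, hQ.height, axis,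
    PiLp.single_apply, if_true] at hz
  have hz' : α - γ + β = δ := mul_right_cancel₀ hQ.height_ne (by linear_combination hz)
  rw [e0, real_inner_smul_left, real_inner_smul_right] at e1
  have ha : ⟪axis h', axis h'⟫ = h' * h' := by
    simp [axis, sq]
  rw [ha] at e1
  have hlow : (δ * h) ^ 2 ≤ ⟪α • P k + (-γ) • P (k + 1) + β • P (k + 2) + (0 : ℝ) • P k,
      α • P k + (-γ) • P (k + 1) + β • P (k + 2) + (0 : ℝ) • P k⟫ := by
    set w := α • P k + (-γ) • P (k + 1) + β • P (k + 2) + (0 : ℝ) • P k with hw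
    have hw2 : w 2 = δ * h := by
      simp only [hw, PiLp.add_apply, PiLp.smul_apply, smul_eq_mul, hP.height, ← hz']
      ring
    simp only [PiLp.inner_apply, Fin.sum_univ_three, RCLike.inner_apply, conj_trivial, hw2]
    nlinarith [mul_self_nonneg (w 0), mul_self_nonneg (w 1)]
  have s0 := hc.succ k
  have s1 := hc.succ (k + 1)
  rw [show k + 1 + 1 = k + 2 from rfl] at s1
  rw [e2, hP.norm, hP.norm, hP.norm, s0, s1] at hlow
  rw [hQ.norm, hQ.norm, hQ.norm] at e1
  have hαβ : 0 < α * β := mul_pos h2 h1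
  have hkey : α * β * turn P Q k ≤ 0 := by
    rw [turn]
    nlinarith [mul_nonneg (sq_nonneg δ) (sub_nonneg.2 hh)]
  exact nonpos_of_mul_nonpos_right hkey hαβ

theorem IsInscribed.chg_eq_zero_of_le (hP : IsInscribed n P h τ) (hQ : IsInscribed n Q h' τ)
    (hc : Compat P Q) (hh : h' * h' ≤ h * h) (i j : ℕ) : chg P Q i j = 0 := by
  have hn := hP.isCone.three_le
  obtain ⟨a, ha⟩ : ∃ a, ∀ k, a < k → k < a + n → 0 < det3 (Q k) (Q (k + 1)) (axis h') := by
    by_cases hex : ∃ a, det3 (Q a) (Q (a + 1)) (axis h') ≤ 0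
    · obtain ⟨a, ha⟩ := hex
      exact ⟨a, fun k h1 h2 => hQ.exceptional_unique h1 h2 ha⟩
    · push Not at hex
      exact ⟨0, fun k _ _ => hex k⟩
  have hle : ∀ k, a < k → k < a + (n - 1) → turn P Q k ≤ 0 := fun k h1 h2 =>
    hP.turn_nonpos hQ hc hh (ha k h1 (by omega)) (ha (k + 1) (by omega) (by omega))
  have hz : ∀ k, a < k → k < a + (n - 1) → turn P Q k = 0 := by
    refine (hc.arm_left hP.isCone (by omega) (by omega) (hP.strictAt a) (hP.noPar a) hle).2 ?_
    rw [show a + (n - 1) + 1 = a + n by omega, hP.isCone.chg_per hQ.isCone, chg_comm, hc.chg_succ]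
  have hsub : ∀ s t, a ≤ s → s < t → t < a + n → chg P Q (s + 1) (t + 1) = 0 := by
    intro s t h1 h2 h3
    refine le_antisymm (hc.arm_left hP.isCone h2 (by omega) (hP.strictAt s) (hP.noPar s)
      fun k h4 h5 => (hz k (by omega) (by omega)).le).1 ?_
    exact (hc.arm_right hQ.isCone h2 (by omega) (hQ.strictAt s) (hQ.noPar s)
      fun k h4 h5 => (hz k (by omega) (by omega)).ge).1
  have hrep : ∀ i, ∃ s, a ≤ s ∧ s < a + n ∧ P i = P (s + 1) ∧ Q i = Q (s + 1) := by
    intro i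
    obtain ⟨m, h1, h2, s, t, e⟩ := exists_rep n (by omega) (a + 1) i
    refine ⟨m - 1, by omega, by omega, ?_, ?_⟩
    · rw [show m - 1 + 1 = m by omega, ← hP.isCone.per_mul m s, e, hP.isCone.per_mul]
    · rw [show m - 1 + 1 = m by omega, ← hQ.isCone.per_mul m s, e, hQ.isCone.per_mul]
  obtain ⟨s, s1, s2, s3, s4⟩ := hrep i
  obtain ⟨t, t1, t2, t3, t4⟩ := hrep j
  have : chg P Q i j = chg P Q (s + 1) (t + 1) := by simp only [chg, s3, s4, t3, t4]
  rw [this]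
  rcases lt_trichotomy s t with hst | rfl | hst
  · exact hsub s t s1 hst t2
  · exact hc.chg_self _
  · rw [chg_comm]; exact hsub t s t1 hst s2

/-- Polygons inscribed in circles are determined by their sides. -/
theorem IsInscribed.chg_eq_zero (hP : IsInscribed n P h τ) (hQ : IsInscribed n Q h' τ)
    (hc : Compat P Q) (i j : ℕ) : chg P Q i j = 0 := by
  rcases le_total (h' * h') (h * h) with hh | hh
  · exact hP.chg_eq_zero_of_le hQ hc hh i j
  · rw [chg_swap, hQ.chg_eq_zero_of_le hP hc.symm hh, neg_zero]

end Inscribed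

section Polygons

variable {ι E : Type*} [NormedAddCommGroup E] [InnerProductSpace ℝ E] [FiniteDimensional ℝ E]
  [Fintype ι] {p p' : ι → E} {𝓛 : Set (Set ι)} {G : Set ι} {n : ℕ} {R F : ℕ → Set ι} {c : ℕ → ι}

omit [Fintype ι] [FiniteDimensional ℝ E] in
theorem rk_lift_singleton (p : ι → E) (t : ι) : rk (lift p 0) {t} = 1 := by
  rw [rk, image_singleton]
  refine finrank_span_singleton fun h => ?_
  have := congrArg (fun w : WithLp 2 (E × ℝ) => w.snd) h
  simp at this

omit [Fintype ι] [FiniteDimensional ℝ E] in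
theorem rk_lift_empty (p : ι → E) (ε : ℝ) : rk (lift p ε) ∅ = 0 := by
  rw [rk, image_empty, Submodule.span_empty, finrank_bot]

omit [Fintype ι] in
theorem transversal_singleton (p : ι → E) (t a : ι) :
    transversal p {t} t (lift p 0 a) = p a - p t := by
  rw [transversal_apply, image_singleton, vectorSpan_singleton,
    Submodule.starProjection_eq_self_iff.2 (by simp)]
  simp

/-- The map to three-space which puts the plane of coordinates `Θ` at height `h` over the point
`o`. -/
noncomputable def raise (Θ : WithLp 2 (E × ℝ) →ₗ[ℝ] EuclideanSpace ℝ (Fin 2))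
    (o : EuclideanSpace ℝ (Fin 2)) (h : ℝ) : WithLp 2 (E × ℝ) →ₗ[ℝ] E3 where
  toFun w := !₂[Θ w 0 - o 0 * w.snd, Θ w 1 - o 1 * w.snd, h * w.snd]
  map_add' x y := by ext i; fin_cases i <;> simp <;> ring
  map_smul' s x := by ext i; fin_cases i <;> simp <;> ring

omit [Fintype ι] [FiniteDimensional ℝ E] in
theorem inner_raise {Θ : WithLp 2 (E × ℝ) →ₗ[ℝ] EuclideanSpace ℝ (Fin 2)}
    {m : EuclideanSpace ℝ (Fin 2)} {h τ : ℝ} (hh : h * h = τ - ⟪m, m⟫ / 4) {a b : ι}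
    (ha : ⟪Θ (lift p 0 a), Θ (lift p 0 a)⟫ = ⟪m, Θ (lift p 0 a)⟫)
    (hb : ⟪Θ (lift p 0 b), Θ (lift p 0 b)⟫ = ⟪m, Θ (lift p 0 b)⟫) :
    ⟪raise Θ ((1 / 2 : ℝ) • m) h (lift p 0 a), raise Θ ((1 / 2 : ℝ) • m) h (lift p 0 b)⟫ =
      τ - ⟪Θ (lift p 0 a) - Θ (lift p 0 b), Θ (lift p 0 a) - Θ (lift p 0 b)⟫ / 2 := by
  simp only [PiLp.inner_apply, Fin.sum_univ_three, Fin.sum_univ_two, RCLike.inner_apply,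
    conj_trivial, raise, LinearMap.coe_mk, AddHom.coe_mk, lift_snd, PiLp.sub_apply] at *
  simp only [PiLp.smul_apply, smul_eq_mul, Matrix.cons_val]
  linear_combination hh + ha / 2 + hb / 2

theorem Config.exists_inscribed (hp : Config p 𝓛) (hL : Link 𝓛 ∅ G n R F c) (h0 : ∅ ∈ 𝓛)
    (hG : G ∈ 𝓛) (hGu : G ≠ univ) (hr : rk (lift p 0) G = 3) :
    ∃ B : ℝ, ∀ τ, B < τ → ∃ P h, IsInscribed n P h τ ∧
      ∀ i j, ⟪P i, P j⟫ = τ - ‖p (c i) - p (c j)‖ ^ 2 / 2 := by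
  have hcG : ∀ i, c i ∈ G := fun i => (hL.FG i).1 (hL.RF i (hL.mem i))
  obtain ⟨t, ht⟩ : ∃ t, t ∈ G := ⟨_, hcG 0⟩
  have hss : (∅ : Set ι) ⊂ G := empty_ssubset.2 ⟨t, ht⟩
  obtain ⟨Θ, h1, h2, h3, h4⟩ := exists_transversal_coords (p := p) (T := {t}) (G := G) rfl
    (singleton_subset_iff.2 ht) (k := 2) (by rw [rk_lift_singleton, hr])
  have hΘt := h2 t rfl
  obtain ⟨μ, ν, hμ⟩ := hp.spherical hG hGu
  have hA : ∀ a ∈ G, lift p 0 a ∈ Submodule.span ℝ (lift p 0 '' G) := fun a ha =>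
    Submodule.subset_span (mem_image_of_mem _ ha)
  have hin : ∀ a ∈ G, ∀ b ∈ G, ⟪Θ (lift p 0 a), Θ (lift p 0 b)⟫ = ⟪p a - p t, p b - p t⟫ :=
    fun a ha b hb => by rw [h1 a ha b hb, transversal_singleton, transversal_singleton]
  have hval : ∀ a ∈ G, pairing (μ - (2 : ℝ) • p t) (ν + ‖p t‖ ^ 2) (lift p 0 a) =
      ⟪p a - p t, p a - p t⟫ := by
    intro a ha
    rw [pairing_lift, inner_sub_left, real_inner_smul_left, real_inner_self_eq_norm_sq,
      norm_sub_sq_real, hμ a ha, real_inner_comm (p a) (p t)]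
    ring
  obtain ⟨m, hm⟩ := h3 (pairing (μ - (2 : ℝ) • p t) (ν + ‖p t‖ ^ 2)) (by
    rintro a rfl; rw [hval a ht, sub_self, inner_zero_left])
  have hself : ∀ a ∈ G, ⟪Θ (lift p 0 a), Θ (lift p 0 a)⟫ = ⟪m, Θ (lift p 0 a)⟫ :=
    fun a ha => by rw [hin a ha a ha, ← hval a ha, hm _ (hA a ha)]
  have hdist : ∀ a ∈ G, ∀ b ∈ G,
      ⟪Θ (lift p 0 a) - Θ (lift p 0 b), Θ (lift p 0 a) - Θ (lift p 0 b)⟫ = ‖p a - p b‖ ^ 2 := by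
    intro a ha b hb
    rw [← real_inner_self_eq_norm_sq, ← sub_sub_sub_cancel_right (p a) (p b) (p t)]
    simp only [inner_sub_left (Θ _), inner_sub_right _ (Θ _), hin a ha a ha, hin a ha b hb,
      hin b hb a ha, hin b hb b hb, inner_sub_left (p a - p t), inner_sub_right _ (p a - p t)]
  refine ⟨⟪m, m⟫ / 4, fun τ hτ => ?_⟩
  set h := √(τ - ⟪m, m⟫ / 4) with hh
  have hh0 : 0 < h := Real.sqrt_pos.2 (by linarith)
  have hh2 : h * h = τ - ⟪m, m⟫ / 4 := Real.mul_self_sqrt (by linarith)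
  set o := (1 / 2 : ℝ) • m
  have hΨ : ∀ φ : WithLp 2 (E × ℝ) →ₗ[ℝ] ℝ, (∀ a ∈ (∅ : Set ι), φ (lift p 0 a) = 0) →
      ∃ m, ∀ x ∈ Submodule.span ℝ (lift p 0 '' G), φ x = ⟪m, raise Θ o h x⟫ := by
    rintro φ -
    obtain ⟨q, hq⟩ := h3 (φ - φ (lift p 0 t) • pairing 0 1) (by
      rintro a rfl
      simp [lift])
    refine ⟨!₂[q 0, q 1, (φ (lift p 0 t) + (q 0 * o 0 + q 1 * o 1)) / h], fun x hx => ?_⟩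
    have := hq x hx
    simp only [LinearMap.sub_apply, LinearMap.smul_apply, pairing_apply, inner_zero_left, smul_eq_mul,
      PiLp.inner_apply, Fin.sum_univ_two, RCLike.inner_apply, conj_trivial] at this
    simp only [raise, LinearMap.coe_mk, AddHom.coe_mk, PiLp.inner_apply, Fin.sum_univ_three,
      RCLike.inner_apply, conj_trivial, Matrix.cons_val]
    field_simp
    linear_combination this
  have htop : (Submodule.span ℝ (lift p 0 '' G)).map (raise Θ o h) = ⊤ := by
    rw [eq_top_iff]
    rintro y -
    obtain ⟨x, hx, hxy⟩ : !₂[y 0 + o 0 * (y 2 / h), y 1 + o 1 * (y 2 / h)] ∈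
      (Submodule.span ℝ (lift p 0 '' G)).map Θ := h4 ▸ trivial
    refine ⟨x + (y 2 / h - x.snd) • lift p 0 t, Submodule.add_mem _ hx
      (Submodule.smul_mem _ _ (hA t ht)), ?_⟩
    ext i
    have e : Θ (x + (y 2 / h - x.snd) • lift p 0 t) =
        !₂[y 0 + o 0 * (y 2 / h), y 1 + o 1 * (y 2 / h)] := by
      rw [map_add, map_smul, hΘt, smul_zero, add_zero, hxy]
    fin_cases i
    · simp [raise, hxy, hΘt]
    · simp [raise, hxy, hΘt]
    · simp [raise]
      field_simp
  obtain ⟨σ, hσ, hcone⟩ := hp.link_isCone hL h0 hG hss hΨ htop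
  have hσ2 : σ * σ = 1 := by rcases hσ with rfl | rfl <;> norm_num
  have hval : ∀ i j, ⟪σ • raise Θ o h (lift p 0 (c i)), σ • raise Θ o h (lift p 0 (c j))⟫ =
      τ - ‖p (c i) - p (c j)‖ ^ 2 / 2 := by
    intro i j
    rw [real_inner_smul_left, real_inner_smul_right, ← mul_assoc, hσ2, one_mul,
      inner_raise hh2 (hself _ (hcG i)) (hself _ (hcG j)), hdist _ (hcG i) _ (hcG j)]
  refine ⟨_, σ * h, ⟨hcone, fun i => ?_, mul_ne_zero (left_ne_zero_of_mul_eq_one hσ2) hh0.ne',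
    fun i => ?_⟩, hval⟩
  · simp [raise]
  · rw [hval, sub_self, norm_zero]; ring

/-- Two-dimensional faces are rigid. -/
theorem Config.distortion_eq_zero_of_polygon (hp : Config p 𝓛) (hp' : Config p' 𝓛) (hG : G ∈ 𝓛)
    (hGu : G ≠ univ) (hΔ : ∀ F ∈ 𝓛, F ⊂ G → ∀ a ∈ F, ∀ b ∈ F, distortion p p' a b = 0)
    (hr : rk (lift p 0) G = 3) {a b : ι} (ha : a ∈ G) (hb : b ∈ G) :
    distortion p p' a b = 0 := by
  classical
  obtain ⟨ε, hε⟩ := hp.exists_good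
  have h0 : (∅ : Set ι) ∈ 𝓛 := (hε.rep _).2 hε.empty_mem
  obtain ⟨n, A, B, hcyc⟩ := hε.empty_mem.link_cycle ((hε.rep _).1 hG) (empty_subset G)
    (by rw [hε.rk _ hG, hε.rk _ h0, hr, rk_lift_empty])
  let c : Set ι → ι := fun S => if h : S.Nonempty then h.some else a
  have hcR : ∀ S ∈ ivl (lift p ε) ∅ G 1, c S ∈ S ∧ c S ∉ (∅ : Set ι) := by
    intro S hS
    obtain ⟨x, hx, -⟩ := exists_mem_notMem_of_ivl (k := 0) hS
    have hne : S.Nonempty := ⟨x, hx⟩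
    simp only [c, dif_pos hne]
    exact ⟨hne.some_mem, notMem_empty _⟩
  have hL := hcyc.link hε h0 (empty_subset G) (by rw [hε.rk _ hG, hε.rk _ h0, hr, rk_lift_empty]) hcR
  have hmem : ∀ x ∈ G, ∃ i, c (A i).1 = x := by
    intro x hx
    have hxi : {x} ∈ ivl (lift p ε) ∅ G 1 := (hε.mem_ivl h0).2
      ⟨hp.singles x, empty_subset _, singleton_subset_iff.2 hx, by
        rw [rk_lift_singleton, rk_lift_empty]⟩
    obtain ⟨i, -, hi⟩ := hcyc.surj_a ⟨{x}, hxi⟩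
    exact ⟨i, by rw [hi]; exact (hcR _ hxi).1⟩
  obtain ⟨β, hβ⟩ := hp.exists_inscribed hL h0 hG hGu hr
  obtain ⟨β', hβ'⟩ := hp'.exists_inscribed hL h0 hG hGu (by rw [← hp.rk_eq hp' hG, hr])
  obtain ⟨P, h, hP, hPv⟩ := hβ (max β β' + 1) (by linarith [le_max_left β β'])
  obtain ⟨Q, h', hQ, hQv⟩ := hβ' (max β β' + 1) (by linarith [le_max_right β β'])
  have hchg : ∀ i j, chg P Q i j = - distortion p p' (c (A i).1) (c (A j).1) / 2 := fun i j => by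
    rw [chg, hPv, hQv, distortion]; ring
  have hc : Compat P Q := ⟨fun i => by rw [hP.norm, hQ.norm], fun i => by
    have := hchg i (i + 1)
    rw [hΔ _ (hL.memF i) (hL.FG i) _ (hL.RF i (hL.mem i)) _ (hL.RF' i (hL.mem _)), chg] at this
    linarith⟩
  obtain ⟨i, hi⟩ := hmem a ha
  obtain ⟨j, hj⟩ := hmem b hb
  have := hchg i j
  rw [hP.chg_eq_zero hQ hc, hi, hj] at this
  linarith

end Polygons

section Rigidity

variable {ι E : Type*} [NormedAddCommGroup E] [InnerProductSpace ℝ E] [FiniteDimensional ℝ E]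
  [Fintype ι] {p p' : ι → E} {𝓛 : Set (Set ι)}

/-- Configurations with the same face lattice, whose edges have the same lengths, are congruent. -/
theorem Config.distortion_eq_zero (hp : Config p 𝓛) (hp' : Config p' 𝓛)
    (hd : 3 ≤ Module.finrank ℝ E)
    (hpair : ∀ a b, a ≠ b → {a, b} ∈ 𝓛 → distortion p p' a b = 0) (a b : ι) :
    distortion p p' a b = 0 := by
  obtain ⟨ε, hε⟩ := hp.exists_good
  have hu : (univ : Set ι) ∈ 𝓛 := (hε.rep _).2 (isFace_univ _)
  have hru : rk (lift p 0) univ = Module.finrank ℝ E + 1 := by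
    rw [rk, image_univ, hp.span, finrank_top,
      (WithLp.linearEquiv 2 ℝ (E × ℝ)).finrank_eq, Module.finrank_prod, Module.finrank_self]
  suffices h : ∀ k, ∀ G ∈ 𝓛, rk (lift p 0) G = k → ∀ a ∈ G, ∀ b ∈ G, distortion p p' a b = 0 from
    h _ univ hu rfl a trivial b trivial
  intro k
  induction k using Nat.strong_induction_on with
  | _ k ih =>
    rintro G hG rfl a ha b hb
    have hlt : ∀ F ∈ 𝓛, F ⊂ G → rk (lift p 0) F < rk (lift p 0) G := fun F hF hFG => by
      rw [← hε.rk _ hF, ← hε.rk _ hG]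
      exact ((hε.rep _).1 hF).rk_lt hFG
    have hΔ : ∀ F ∈ 𝓛, F ⊂ G → ∀ a ∈ F, ∀ b ∈ F, distortion p p' a b = 0 := fun F hF hFG =>
      ih _ (hlt F hF hFG) F hF rfl
    rcases (show rk (lift p 0) G ≤ 2 ∨ rk (lift p 0) G = 3 ∨ 4 ≤ rk (lift p 0) G by omega)
      with h | h | h
    · by_cases hab : a = b
      · rw [hab, distortion_self]
      refine hpair a b hab ?_
      have hss : ∀ x ∈ G, ∀ y ∈ G, x ≠ y → {x} ⊂ G := fun x hx y hy hxy =>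
        (singleton_subset_iff.2 hx).ssubset_of_ne fun e => hxy (e.symm.subset hy : y = x).symm
      have hGf := (hε.rep _).1 hG
      by_contra hne
      obtain ⟨z, hz, hza, hzb⟩ : ∃ z ∈ G, z ≠ a ∧ z ≠ b := by
        by_contra! hcon
        refine hne ((Subset.antisymm (fun x hx => ?_) ?_ : G = {a, b}) ▸ hG)
        · by_cases hxa : x = a
          · exact Or.inl hxa
          · exact Or.inr (hcon x hx hxa)
        · rintro x (rfl | rfl)
          · exact ha
          · exact hb
      have hrG : rk (lift p ε) G = rk (lift p ε) ∅ + 2 := by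
        have h1 := hlt _ (hp.singles a) (hss a ha b hb hab)
        rw [rk_lift_singleton] at h1
        rw [hε.rk _ hG, rk_lift_empty]
        omega
      obtain ⟨R₁, R₂, -, hiff⟩ := hε.empty_mem.diamond hGf (empty_subset _) hrG
      have hm : ∀ x ∈ G, {x} = R₁ ∨ {x} = R₂ := fun x hx => (hiff _).1
        ((hε.mem_ivl ((hε.rep _).2 hε.empty_mem)).2 ⟨hp.singles x, empty_subset _,
          singleton_subset_iff.2 hx, by rw [rk_lift_singleton, rk_lift_empty]⟩)
      have hinj : ∀ {x y : ι} {S : Set ι}, {x} = S → {y} = S → x = y := fun h h' =>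
        singleton_injective (h.trans h'.symm)
      rcases hm a ha with h1 | h1 <;> rcases hm b hb with h2 | h2 <;> rcases hm z hz with h3 | h3
      · exact hab (hinj h1 h2)
      · exact hab (hinj h1 h2)
      · exact hza (hinj h3 h1)
      · exact hzb (hinj h3 h2)
      · exact hzb (hinj h3 h2)
      · exact hza (hinj h3 h1)
      · exact hab (hinj h1 h2)
      · exact hab (hinj h1 h2)
    · refine hp.distortion_eq_zero_of_polygon hp' hG (fun e => ?_) hΔ h ha hb
      rw [e, hru] at h
      omega
    · exact hp.distortion_eq_zero_of_proper hp' hG hΔ h ha hb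

end Rigidity

/-! ### Contact sets of intersections of congruent balls -/

section Contact

open Filter Topology

variable {ι E : Type*} [NormedAddCommGroup E]

/-- The index sets of those balls of radius `r` about the points `p i` which have a given point of
the boundary of their intersection on their boundary. -/
def IsContact (p : ι → E) (r : ℝ) (S : Set ι) : Prop :=
  S.Nonempty ∧ ∃ x, (∀ i, ‖x - p i‖ ≤ r) ∧ ∀ i, i ∈ S ↔ ‖x - p i‖ = r

theorem IsContact.sub_const {p : ι → E} {r : ℝ} {S : Set ι} (h : IsContact p r S) (m : E) :
    IsContact (fun i => p i - m) r S := by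
  obtain ⟨hS, x, hx⟩ := h
  exact ⟨hS, x - m, by simpa only [sub_sub_sub_cancel_right] using hx⟩

theorem isContact_sub_const {p : ι → E} {r : ℝ} {S : Set ι} {m : E} :
    IsContact (fun i => p i - m) r S ↔ IsContact p r S :=
  ⟨fun h => by simpa using h.sub_const (-m), fun h => h.sub_const m⟩

variable [InnerProductSpace ℝ E] {p : ι → E} {r : ℝ}

theorem norm_add_smul_sub_sq (x e q : E) (t : ℝ) :
    ‖x + t • e - q‖ ^ 2 = ‖x - q‖ ^ 2 + 2 * t * (⟪e, x⟫ - ⟪e, q⟫) + t ^ 2 * ‖e‖ ^ 2 := by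
  rw [add_sub_right_comm, norm_add_sq_real, real_inner_smul_right, real_inner_comm, inner_sub_right,
    norm_smul, mul_pow, Real.norm_eq_abs, sq_abs]
  ring

/-- Moving away from a point in a direction along which its farthest points stay equidistant, until
a further point becomes a farthest one. -/
theorem exists_farthest_ssubset [Fintype ι] {x e : E} {k : ι} (hk : ∀ j, ‖x - p j‖ ≤ ‖x - p k‖)
    (he : ∀ i, ‖x - p i‖ = ‖x - p k‖ → ⟪e, p i⟫ = ⟪e, p k⟫) (hlt : ∃ j, ⟪e, p j⟫ < ⟪e, p k⟫) :
    ∃ t : ℝ, 0 < t ∧ (∀ j, ‖x + t • e - p j‖ ≤ ‖x + t • e - p k‖) ∧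
      {i | ‖x - p i‖ = ‖x - p k‖} ⊂ {i | ‖x + t • e - p i‖ = ‖x + t • e - p k‖} := by
  classical
  let τ : ι → ℝ := fun j => (‖x - p k‖ ^ 2 - ‖x - p j‖ ^ 2) / (2 * (⟪e, p k⟫ - ⟪e, p j⟫))
  obtain ⟨m, hm, hmin⟩ := Finset.exists_min_image
    (Finset.univ.filter fun j => ⟪e, p j⟫ < ⟪e, p k⟫) τ
    (hlt.imp fun j hj => Finset.mem_filter.2 ⟨Finset.mem_univ _, hj⟩)
  replace hm := (Finset.mem_filter.1 hm).2
  have hne : ‖x - p m‖ < ‖x - p k‖ := lt_of_le_of_ne (hk m) fun h => hm.ne (he m h)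
  have hpos : 0 < τ m := div_pos (sub_pos.2 (pow_lt_pow_left₀ hne (norm_nonneg _) two_ne_zero))
    (by linarith)
  have key : ∀ j, ‖x + τ m • e - p k‖ ^ 2 - ‖x + τ m • e - p j‖ ^ 2 =
      ‖x - p k‖ ^ 2 - ‖x - p j‖ ^ 2 - τ m * (2 * (⟪e, p k⟫ - ⟪e, p j⟫)) := by
    intro j
    rw [norm_add_smul_sub_sq, norm_add_smul_sub_sq]
    ring
  have hm0 : ‖x + τ m • e - p m‖ = ‖x + τ m • e - p k‖ := by
    refine (sq_eq_sq₀ (norm_nonneg _) (norm_nonneg _)).1 ?_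
    have h1 := key m
    rw [div_mul_cancel₀ _ (mul_pos two_pos (sub_pos.2 hm)).ne', sub_self, sub_eq_zero] at h1
    exact h1.symm
  refine ⟨τ m, hpos, fun j => ?_, ?_⟩
  · refine (sq_le_sq₀ (norm_nonneg _) (norm_nonneg _)).1 ?_
    have h1 := key j
    have h2 := pow_le_pow_left₀ (norm_nonneg _) (hk j) 2
    by_cases hj : ⟪e, p j⟫ < ⟪e, p k⟫
    · have h3 := (le_div_iff₀ (by linarith)).1 (hmin j (Finset.mem_filter.2 ⟨Finset.mem_univ _, hj⟩))
      linarith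
    · have h3 := mul_nonneg hpos.le (sub_nonneg.2 (not_lt.1 hj))
      linarith
  · refine (ssubset_iff_of_subset fun i hi => ?_).2 ⟨m, hm0, hne.ne⟩
    refine (sq_eq_sq₀ (norm_nonneg _) (norm_nonneg _)).1 ?_
    have h1 := key i
    rw [he i hi, show ‖x - p i‖ = ‖x - p k‖ from hi] at h1
    linarith

variable [Fintype ι]
  (hV : ∀ x k, (∀ j, ‖x - p j‖ ≤ ‖x - p k‖) →
    (∀ e, (∀ i, ‖x - p i‖ = ‖x - p k‖ → ⟪e, p i⟫ = ⟪e, p k⟫) → e = 0) → ‖x - p k‖ < r)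

include hV in
theorem exists_recession_direction {x : E} {k : ι} (hk : ∀ j, ‖x - p j‖ ≤ ‖x - p k‖)
    (hr : r ≤ ‖x - p k‖) :
    ∃ e ≠ 0, ∀ i, ‖x - p i‖ = ‖x - p k‖ → ∀ j, ⟪e, p i⟫ ≤ ⟪e, p j⟫ := by
  induction hn : ({i | ‖x - p i‖ = ‖x - p k‖}ᶜ : Set ι).ncard using Nat.strong_induction_on
    generalizing x with
  | _ n ih =>
    obtain ⟨e, he, he0, hex⟩ : ∃ e, (∀ i, ‖x - p i‖ = ‖x - p k‖ → ⟪e, p i⟫ = ⟪e, p k⟫) ∧ e ≠ 0 ∧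
        0 ≤ ⟪e, x⟫ - ⟪e, p k⟫ := by
      have h1 : ¬ ∀ e, (∀ i, ‖x - p i‖ = ‖x - p k‖ → ⟪e, p i⟫ = ⟪e, p k⟫) → e = 0 := fun h =>
        hr.not_gt (hV x k hk h)
      push Not at h1
      obtain ⟨e, he, he0⟩ := h1
      rcases le_total 0 (⟪e, x⟫ - ⟪e, p k⟫) with h | h
      · exact ⟨e, he, he0, h⟩
      · exact ⟨-e, by simpa using he, by simpa using he0, by simp only [inner_neg_left]; linarith⟩
    by_cases hlt : ∃ j, ⟪e, p j⟫ < ⟪e, p k⟫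
    · obtain ⟨t, ht, h1, h2⟩ := exists_farthest_ssubset hk he hlt
      have h3 : ‖x - p k‖ ≤ ‖x + t • e - p k‖ := by
        refine (sq_le_sq₀ (norm_nonneg _) (norm_nonneg _)).1 ?_
        rw [norm_add_smul_sub_sq]
        have := mul_nonneg ht.le hex
        have := mul_nonneg (sq_nonneg t) (sq_nonneg ‖e‖)
        linarith
      obtain ⟨e', h0, h4⟩ := ih _ (hn ▸ ncard_lt_ncard (compl_lt_compl_iff_lt.2 h2)) h1
        (hr.trans h3) rfl
      exact ⟨e', h0, fun i hi => h4 i (h2.1 hi)⟩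
    · push Not at hlt
      exact ⟨e, he0, fun i hi j => (he i hi).trans_le (hlt j)⟩

include hV in
theorem exists_farthest_superset (haff : ∀ e, (∀ i j, ⟪e, p i⟫ = ⟪e, p j⟫) → e = 0) {x : E} {k : ι}
    (hk : ∀ j, ‖x - p j‖ ≤ ‖x - p k‖) :
    ∃ y, (∀ j, ‖y - p j‖ ≤ ‖y - p k‖) ∧ ‖y - p k‖ < r ∧
      ∀ i, ‖x - p i‖ = ‖x - p k‖ → ‖y - p i‖ = ‖y - p k‖ := by
  induction hn : ({i | ‖x - p i‖ = ‖x - p k‖}ᶜ : Set ι).ncard using Nat.strong_induction_on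
    generalizing x with
  | _ n ih =>
    by_cases h1 : ∀ e, (∀ i, ‖x - p i‖ = ‖x - p k‖ → ⟪e, p i⟫ = ⟪e, p k⟫) → e = 0
    · exact ⟨x, hk, hV x k hk h1, fun i hi => hi⟩
    push Not at h1
    obtain ⟨e, he, hlt⟩ : ∃ e, (∀ i, ‖x - p i‖ = ‖x - p k‖ → ⟪e, p i⟫ = ⟪e, p k⟫) ∧
        ∃ j, ⟪e, p j⟫ < ⟪e, p k⟫ := by
      obtain ⟨e, he, he0⟩ := h1
      obtain ⟨j, hj⟩ : ∃ j, ⟪e, p j⟫ ≠ ⟪e, p k⟫ := by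
        by_contra! hcon
        exact he0 (haff e fun i j => (hcon i).trans (hcon j).symm)
      rcases hj.lt_or_gt with h | h
      · exact ⟨e, he, j, h⟩
      · exact ⟨-e, by simpa using he, j, by simpa using h⟩
    obtain ⟨t, -, h1, h2⟩ := exists_farthest_ssubset hk he hlt
    obtain ⟨y, h3, h4, h5⟩ := ih _ (hn ▸ ncard_lt_ncard (compl_lt_compl_iff_lt.2 h2)) h1 rfl
    exact ⟨y, h3, h4, fun i hi => h5 i (h2.1 hi)⟩

include hV in
/-- Every set of farthest points of a point at distance at least `r` is a contact set. -/
theorem isContact_farthest (haff : ∀ e, (∀ i j, ⟪e, p i⟫ = ⟪e, p j⟫) → e = 0) {x : E} {k : ι}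
    (hk : ∀ j, ‖x - p j‖ ≤ ‖x - p k‖) (hr : r ≤ ‖x - p k‖) :
    IsContact p r {i | ‖x - p i‖ = ‖x - p k‖} := by
  obtain ⟨y, h1, h2, h3⟩ := exists_farthest_superset hV haff hk
  obtain ⟨t, ⟨ht0, ht1⟩, ht⟩ : ∃ t ∈ Icc (0 : ℝ) 1, ‖x + t • (y - x) - p k‖ = r := by
    refine intermediate_value_Icc' zero_le_one (f := fun t : ℝ => ‖x + t • (y - x) - p k‖)
      (by fun_prop) ⟨?_, ?_⟩
    · simpa using h2.le
    · simpa using hr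
  replace ht1 : t < 1 := by
    refine lt_of_le_of_ne ht1 ?_
    rintro rfl
    rw [one_smul, add_sub_cancel] at ht
    exact h2.ne ht
  have key : ∀ j, ‖x + t • (y - x) - p k‖ ^ 2 - ‖x + t • (y - x) - p j‖ ^ 2 =
      (1 - t) * (‖x - p k‖ ^ 2 - ‖x - p j‖ ^ 2) + t * (‖y - p k‖ ^ 2 - ‖y - p j‖ ^ 2) := by
    intro j
    have h4 : ∀ q, ‖y - q‖ ^ 2 = ‖x - q‖ ^ 2 + 2 * 1 * (⟪y - x, x⟫ - ⟪y - x, q⟫) +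
        1 ^ 2 * ‖y - x‖ ^ 2 := by
      intro q
      rw [← norm_add_smul_sub_sq, one_smul, add_sub_cancel]
    rw [norm_add_smul_sub_sq, norm_add_smul_sub_sq, h4 (p k), h4 (p j)]
    ring
  have hx2 : ∀ j, 0 ≤ ‖x - p k‖ ^ 2 - ‖x - p j‖ ^ 2 := fun j =>
    sub_nonneg.2 (pow_le_pow_left₀ (norm_nonneg _) (hk j) 2)
  have hy2 : ∀ j, 0 ≤ ‖y - p k‖ ^ 2 - ‖y - p j‖ ^ 2 := fun j =>
    sub_nonneg.2 (pow_le_pow_left₀ (norm_nonneg _) (h1 j) 2)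
  refine ⟨⟨k, rfl⟩, x + t • (y - x), fun j => ?_, fun j => ⟨fun hj => ?_, fun hj => ?_⟩⟩
  · rw [← ht]
    refine (sq_le_sq₀ (norm_nonneg _) (norm_nonneg _)).1 (sub_nonneg.1 ?_)
    rw [key]
    exact add_nonneg (mul_nonneg (by linarith) (hx2 j)) (mul_nonneg ht0 (hy2 j))
  · rw [← ht]
    refine (sq_eq_sq₀ (norm_nonneg _) (norm_nonneg _)).1 (sub_eq_zero.1 ?_).symm
    rw [key, h3 j hj, show ‖x - p j‖ = ‖x - p k‖ from hj]
    ring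
  · refine (sq_eq_sq₀ (norm_nonneg _) (norm_nonneg _)).1 (sub_eq_zero.1 ?_).symm
    have h4 := key j
    rw [ht, hj, sub_self] at h4
    have h5 := mul_nonneg (sub_nonneg.2 ht1.le) (hx2 j)
    have h6 := mul_nonneg ht0 (hy2 j)
    exact (mul_eq_zero_iff_left (sub_pos.2 ht1).ne').1 (by linarith)

variable [FiniteDimensional ℝ E]

omit [Fintype ι] [FiniteDimensional ℝ E] in
theorem pairing_lift_eq (y : E) (ε : ℝ) (i : ι) :
    pairing ((2 * ε) • y) 1 (lift p ε i) = 1 + ε * ‖y‖ ^ 2 - ε * ‖y - p i‖ ^ 2 := by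
  rw [pairing_lift, norm_sub_sq_real, real_inner_smul_left]
  ring

include hV in
omit [FiniteDimensional ℝ E] in
theorem IsContact.isFace_lift (hcent : ∑ i, p i = 0)
    (haff : ∀ e, (∀ i j, ⟪e, p i⟫ = ⟪e, p j⟫) → e = 0) {ε : ℝ} (hε : 0 < ε) (hεr : ε * r ^ 2 < 1)
    {S : Set ι} (hS : IsContact p r S) : IsFace (lift p ε) S := by
  obtain ⟨⟨k, hk⟩, x, hx, hxS⟩ := hS
  have hkr := (hxS k).1 hk
  have hfar : ∀ j, ‖x - p j‖ ≤ ‖x - p k‖ := fun j => (hx j).trans_eq hkr.symm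
  obtain ⟨e, he0, he⟩ := exists_recession_direction hV hfar hkr.ge
  have hek := he k rfl
  have hneg : ⟪e, p k⟫ < 0 := by
    by_contra! hcon
    have h1 : ∑ i, ⟪e, p i⟫ = 0 := by rw [← inner_sum, hcent, inner_zero_right]
    have h2 := (Finset.sum_eq_zero_iff_of_nonneg fun i _ => hcon.trans (hek i)).1 h1
    exact he0 (haff e fun i j => by rw [h2 i (Finset.mem_univ _), h2 j (Finset.mem_univ _)])
  obtain ⟨t, ht0, ht⟩ : ∃ t : ℝ, 0 ≤ t ∧ ε * (2 * t * -⟪e, p k⟫) = 1 - ε * r ^ 2 + ε * ‖x‖ ^ 2 := by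
    refine ⟨(1 - ε * r ^ 2 + ε * ‖x‖ ^ 2) / (2 * ε * -⟪e, p k⟫), div_nonneg ?_ ?_, ?_⟩
    · have := mul_nonneg hε.le (sq_nonneg ‖x‖)
      linarith
    · exact mul_nonneg (by linarith) (by linarith)
    · have := hneg.ne
      field_simp
  have key : ∀ i, pairing ((2 * ε) • (x + t • e)) 1 (lift p ε i) =
      ε * (r ^ 2 - ‖x - p i‖ ^ 2) + ε * (2 * t * (⟪e, p i⟫ - ⟪e, p k⟫)) := by
    intro i
    have h1 := norm_add_smul_sub_sq x e 0 t
    rw [sub_zero, sub_zero, inner_zero_right, sub_zero] at h1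
    rw [pairing_lift_eq, norm_add_smul_sub_sq, h1]
    linear_combination -ht
  have hnn : ∀ i, 0 ≤ ε * (r ^ 2 - ‖x - p i‖ ^ 2) := fun i =>
    mul_nonneg hε.le (sub_nonneg.2 (pow_le_pow_left₀ (norm_nonneg _) (hx i) 2))
  have hnn' : ∀ i, 0 ≤ ε * (2 * t * (⟪e, p i⟫ - ⟪e, p k⟫)) := fun i =>
    mul_nonneg hε.le (mul_nonneg (by linarith) (sub_nonneg.2 (hek i)))
  refine ⟨_, fun i => (key i).symm ▸ add_nonneg (hnn i) (hnn' i), fun i => ⟨fun hi => ?_,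
    fun hi => (hxS i).2 ?_⟩⟩
  · have h1 := (hxS i).1 hi
    have h2 := (he i (h1.trans hkr.symm) k).antisymm (hek i)
    rw [key, h1, h2]
    ring
  · rw [key, add_eq_zero_iff_of_nonneg (hnn i) (hnn' i)] at hi
    have h1 := (mul_eq_zero_iff_left hε.ne').1 hi.1
    rw [← hkr]
    refine (sq_eq_sq₀ (norm_nonneg _) (norm_nonneg _)).1 ?_
    rw [hkr]
    linarith

omit [Fintype ι] in
theorem span_range_lift_eq_top [Nonempty ι] (haff : ∀ e, (∀ i j, ⟪e, p i⟫ = ⟪e, p j⟫) → e = 0) :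
    Submodule.span ℝ (range (lift p 0)) = ⊤ := by
  rw [← Submodule.orthogonal_eq_bot_iff, Submodule.eq_bot_iff]
  intro w hw
  have h1 : ∀ i, ⟪w.fst, p i⟫ + w.snd = 0 := by
    intro i
    have h2 := (Submodule.mem_orthogonal' _ _).1 hw _ (Submodule.subset_span ⟨i, rfl⟩)
    rw [WithLp.prod_inner_apply] at h2
    simpa using h2
  have h3 : w.fst = 0 := haff _ fun i j => by linarith [h1 i, h1 j]
  have h4 := h1 (Classical.arbitrary ι)
  rw [h3, inner_zero_left, zero_add] at h4
  exact (WithLp.ofLp_injective 2) (Prod.ext h3 h4)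

include hV in
theorem config_of_isContact [Nonempty ι] (hcent : ∑ i, p i = 0)
    (haff : ∀ e, (∀ i j, ⟪e, p i⟫ = ⟪e, p j⟫) → e = 0) (hr : 0 < r)
    (hsing : ∀ i, IsContact p r {i}) :
    Config p {S | S = ∅ ∨ S = univ ∨ IsContact p r S} where
  cent := hcent
  span := span_range_lift_eq_top haff
  singles i := Or.inr (Or.inr (hsing i))
  rep := by
    have hsmall : ∀ᶠ ε in 𝓝[>] (0 : ℝ), ε * r ^ 2 < 1 := by
      have : Tendsto (fun ε : ℝ => ε * r ^ 2) (𝓝[>] 0) (𝓝 (0 * r ^ 2)) :=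
        ((continuous_mul_const _).tendsto 0).mono_left nhdsWithin_le_nhds
      rw [zero_mul] at this
      exact this.eventually_lt_const one_pos
    filter_upwards [hsmall, eventually_small p, self_mem_nhdsWithin] with ε hεr hεp hε S
    replace hε : 0 < ε := hε
    constructor
    · rintro (rfl | rfl | hS)
      · refine ⟨pairing 0 1, fun i => ?_, fun i => ?_⟩
        · rw [pairing_lift, inner_zero_left]
          linarith [hεp i]
        · rw [pairing_lift, inner_zero_left, zero_add, one_mul]
          exact iff_of_false (notMem_empty _) (by linarith [hεp i])
      · exact isFace_univ _
      · exact hS.isFace_lift hV hcent haff hε hεr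
    · rintro ⟨φ, hφ, hφS⟩
      rcases S.eq_empty_or_nonempty with hS | ⟨k, hk⟩
      · exact Or.inl hS
      by_cases hS' : S = univ
      · exact Or.inr (Or.inl hS')
      refine Or.inr (Or.inr ?_)
      obtain ⟨n, s, rfl⟩ := exists_pairing φ
      obtain ⟨j, hj⟩ := (ne_univ_iff_exists_notMem S).1 hS'
      have hs0 : 0 < s := by
        have h1 : ∑ i, pairing n s (lift p ε i) = s * ∑ i, (1 - ε * ‖p i‖ ^ 2) := by
          simp only [pairing_lift, Finset.sum_add_distrib, ← Finset.mul_sum]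
          rw [← inner_sum, hcent, inner_zero_right, zero_add]
        have h2 : 0 < ∑ i, pairing n s (lift p ε i) :=
          Finset.sum_pos' (fun i _ => hφ i) ⟨j, Finset.mem_univ _,
            lt_of_le_of_ne (hφ j) fun e => hj ((hφS j).2 e.symm)⟩
        rw [h1] at h2
        exact pos_of_mul_pos_left h2 (Finset.sum_nonneg fun i _ => by linarith [hεp i])
      set y : E := (2 * ε)⁻¹ • s⁻¹ • n with hy
      have key : ∀ i, pairing n s (lift p ε i) =
          s * (1 + ε * ‖y‖ ^ 2 - ε * ‖y - p i‖ ^ 2) := by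
        intro i
        rw [← pairing_lift_eq, hy, smul_inv_smul₀ (by positivity), pairing_lift, pairing_lift,
          real_inner_smul_left]
        field_simp
      have hiff : ∀ i, i ∈ S ↔ ε * ‖y - p i‖ ^ 2 = 1 + ε * ‖y‖ ^ 2 := fun i => by
        rw [hφS, key, mul_eq_zero_iff_left hs0.ne', sub_eq_zero, eq_comm]
      have hle : ∀ i, ε * ‖y - p i‖ ^ 2 ≤ ε * ‖y - p k‖ ^ 2 := fun i => by
        rw [(hiff k).1 hk]
        have := hφ i
        rw [key] at this
        linarith [nonneg_of_mul_nonneg_right this hs0]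
      have hfar : ∀ j, ‖y - p j‖ ≤ ‖y - p k‖ := fun j =>
        (sq_le_sq₀ (norm_nonneg _) (norm_nonneg _)).1 (le_of_mul_le_mul_left (hle j) hε)
      have hry : r ≤ ‖y - p k‖ := by
        refine (sq_le_sq₀ hr.le (norm_nonneg _)).1 (le_of_mul_le_mul_left ?_ hε)
        rw [(hiff k).1 hk]
        have := mul_nonneg hε.le (sq_nonneg ‖y‖)
        linarith
      convert isContact_farthest hV haff hfar hry using 1
      ext i
      rw [hiff, ← (hiff k).1 hk, mul_right_inj' hε.ne', sq_eq_sq₀ (norm_nonneg _) (norm_nonneg _)]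
      rfl

end Contact

/-! ### Faces of ball polyhedra -/

section BallPoly

variable {d : ℕ} {C : Set (EuclideanSpace ℝ (Fin d))} {r : ℝ} {S T : Set C}
  {x : EuclideanSpace ℝ (Fin d)}

/-- The points of `P_{C,r}` which lie on the spheres of radius `r` about all points of `S`. -/
def contactFace (C : Set (EuclideanSpace ℝ (Fin d))) (r : ℝ) (S : Set C) :
    Set (EuclideanSpace ℝ (Fin d)) :=
  {x | (∀ i : C, ‖x - i‖ ≤ r) ∧ ∀ i ∈ S, ‖x - i‖ = r}

theorem mem_ballPoly : x ∈ ballPoly C r ↔ ∀ i : C, ‖x - i‖ ≤ r := by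
  simp [ballPoly, dist_eq_norm]

theorem interior_ballPoly (hC : C.Finite) (hr : r ≠ 0) :
    interior (ballPoly C r) =
      {x : EuclideanSpace ℝ (Fin d) | ∀ i : C, ‖x - i‖ < r} := by
  rw [ballPoly, hC.interior_biInter]
  ext x
  simp [interior_closedBall _ hr, dist_eq_norm]

theorem mem_frontier_ballPoly (hC : C.Finite) (hr : r ≠ 0) :
    x ∈ frontier (ballPoly C r) ↔ (∀ i : C, ‖x - i‖ ≤ r) ∧ ∃ i : C, ‖x - i‖ = r := by
  have hcl : IsClosed (ballPoly C r) := isClosed_biInter fun _ _ => isClosed_closedBall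
  rw [hcl.frontier_eq, mem_sdiff, interior_ballPoly hC hr, mem_ballPoly]
  refine and_congr_right fun h => ?_
  simp only [mem_ofPred_eq, not_forall, not_lt]
  exact exists_congr fun i => ⟨(h i).antisymm, fun e => e.ge⟩

theorem mem_vorF : x ∈ vorF C ((↑) '' S) ↔ ∀ i : C, i ∈ S ↔ ∀ j : C, ‖x - j‖ ≤ ‖x - i‖ := by
  rw [vorF, mem_ofPred_eq, Set.ext_iff]
  constructor
  · intro h i
    have := h i
    simpa [dist_eq_norm] using this
  · intro h c
    by_cases hc : c ∈ C
    · have := h ⟨c, hc⟩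
      simpa [dist_eq_norm, hc] using this
    · simp [hc]

theorem mem_vorF_inter_frontier (hC : C.Finite) (hr : r ≠ 0) :
    x ∈ vorF C ((↑) '' S) ∩ frontier (ballPoly C r) ↔
      S.Nonempty ∧ (∀ i : C, ‖x - i‖ ≤ r) ∧ ∀ i : C, i ∈ S ↔ ‖x - i‖ = r := by
  rw [mem_inter_iff, mem_vorF, mem_frontier_ballPoly hC hr]
  constructor
  · rintro ⟨h1, h2, k, hk⟩
    refine ⟨⟨k, (h1 k).2 fun j => (h2 j).trans_eq hk.symm⟩, h2, fun i => (h1 i).trans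
      ⟨fun h => (h2 i).antisymm (hk ▸ h k), fun h j => (h2 j).trans_eq h.symm⟩⟩
  · rintro ⟨⟨k, hk⟩, h2, h3⟩
    have hkr := (h3 k).1 hk
    exact ⟨fun i => (h3 i).trans ⟨fun h j => (h2 j).trans_eq h.symm,
      fun h => (h2 i).antisymm (hkr ▸ h k)⟩, h2, k, hkr⟩

theorem nonempty_vorF_inter_frontier (hC : C.Finite) (hr : r ≠ 0) :
    (vorF C ((↑) '' S) ∩ frontier (ballPoly C r)).Nonempty ↔
      IsContact ((↑) : C → EuclideanSpace ℝ (Fin d)) r S := by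
  simp only [Set.Nonempty, mem_vorF_inter_frontier hC hr, exists_and_left, IsContact]

theorem closure_vorF_inter_frontier (hC : C.Finite) (hr : r ≠ 0)
    (hS : IsContact ((↑) : C → EuclideanSpace ℝ (Fin d)) r S) :
    closure (vorF C ((↑) '' S)) ∩ frontier (ballPoly C r) = contactFace C r S := by
  obtain ⟨⟨k, hk⟩, z, hz, hzS⟩ := hS
  have hkr := (hzS k).1 hk
  ext x
  rw [mem_inter_iff, mem_frontier_ballPoly hC hr]
  constructor
  · rintro ⟨h1, h2, l, hl⟩
    refine ⟨h2, fun i hi => (h2 i).antisymm ?_⟩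
    have h3 : closure (vorF C ((↑) '' S)) ⊆ {x | ‖x - l‖ ≤ ‖x - i‖} :=
      closure_minimal (fun y hy => (mem_vorF.1 hy i).1 hi l)
        (isClosed_le (by fun_prop) (by fun_prop))
    exact hl ▸ h3 h1
  · rintro ⟨h1, h2⟩
    refine ⟨?_, h1, k, h2 k hk⟩
    have h3 : Filter.Tendsto (fun t : ℝ => x + t • (z - x)) (nhdsWithin 0 (Ioi 0)) (nhds x) := by
      have : Filter.Tendsto (fun t : ℝ => x + t • (z - x)) (nhds 0) (nhds (x + (0 : ℝ) • (z - x))) :=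
        Continuous.tendsto (by fun_prop) 0
      rw [zero_smul, add_zero] at this
      exact this.mono_left nhdsWithin_le_nhds
    refine mem_closure_of_tendsto h3 ?_
    filter_upwards [Ioo_mem_nhdsGT (zero_lt_one' ℝ)] with t ht
    have key : ∀ j l : C, ‖x + t • (z - x) - l‖ ^ 2 - ‖x + t • (z - x) - j‖ ^ 2 =
        (1 - t) * (‖x - l‖ ^ 2 - ‖x - j‖ ^ 2) + t * (‖z - l‖ ^ 2 - ‖z - j‖ ^ 2) := by
      intro j l
      have h4 : ∀ q, ‖z - q‖ ^ 2 = ‖x - q‖ ^ 2 + 2 * 1 * (⟪z - x, x⟫ - ⟪z - x, q⟫) +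
          1 ^ 2 * ‖z - x‖ ^ 2 := by
        intro q
        rw [← norm_add_smul_sub_sq, one_smul, add_sub_cancel]
      rw [norm_add_smul_sub_sq, norm_add_smul_sub_sq, h4 l, h4 j]
      ring
    have hle : ∀ {y : EuclideanSpace ℝ (Fin d)} (j : C), ‖y - j‖ ≤ r → 0 ≤ r ^ 2 - ‖y - j‖ ^ 2 :=
      fun j h => sub_nonneg.2 (pow_le_pow_left₀ (norm_nonneg _) h 2)
    refine mem_vorF.2 fun i => ⟨fun hi j => ?_, fun h => ?_⟩
    · refine (sq_le_sq₀ (norm_nonneg _) (norm_nonneg _)).1 (sub_nonneg.1 ?_)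
      rw [key, h2 i hi, (hzS i).1 hi]
      exact add_nonneg (mul_nonneg (by linarith [ht.2]) (hle j (h1 j)))
        (mul_nonneg ht.1.le (hle j (hz j)))
    · have h4 := pow_le_pow_left₀ (norm_nonneg _) (h k) 2
      have h5 := key i k
      rw [h2 k hk, hkr] at h5
      have h6 := mul_nonneg (sub_nonneg.2 ht.2.le) (hle i (h1 i))
      have h7 := mul_nonneg ht.1.le (hle i (hz i))
      have h8 := (mul_eq_zero_iff_left ht.1.ne').1 (h7.antisymm' (by linarith))
      rw [hzS, ← sq_eq_sq₀ (norm_nonneg _) ((norm_nonneg _).trans (hz i))]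
      linarith

theorem mem_closedFaces (hC : C.Finite) (hr : r ≠ 0) {F : Set (EuclideanSpace ℝ (Fin d))} :
    F ∈ closedFaces C r ↔ ∃ S : Set C, IsContact ((↑) : C → EuclideanSpace ℝ (Fin d)) r S ∧
      F = contactFace C r S := by
  constructor
  · rintro ⟨S, hS, h1, rfl⟩
    obtain ⟨S, rfl⟩ : ∃ T : Set C, (↑) '' T = S :=
      ⟨(↑) ⁻¹' S, by rw [Subtype.image_preimage_coe, inter_eq_right.2 hS]⟩
    have h2 := (nonempty_vorF_inter_frontier hC hr).1 h1
    exact ⟨S, h2, closure_vorF_inter_frontier hC hr h2⟩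
  · rintro ⟨S, hS, rfl⟩
    exact ⟨(↑) '' S, Subtype.coe_image_subset _ _, (nonempty_vorF_inter_frontier hC hr).2 hS,
      (closure_vorF_inter_frontier hC hr hS).symm⟩

theorem contactFace_subset_iff (hS : IsContact ((↑) : C → EuclideanSpace ℝ (Fin d)) r S) :
    contactFace C r S ⊆ contactFace C r T ↔ T ⊆ S := by
  obtain ⟨-, z, hz, hzS⟩ := hS
  exact ⟨fun h i hi => (hzS i).2 ((h ⟨hz, fun j hj => (hzS j).1 hj⟩).2 i hi),
    fun h x hx => ⟨hx.1, fun i hi => hx.2 i (h hi)⟩⟩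

/-- In an `r`-convex configuration, every single ball contributes a facet. -/
theorem RConvexPosition.isContact_singleton (h : RConvexPosition r C) (i : C) :
    IsContact ((↑) : C → EuclideanSpace ℝ (Fin d)) r {i} := by
  obtain ⟨⟨q, hq⟩, h⟩ := h
  obtain ⟨x, hx, hxi⟩ : ∃ x, C \ {(i : EuclideanSpace ℝ (Fin d))} ⊆ closedBall x r ∧
      r < ‖x - i‖ := by
    have h1 := h i i.2
    simp only [rConvexHull, mem_iInter, not_forall, mem_ofPred_eq, mem_closedBall, not_le] at h1
    obtain ⟨x, hx, h2⟩ := h1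
    exact ⟨x, hx, by rwa [dist_comm, dist_eq_norm] at h2⟩
  have hq' : ∀ j : C, ‖q - j‖ < r := fun j => by
    rw [← dist_eq_norm, dist_comm]
    exact hq j.2
  have hx' : ∀ j : C, j ≠ i → ‖x - j‖ ≤ r := fun j hj => by
    rw [← dist_eq_norm, dist_comm]
    exact hx ⟨j.2, fun e => hj (Subtype.ext e)⟩
  obtain ⟨t, ⟨ht0, ht1⟩, ht⟩ : ∃ t ∈ Icc (0 : ℝ) 1, ‖q + t • (x - q) - i‖ = r := by
    refine intermediate_value_Icc zero_le_one (f := fun t : ℝ => ‖q + t • (x - q) - i‖)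
      (by fun_prop) ⟨?_, ?_⟩
    · simpa using (hq' i).le
    · simpa using hxi.le
  replace ht1 : t < 1 := by
    refine lt_of_le_of_ne ht1 ?_
    rintro rfl
    rw [one_smul, add_sub_cancel] at ht
    exact hxi.ne' ht
  have key : ∀ j : C, j ≠ i → ‖q + t • (x - q) - j‖ < r := by
    intro j hj
    have h1 : q + t • (x - q) - j = (1 - t) • (q - j) + t • (x - j) := by module
    calc ‖q + t • (x - q) - j‖ ≤ ‖(1 - t) • (q - j)‖ + ‖t • (x - j)‖ := h1 ▸ norm_add_le _ _
      _ = (1 - t) * ‖q - j‖ + t * ‖x - j‖ := by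
        rw [norm_smul, norm_smul, Real.norm_of_nonneg ht0, Real.norm_of_nonneg (by linarith)]
      _ < (1 - t) * r + t * r := add_lt_add_of_lt_of_le
        (mul_lt_mul_of_pos_left (hq' j) (by linarith)) (mul_le_mul_of_nonneg_left (hx' j hj) ht0)
      _ = r := by ring
  refine ⟨singleton_nonempty i, q + t • (x - q), fun j => ?_, fun j => ?_⟩
  · by_cases hj : j = i
    · rw [hj, ht]
    · exact (key j hj).le
  · by_cases hj : j = i
    · simp [hj, ht]
    · simp [hj, (key j hj).ne]

/-- The span of a pair of points which touches the boundary is a wall of the farthest-point Voronoi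
diagram. -/
theorem setDim_vorF_pair {a b : C} (hC : C.Finite) (hab : a ≠ b)
    (h : IsContact ((↑) : C → EuclideanSpace ℝ (Fin d)) r {a, b}) :
    setDim (vorF C {(a : EuclideanSpace ℝ (Fin d)), (b : EuclideanSpace ℝ (Fin d))}) = d - 1 := by
  have := hC.to_subtype
  obtain ⟨-, x, hx, hxS⟩ := h
  rw [← image_pair]
  set n : EuclideanSpace ℝ (Fin d) := b - a with hn
  have hn0 : n ≠ 0 := sub_ne_zero.2 fun e => hab (Subtype.ext e.symm)
  have hmem : ∀ y : EuclideanSpace ℝ (Fin d), (∀ j : C, j ≠ a → j ≠ b → ‖y - j‖ < ‖y - a‖) → ‖y - a‖ = ‖y - b‖ →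
      y ∈ vorF C ((↑) '' ({a, b} : Set C)) := by
    intro y h1 h2
    have h3 : ∀ j : C, ‖y - j‖ ≤ ‖y - a‖ := by
      intro j
      by_cases hja : j = a
      · rw [hja]
      by_cases hjb : j = b
      · rw [hjb, h2]
      exact (h1 j hja hjb).le
    refine mem_vorF.2 fun i => ⟨?_, fun h4 => ?_⟩
    · rintro (rfl | rfl)
      · exact h3
      · exact fun j => (h3 j).trans_eq h2
    · by_contra hcon
      rw [mem_insert_iff, mem_singleton_iff, not_or] at hcon
      exact (h1 i hcon.1 hcon.2).not_ge (h4 a)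
  have hxa := (hxS a).1 (Or.inl rfl)
  have hxb := (hxS b).1 (Or.inr rfl)
  have hxmem : x ∈ vorF C ((↑) '' ({a, b} : Set C)) := by
    refine hmem x (fun j hja hjb => ?_) (hxa.trans hxb.symm)
    rw [hxa]
    refine lt_of_le_of_ne (hx j) fun e => ?_
    rcases (hxS j).2 e with h1 | h1
    · exact hja h1
    · exact hjb h1
  have hiff : ∀ y : EuclideanSpace ℝ (Fin d), ‖y - a‖ ^ 2 - ‖y - b‖ ^ 2 =
      2 * ⟪n, y⟫ + (‖(a : EuclideanSpace ℝ (Fin d))‖ ^ 2 - ‖(b : EuclideanSpace ℝ (Fin d))‖ ^ 2) := by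
    intro y
    rw [norm_sub_sq_real, norm_sub_sq_real, hn, inner_sub_left, real_inner_comm y,
      real_inner_comm y]
    ring
  have hdir : (affineSpan ℝ (vorF C ((↑) '' ({a, b} : Set C)))).direction = (ℝ ∙ n)ᗮ := by
    rw [direction_affineSpan]
    refine le_antisymm ?_ fun u hu => ?_
    · rw [vectorSpan_def, Submodule.span_le]
      rintro - ⟨y, hy, z, hz, rfl⟩
      have h1 : ∀ y ∈ vorF C ((↑) '' ({a, b} : Set C)), ‖y - a‖ = ‖y - b‖ := fun y hy =>
        (((mem_vorF.1 hy b).1 (Or.inr rfl)) a).antisymm (((mem_vorF.1 hy a).1 (Or.inl rfl)) b)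
      have h2 := hiff y
      have h3 := hiff z
      rw [h1 y hy, sub_self] at h2
      rw [h1 z hz, sub_self] at h3
      rw [SetLike.mem_coe, Submodule.mem_orthogonal_singleton_iff_inner_right]
      change ⟪n, y - z⟫ = 0
      rw [inner_sub_right]
      linarith
    · rw [Submodule.mem_orthogonal_singleton_iff_inner_right] at hu
      have h1 : ∀ᶠ t in nhds (0 : ℝ), ∀ j : C, j ≠ a → j ≠ b →
          ‖x + t • u - j‖ < ‖x + t • u - a‖ := by
        refine Filter.eventually_all.2 fun j => ?_
        by_cases hja : j = a
        · exact Filter.Eventually.of_forall fun t h => (h hja).elim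
        by_cases hjb : j = b
        · exact Filter.Eventually.of_forall fun t _ h => (h hjb).elim
        have h2 : ‖x + (0 : ℝ) • u - j‖ < ‖x + (0 : ℝ) • u - a‖ := by
          rw [zero_smul, add_zero, hxa]
          refine lt_of_le_of_ne (hx j) fun e => ?_
          rcases (hxS j).2 e with h1 | h1
          · exact hja h1
          · exact hjb h1
        have h3 : ∀ᶠ t in nhds (0 : ℝ), ‖x + t • u - j‖ < ‖x + t • u - a‖ :=
          (isOpen_lt (by fun_prop) (by fun_prop)).mem_nhds h2
        exact h3.mono fun t ht _ _ => ht
      obtain ⟨t, h2, ht⟩ := ((h1.filter_mono (nhdsWithin_le_nhds (s := Ioi 0))).and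
        self_mem_nhdsWithin).exists
      replace ht : (0 : ℝ) < t := ht
      have h3 : x + t • u ∈ vorF C ((↑) '' ({a, b} : Set C)) := by
        refine hmem _ h2 ((sq_eq_sq₀ (norm_nonneg _) (norm_nonneg _)).1 (sub_eq_zero.1 ?_))
        have h4 := hiff x
        rw [hxa, hxb, sub_self] at h4
        rw [hiff, inner_add_right, real_inner_smul_right, hu, mul_zero, add_zero]
        exact h4.symm
      have h4 := vsub_mem_vectorSpan ℝ h3 hxmem
      rw [vsub_eq_sub, add_sub_cancel_left] at h4
      exact (Submodule.smul_mem_iff _ ht.ne').1 h4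
  have h1 := Submodule.finrank_add_finrank_orthogonal (ℝ ∙ n)
  rw [finrank_span_singleton hn0, finrank_euclideanSpace_fin] at h1
  rw [setDim, hdir]
  omega

end BallPoly

/-! ### Isomorphisms of face lattices -/

section LatticeIso

theorem exists_equiv_of_subset_iff {α β : Type*} {𝒮 : Set (Set α)} {𝒮' : Set (Set β)}
    (h1 : ∀ a, {a} ∈ 𝒮) (h1' : ∀ b, {b} ∈ 𝒮') (h0 : ∀ S ∈ 𝒮, S.Nonempty)
    (h0' : ∀ S ∈ 𝒮', S.Nonempty) {σ : Set α → Set β} (hσ : ∀ S ∈ 𝒮, σ S ∈ 𝒮')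
    (hle : ∀ S ∈ 𝒮, ∀ T ∈ 𝒮, σ S ⊆ σ T ↔ S ⊆ T) (hsurj : ∀ T ∈ 𝒮', ∃ S ∈ 𝒮, σ S = T) :
    ∃ f : α ≃ β, ∀ S ∈ 𝒮, σ S = f '' S := by
  have hf : ∀ a, ∃ b, σ {a} = {b} := by
    intro a
    obtain ⟨b, hb⟩ := h0' _ (hσ _ (h1 a))
    obtain ⟨T, hT, e⟩ := hsurj _ (h1' b)
    have h2 : T ⊆ {a} := (hle T hT _ (h1 a)).1 (e ▸ singleton_subset_iff.2 hb)
    exact ⟨b, ((h0 T hT).subset_singleton_iff.1 h2) ▸ e⟩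
  choose f hf using hf
  have hmem : ∀ S ∈ 𝒮, ∀ a, f a ∈ σ S ↔ a ∈ S := fun S hS a => by
    rw [← singleton_subset_iff, ← hf, hle _ (h1 a) _ hS, singleton_subset_iff]
  have hinj : Function.Injective f := fun a b e =>
    (hmem _ (h1 b) a).1 (by rw [hf, e]; exact mem_singleton _)
  have hsur : Function.Surjective f := fun b => by
    obtain ⟨T, hT, e⟩ := hsurj _ (h1' b)
    obtain ⟨a, ha⟩ := h0 T hT
    exact ⟨a, mem_singleton_iff.1 (e ▸ (hmem T hT a).2 ha)⟩
  refine ⟨Equiv.ofBijective f ⟨hinj, hsur⟩, fun S hS => ?_⟩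
  ext b
  obtain ⟨a, rfl⟩ := hsur b
  rw [hmem S hS]
  exact (hinj.mem_set_image (s := S)).symm

variable {d : ℕ} {C C' : Set (EuclideanSpace ℝ (Fin d))} {r : ℝ}

theorem contactFace_mem_faceLat (hC : C.Finite) (hr : r ≠ 0) {S : Set C}
    (hS : IsContact ((↑) : C → EuclideanSpace ℝ (Fin d)) r S) : contactFace C r S ∈ faceLat C r :=
  Or.inl ((mem_closedFaces hC hr).2 ⟨S, hS, rfl⟩)

theorem subset_ballPoly_of_mem_faceLat (hC : C.Finite) (hr : r ≠ 0)
    {F : Set (EuclideanSpace ℝ (Fin d))} (hF : F ∈ faceLat C r) : F ⊆ ballPoly C r := by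
  rcases hF with hF | rfl | rfl
  · obtain ⟨S, -, rfl⟩ := (mem_closedFaces hC hr).1 hF
    exact fun x hx => mem_ballPoly.2 hx.1
  · exact empty_subset _
  · exact subset_rfl

theorem contactFace_ne_ballPoly (h : RConvexPosition r C) {S : Set C} (hS : S.Nonempty) :
    contactFace C r S ≠ ballPoly C r := by
  obtain ⟨⟨q, hq⟩, -⟩ := h
  obtain ⟨k, hk⟩ := hS
  have hq' : ∀ j : C, ‖q - j‖ < r := fun j => by
    rw [← dist_eq_norm, dist_comm]
    exact hq j.2
  intro e
  have h1 : q ∈ contactFace C r S := e ▸ mem_ballPoly.2 fun j => (hq' j).le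
  exact (hq' k).ne (h1.2 k hk)

theorem exists_contactFace_of_orderIso (hr : r ≠ 0) (hC : C.Finite) (hC' : C'.Finite)
    (h : RConvexPosition r C) (φ : {F // F ∈ faceLat C r} ≃o {F // F ∈ faceLat C' r}) {S : Set C}
    (hS : IsContact ((↑) : C → EuclideanSpace ℝ (Fin d)) r S) :
    ∃ T : Set C', IsContact ((↑) : C' → EuclideanSpace ℝ (Fin d)) r T ∧
      (φ ⟨contactFace C r S, contactFace_mem_faceLat hC hr hS⟩ : Set (EuclideanSpace ℝ (Fin d))) =
        contactFace C' r T := by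
  generalize hφ : φ ⟨contactFace C r S, contactFace_mem_faceLat hC hr hS⟩ = G
  obtain ⟨G, hG⟩ := G
  rcases id hG with h1 | h1 | h1
  · exact (mem_closedFaces hC' hr).1 h1
  · exfalso
    have hbot : (∅ : Set (EuclideanSpace ℝ (Fin d))) ∈ faceLat C r := Or.inr (Or.inl rfl)
    have h2 : (⟨contactFace C r S, contactFace_mem_faceLat hC hr hS⟩ : {F // F ∈ faceLat C r}) ≤
        ⟨∅, hbot⟩ := φ.le_iff_le.1 (hφ.le.trans (h1.subset.trans (empty_subset _)))
    obtain ⟨-, z, hz, hzS⟩ := id hS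
    exact h2 (show z ∈ contactFace C r S from ⟨hz, fun j hj => (hzS j).1 hj⟩)
  · exfalso
    have htop : ballPoly C r ∈ faceLat C r := Or.inr (Or.inr rfl)
    have h2 : (⟨ballPoly C r, htop⟩ : {F // F ∈ faceLat C r}) ≤
        ⟨contactFace C r S, contactFace_mem_faceLat hC hr hS⟩ := φ.le_iff_le.1
      (((subset_ballPoly_of_mem_faceLat hC' hr (φ ⟨ballPoly C r, htop⟩).2).trans
        h1.symm.subset).trans hφ.ge)
    exact contactFace_ne_ballPoly h hS.1 (Subset.antisymm
      (subset_ballPoly_of_mem_faceLat hC hr (contactFace_mem_faceLat hC hr hS)) h2)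

/-- An isomorphism of face lattices is induced by a bijection between the centers. -/
theorem exists_equiv_of_orderIso (hr : r ≠ 0) (hC : C.Finite) (hC' : C'.Finite)
    (h : RConvexPosition r C) (h' : RConvexPosition r C')
    (φ : {F // F ∈ faceLat C r} ≃o {F // F ∈ faceLat C' r}) :
    ∃ f : C ≃ C', (∀ S, IsContact ((↑) : C' → EuclideanSpace ℝ (Fin d)) r (f '' S) ↔
        IsContact ((↑) : C → EuclideanSpace ℝ (Fin d)) r S) ∧
      ∀ S, IsContact ((↑) : C → EuclideanSpace ℝ (Fin d)) r S → ∀ hF,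
        (φ ⟨contactFace C r S, hF⟩ : Set (EuclideanSpace ℝ (Fin d))) =
          contactFace C' r (f '' S) := by
  classical
  let 𝒮 : Set (Set C) := {S | IsContact ((↑) : C → EuclideanSpace ℝ (Fin d)) r S}
  let 𝒮' : Set (Set C') := {S | IsContact ((↑) : C' → EuclideanSpace ℝ (Fin d)) r S}
  have hex : ∀ S : Set C, ∃ T : Set C', S ∈ 𝒮 → T ∈ 𝒮' ∧ ∀ hF,
      (φ ⟨contactFace C r S, hF⟩ : Set (EuclideanSpace ℝ (Fin d))) = contactFace C' r T := by
    intro S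
    by_cases hS : S ∈ 𝒮
    · obtain ⟨T, hT, e⟩ := exists_contactFace_of_orderIso hr hC hC' h φ hS
      exact ⟨T, fun _ => ⟨hT, fun _ => e⟩⟩
    · exact ⟨∅, fun h => (hS h).elim⟩
  choose σ hσ using hex
  have hle : ∀ S ∈ 𝒮, ∀ T ∈ 𝒮, σ S ⊆ σ T ↔ S ⊆ T := by
    intro S hS T hT
    rw [← contactFace_subset_iff (hσ T hT).1, ← contactFace_subset_iff hT,
      ← (hσ S hS).2 (contactFace_mem_faceLat hC hr hS),
      ← (hσ T hT).2 (contactFace_mem_faceLat hC hr hT)]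
    exact φ.le_iff_le
  have hsurj : ∀ T ∈ 𝒮', ∃ S ∈ 𝒮, σ S = T := by
    intro T hT
    obtain ⟨S, hS, e⟩ := exists_contactFace_of_orderIso hr hC' hC h' φ.symm hT
    refine ⟨S, hS, ?_⟩
    have e1 : φ ⟨contactFace C r S, contactFace_mem_faceLat hC hr hS⟩ =
        ⟨contactFace C' r T, contactFace_mem_faceLat hC' hr hT⟩ := by
      rw [← φ.eq_symm_apply]
      exact Subtype.ext e.symm
    have e2 : contactFace C' r T = contactFace C' r (σ S) := by
      rw [← (hσ S hS).2 (contactFace_mem_faceLat hC hr hS), e1]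
    exact Subset.antisymm ((contactFace_subset_iff hT).1 e2.subset)
      ((contactFace_subset_iff (hσ S hS).1).1 e2.symm.subset)
  obtain ⟨f, hf⟩ := exists_equiv_of_subset_iff (fun a => h.isContact_singleton a)
    (fun b => h'.isContact_singleton b) (fun S hS => hS.1) (fun S hS => hS.1)
    (fun S hS => (hσ S hS).1) hle hsurj
  refine ⟨f, fun S => ⟨fun hS => ?_, fun hS => hf S hS ▸ (hσ S hS).1⟩,
    fun S hS hF => hf S hS ▸ (hσ S hS).2 hF⟩
  obtain ⟨T, hT, e⟩ := hsurj _ hS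
  rw [hf T hT] at e
  exact f.injective.image_injective e ▸ hT

end LatticeIso

/-! ### Basic ball polyhedra are determined by the distances of their centers -/

section Basic

variable {E : Type*} [NormedAddCommGroup E] [InnerProductSpace ℝ E] [FiniteDimensional ℝ E]

theorem exists_isometryEquiv_of_norm_sub_eq {ι : Type*} [Finite ι] [Nonempty ι] {p p' : ι → E}
    (haff : ∀ e, (∀ i j, ⟪e, p i⟫ = ⟪e, p j⟫) → e = 0)
    (h : ∀ i j, ‖p i - p j‖ = ‖p' i - p' j‖) : ∃ g : E ≃ᵢ E, ∀ i, g (p i) = p' i := by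
  have := Fintype.ofFinite ι
  classical
  let k := Classical.arbitrary ι
  let A := Fintype.linearCombination ℝ fun i => p i - p k
  let B := Fintype.linearCombination ℝ fun i => p' i - p' k
  have hinner : ∀ i j, ⟪p i - p k, p j - p k⟫ = ⟪p' i - p' k, p' j - p' k⟫ := by
    intro i j
    have h1 := norm_sub_sq_real (p i - p k) (p j - p k)
    have h2 := norm_sub_sq_real (p' i - p' k) (p' j - p' k)
    rw [sub_sub_sub_cancel_right] at h1 h2
    rw [h, h, h] at h1
    linarith
  have hnorm : ∀ t, ‖A t‖ = ‖B t‖ := by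
    intro t
    refine (sq_eq_sq₀ (norm_nonneg _) (norm_nonneg _)).1 ?_
    simp only [← real_inner_self_eq_norm_sq, A, B, Fintype.linearCombination_apply, sum_inner,
      inner_sum, real_inner_smul_left, real_inner_smul_right, hinner]
  have hsurj : Function.Surjective A := by
    rw [← LinearMap.range_eq_top, Fintype.range_linearCombination,
      ← Submodule.orthogonal_eq_bot_iff, Submodule.eq_bot_iff]
    intro e he
    have h1 : ∀ i, ⟪e, p i⟫ = ⟪e, p k⟫ := by
      intro i
      have := (Submodule.mem_orthogonal' _ _).1 he _ (Submodule.subset_span ⟨i, rfl⟩)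
      rwa [inner_sub_right, sub_eq_zero] at this
    exact haff e fun i j => (h1 i).trans (h1 j).symm
  obtain ⟨s, hs⟩ := A.exists_rightInverse_of_surjective (LinearMap.range_eq_top.2 hsurj)
  have hs' : ∀ x, A (s x) = x := fun x => LinearMap.congr_fun hs x
  have hL : ∀ t, B (s (A t)) = B t := by
    intro t
    rw [← sub_eq_zero, ← map_sub, ← norm_eq_zero, ← hnorm, map_sub, hs', sub_self, norm_zero]
  let L : E →ₗᵢ[ℝ] E := ⟨B ∘ₗ s, fun x => by
    rw [LinearMap.comp_apply, ← hnorm, hs']⟩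
  let L' : E ≃ₗᵢ[ℝ] E := L.toLinearIsometryEquiv rfl
  refine ⟨((IsometryEquiv.subRight (p k)).trans L'.toIsometryEquiv).trans
    (IsometryEquiv.addRight (p' k)), fun i => ?_⟩
  have h1 : L (p i - p k) = p' i - p' k := by
    have h2 : A (Pi.single i 1) = p i - p k := by simp [A]
    have h3 : B (Pi.single i 1) = p' i - p' k := by simp [B]
    rw [← h2, ← h3]
    exact hL _
  have h2 : L' (p i - p k) = p' i - p' k := h1
  simp [h2]

variable {d : ℕ} {C C' : Set (EuclideanSpace ℝ (Fin d))} {r : ℝ}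

theorem eq_zero_of_inner_eq_of_setDim (h : setDim (convexHull ℝ C) = d)
    {e : EuclideanSpace ℝ (Fin d)} (he : ∀ i ∈ C, ∀ j ∈ C, ⟪e, i⟫ = ⟪e, j⟫) : e = 0 := by
  rw [setDim, affineSpan_convexHull, direction_affineSpan] at h
  have h1 : vectorSpan ℝ C = ⊤ := Submodule.eq_top_of_finrank_eq (by simpa using h)
  have h2 : vectorSpan ℝ C ≤ (ℝ ∙ e)ᗮ := by
    rw [vectorSpan_def, Submodule.span_le]
    rintro - ⟨y, hy, z, hz, rfl⟩
    rw [SetLike.mem_coe, Submodule.mem_orthogonal_singleton_iff_inner_right]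
    change ⟪e, y - z⟫ = 0
    rw [inner_sub_right, he y hy z hz, sub_self]
  have h3 : e ∈ (ℝ ∙ e)ᗮ := h2 (h1 ▸ trivial)
  rwa [Submodule.mem_orthogonal_singleton_iff_inner_right, inner_self_eq_zero] at h3

theorem IsBasicBallPolyhedron.norm_sub_lt (hC : IsBasicBallPolyhedron C r)
    {x : EuclideanSpace ℝ (Fin d)} {k : C} (hk : ∀ j : C, ‖x - j‖ ≤ ‖x - k‖)
    (h : ∀ e : EuclideanSpace ℝ (Fin d),
      (∀ i : C, ‖x - i‖ = ‖x - k‖ → ⟪e, (i : EuclideanSpace ℝ (Fin d))⟫ = ⟪e, k⟫) → e = 0) :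
    ‖x - k‖ < r := by
  obtain ⟨hr, hfin, -, -, -, -, -, hV⟩ := hC
  have h1 : vorF C ((↑) '' {i : C | ‖x - i‖ = ‖x - k‖}) = {x} := by
    refine eq_singleton_iff_unique_mem.2 ⟨mem_vorF.2 fun i => ⟨fun hi j => (hk j).trans_eq hi.symm,
      fun hi => (hk i).antisymm (hi k)⟩, fun y hy => sub_eq_zero.1 (h _ fun i hi => ?_)⟩
    have h2 := mem_vorF.1 hy
    have h3 : ‖y - i‖ = ‖y - k‖ := ((h2 k).1 rfl i).antisymm ((h2 i).1 hi k)
    have h4 := norm_sub_sq_real x i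
    have h5 := norm_sub_sq_real x k
    have h6 := norm_sub_sq_real y i
    have h7 := norm_sub_sq_real y k
    rw [hi] at h4
    rw [h3] at h6
    rw [inner_sub_left, inner_sub_left]
    linarith
  have h2 := hV _ (Subtype.coe_image_subset _ _) x h1
  rw [interior_ballPoly hfin hr.ne'] at h2
  exact h2 k

theorem IsBasicBallPolyhedron.exists_config (hC : IsBasicBallPolyhedron C r) {ι : Type*} [Fintype ι]
    (f : ι ≃ C) : ∃ m, Config (fun i => (f i : EuclideanSpace ℝ (Fin d)) - m)
      {S | S = ∅ ∨ S = univ ∨ IsContact ((↑) : C → EuclideanSpace ℝ (Fin d)) r (f '' S)} := by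
  obtain ⟨hr, hfin, hcard, hd, hdim, -, hpos, -⟩ := id hC
  have : Nonempty ι := by
    have h1 : C.Nonempty := nonempty_of_ncard_ne_zero (by omega)
    exact h1.to_subtype.map f.symm
  have hcontact : ∀ S : Set ι, IsContact ((↑) : C → EuclideanSpace ℝ (Fin d)) r (f '' S) ↔
      IsContact (fun i => (f i : EuclideanSpace ℝ (Fin d))) r S := by
    intro S
    rw [IsContact, IsContact, image_nonempty]
    simp only [f.surjective.forall, f.injective.mem_set_image]
  set m := (Fintype.card ι : ℝ)⁻¹ • ∑ i, (f i : EuclideanSpace ℝ (Fin d)) with hm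
  have h1 := config_of_isContact (p := fun i => (f i : EuclideanSpace ℝ (Fin d)) - m) (r := r)
    (fun x k hk he => ?_) ?_ (fun e he => ?_) hr fun i => ?_
  · refine ⟨m, ?_⟩
    simpa only [isContact_sub_const, ← hcontact] using h1
  · simp only [sub_sub_eq_add_sub] at hk he ⊢
    refine hC.norm_sub_lt (fun j => ?_) fun e h => he e fun i hi => ?_
    · simpa using hk (f.symm j)
    · rw [inner_sub_right, inner_sub_right, h _ hi]
  · rw [Finset.sum_sub_distrib, Finset.sum_const, Finset.card_univ, hm, ← Nat.cast_smul_eq_nsmul ℝ,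
      smul_inv_smul₀ (Nat.cast_ne_zero.2 Fintype.card_ne_zero), sub_self]
  · refine eq_zero_of_inner_eq_of_setDim hdim fun i hi j hj => ?_
    have h2 := he (f.symm ⟨i, hi⟩) (f.symm ⟨j, hj⟩)
    rw [inner_sub_right, inner_sub_right, sub_left_inj] at h2
    simpa using h2
  · rw [isContact_sub_const, ← hcontact, image_singleton]
    exact hpos.isContact_singleton _

theorem image_ballPoly_of_equiv (f : C ≃ C')
    (g : EuclideanSpace ℝ (Fin d) ≃ᵢ EuclideanSpace ℝ (Fin d)) (hg : ∀ i : C, g i = f i) :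
    g '' ballPoly C r = ballPoly C' r := by
  ext y
  obtain ⟨x, rfl⟩ := g.surjective y
  rw [g.injective.mem_set_image, mem_ballPoly, mem_ballPoly, f.surjective.forall]
  simp only [← dist_eq_norm, ← hg, g.dist_eq]

omit [FiniteDimensional ℝ E] in
theorem norm_sub_sq_eq_of_angle_eq {p p' a b a' b' : E} (ha : ‖p - a‖ = r) (hb : ‖p - b‖ = r)
    (ha' : ‖p' - a'‖ = r) (hb' : ‖p' - b'‖ = r)
    (h : InnerProductGeometry.angle (a - p) (b - p) = InnerProductGeometry.angle (a' - p') (b' - p')) :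
    ‖a - b‖ ^ 2 = ‖a' - b'‖ ^ 2 := by
  have h1 := InnerProductGeometry.norm_sub_sq_eq_norm_sq_add_norm_sq_sub_two_mul_norm_mul_norm_mul_cos_angle
    (a - p) (b - p)
  have h2 := InnerProductGeometry.norm_sub_sq_eq_norm_sq_add_norm_sq_sub_two_mul_norm_mul_norm_mul_cos_angle
    (a' - p') (b' - p')
  rw [sub_sub_sub_cancel_right, norm_sub_rev a p, norm_sub_rev b p, ha, hb, h] at h1
  rw [sub_sub_sub_cancel_right, norm_sub_rev a' p', norm_sub_rev b' p', ha', hb'] at h2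
  rw [pow_two, pow_two, h1, h2]

end Basic

/-- global rigidity of basic `r`-ball polyhedra with respect to their inner
dihedral angles. -/
theorem stmt1 {d : ℕ} (hd : 3 ≤ d) (r : ℝ) (hr : 0 < r)
    (C C' : Set (EuclideanSpace ℝ (Fin d)))
    (hC : IsBasicBallPolyhedron C r) (hC' : IsBasicBallPolyhedron C' r)
    (φ : {F // F ∈ faceLat C r} ≃o {F // F ∈ faceLat C' r})
    (hangles : ∀ c₁ c₂ : EuclideanSpace ℝ (Fin d), c₁ ∈ C → c₂ ∈ C → c₁ ≠ c₂ →
      setDim (vorF C {c₁, c₂}) = d - 1 →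
      ∀ hF : closure (vorF C {c₁, c₂}) ∩ frontier (ballPoly C r) ∈ faceLat C r,
      ∀ c₁' c₂' : EuclideanSpace ℝ (Fin d), c₁' ∈ C' → c₂' ∈ C' → c₁' ≠ c₂' →
        (φ ⟨closure (vorF C {c₁, c₂}) ∩ frontier (ballPoly C r), hF⟩ :
            Set (EuclideanSpace ℝ (Fin d)))
          = closure (vorF C' {c₁', c₂'}) ∩ frontier (ballPoly C' r) →
      ∀ p ∈ vorF C {c₁, c₂} ∩ frontier (ballPoly C r),
      ∀ p' ∈ vorF C' {c₁', c₂'} ∩ frontier (ballPoly C' r),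
        Real.pi - InnerProductGeometry.angle (c₁ - p) (c₂ - p)
          = Real.pi - InnerProductGeometry.angle (c₁' - p') (c₂' - p')) :
    ∃ g : EuclideanSpace ℝ (Fin d) ≃ᵢ EuclideanSpace ℝ (Fin d),
      g '' ballPoly C r = ballPoly C' r := by
  have hfin := hC.2.1
  have hfin' := hC'.2.1
  have hcard := hC.2.2.1
  have hdim := hC.2.2.2.2.1
  have hpos := hC.2.2.2.2.2.2.1
  have hpos' := hC'.2.2.2.2.2.2.1
  have := hfin.fintype
  have : Nonempty C := (nonempty_of_ncard_ne_zero (by omega : C.ncard ≠ 0)).to_subtype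
  obtain ⟨f, hf, hφ⟩ := exists_equiv_of_orderIso hr.ne' hfin hfin' hpos hpos' φ
  obtain ⟨m, hm⟩ := hC.exists_config (Equiv.refl C)
  obtain ⟨m', hm'⟩ := hC'.exists_config f
  simp only [hf] at hm'
  simp only [Equiv.coe_refl, image_id, id_eq] at hm
  have key := hm.distortion_eq_zero hm' (by simpa using hd) fun a b hab h => ?_
  · obtain ⟨g, hg⟩ := exists_isometryEquiv_of_norm_sub_eq (p := ((↑) : C → EuclideanSpace ℝ (Fin d)))
      (p' := fun i => (f i : EuclideanSpace ℝ (Fin d)))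
      (fun e he => eq_zero_of_inner_eq_of_setDim hdim fun i hi j hj => he ⟨i, hi⟩ ⟨j, hj⟩)
      fun i j => by
        have h1 := key i j
        rw [distortion, sub_sub_sub_cancel_right, sub_sub_sub_cancel_right, sub_eq_zero] at h1
        exact ((sq_eq_sq₀ (norm_nonneg _) (norm_nonneg _)).1 h1).symm
    exact ⟨g, image_ballPoly_of_equiv f g hg⟩
  rw [distortion, sub_sub_sub_cancel_right, sub_sub_sub_cancel_right, sub_eq_zero]
  rcases h with h | h | h
  · exact ((insert_nonempty _ _).ne_empty h).elim
  · exfalso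
    have h1 := ncard_pair hab
    rw [h, ncard_univ, Nat.card_coe_set_eq] at h1
    omega
  · have h' := (hf _).2 h
    have hFφ := hφ _ h
    rw [← closure_vorF_inter_frontier hfin hr.ne' h, ← closure_vorF_inter_frontier hfin' hr.ne' h']
      at hFφ
    obtain ⟨x, hx⟩ := (nonempty_vorF_inter_frontier hfin hr.ne').2 h
    obtain ⟨x', hx'⟩ := (nonempty_vorF_inter_frontier hfin' hr.ne').2 h'
    obtain ⟨-, -, hxS⟩ := (mem_vorF_inter_frontier hfin hr.ne').1 hx
    obtain ⟨-, -, hxS'⟩ := (mem_vorF_inter_frontier hfin' hr.ne').1 hx'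
    rw [image_pair] at hx hxS' hx' hFφ
    simp only [image_pair] at hx' hFφ
    have h1 := hangles a b a.2 b.2 (fun e => hab (Subtype.ext e)) (setDim_vorF_pair hfin hab h)
      (by
        rw [← image_pair, closure_vorF_inter_frontier hfin hr.ne' h]
        exact contactFace_mem_faceLat hfin hr.ne' h)
      (f a) (f b) (f a).2 (f b).2 (fun e => hab (f.injective (Subtype.ext e))) (hFφ _) x hx x' hx'
    exact (norm_sub_sq_eq_of_angle_eq ((hxS a).1 (Or.inl rfl)) ((hxS b).1 (Or.inr rfl))
      ((hxS' (f a)).1 (Or.inl rfl)) ((hxS' (f b)).1 (Or.inr rfl)) (by linarith)).symm
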